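/- Assume the Riemann Hypothesis and the quantitative Twin Prime Conjecture. For any small ε > 0 and any integer M > 2, F(x,T) = (T/(2π)) log(T/(2π)) − T/(2π) + O_ε(T·(T/x)^{1/2−ε}) + O_{ε,M}(T/(log T)^{M−2}) uniformly for T ≤ x ≤ T^{2−29ε}. -/

import Mathlib

open Real MeasureTheory

/-- The singular series of the twin prime / Goldbach type problems. -/
noncomputable def singularSeries (d : ℕ) : ℝ :=
  if Even d then
    2 * (∏' p : Nat.Primes, if 2 < (p : ℕ) then (1 - 1 / ((p : ℝ) - 1) ^ 2) else 1) *
      ∏ p ∈ d.primeFactors.filter (fun p => 2 < p), ((p : ℝ) - 1) / ((p : ℝ) - 2)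
  else 0

/-- The quantitative twin prime conjecture. -/
def TwinPrimeConjecture : Prop :=
  ∀ ε : ℝ, 0 < ε → ∃ C : ℝ, 0 < C ∧ ∀ N d : ℕ, 1 ≤ d → d ≤ N →
    |(∑ n ∈ Finset.Icc 1 N,
        ArithmeticFunction.vonMangoldt n * ArithmeticFunction.vonMangoldt (n + d)) -
      singularSeries d * N| ≤ C * (N : ℝ) ^ ((1 : ℝ) / 2 + ε)

/-- A nontrivial zero of the Riemann zeta function. -/
def IsNontrivialZero (ρ : ℂ) : Prop := riemannZeta ρ = 0 ∧ 0 < ρ.re ∧ ρ.re < 1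

/-- The multiplicity (order of vanishing) of `riemannZeta` at a point. -/
noncomputable def zetaZeroOrder (ρ : ℂ) : ℕ := sInf {n | iteratedDeriv n riemannZeta ρ ≠ 0}

/-- Montgomery's pair correlation function `F(x,T)`, with zeros counted with multiplicity. -/
noncomputable def Fpair (x T : ℝ) : ℂ :=
  ∑' ρ : {ρ : ℂ // IsNontrivialZero ρ ∧ 0 ≤ ρ.im ∧ ρ.im ≤ T},
    ∑' ρ' : {ρ : ℂ // IsNontrivialZero ρ ∧ 0 ≤ ρ.im ∧ ρ.im ≤ T},
      ((zetaZeroOrder ρ * zetaZeroOrder ρ' : ℕ) : ℂ) *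
        (x : ℂ) ^ (Complex.I * (((ρ : ℂ).im - (ρ' : ℂ).im : ℝ) : ℂ)) *
        (4 / (4 + (((ρ : ℂ).im - (ρ' : ℂ).im : ℝ) : ℂ) ^ 2))

/-- The constant `B = -C₀ - log 2π`. -/
noncomputable def Bconst : ℝ := -Real.eulerMascheroniConstant - Real.log (2 * Real.pi)

/-- `ε(y) = Σ_{h ≤ y} 𝔖(h) - y + (1/2) log y`. -/
noncomputable def epsErr (y : ℝ) : ℝ :=
  (∑ h ∈ Finset.Icc 1 ⌊y⌋₊, singularSeries h) - y + Real.log y / 2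

/-- `f(y) = ∫_1^y (ε(u) - B/2) du`. -/
noncomputable def fErr (y : ℝ) : ℝ := ∫ u in (1 : ℝ)..y, (epsErr u - Bconst / 2)

open Filter Finset
open Complex (I)
open ArithmeticFunction (vonMangoldt_nonneg vonMangoldt_le_log vonMangoldt_apply
  vonMangoldt_apply_prime)

/-! ### Entire functions of finite order: zeros and logarithmic derivative -/

lemma entire_order_ne_top {f : ℂ → ℂ} (hf : Differentiable ℂ f) (h0 : f 0 ≠ 0) (z : ℂ) :
    analyticOrderAt f z ≠ ⊤ := by
  intro h
  rw [analyticOrderAt_eq_top] at h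
  have : f = fun _ => 0 := by
    apply AnalyticOnNhd.eq_of_eventuallyEq (𝕜 := ℂ) (z₀ := z)
    · exact fun w _ => hf.analyticAt w
    · exact fun w _ => analyticAt_const
    · exact h
  exact h0 (by rw [this])

lemma analyticOrderNatAt_eq_zero_of_ne {f : ℂ → ℂ} (hf : Differentiable ℂ f) {z : ℂ}
    (h : f z ≠ 0) : analyticOrderNatAt f z = 0 := by
  have := ((hf.analyticAt z).analyticOrderAt_eq_zero).2 h
  simp [analyticOrderNatAt, this]

lemma eq_zero_of_analyticOrderNatAt_ne {f : ℂ → ℂ} (hf : Differentiable ℂ f) {z : ℂ}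
    (h : analyticOrderNatAt f z ≠ 0) : f z = 0 := by
  by_contra h'
  exact h (analyticOrderNatAt_eq_zero_of_ne hf h')

lemma analyticOrderNatAt_pos_of_zero {f : ℂ → ℂ} (hf : Differentiable ℂ f) (h0 : f 0 ≠ 0) {z : ℂ}
    (h : f z = 0) : 1 ≤ analyticOrderNatAt f z := by
  by_contra h'
  have h1 : analyticOrderNatAt f z = 0 := by omega
  have h2 := Nat.cast_analyticOrderNatAt (entire_order_ne_top hf h0 z)
  rw [h1] at h2
  exact ((hf.analyticAt z).analyticOrderAt_eq_zero).1 (by simpa using h2.symm) h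

lemma exists_factor_zeros {f : ℂ → ℂ} (hf : Differentiable ℂ f) (h0 : f 0 ≠ 0) (S : Finset ℂ) :
    ∃ g : ℂ → ℂ, Differentiable ℂ g ∧
      (∀ z, f z = (∏ ρ ∈ S, (1 - z / ρ) ^ analyticOrderNatAt f ρ) * g z) ∧ ∀ ρ ∈ S, g ρ ≠ 0 := by
  classical
  induction S using Finset.induction_on with
  | empty => exact ⟨f, hf, by simp, by simp⟩
  | insert a S ha ih =>
    obtain ⟨g, hg, hfg, hgS⟩ := ih
    have h00 := analyticOrderNatAt_eq_zero_of_ne hf h0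
    by_cases ha0 : a = 0
    · subst ha0
      refine ⟨g, hg, ?_, ?_⟩
      · intro z
        rw [prod_insert ha, h00, hfg z]; simp
      · intro ρ hρ
        rcases mem_insert.1 hρ with rfl | h
        · intro h; apply h0; rw [hfg, h, mul_zero]
        · exact hgS ρ h
    set P : ℂ → ℂ := fun z => ∏ ρ ∈ S, (1 - z / ρ) ^ analyticOrderNatAt f ρ with hP
    have hPd : Differentiable ℂ P := by
      rw [hP]; fun_prop
    have hPa : P a ≠ 0 := by
      rw [hP]
      refine prod_ne_zero_iff.2 fun ρ hρ => ?_
      by_cases hρ0 : ρ = 0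
      · subst hρ0; simp
      · apply pow_ne_zero
        rw [sub_ne_zero]
        intro h
        rw [eq_div_iff hρ0, one_mul] at h
        exact ha (h ▸ hρ)
    have hfPg : f = P * g := by ext z; exact hfg z
    have hord : analyticOrderAt f a = analyticOrderAt g a := by
      conv_lhs => rw [hfPg]
      rw [analyticOrderAt_mul (hPd.analyticAt a) (hg.analyticAt a),
        ((hPd.analyticAt a).analyticOrderAt_eq_zero).2 hPa, zero_add]
    have hordg : analyticOrderAt g a = (analyticOrderNatAt f a : ℕ∞) := by
      rw [← hord, Nat.cast_analyticOrderNatAt (entire_order_ne_top hf h0 a)]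
    obtain ⟨u, hu, hua, hgu⟩ := ((hg.analyticAt a).analyticOrderAt_eq_natCast).1 hordg
    set m := analyticOrderNatAt f a with hm
    have hfac : ∀ z, z ≠ a → (1 - z / a) ≠ 0 := by
      intro z hz
      rw [sub_ne_zero]
      intro h
      rw [eq_div_iff ha0, one_mul] at h
      exact hz h.symm
    have hfac2 : ∀ z, (1 - z / a) * (-a) = z - a := by
      intro z; field_simp; ring
    refine ⟨fun z => if z = a then (-a) ^ m * u a else g z / (1 - z / a) ^ m, ?_, ?_, ?_⟩
    · intro z
      by_cases hz : z = a
      · subst hz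
        have : (fun w => if w = z then (-z) ^ m * u z else g w / (1 - w / z) ^ m) =ᶠ[nhds z]
            fun w => (-z) ^ m * u w := by
          filter_upwards [hgu] with w hw
          split_ifs with h
          · rw [h]
          · rw [hw, ← hfac2, mul_pow, smul_eq_mul]
            field_simp [hfac w h]
        exact ((hu.differentiableAt.const_mul _).congr_of_eventuallyEq this)
      · have : (fun w => if w = a then (-a) ^ m * u a else g w / (1 - w / a) ^ m) =ᶠ[nhds z]
            fun w => g w / (1 - w / a) ^ m := by
          filter_upwards [isOpen_ne.mem_nhds hz] with w hw
          simp [show w ≠ a from hw]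
        refine DifferentiableAt.congr_of_eventuallyEq ?_ this
        refine (hg z).div (by fun_prop) (pow_ne_zero _ (hfac z hz))
    · intro z
      rw [prod_insert ha, hfg z]
      dsimp only
      split_ifs with h
      · subst h
        have h1 := hgu.self_of_nhds
        rw [h1]
        by_cases hm0 : m = 0
        · simp [hm0, ← hm]
        · simp [hm0, ← hm, div_self ha0]
      · rw [← hm]
        have := pow_ne_zero m (hfac z h)
        field_simp
    · intro ρ hρ
      rcases mem_insert.1 hρ with rfl | h
      · simp [hua, ha0]
      · have : ρ ≠ a := fun h' => ha (h' ▸ h)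
        simp only [this, if_false]
        exact div_ne_zero (hgS ρ h) (pow_ne_zero _ (hfac ρ this))

lemma finite_zeros_closedBall {f : ℂ → ℂ} (hf : Differentiable ℂ f) (h0 : f 0 ≠ 0) (R : ℝ) :
    {z : ℂ | f z = 0 ∧ ‖z‖ ≤ R}.Finite := by
  by_contra hinf
  obtain ⟨x, -, hx⟩ := Set.Infinite.exists_accPt_of_subset_isCompact (K := Metric.closedBall 0 R)
    hinf (isCompact_closedBall 0 R) (fun z hz => by simpa using hz.2)
  have h1 : f = fun _ => 0 := by
    apply AnalyticOnNhd.eq_of_frequently_eq (𝕜 := ℂ) (z₀ := x)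
    · exact fun w _ => hf.analyticAt w
    · exact fun w _ => analyticAt_const
    · rw [accPt_iff_frequently_nhdsNE] at hx
      exact hx.mono fun z hz => hz.1
  exact h0 (by rw [h1])

lemma cofactor_bound {f : ℂ → ℂ} (hf : Differentiable ℂ f) (h0 : f 0 ≠ 0) {K : ℝ} 
    (hK : ∀ s, ‖f s‖ ≤ exp (K * (1 + ‖s‖) ^ (3 / 2 : ℝ))) {R : ℝ} (hR : 0 < R)
    {S : Finset ℂ} (hS : ∀ ρ ∈ S, ‖ρ‖ ≤ R) {g : ℂ → ℂ} (hg : Differentiable ℂ g)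
    (hfg : ∀ z, f z = (∏ ρ ∈ S, (1 - z / ρ) ^ analyticOrderNatAt f ρ) * g z) {z : ℂ}
    (hz : ‖z‖ ≤ 4 * R) :
    3 ^ (∑ ρ ∈ S, analyticOrderNatAt f ρ) * ‖g z‖ ≤
      exp (K * (1 + 4 * R) ^ (3 / 2 : ℝ)) := by
  have key : ‖g z‖ ≤ exp (K * (1 + 4 * R) ^ (3 / 2 : ℝ)) /
      3 ^ (∑ ρ ∈ S, analyticOrderNatAt f ρ) := by
    apply Complex.norm_le_of_forall_mem_frontier_norm_le (U := Metric.ball (0 : ℂ) (4 * R))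
      Metric.isBounded_ball hg.diffContOnCl
    · intro w hw
      rw [frontier_ball _ (by positivity), mem_sphere_zero_iff_norm] at hw
      rw [le_div_iff₀ (by positivity)]
      calc ‖g w‖ * 3 ^ (∑ ρ ∈ S, analyticOrderNatAt f ρ)
          ≤ ‖g w‖ * ∏ ρ ∈ S, ‖(1 - w / ρ)‖ ^ analyticOrderNatAt f ρ := by
            gcongr
            rw [← prod_pow_eq_pow_sum]
            apply prod_le_prod (by intros; positivity)
            intro ρ hρ
            by_cases hρ0 : ρ = 0
            · subst hρ0
              simp [analyticOrderNatAt_eq_zero_of_ne hf h0]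
            · gcongr
              have h1 : ‖w / ρ‖ ≥ 4 := by
                rw [norm_div, hw, ge_iff_le, le_div_iff₀ (norm_pos_iff.2 hρ0)]
                have := hS ρ hρ
                linarith
              have h2 := norm_sub_norm_le (w / ρ) 1
              rw [norm_sub_rev] at h2
              simp at h2
              simp at h1
              linarith
        _ = ‖f w‖ := by
            rw [hfg w, norm_mul, norm_prod, mul_comm]
            simp
        _ ≤ _ := by
            have := hK w
            rwa [hw] at this
    · rw [closure_ball _ (by positivity)]
      simpa using hz
  rw [le_div_iff₀ (by positivity)] at key
  linarith

lemma zero_count_bound {f : ℂ → ℂ} (hf : Differentiable ℂ f) (h0 : f 0 ≠ 0) {K : ℝ} (hK0 : 0 ≤ K)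
    (hK : ∀ s, ‖f s‖ ≤ exp (K * (1 + ‖s‖) ^ (3 / 2 : ℝ))) :
    ∃ C : ℝ, 0 ≤ C ∧ ∀ R : ℝ, 1 ≤ R → ∀ S : Finset ℂ, (∀ ρ ∈ S, ‖ρ‖ ≤ R) →
      (∑ ρ ∈ S, (analyticOrderNatAt f ρ : ℝ)) ≤ C * R ^ (3 / 2 : ℝ) := by
  refine ⟨K * 5 ^ (3 / 2 : ℝ) + |log ‖f 0‖|, by positivity, fun R hR S hS => ?_⟩
  obtain ⟨g, hg, hfg, -⟩ := exists_factor_zeros hf h0 S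
  have h1 := cofactor_bound hf h0 hK (by linarith) hS hg hfg (z := 0) (by simp; linarith)
  have h2 : g 0 = f 0 := by rw [hfg 0]; simp
  rw [h2] at h1
  have hf0 : 0 < ‖f 0‖ := norm_pos_iff.2 h0
  have h3 := log_le_log (by positivity) h1
  rw [log_mul (by positivity) hf0.ne', log_pow, log_exp] at h3
  have h4 : (1 : ℝ) ≤ log 3 := by
    rw [le_log_iff_exp_le (by norm_num)]
    linarith [exp_one_lt_d9]
  push_cast at h3
  set N : ℝ := ∑ ρ ∈ S, (analyticOrderNatAt f ρ : ℝ)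
  have hN : 0 ≤ N := by positivity
  have h5 : (1 + 4 * R) ^ (3 / 2 : ℝ) ≤ 5 ^ (3 / 2 : ℝ) * R ^ (3 / 2 : ℝ) := by
    rw [← mul_rpow (by norm_num) (by linarith)]
    apply rpow_le_rpow <;> linarith
  have h6 : 1 ≤ R ^ (3 / 2 : ℝ) := one_le_rpow hR (by norm_num)
  have h7 := neg_abs_le (log ‖f 0‖)
  have h8 := abs_nonneg (log ‖f 0‖)
  nlinarith [mul_le_mul_of_nonneg_left h5 hK0, mul_le_mul_of_nonneg_left h6 h8,
    mul_le_mul_of_nonneg_left h4 hN]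

lemma exists_dyadic_majorant (r : ℝ) (hr : 0 ≤ r) :
    ∃ k : ℕ, r ≤ 2 ^ k ∧ 1 / (1 + r ^ 2) ≤ 4 * (1 / 4 : ℝ) ^ k := by
  classical
  have hex : ∃ k : ℕ, r ≤ 2 ^ k := by
    obtain ⟨k, hk⟩ := pow_unbounded_of_one_lt r (by norm_num : (1 : ℝ) < 2)
    exact ⟨k, hk.le⟩
  refine ⟨Nat.find hex, Nat.find_spec hex, ?_⟩
  rcases h : Nat.find hex with _ | n
  · rw [div_le_iff₀ (by positivity)]
    nlinarith [sq_nonneg r]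
  · have h1 := Nat.find_min hex (m := n) (by omega)
    push Not at h1
    have h2 : (2 ^ n : ℝ) ^ 2 ≤ r ^ 2 := by gcongr
    have h3 : (2 ^ n : ℝ) ^ 2 = 4 ^ n := by rw [← pow_mul, mul_comm, pow_mul]; norm_num
    rw [pow_succ, one_div_pow]
    rw [div_le_iff₀ (by positivity)]
    have : (4 : ℝ) ^ n > 0 := by positivity
    field_simp
    rw [h3] at h2
    rw [pow_succ]
    linarith

lemma summable_order_div {f : ℂ → ℂ} (hf : Differentiable ℂ f) (h0 : f 0 ≠ 0) {K : ℝ} (hK0 : 0 ≤ K)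
    (hK : ∀ s, ‖f s‖ ≤ exp (K * (1 + ‖s‖) ^ (3 / 2 : ℝ))) :
    Summable fun ρ : ℂ => (analyticOrderNatAt f ρ : ℝ) / (1 + ‖ρ‖ ^ 2) := by
  classical
  obtain ⟨C, hC0, hC⟩ := zero_count_bound hf h0 hK0 hK
  choose k hk1 hk2 using fun ρ : ℂ => exists_dyadic_majorant ‖ρ‖ (norm_nonneg _)
  set r : ℝ := 2 ^ (3 / 2 : ℝ) / 4 with hr
  have hr0 : 0 ≤ r := by positivity
  have hr1 : r < 1 := by
    rw [hr, div_lt_one (by norm_num)]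
    calc (2 : ℝ) ^ (3 / 2 : ℝ) < 2 ^ (2 : ℝ) := rpow_lt_rpow_of_exponent_lt (by norm_num) (by norm_num)
      _ = 4 := by norm_num
  have hgeo := summable_geometric_of_lt_one hr0 hr1
  apply summable_of_sum_le (c := ∑' j : ℕ, 4 * C * r ^ j) (fun ρ => by positivity)
  intro S
  calc ∑ ρ ∈ S, (analyticOrderNatAt f ρ : ℝ) / (1 + ‖ρ‖ ^ 2)
      ≤ ∑ ρ ∈ S, (analyticOrderNatAt f ρ : ℝ) * (4 * (1 / 4 : ℝ) ^ (k ρ)) := by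
        apply sum_le_sum
        intro ρ _
        rw [div_eq_mul_one_div]
        gcongr
        exact hk2 ρ
    _ = ∑ j ∈ S.image k, ∑ ρ ∈ S with k ρ = j,
          (analyticOrderNatAt f ρ : ℝ) * (4 * (1 / 4 : ℝ) ^ (k ρ)) := by
        rw [sum_fiberwise_of_maps_to]
        intro ρ hρ
        exact mem_image_of_mem k hρ
    _ ≤ ∑ j ∈ S.image k, 4 * C * r ^ j := by
        apply sum_le_sum
        intro j _
        calc ∑ ρ ∈ S with k ρ = j, (analyticOrderNatAt f ρ : ℝ) * (4 * (1 / 4 : ℝ) ^ (k ρ))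
            = (∑ ρ ∈ S with k ρ = j, (analyticOrderNatAt f ρ : ℝ)) * (4 * (1 / 4 : ℝ) ^ j) := by
              rw [sum_mul]
              apply sum_congr rfl
              intro ρ hρ
              rw [(mem_filter.1 hρ).2]
          _ ≤ (C * ((2 : ℝ) ^ j) ^ (3 / 2 : ℝ)) * (4 * (1 / 4 : ℝ) ^ j) := by
              gcongr
              apply hC _ (one_le_pow₀ (by norm_num))
              intro ρ hρ
              have := hk1 ρ
              rwa [(mem_filter.1 hρ).2] at this
          _ = _ := by
              rw [hr, div_pow, div_pow, one_pow, ← rpow_natCast (2 : ℝ) j, ← rpow_mul (by norm_num),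
                mul_comm (j : ℝ), rpow_mul (by norm_num), rpow_natCast]
              ring
    _ ≤ _ := Summable.sum_le_tsum _ (fun i _ => by positivity) (hgeo.mul_left _)

lemma exists_dist_zero_lower {f : ℂ → ℂ} (hf : Differentiable ℂ f) {s : ℂ} (hs : f s ≠ 0) :
    ∃ c : ℝ, 0 < c ∧ ∀ ρ, f ρ = 0 → c * (1 + ‖ρ‖) ≤ ‖s - ρ‖ := by
  obtain ⟨δ, hδ, hb⟩ := Metric.eventually_nhds_iff.1 (hf.continuous.continuousAt.eventually_ne hs)
  refine ⟨((1 + ‖s‖) / δ + 1)⁻¹, by positivity, fun ρ hρ => ?_⟩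
  have h1 : δ ≤ ‖s - ρ‖ := by
    by_contra h
    push Not at h
    exact hb (y := ρ) (by rw [dist_comm, dist_eq_norm]; exact h) hρ
  rw [inv_mul_le_iff₀ (by positivity)]
  have h2 : ‖ρ‖ ≤ ‖s‖ + ‖s - ρ‖ := by
    calc ‖ρ‖ = ‖s - (s - ρ)‖ := by ring_nf
      _ ≤ _ := norm_sub_le _ _
  have h3 : 1 + ‖s‖ ≤ (1 + ‖s‖) / δ * ‖s - ρ‖ := by
    rw [div_mul_eq_mul_div, le_div_iff₀ hδ]
    gcongr
  linarith

lemma summable_order_mul_sub {f : ℂ → ℂ} (hf : Differentiable ℂ f) (h0 : f 0 ≠ 0) {K : ℝ}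
    (hK0 : 0 ≤ K) (hK : ∀ s, ‖f s‖ ≤ exp (K * (1 + ‖s‖) ^ (3 / 2 : ℝ))) {s w : ℂ}
    (hs : f s ≠ 0) (hw : f w ≠ 0) :
    Summable fun ρ : ℂ => ‖(analyticOrderNatAt f ρ : ℂ) * (1 / (s - ρ) - 1 / (w - ρ))‖ := by
  obtain ⟨c, hc, hcs⟩ := exists_dist_zero_lower hf hs
  obtain ⟨d, hd, hdw⟩ := exists_dist_zero_lower hf hw
  refine Summable.of_nonneg_of_le (fun _ => norm_nonneg _) (fun ρ => ?_)
    ((summable_order_div hf h0 hK0 hK).mul_left (‖s - w‖ / (c * d)))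
  by_cases hρ : f ρ = 0
  · have h1 := hcs ρ hρ
    have h2 := hdw ρ hρ
    have p1 : 0 < ‖s - ρ‖ := lt_of_lt_of_le (by positivity) h1
    have p2 : 0 < ‖w - ρ‖ := lt_of_lt_of_le (by positivity) h2
    have e1 : 1 / (s - ρ) - 1 / (w - ρ) = (w - s) / ((s - ρ) * (w - ρ)) := by
      have := norm_pos_iff.1 p1
      have := norm_pos_iff.1 p2
      field_simp
      ring
    rw [e1, norm_mul, norm_div, norm_mul, Complex.norm_natCast, norm_sub_rev w s]
    have h3 : c * d * (1 + ‖ρ‖ ^ 2) ≤ ‖s - ρ‖ * ‖w - ρ‖ := by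
      calc c * d * (1 + ‖ρ‖ ^ 2) ≤ (c * (1 + ‖ρ‖)) * (d * (1 + ‖ρ‖)) := by
            have := norm_nonneg ρ
            have : 0 ≤ c * d * ‖ρ‖ := by positivity
            nlinarith
        _ ≤ _ := by gcongr
    calc (analyticOrderNatAt f ρ : ℝ) * (‖s - w‖ / (‖s - ρ‖ * ‖w - ρ‖))
        ≤ (analyticOrderNatAt f ρ : ℝ) * (‖s - w‖ / (c * d * (1 + ‖ρ‖ ^ 2))) := by gcongr
      _ = _ := by field_simp
  · simp [analyticOrderNatAt_eq_zero_of_ne hf hρ]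

lemma logDeriv_zeros_prod {f : ℂ → ℂ} (hf : Differentiable ℂ f) (h0 : f 0 ≠ 0) (S : Finset ℂ)
    {g : ℂ → ℂ} (hg : Differentiable ℂ g)
    (hfg : ∀ z, f z = (∏ ρ ∈ S, (1 - z / ρ) ^ analyticOrderNatAt f ρ) * g z) {s : ℂ}
    (hs : f s ≠ 0) :
    logDeriv f s = (∑ ρ ∈ S, (analyticOrderNatAt f ρ : ℂ) * (1 / (s - ρ))) + logDeriv g s := by
  have hne := hs
  rw [hfg s] at hne
  have h1 := left_ne_zero_of_mul hne
  have h2 := right_ne_zero_of_mul hne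
  have hff : f = fun z => (∏ ρ ∈ S, (1 - z / ρ) ^ analyticOrderNatAt f ρ) * g z := funext hfg
  conv_lhs => rw [hff]
  rw [logDeriv_mul s h1 h2 (by fun_prop) (hg s)]
  congr 1
  rw [logDeriv_prod (fun ρ hρ => prod_ne_zero_iff.1 h1 ρ hρ) (fun ρ _ => by fun_prop)]
  apply sum_congr rfl
  intro ρ hρ
  rw [logDeriv_fun_pow (by fun_prop)]
  by_cases hρ0 : ρ = 0
  · subst hρ0; simp [analyticOrderNatAt_eq_zero_of_ne hf h0]
  by_cases hz : f ρ = 0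
  · congr 1
    have hsρ : s - ρ ≠ 0 := by
      intro h; rw [sub_eq_zero] at h; exact hs (h ▸ hz)
    have : (1 - s / ρ) ≠ 0 := by
      intro h; apply hsρ; field_simp at h; linear_combination -h
    rw [logDeriv_apply]
    simp only [deriv_const_sub, deriv_div_const, deriv_id'']
    rw [div_eq_iff this]
    field_simp
    ring
  · simp [analyticOrderNatAt_eq_zero_of_ne hf hz]

lemma logDeriv_cofactor_sub_le {g : ℂ → ℂ} (hg : Differentiable ℂ g) {R M : ℝ} (hR : 0 < R)
    (hM : 0 < M) (hne : ∀ z, ‖z‖ < R → g z ≠ 0)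
    (hb : ∀ z, ‖z‖ < R → ‖g z‖ ≤ ‖g 0‖ * exp M) {s w : ℂ} (hs : ‖s‖ < R / 4)
    (hw : ‖w‖ < R / 4) : ‖logDeriv g s - logDeriv g w‖ ≤ 128 * M / R ^ 2 * ‖s - w‖ := by
  have hd : DifferentiableOn ℂ (logDeriv g) (Metric.ball 0 R) := by
    intro z hz
    have hz' : ‖z‖ < R := by simpa using hz
    rw [show logDeriv g = fun z => deriv g z / g z from rfl]
    exact ((hg.deriv z).div (hg z) (hne z hz')).differentiableWithinAt
  obtain ⟨h, hh0, hh⟩ := hd.isExactOn_ball.with_val_at 0 0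
  have hhd : DifferentiableOn ℂ h (Metric.ball 0 R) := fun z hz =>
    (hh z hz).differentiableAt.differentiableWithinAt
  have hexp : ∀ z ∈ Metric.ball (0 : ℂ) R, g z = g 0 * Complex.exp (h z) := by
    have hconst : ∀ z ∈ Metric.ball (0 : ℂ) R,
        HasDerivAt (fun z => g z * Complex.exp (-h z)) 0 z := by
      intro z hz
      have hz' : ‖z‖ < R := by simpa using hz
      have := (hg z).hasDerivAt.mul (hh z hz).neg.cexp
      refine this.congr_deriv ?_
      rw [logDeriv_apply]
      have := hne z hz'
      field_simp
      ring
    intro z hz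
    have h0m : (0 : ℂ) ∈ Metric.ball (0 : ℂ) R := by simpa using hR
    have := (convex_ball (0 : ℂ) R).norm_image_sub_le_of_norm_hasDerivWithin_le
      (f := fun z => g z * Complex.exp (-h z)) (f' := fun _ => 0) (C := 0)
      (fun x hx => (hconst x hx).hasDerivWithinAt) (fun x hx => by simp) h0m hz
    simp only [zero_mul, norm_le_zero_iff, sub_eq_zero, hh0, neg_zero, Complex.exp_zero,
      mul_one] at this
    rw [← this, mul_assoc, ← Complex.exp_add]
    simp
  have h00 : g 0 ≠ 0 := hne 0 (by simpa using hR)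
  have hre : Set.MapsTo h (Metric.ball 0 R) {z | z.re ≤ M} := by
    intro z hz
    have hz' : ‖z‖ < R := by simpa using hz
    have h1 := hb z hz'
    rw [hexp z hz, norm_mul, Complex.norm_exp] at h1
    have h2 := le_of_mul_le_mul_left h1 (norm_pos_iff.2 h00)
    exact exp_le_exp.1 h2
  have hbc : ∀ z, ‖z‖ ≤ R / 2 → ‖h z‖ ≤ 2 * M := by
    intro z hz
    have := Complex.borelCaratheodory_zero hM hhd hre hR (z := z) (by simp; linarith) hh0
    refine this.trans ?_
    rw [div_le_iff₀ (by linarith)]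
    nlinarith [norm_nonneg z]
  have hdh : ∀ z ∈ Metric.ball (0 : ℂ) R, deriv h z = logDeriv g z := fun z hz => (hh z hz).deriv
  have hd1 : ∀ z, ‖z‖ ≤ 3 * R / 8 → ‖logDeriv g z‖ ≤ 16 * M / R := by
    intro z hz
    rw [← hdh z (by simp; linarith)]
    have hsub : Metric.closedBall z (R / 8) ⊆ Metric.ball 0 R := by
      intro y hy
      rw [mem_closedBall_iff_norm] at hy
      have := norm_le_norm_add_norm_sub' y z
      simp
      linarith
    have := Complex.norm_deriv_le_of_forall_mem_sphere_norm_le (c := z) (R := R / 8) (C := 2 * M)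
      (f := h) (by positivity)
      ⟨hhd.mono (Metric.ball_subset_closedBall.trans hsub), (hhd.continuousOn.mono ((Metric.closure_ball_subset_closedBall).trans hsub))⟩
      (fun y hy => hbc y (by
        rw [mem_sphere_iff_norm] at hy
        have := norm_le_norm_add_norm_sub' y z
        linarith))
    refine this.trans (le_of_eq ?_)
    field_simp
    ring
  have hd2 : ∀ z ∈ Metric.ball (0 : ℂ) (R / 4), ‖deriv (logDeriv g) z‖ ≤ 128 * M / R ^ 2 := by
    intro z hz
    have hz' : ‖z‖ < R / 4 := by simpa using hz
    have hsub : Metric.closedBall z (R / 8) ⊆ Metric.ball 0 R := by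
      intro y hy
      rw [mem_closedBall_iff_norm] at hy
      have := norm_le_norm_add_norm_sub' y z
      simp
      linarith
    have := Complex.norm_deriv_le_of_forall_mem_sphere_norm_le (c := z) (R := R / 8)
      (C := 16 * M / R)
      (f := logDeriv g) (by positivity)
      ⟨hd.mono (Metric.ball_subset_closedBall.trans hsub), (hd.continuousOn.mono ((Metric.closure_ball_subset_closedBall).trans hsub))⟩
      (fun y hy => hd1 y (by
        rw [mem_sphere_iff_norm] at hy
        have := norm_le_norm_add_norm_sub' y z
        linarith))
    refine this.trans (le_of_eq ?_)
    field_simp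
    ring
  refine (convex_ball (0 : ℂ) (R / 4)).norm_image_sub_le_of_norm_deriv_le (fun x hx => ?_) hd2
    (by simpa using hw) (by simpa using hs)
  have hx' : ‖x‖ < R / 4 := by simpa using hx
  exact (hd x (by simp; linarith)).differentiableAt (Metric.isOpen_ball.mem_nhds (by simp; linarith))

/-- Partial fractions for the logarithmic derivative of an entire function of order `≤ 3/2`. -/
theorem logDeriv_sub_eq_tsum {f : ℂ → ℂ} (hf : Differentiable ℂ f) (h0 : f 0 ≠ 0) {K : ℝ}
    (hK0 : 0 ≤ K) (hK : ∀ s, ‖f s‖ ≤ exp (K * (1 + ‖s‖) ^ (3 / 2 : ℝ))) {s w : ℂ}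
    (hs : f s ≠ 0) (hw : f w ≠ 0) :
    logDeriv f s - logDeriv f w =
      ∑' ρ : ℂ, (analyticOrderNatAt f ρ : ℂ) * (1 / (s - ρ) - 1 / (w - ρ)) := by
  have hsum := summable_order_mul_sub hf h0 hK0 hK hs hw
  set a : ℂ → ℂ := fun ρ => (analyticOrderNatAt f ρ : ℂ) * (1 / (s - ρ) - 1 / (w - ρ)) with ha
  set S : ℕ → Finset ℂ := fun n => (finite_zeros_closedBall hf h0 n).toFinset with hSdef
  have hmem : ∀ n ρ, ρ ∈ S n ↔ f ρ = 0 ∧ ‖ρ‖ ≤ n := by intro n ρ; simp [S]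
  have hlim1 : Tendsto (fun n : ℕ => ∑ ρ ∈ S n, a ρ) atTop (nhds (∑' ρ, a ρ)) := by
    have : (fun n : ℕ => ∑ ρ ∈ S n, a ρ) = fun n => ∑' ρ, Set.indicator (S n : Set ℂ) a ρ := by
      ext n
      rw [← Finset.tsum_subtype, ← _root_.tsum_subtype]
      rfl
    rw [this]
    refine tendsto_tsum_of_dominated_convergence hsum (fun ρ => ?_) (Eventually.of_forall
      fun n ρ => ?_)
    · by_cases hρ : f ρ = 0
      · apply tendsto_const_nhds.congr'
        filter_upwards [eventually_ge_atTop ⌈‖ρ‖⌉₊] with n hn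
        rw [Set.indicator_of_mem]
        simp only [mem_coe, hmem]
        exact ⟨hρ, (Nat.le_ceil _).trans (by exact_mod_cast hn)⟩
      · have : a ρ = 0 := by simp [ha, analyticOrderNatAt_eq_zero_of_ne hf hρ]
        apply tendsto_const_nhds.congr
        intro n
        rw [Set.indicator_apply]
        split_ifs <;> simp [this]
    · exact norm_indicator_le_norm_self _ _
  set L := |log ‖f 0‖|
  set M : ℕ → ℝ := fun n => K * (1 + 4 * (n : ℝ)) ^ (3 / 2 : ℝ) + L + 1 with hMdef
  have hMpos : ∀ n, 0 < M n := fun n => by positivity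
  have hbound : ∀ᶠ n : ℕ in atTop,
      ‖logDeriv f s - logDeriv f w - ∑ ρ ∈ S n, a ρ‖ ≤ 128 * M n / (n : ℝ) ^ 2 * ‖s - w‖ := by
    filter_upwards [eventually_gt_atTop ⌈4 * ‖s‖⌉₊, eventually_gt_atTop ⌈4 * ‖w‖⌉₊]
      with n hn1 hn2
    have hn1' : 4 * ‖s‖ < n := Nat.lt_of_ceil_lt hn1
    have hn2' : 4 * ‖w‖ < n := Nat.lt_of_ceil_lt hn2
    have hnpos : (0 : ℝ) < n := lt_of_le_of_lt (by positivity) hn1'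
    obtain ⟨g, hg, hfg, hgS⟩ := exists_factor_zeros hf h0 (S n)
    have e1 := logDeriv_zeros_prod hf h0 (S n) hg hfg hs
    have e2 := logDeriv_zeros_prod hf h0 (S n) hg hfg hw
    have e3 : logDeriv f s - logDeriv f w - ∑ ρ ∈ S n, a ρ = logDeriv g s - logDeriv g w := by
      rw [e1, e2, ha]
      simp only [mul_sub, sum_sub_distrib]
      ring
    rw [e3]
    have hg0 : g 0 = f 0 := by rw [hfg 0]; simp
    apply logDeriv_cofactor_sub_le hg hnpos (hMpos n)
    · intro z hz
      by_cases hfz : f z = 0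
      · exact hgS z ((hmem n z).2 ⟨hfz, hz.le⟩)
      · intro h; apply hfz; rw [hfg z, h, mul_zero]
    · intro z hz
      have := cofactor_bound hf h0 hK hnpos (S := S n) (fun ρ hρ => ((hmem n ρ).1 hρ).2) hg hfg
        (z := z) (by linarith)
      rw [hg0]
      have h3 : (1 : ℝ) ≤ 3 ^ (∑ ρ ∈ S n, analyticOrderNatAt f ρ) := one_le_pow₀ (by norm_num)
      have hf0 : 0 < ‖f 0‖ := norm_pos_iff.2 h0
      calc ‖g z‖ ≤ 3 ^ (∑ ρ ∈ S n, analyticOrderNatAt f ρ) * ‖g z‖ :=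
            le_mul_of_one_le_left (norm_nonneg _) h3
        _ ≤ _ := this
        _ ≤ exp (log ‖f 0‖ + M n) := by
            apply exp_le_exp.2
            have := neg_abs_le (log ‖f 0‖)
            simp only [hMdef]
            linarith
        _ = _ := by rw [exp_add, exp_log hf0]
    · linarith
    · linarith
  have hlim2 : Tendsto (fun n : ℕ => 128 * M n / (n : ℝ) ^ 2 * ‖s - w‖) atTop
      (nhds 0) := by
    have hup : ∀ᶠ n : ℕ in atTop, 128 * M n / (n : ℝ) ^ 2 * ‖s - w‖ ≤
        128 * (K * 5 ^ (3 / 2 : ℝ) + L + 1) * ‖s - w‖ * (n : ℝ) ^ (-(1 / 2) : ℝ) := by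
      filter_upwards [eventually_ge_atTop 1] with n hn
      have hn' : (1 : ℝ) ≤ n := by exact_mod_cast hn
      have h1 : (n : ℝ) ^ (-(1 / 2) : ℝ) = (n : ℝ) ^ (3 / 2 : ℝ) / (n : ℝ) ^ 2 := by
        rw [← rpow_natCast, ← rpow_sub (by linarith)]
        norm_num
      have h2 : M n ≤ (K * 5 ^ (3 / 2 : ℝ) + L + 1) * (n : ℝ) ^ (3 / 2 : ℝ) := by
        have h5 : (1 + 4 * (n : ℝ)) ^ (3 / 2 : ℝ) ≤ 5 ^ (3 / 2 : ℝ) * (n : ℝ) ^ (3 / 2 : ℝ) := by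
          rw [← mul_rpow (by norm_num) (by linarith)]
          apply rpow_le_rpow <;> linarith
        have h6 : 1 ≤ (n : ℝ) ^ (3 / 2 : ℝ) := one_le_rpow hn' (by norm_num)
        have hL : 0 ≤ L := abs_nonneg _
        simp only [hMdef]
        nlinarith [mul_le_mul_of_nonneg_left h5 hK0]
      rw [h1]
      calc 128 * M n / (n : ℝ) ^ 2 * ‖s - w‖
          ≤ 128 * ((K * 5 ^ (3 / 2 : ℝ) + L + 1) * (n : ℝ) ^ (3 / 2 : ℝ)) / (n : ℝ) ^ 2 * ‖s - w‖ := by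
            gcongr
        _ = _ := by ring
    refine tendsto_of_tendsto_of_tendsto_of_le_of_le' tendsto_const_nhds ?_
      (Eventually.of_forall fun n => by have := hMpos n; positivity) hup
    have := ((tendsto_rpow_neg_atTop (y := 1 / 2) (by norm_num)).comp
      tendsto_natCast_atTop_atTop).const_mul (128 * (K * 5 ^ (3 / 2 : ℝ) + L + 1) * ‖s - w‖)
    simpa using this
  have hlim3 := squeeze_zero_norm' hbound hlim2
  have hlim4 := hlim1.add hlim3
  simp only [add_sub_cancel, add_zero] at hlim4
  exact tendsto_nhds_unique tendsto_const_nhds hlim4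

/-! ### The entire function `(s - 1) ζ(s)` -/

/-- The entire function `(s - 1) ζ(s)`. -/
noncomputable def zetaEntire (s : ℂ) : ℂ := if s = 1 then 1 else (s - 1) * riemannZeta s

lemma zetaEntire_of_ne {s : ℂ} (hs : s ≠ 1) : zetaEntire s = (s - 1) * riemannZeta s := if_neg hs

lemma zetaEntire_one : zetaEntire 1 = 1 := if_pos rfl

lemma zetaEntire_zero : zetaEntire 0 = 1 / 2 := by
  rw [zetaEntire_of_ne (by norm_num), riemannZeta_zero]; norm_num

lemma differentiable_zetaEntire : Differentiable ℂ zetaEntire := by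
  rw [← differentiableOn_univ]
  refine (Complex.differentiableOn_compl_singleton_and_continuousAt_iff (c := (1 : ℂ))
    univ_mem).1 ⟨?_, ?_⟩
  · intro s hs
    have hs1 : s ≠ 1 := by simpa using hs
    have : zetaEntire =ᶠ[nhds s] fun s => (s - 1) * riemannZeta s := by
      filter_upwards [isOpen_ne.mem_nhds hs1] with w hw
      exact zetaEntire_of_ne hw
    refine (DifferentiableAt.congr_of_eventuallyEq ?_ this).differentiableWithinAt
    exact (by fun_prop : DifferentiableAt ℂ (fun s : ℂ => s - 1) s).mul
      (differentiableAt_riemannZeta hs1)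
  · rw [continuousAt_iff_punctured_nhds, zetaEntire_one]
    refine riemannZeta_residue_one.congr' ?_
    filter_upwards [self_mem_nhdsWithin] with w hw
    exact (zetaEntire_of_ne hw).symm

/-- Euler–Maclaurin terms for `(s - 1) ζ(s) - 1`. -/
noncomputable def zetaEMTerm (s : ℂ) (n : ℕ) : ℂ :=
  (s - 1) * ((n + 1 : ℝ) : ℂ) ^ (-s) + ((n + 2 : ℝ) : ℂ) ^ (1 - s) - ((n + 1 : ℝ) : ℂ) ^ (1 - s)

lemma norm_zetaEMTerm_le {s : ℂ} (hs : 0 < s.re) (n : ℕ) :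
    ‖zetaEMTerm s n‖ ≤ ‖s - 1‖ * ‖s‖ * (n + 1 : ℝ) ^ (-s.re - 1) := by
  set a : ℝ := n + 1 with ha
  have ha0 : 0 < a := by positivity
  have hcd : ∀ (c : ℂ) (u : ℝ), u ∈ Set.Icc a (a + 1) →
      HasDerivAt (fun u : ℝ => (u : ℂ) ^ c) (c * (u : ℂ) ^ (c - 1)) u := by
    intro c u hu
    have hu0 : (u : ℂ) ∈ Complex.slitPlane := by
      rw [Complex.ofReal_mem_slitPlane]
      exact lt_of_lt_of_le ha0 hu.1
    have := ((hasDerivAt_id (u : ℂ)).cpow_const (c := c) hu0).comp_ofReal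
    simpa using this
  have h1 : ∀ u ∈ Set.Icc a (a + 1), ‖(u : ℂ) ^ (-s) - (a : ℂ) ^ (-s)‖ ≤ ‖s‖ * a ^ (-s.re - 1) := by
    intro u hu
    have hab : a ∈ Set.Icc a (a + 1) := ⟨le_rfl, by linarith⟩
    have := (convex_Icc a (a + 1)).norm_image_sub_le_of_norm_hasDerivWithin_le
      (f := fun u : ℝ => (u : ℂ) ^ (-s)) (C := ‖s‖ * a ^ (-s.re - 1))
      (fun x hx => (hcd (-s) x hx).hasDerivWithinAt) (fun x hx => by
        have hx0 : 0 < x := lt_of_lt_of_le ha0 hx.1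
        rw [norm_mul, norm_neg, Complex.norm_cpow_eq_rpow_re_of_pos hx0]
        gcongr ?_ * ?_
        have : (-s - 1).re = -s.re - 1 := by simp
        rw [this]
        exact rpow_le_rpow_of_nonpos ha0 hx.1 (by linarith)) hab hu
    refine this.trans ?_
    have h2 : ‖u - a‖ ≤ 1 := by
      rw [norm_eq_abs, abs_le]; constructor <;> linarith [hu.1, hu.2]
    exact mul_le_of_le_one_right (by positivity) h2
  have hab : a ∈ Set.Icc a (a + 1) := ⟨le_rfl, by linarith⟩
  have hb : a + 1 ∈ Set.Icc a (a + 1) := ⟨by linarith, le_rfl⟩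
  have h3 := (convex_Icc a (a + 1)).norm_image_sub_le_of_norm_hasDerivWithin_le
      (f := fun u : ℝ => (u : ℂ) ^ (1 - s) + (s - 1) * (a : ℂ) ^ (-s) * u)
      (f' := fun u : ℝ => (1 - s) * (u : ℂ) ^ (1 - s - 1) + (s - 1) * (a : ℂ) ^ (-s) * 1)
      (C := ‖s - 1‖ * ‖s‖ * a ^ (-s.re - 1))
      (fun x hx => ((hcd (1 - s) x hx).add
        (((hasDerivAt_id x).ofReal_comp).const_mul _)).hasDerivWithinAt) (fun x hx => by
        have e : (1 - s) * (x : ℂ) ^ (1 - s - 1) + (s - 1) * (a : ℂ) ^ (-s) * 1 =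
            -(s - 1) * ((x : ℂ) ^ (-s) - (a : ℂ) ^ (-s)) := by
          rw [show (1 : ℂ) - s - 1 = -s by ring]; ring
        rw [e, norm_mul, norm_neg, mul_assoc]
        gcongr
        exact h1 x hx) hab hb
  have e2 : zetaEMTerm s n = (((a + 1 : ℝ) : ℂ) ^ (1 - s) + (s - 1) * (a : ℂ) ^ (-s) * ((a + 1 : ℝ) : ℂ))
      - ((a : ℂ) ^ (1 - s) + (s - 1) * (a : ℂ) ^ (-s) * a) := by
    rw [zetaEMTerm, ha, show ((n : ℝ) + 1 + 1) = n + 2 by ring]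
    push_cast
    ring
  rw [e2]
  refine h3.trans ?_
  simp

lemma zetaEntire_eq_of_one_lt_re {s : ℂ} (hs : 1 < s.re) :
    zetaEntire s = 1 + ∑' n : ℕ, zetaEMTerm s n := by
  have hs1 : s ≠ 1 := by rintro rfl; simp at hs
  have h1 : HasSum (fun n : ℕ => ((n + 1 : ℝ) : ℂ) ^ (-s)) (riemannZeta s) := by
    have hsum := (Complex.summable_one_div_nat_cpow (p := s)).2 hs
    have := (summable_nat_add_iff 1).2 hsum
    rw [zeta_eq_tsum_one_div_nat_add_one_cpow hs]
    have e : (fun n : ℕ => 1 / ((n + 1 : ℕ) : ℂ) ^ s) = fun n : ℕ => ((n + 1 : ℝ) : ℂ) ^ (-s) := by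
      ext n; rw [Complex.cpow_neg, one_div]; push_cast; rfl
    have e' : (fun n : ℕ => 1 / ((n : ℂ) + 1) ^ s) = fun n : ℕ => ((n + 1 : ℝ) : ℂ) ^ (-s) := by
      ext n; rw [Complex.cpow_neg, one_div]; push_cast; rfl
    rw [e] at this
    rw [e']
    exact this.hasSum
  have h2 : HasSum (fun n : ℕ => ((n + 2 : ℝ) : ℂ) ^ (1 - s) - ((n + 1 : ℝ) : ℂ) ^ (1 - s))
      (0 - 1) := by
    have hsm : Summable (fun n : ℕ => ((n + 2 : ℝ) : ℂ) ^ (1 - s) - ((n + 1 : ℝ) : ℂ) ^ (1 - s)) := by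
      have h3 : Summable fun n : ℕ => zetaEMTerm s n := by
        refine Summable.of_norm_bounded (g := fun n : ℕ => ‖s - 1‖ * ‖s‖ * (n + 1 : ℝ) ^ (-s.re - 1)) ?_
          (fun n => norm_zetaEMTerm_le (by linarith) n)
        refine Summable.mul_left _ ?_
        have := (summable_nat_add_iff 1).2 ((summable_nat_rpow (p := -s.re - 1)).2 (by linarith))
        simpa using this
      have := h3.sub (h1.summable.mul_left (s - 1))
      refine this.congr fun n => ?_
      rw [zetaEMTerm]; ring
    have h4 : Tendsto (fun n : ℕ => ((n + 1 : ℝ) : ℂ) ^ (1 - s)) atTop (nhds 0) := by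
      rw [tendsto_zero_iff_norm_tendsto_zero]
      have : Tendsto (fun n : ℕ => (n + 1 : ℝ) ^ (-(s.re - 1))) atTop (nhds 0) :=
        (tendsto_rpow_neg_atTop (by linarith)).comp
          (tendsto_atTop_add_const_right _ 1 tendsto_natCast_atTop_atTop)
      refine this.congr fun n => ?_
      rw [Complex.norm_cpow_eq_rpow_re_of_pos (by positivity)]
      simp
    rw [hsm.hasSum_iff_tendsto_nat]
    have h5 := h4.sub_const 1
    refine h5.congr fun n => ?_
    have := sum_range_sub (fun n : ℕ => ((n + 1 : ℝ) : ℂ) ^ (1 - s)) n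
    simp only [Nat.cast_zero, zero_add, Complex.ofReal_one, Complex.one_cpow] at this
    rw [← this]
    apply sum_congr rfl
    intro i _
    push_cast
    ring_nf
  have h3 := (h1.mul_left (s - 1)).add h2
  rw [zetaEntire_of_ne hs1]
  have h4 : HasSum (fun n => zetaEMTerm s n) ((s - 1) * riemannZeta s + (0 - 1)) := by
    refine h3.congr_fun ?_
    intro n
    rw [zetaEMTerm]; ring
  rw [h4.tsum_eq]; ring

lemma summable_zetaEMTerm_bound {σ : ℝ} (hσ : 0 < σ) :
    Summable fun n : ℕ => (n + 1 : ℝ) ^ (-σ - 1) := by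
  have := (summable_nat_add_iff 1).2 ((summable_nat_rpow (p := -σ - 1)).2 (by linarith))
  simpa using this

lemma zetaEntire_eq {s : ℂ} (hs : 1 / 4 < s.re) : zetaEntire s = 1 + ∑' n : ℕ, zetaEMTerm s n := by
  set R := ‖s‖ + 3 with hR
  have hR0 : 0 < R := by positivity
  set U : Set ℂ := {z | 1 / 4 < z.re} ∩ Metric.ball 0 R with hU
  have hUo : IsOpen U := (isOpen_lt continuous_const Complex.continuous_re).inter Metric.isOpen_ball
  have hUc : Convex ℝ U := by
    refine Convex.inter ?_ (convex_ball _ _)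
    exact convex_halfSpace_re_gt _
  have hd : DifferentiableOn ℂ (fun s => ∑' n : ℕ, zetaEMTerm s n) U := by
    refine Complex.differentiableOn_tsum_of_summable_norm (u := fun n : ℕ => (R + 1) * R * (n + 1 : ℝ) ^ (-(1 / 4 : ℝ) - 1))
      ((summable_zetaEMTerm_bound (by norm_num)).mul_left _) (fun n => ?_) hUo ?_
    · intro z _
      have h1 : ((n + 1 : ℝ) : ℂ) ≠ 0 := by exact_mod_cast (by positivity : (n + 1 : ℝ) ≠ 0)
      have h2 : ((n + 2 : ℝ) : ℂ) ≠ 0 := by exact_mod_cast (by positivity : (n + 2 : ℝ) ≠ 0)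
      have e1 : DifferentiableAt ℂ (fun z : ℂ => ((n + 1 : ℝ) : ℂ) ^ (-z)) z :=
        (differentiableAt_id.neg).const_cpow (Or.inl h1)
      have e2 : DifferentiableAt ℂ (fun z : ℂ => ((n + 1 : ℝ) : ℂ) ^ (1 - z)) z :=
        (differentiableAt_id.const_sub 1).const_cpow (Or.inl h1)
      have e3 : DifferentiableAt ℂ (fun z : ℂ => ((n + 2 : ℝ) : ℂ) ^ (1 - z)) z :=
        (differentiableAt_id.const_sub 1).const_cpow (Or.inl h2)
      exact ((((differentiableAt_id.sub_const 1).mul e1).add e3).sub e2).differentiableWithinAt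
    · intro n w hw
      have hw1 : 1 / 4 < w.re := hw.1
      have hw2 : ‖w‖ < R := by simpa using hw.2
      refine (norm_zetaEMTerm_le (by linarith) n).trans ?_
      have : ‖w - 1‖ ≤ R + 1 := by
        have := norm_sub_le w 1
        simp at this
        linarith
      gcongr ?_ * ?_ * ?_
      exact rpow_le_rpow_of_exponent_le (by linarith [(Nat.cast_nonneg n : (0 : ℝ) ≤ n)]) (by linarith)
  have h2U : (2 : ℂ) ∈ U := by
    refine ⟨by norm_num, ?_⟩
    simp only [Metric.mem_ball, dist_zero_right, hR]
    have := norm_nonneg s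
    norm_num
    linarith
  have hev : zetaEntire =ᶠ[nhds 2] fun s => 1 + ∑' n : ℕ, zetaEMTerm s n := by
    have : {z : ℂ | 1 < z.re} ∈ nhds (2 : ℂ) :=
      (isOpen_lt continuous_const Complex.continuous_re).mem_nhds (by norm_num)
    filter_upwards [this] with z hz
    exact zetaEntire_eq_of_one_lt_re hz
  have := AnalyticOnNhd.eqOn_of_preconnected_of_eventuallyEq (𝕜 := ℂ) (f := zetaEntire)
    (g := fun s => 1 + ∑' n : ℕ, zetaEMTerm s n) (U := U)
    (differentiable_zetaEntire.differentiableOn.analyticOnNhd hUo)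
    ((hd.const_add 1).analyticOnNhd hUo) hUc.isPreconnected h2U hev
  exact this ⟨hs, by simp [hR]⟩

/-- Polynomial bound to the right of the critical line. -/
lemma norm_zetaEntire_le_right : ∃ C : ℝ, 1 ≤ C ∧ ∀ s : ℂ, 1 / 2 ≤ s.re →
    ‖zetaEntire s‖ ≤ C * (1 + ‖s‖) ^ 2 := by
  have hsm := summable_zetaEMTerm_bound (σ := 1 / 2) (by norm_num)
  set B := ∑' n : ℕ, (n + 1 : ℝ) ^ (-(1 / 2) - 1 : ℝ)
  have hB : 0 ≤ B := tsum_nonneg fun n => by positivity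
  refine ⟨1 + B, by linarith, fun s hs => ?_⟩
  have h1 : ‖∑' n : ℕ, zetaEMTerm s n‖ ≤ ‖s - 1‖ * ‖s‖ * B := by
    refine tsum_of_norm_bounded (hsm.hasSum.mul_left _) fun n => ?_
    refine (norm_zetaEMTerm_le (by linarith) n).trans ?_
    gcongr ?_ * ?_
    exact rpow_le_rpow_of_exponent_le (by linarith [(Nat.cast_nonneg n : (0 : ℝ) ≤ n)]) (by linarith)
  rw [zetaEntire_eq (by linarith)]
  have h2 := norm_add_le 1 (∑' n : ℕ, zetaEMTerm s n)
  have h3 := norm_sub_le s 1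
  simp only [norm_one] at h2 h3
  have h4 : ‖s - 1‖ * ‖s‖ ≤ (1 + ‖s‖) ^ 2 := by nlinarith [norm_nonneg s, norm_nonneg (s - 1)]
  nlinarith [norm_nonneg s, mul_le_mul_of_nonneg_right h4 hB]

lemma norm_Gamma_le_re {z : ℂ} (hz : 0 < z.re) : ‖Complex.Gamma z‖ ≤ Gamma z.re := by
  rw [Complex.Gamma_eq_integral hz, Complex.GammaIntegral, Gamma_eq_integral hz]
  refine (norm_integral_le_integral_norm _).trans (le_of_eq ?_)
  apply setIntegral_congr_fun measurableSet_Ioi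
  intro x hx
  have hx0 : 0 < x := hx
  simp only [norm_mul, Complex.norm_real, norm_eq_abs, abs_of_pos (exp_pos _)]
  rw [Complex.norm_cpow_eq_rpow_re_of_pos hx0]
  simp

lemma Gamma_le_exp {x : ℝ} (hx : 1 / 2 ≤ x) :
    Gamma x ≤ 2 * exp (2 * 3 ^ (3 / 2 : ℝ) * (1 + x) ^ (3 / 2 : ℝ)) := by
  have h1 : Gamma (x + 2) = (x + 1) * x * Gamma x := by
    rw [show x + 2 = x + 1 + 1 by ring, Gamma_add_one (by linarith),
      Gamma_add_one (by linarith)]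
    ring
  have hG : 0 < Gamma x := Gamma_pos_of_pos (by linarith)
  have h2 : Gamma x ≤ 2 * Gamma (x + 2) := by
    rw [h1]
    have : 1 / 2 ≤ (x + 1) * x := by nlinarith
    nlinarith
  set n := ⌈x⌉₊ + 1 with hn
  have hxn : x + 2 ≤ (n : ℝ) + 1 := by
    have := Nat.le_ceil x
    rw [hn]; push_cast; linarith
  have hn3 : (n : ℝ) ≤ 3 * (1 + x) := by
    have := (Nat.ceil_lt_add_one (by linarith : 0 ≤ x)).le
    rw [hn]; push_cast; linarith
  have h3 : Gamma (x + 2) ≤ Gamma ((n : ℝ) + 1) := by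
    apply Gamma_strictMonoOn_Ici.monotoneOn _ _ hxn <;> simp only [Set.mem_Ici] <;> linarith
  rw [Gamma_nat_eq_factorial] at h3
  have h4 : ((n.factorial : ℕ) : ℝ) ≤ (n : ℝ) ^ n := by exact_mod_cast Nat.factorial_le_pow n
  have hn0 : (0 : ℝ) < n := by rw [hn]; positivity
  have h5 : (n : ℝ) ^ n = exp (n * log n) := by
    rw [exp_nat_mul, exp_log hn0]
  have h6 : log n ≤ 2 * (n : ℝ) ^ (1 / 2 : ℝ) := by
    have := log_le_rpow_div (x := n) hn0.le (ε := 1 / 2) (by norm_num)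
    linarith
  have h7 : n * log n ≤ 2 * (n : ℝ) ^ (3 / 2 : ℝ) := by
    calc n * log n ≤ n * (2 * (n : ℝ) ^ (1 / 2 : ℝ)) := by gcongr
      _ = 2 * ((n : ℝ) ^ (1 : ℝ) * (n : ℝ) ^ (1 / 2 : ℝ)) := by rw [rpow_one]; ring
      _ = _ := by rw [← rpow_add hn0]; norm_num
  have h8 : (n : ℝ) ^ (3 / 2 : ℝ) ≤ 3 ^ (3 / 2 : ℝ) * (1 + x) ^ (3 / 2 : ℝ) := by
    rw [← mul_rpow (by norm_num) (by linarith)]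
    exact rpow_le_rpow hn0.le hn3 (by norm_num)
  have h9 : exp (n * log n) ≤ exp (2 * 3 ^ (3 / 2 : ℝ) * (1 + x) ^ (3 / 2 : ℝ)) := by
    apply exp_le_exp.2; nlinarith
  linarith

lemma norm_cos_le_exp (z : ℂ) : ‖Complex.cos z‖ ≤ exp ‖z‖ := by
  rw [Complex.cos]
  have h1 : ‖Complex.exp (z * I)‖ ≤ exp ‖z‖ := by
    refine (Complex.norm_exp_le_exp_norm _).trans ?_; simp
  have h2 : ‖Complex.exp (-z * I)‖ ≤ exp ‖z‖ := by
    refine (Complex.norm_exp_le_exp_norm _).trans ?_; simp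
  rw [norm_div]
  have := norm_add_le (Complex.exp (z * I)) (Complex.exp (-z * I))
  simp
  simp at this h1 h2
  linarith

lemma zetaEntire_functional {z : ℂ} (hz : 0 < z.re) (hz1 : z ≠ 1) :
    zetaEntire (1 - z) = -z * (2 * (2 * π) ^ (-z) * Complex.Gamma z * Complex.cos (π * z / 2)) *
      riemannZeta z := by
  have hz0 : z ≠ 0 := by rintro rfl; simp at hz
  have h1 : (1 - z) ≠ 1 := by
    intro h; apply hz0; linear_combination -h
  rw [zetaEntire_of_ne h1, riemannZeta_one_sub (fun n h => by
    rw [h] at hz; simp at hz; linarith [(Nat.cast_nonneg n : (0 : ℝ) ≤ n)]) hz1]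
  ring

lemma zetaEntire_growth : ∃ K : ℝ, 0 ≤ K ∧
    ∀ s, ‖zetaEntire s‖ ≤ exp (K * (1 + ‖s‖) ^ (3 / 2 : ℝ)) := by
  obtain ⟨C, hC1, hC⟩ := norm_zetaEntire_le_right
  obtain ⟨B, hB⟩ := (isCompact_closedBall (0 : ℂ) 3).exists_bound_of_continuousOn
    differentiable_zetaEntire.continuous.continuousOn
  have hsq : ∀ r : ℝ, 0 ≤ r → (1 + r) ^ 2 ≤ exp (2 * (1 + r)) := by
    intro r hr
    have := add_one_le_exp (r)
    calc (1 + r) ^ 2 ≤ (exp (1 + r)) ^ 2 := by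
          gcongr; linarith [add_one_le_exp (1 + r)]
      _ = _ := by rw [← exp_nat_mul]; norm_num
  have hpow : ∀ r : ℝ, 0 ≤ r → 1 + r ≤ (1 + r) ^ (3 / 2 : ℝ) := by
    intro r hr
    conv_lhs => rw [← rpow_one (1 + r)]
    exact rpow_le_rpow_of_exponent_le (by linarith) (by norm_num)
  have hCe : C ≤ exp C := by linarith [add_one_le_exp C]
  have hBe : B ≤ exp |B| := by linarith [add_one_le_exp |B|, le_abs_self B]
  refine ⟨C + |B| + 30 + 2 * 3 ^ (3 / 2 : ℝ) * 2 ^ (3 / 2 : ℝ) , by positivity, fun s => ?_⟩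
  have hs0 := norm_nonneg s
  set r := ‖s‖ with hr
  set w := (1 + r) ^ (3 / 2 : ℝ) with hw
  have hw1 : 1 + r ≤ w := hpow r hs0
  set D : ℝ := 2 * 3 ^ (3 / 2 : ℝ) * 2 ^ (3 / 2 : ℝ) with hD
  have hD0 : 0 ≤ D := by positivity
  have hB0 : 0 ≤ |B| := abs_nonneg B
  by_cases h : 1 / 2 ≤ s.re
  · calc ‖zetaEntire s‖ ≤ C * (1 + r) ^ 2 := hC s h
      _ ≤ exp C * exp (2 * (1 + r)) := by gcongr; exact hsq r hs0
      _ = exp (C + 2 * (1 + r)) := by rw [exp_add]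
      _ ≤ _ := by
        apply exp_le_exp.2
        nlinarith [mul_nonneg hB0 (by linarith : 0 ≤ w), mul_nonneg hD0 (by linarith : 0 ≤ w)]
  by_cases h3 : r ≤ 3
  · calc ‖zetaEntire s‖ ≤ B := hB s (by simpa using h3)
      _ ≤ _ := hBe
      _ ≤ _ := by
        apply exp_le_exp.2
        nlinarith [mul_nonneg hB0 (by linarith : 0 ≤ w), mul_nonneg hD0 (by linarith : 0 ≤ w)]
  push Not at h h3
  obtain ⟨z, rfl⟩ : ∃ z, s = 1 - z := ⟨1 - s, by ring⟩
  have hzre : 1 / 2 ≤ z.re := by simp at h; linarith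
  have hz1n : 3 < ‖z - 1‖ := by rw [norm_sub_rev]; exact h3
  have hz1 : z ≠ 1 := by rintro rfl; norm_num at hz1n
  have hzn : ‖z‖ ≤ 1 + r := by
    have := norm_sub_le 1 (1 - z)
    simp only [sub_sub_cancel, norm_one] at this
    exact this
  have hzre2 : z.re ≤ 1 + r := (Complex.re_le_norm z).trans hzn
  rw [zetaEntire_functional (by linarith) hz1]
  have hz1' : z - 1 ≠ 0 := sub_ne_zero.2 hz1
  have hζ : ‖riemannZeta z‖ ≤ C * (1 + ‖z‖) ^ 2 := by
    have := hC z hzre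
    rw [zetaEntire_of_ne hz1, norm_mul] at this
    nlinarith [norm_nonneg (riemannZeta z)]
  have hp : ‖(2 * π : ℂ) ^ (-z)‖ ≤ 1 := by
    have : (2 * π : ℂ) = ((2 * π : ℝ) : ℂ) := by push_cast; rfl
    rw [this, Complex.norm_cpow_eq_rpow_re_of_pos (by positivity)]
    apply rpow_le_one_of_one_le_of_nonpos
    · nlinarith [pi_gt_three]
    · simp; linarith
  have hG : ‖Complex.Gamma z‖ ≤ 2 * exp (D * w) := by
    refine (norm_Gamma_le_re (by linarith)).trans ((Gamma_le_exp hzre).trans ?_)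
    refine mul_le_mul_of_nonneg_left (exp_le_exp.2 ?_) (by norm_num)
    rw [hD, mul_assoc (2 * 3 ^ (3 / 2 : ℝ) : ℝ)]
    refine mul_le_mul_of_nonneg_left ?_ (by positivity)
    rw [hw, ← mul_rpow (by norm_num) (by linarith)]
    apply rpow_le_rpow <;> linarith
  have hcos : ‖Complex.cos (π * z / 2)‖ ≤ exp (2 * (1 + r)) := by
    refine (norm_cos_le_exp _).trans (exp_le_exp.2 ?_)
    rw [norm_div, norm_mul, Complex.norm_real, norm_eq_abs, abs_of_pos pi_pos]
    simp
    nlinarith [pi_lt_four, norm_nonneg z, pi_pos]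
  have hlin : ‖z‖ ≤ exp (1 + r) := by linarith [add_one_le_exp (1 + r)]
  have hζ2 : ‖riemannZeta z‖ ≤ exp C * exp (4 * (1 + r)) := by
    refine hζ.trans ?_
    gcongr
    refine (hsq _ (norm_nonneg z)).trans (exp_le_exp.2 ?_)
    linarith
  have h4 : (4 : ℝ) ≤ exp 4 := by linarith [add_one_le_exp 4]
  calc ‖-z * (2 * (2 * π) ^ (-z) * Complex.Gamma z * Complex.cos (π * z / 2)) * riemannZeta z‖
      = ‖z‖ * (2 * ‖(2 * π : ℂ) ^ (-z)‖ * ‖Complex.Gamma z‖ * ‖Complex.cos (π * z / 2)‖) *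
          ‖riemannZeta z‖ := by simp
    _ ≤ exp (1 + r) * (2 * 1 * (2 * exp (D * w)) * exp (2 * (1 + r))) *
          (exp C * exp (4 * (1 + r))) := by gcongr
    _ = 4 * exp (7 * (1 + r) + D * w + C) := by
      have : 7 * (1 + r) + D * w + C = (1 + r) + D * w + 2 * (1 + r) + C + 4 * (1 + r) := by ring
      rw [this]; simp only [exp_add]; ring
    _ ≤ exp 4 * exp (7 * (1 + r) + D * w + C) := by gcongr
    _ = exp (4 + (7 * (1 + r) + D * w + C)) := by rw [← exp_add]
    _ ≤ _ := by
      apply exp_le_exp.2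
      nlinarith [mul_nonneg hB0 (by linarith : 0 ≤ w), mul_nonneg (by linarith : 0 ≤ C) (by linarith : 0 ≤ w - 1)]

/-! ### The zeros of the zeta function -/

lemma zetaEntire_zero_ne : zetaEntire 0 ≠ 0 := by rw [zetaEntire_zero]; norm_num

lemma zeta_zero_of_zetaEntire {ρ : ℂ} (h : zetaEntire ρ = 0) : ρ ≠ 1 ∧ riemannZeta ρ = 0 := by
  have h1 : ρ ≠ 1 := by
    rintro rfl
    rw [zetaEntire_one] at h
    exact one_ne_zero h
  rw [zetaEntire_of_ne h1] at h
  exact ⟨h1, (mul_eq_zero.1 h).resolve_left (sub_ne_zero.2 h1)⟩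

lemma zetaEntire_zero_cases (hRH : RiemannHypothesis) {ρ : ℂ} (h : zetaEntire ρ = 0) :
    (∃ k : ℕ, ρ = -2 * (k + 1)) ∨ ρ.re = 1 / 2 := by
  obtain ⟨h1, h2⟩ := zeta_zero_of_zetaEntire h
  by_cases hk : ∃ k : ℕ, ρ = -2 * (k + 1)
  · exact Or.inl hk
  · exact Or.inr (hRH ρ h2 hk h1)

lemma zetaEntire_ne_zero_of_one_le_re {s : ℂ} (hs : 1 ≤ s.re) : zetaEntire s ≠ 0 := by
  intro h
  exact riemannZeta_ne_zero_of_one_le_re hs (zeta_zero_of_zetaEntire h).2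

lemma analyticOrderNatAt_trivial_zero (k : ℕ) :
    analyticOrderNatAt zetaEntire (-2 * ((k : ℂ) + 1)) = 1 := by
  have hz : zetaEntire (-2 * ((k : ℂ) + 1)) = 0 := by
    rw [zetaEntire_of_ne, riemannZeta_neg_two_mul_nat_add_one, mul_zero]
    intro h
    have := congrArg Complex.re h
    simp at this
    have hk : (0 : ℝ) ≤ k := Nat.cast_nonneg k
    linarith
  have hd : deriv zetaEntire (-2 * ((k : ℂ) + 1)) ≠ 0 := by
    set z0 : ℂ := 2 * k + 3 with hz0
    have hz0re : z0.re = 2 * k + 3 := by simp [hz0]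
    have hk : (0 : ℝ) ≤ k := Nat.cast_nonneg k
    have hz01 : z0 ≠ 1 := by intro h; rw [h] at hz0re; simp at hz0re; linarith
    have e0 : 1 - z0 = -2 * ((k : ℂ) + 1) := by rw [hz0]; ring
    set A : ℂ → ℂ := fun z => -z * (2 * (2 * π) ^ (-z) * Complex.Gamma z) * riemannZeta z with hA
    have h2pi : (2 * π : ℂ) ≠ 0 := by simp [pi_ne_zero]
    have hAd : DifferentiableAt ℂ A z0 := by
      have h1 : DifferentiableAt ℂ (fun z : ℂ => (2 * π : ℂ) ^ (-z)) z0 :=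
        (differentiableAt_id.neg).const_cpow (Or.inl h2pi)
      have h2 : DifferentiableAt ℂ Complex.Gamma z0 := by
        apply Complex.differentiableAt_Gamma
        intro m h
        rw [h] at hz0re
        simp at hz0re
        linarith [(Nat.cast_nonneg m : (0 : ℝ) ≤ m)]
      exact ((differentiableAt_id.neg).mul ((h1.const_mul 2).mul h2)).mul
        (differentiableAt_riemannZeta hz01)
    have hA0 : A z0 ≠ 0 := by
      have h1 : z0 ≠ 0 := by intro h; rw [h] at hz0re; simp at hz0re; linarith
      have h2 : Complex.Gamma z0 ≠ 0 := Complex.Gamma_ne_zero_of_re_pos (by rw [hz0re]; linarith)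
      have h3 : riemannZeta z0 ≠ 0 := riemannZeta_ne_zero_of_one_le_re (by rw [hz0re]; linarith)
      have h4 : (2 * π : ℂ) ^ (-z0) ≠ 0 := by simp [Complex.cpow_eq_zero_iff, h2pi]
      simp only [hA]
      exact mul_ne_zero (mul_ne_zero (neg_ne_zero.2 h1)
        (mul_ne_zero (mul_ne_zero two_ne_zero h4) h2)) h3
    have hcos : Complex.cos (π * z0 / 2) = 0 := by
      rw [Complex.cos_eq_zero_iff]
      exact ⟨k + 1, by rw [hz0]; push_cast; ring⟩
    have hsin : Complex.sin (π * z0 / 2) ≠ 0 := by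
      intro h
      have := Complex.sin_sq_add_cos_sq (π * z0 / 2)
      rw [h, hcos] at this
      norm_num at this
    have hder : HasDerivAt (fun z => A z * Complex.cos (π * z / 2))
        (A z0 * (-Complex.sin (π * z0 / 2) * (π / 2))) z0 := by
      have hc : HasDerivAt (fun z : ℂ => Complex.cos (π * z / 2))
          (-Complex.sin (π * z0 / 2) * (π / 2)) z0 := by
        have : HasDerivAt (fun z : ℂ => π * z / 2) (π / 2 : ℂ) z0 := by
          simpa using ((hasDerivAt_id z0).const_mul (π : ℂ)).div_const 2
        exact this.ccos
      have := hAd.hasDerivAt.mul hc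
      rw [hcos, mul_zero, zero_add] at this
      exact this
    have hev : (fun z => zetaEntire (1 - z)) =ᶠ[nhds z0] fun z => A z * Complex.cos (π * z / 2) := by
      have hopen : IsOpen {z : ℂ | 1 < z.re} := isOpen_lt continuous_const Complex.continuous_re
      filter_upwards [hopen.mem_nhds (show z0 ∈ {z : ℂ | 1 < z.re} by
        change 1 < z0.re; rw [hz0re]; linarith)] with z hz
      have hz' : 1 < z.re := hz
      rw [zetaEntire_functional (by linarith) (by rintro rfl; simp at hz')]
      simp only [hA]; ring
    have hder2 : HasDerivAt (fun z => zetaEntire (1 - z)) (deriv zetaEntire (1 - z0) * (-1)) z0 := by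
      have h1 : HasDerivAt (fun z : ℂ => 1 - z) (-1) z0 := by
        simpa using (hasDerivAt_id z0).const_sub 1
      exact ((differentiable_zetaEntire (1 - z0)).hasDerivAt).comp z0 h1
    have := hder2.unique (hder.congr_of_eventuallyEq hev)
    intro h
    rw [e0, h, zero_mul] at this
    have hpi : (π / 2 : ℂ) ≠ 0 := by simp [pi_ne_zero]
    exact mul_ne_zero hA0 (mul_ne_zero (neg_ne_zero.2 hsin) hpi) this.symm
  have := (differentiable_zetaEntire.analyticAt _).analyticOrderAt_eq_one_of_zero_deriv_ne_zero hz hd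
  rw [analyticOrderNatAt, this]
  rfl

lemma zetaZeroOrder_eq {ρ : ℂ} (h1 : ρ ≠ 1) :
    zetaZeroOrder ρ = analyticOrderNatAt zetaEntire ρ := by
  have hana : AnalyticAt ℂ riemannZeta ρ := by
    apply DifferentiableOn.analyticAt (s := {1}ᶜ)
    · intro z hz
      exact (differentiableAt_riemannZeta hz).differentiableWithinAt
    · exact isOpen_compl_singleton.mem_nhds h1
  have hev : zetaEntire =ᶠ[nhds ρ] (fun s => s - 1) * riemannZeta := by
    filter_upwards [isOpen_compl_singleton.mem_nhds (show ρ ∈ ({1}ᶜ : Set ℂ) from h1)] with z hz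
    exact zetaEntire_of_ne hz
  have hord : analyticOrderAt zetaEntire ρ = analyticOrderAt riemannZeta ρ := by
    rw [analyticOrderAt_congr hev, analyticOrderAt_mul (by fun_prop) hana]
    have : analyticOrderAt (fun s : ℂ => s - 1) ρ = 0 := by
      rw [AnalyticAt.analyticOrderAt_eq_zero (by fun_prop)]
      exact sub_ne_zero.2 h1
    rw [this, zero_add]
  have hne := entire_order_ne_top differentiable_zetaEntire zetaEntire_zero_ne ρ
  have hcast := Nat.cast_analyticOrderNatAt hne
  set n := analyticOrderNatAt zetaEntire ρ with hn
  rw [hord] at hcast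
  have hle := (natCast_le_analyticOrderAt_iff_iteratedDeriv_eq_zero (n := n) hana).1 hcast.le
  have hnot : ¬ ∀ i < n + 1, iteratedDeriv i riemannZeta ρ = 0 := by
    rw [← natCast_le_analyticOrderAt_iff_iteratedDeriv_eq_zero hana, ← hcast]
    norm_cast
    omega
  push Not at hnot
  obtain ⟨i, hi, hine⟩ := hnot
  have hin : i = n := by
    by_contra hne
    exact hine (hle i (by omega))
  rw [hin] at hine
  unfold zetaZeroOrder
  apply le_antisymm
  · exact Nat.sInf_le hine
  · apply le_csInf ⟨n, hine⟩
    intro m hm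
    by_contra hlt
    exact hm (hle m (by omega))

/-- The multiplicity of `1 / 2 + iγ` as a zero of the zeta function. -/
noncomputable def zeroMult (γ : ℝ) : ℕ := analyticOrderNatAt zetaEntire (1 / 2 + I * γ)

/-- Both the critical line and the set of trivial zeros, as a single parametrized family. -/
noncomputable def zeroPoint : ℝ ⊕ ℕ → ℂ :=
  Sum.elim (fun γ : ℝ => 1 / 2 + I * γ) (fun k : ℕ => -2 * ((k : ℂ) + 1))

lemma zeroPoint_injective : Function.Injective zeroPoint := by
  apply Function.Injective.sumElim
  · intro a b h
    have := congrArg Complex.im h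
    simpa using this
  · intro a b h
    have := congrArg Complex.re h
    simpa using this
  · intro a b h
    have := congrArg Complex.re h
    simp at this
    linarith [(Nat.cast_nonneg b : (0 : ℝ) ≤ b)]

lemma support_order_subset (hRH : RiemannHypothesis) {E : Type*} [NormedAddCommGroup E]
    [NormedSpace ℝ E] (φ : ℂ → E) :
    Function.support (fun ρ : ℂ => (analyticOrderNatAt zetaEntire ρ : ℝ) • φ ρ) ⊆
      Set.range zeroPoint := by
  intro ρ hρ
  have h1 : analyticOrderNatAt zetaEntire ρ ≠ 0 := by
    intro h
    apply hρ
    simp [h]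
  rcases zetaEntire_zero_cases hRH
    (eq_zero_of_analyticOrderNatAt_ne differentiable_zetaEntire h1) with ⟨k, hk⟩ | h
  · exact ⟨Sum.inr k, by simp [zeroPoint, hk]⟩
  · refine ⟨Sum.inl ρ.im, ?_⟩
    simp only [zeroPoint, Sum.elim_inl]
    apply Complex.ext <;> simp [h]

lemma summable_zeros (hRH : RiemannHypothesis) {E : Type*} [NormedAddCommGroup E]
    [NormedSpace ℝ E] [CompleteSpace E] {φ : ℂ → E}
    (h : Summable fun ρ : ℂ => (analyticOrderNatAt zetaEntire ρ : ℝ) • φ ρ) :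
    (Summable fun γ : ℝ => (zeroMult γ : ℝ) • φ (1 / 2 + I * γ)) ∧
    (Summable fun k : ℕ => φ (-2 * ((k : ℂ) + 1))) ∧
    ∑' ρ : ℂ, (analyticOrderNatAt zetaEntire ρ : ℝ) • φ ρ =
      ∑' γ : ℝ, (zeroMult γ : ℝ) • φ (1 / 2 + I * γ) +
      ∑' k : ℕ, φ (-2 * ((k : ℂ) + 1)) := by
  set F : ℂ → E := fun ρ : ℂ => (analyticOrderNatAt zetaEntire ρ : ℝ) • φ ρ with hF
  have h1 : Summable (F ∘ zeroPoint) := h.comp_injective zeroPoint_injective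
  have e1 : (F ∘ zeroPoint) ∘ Sum.inl =
      fun γ : ℝ => (zeroMult γ : ℝ) • φ (1 / 2 + I * γ) := by
    ext γ; simp [hF, zeroPoint, zeroMult]
  have e2 : (F ∘ zeroPoint) ∘ Sum.inr = fun k : ℕ => φ (-2 * ((k : ℂ) + 1)) := by
    ext k; simp only [hF, zeroPoint, Function.comp, Sum.elim_inr, analyticOrderNatAt_trivial_zero]
    simp
  have s1 : Summable ((F ∘ zeroPoint) ∘ Sum.inl) := h1.comp_injective Sum.inl_injective
  have s2 : Summable ((F ∘ zeroPoint) ∘ Sum.inr) := h1.comp_injective Sum.inr_injective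
  refine ⟨e1 ▸ s1, e2 ▸ s2, ?_⟩
  rw [← e1, ← e2, ← zeroPoint_injective.tsum_eq (support_order_subset hRH φ)]
  exact (s1.hasSum.sum s2.hasSum).tsum_eq

/-! ### Bounds for sums over zeros -/

local notation "Λ" => ArithmeticFunction.vonMangoldt

lemma vonMangoldt_term (s : ℂ) (n : ℕ) :
    LSeries.term (fun n => ((Λ n : ℝ) : ℂ)) s n = ((Λ n : ℝ) : ℂ) * (n : ℂ) ^ (-s) := by
  rcases Nat.eq_zero_or_pos n with rfl | hn
  · simp
  · rw [LSeries.term_of_ne_zero hn.ne', Complex.cpow_neg, div_eq_mul_inv]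

lemma hasSum_vonMangoldt {s : ℂ} (hs : 1 < s.re) :
    HasSum (fun n : ℕ => ((Λ n : ℝ) : ℂ) * (n : ℂ) ^ (-s)) (1 / (s - 1) - logDeriv zetaEntire s) := by
  have h1 := (ArithmeticFunction.LSeriesSummable_vonMangoldt hs).LSeriesHasSum
  rw [ArithmeticFunction.LSeries_vonMangoldt_eq_deriv_riemannZeta_div hs] at h1
  have hs1 : s ≠ 1 := by rintro rfl; simp at hs
  have hev : zetaEntire =ᶠ[nhds s] fun z => (z - 1) * riemannZeta z := by
    filter_upwards [isOpen_compl_singleton.mem_nhds (show s ∈ ({1}ᶜ : Set ℂ) from hs1)] with z hz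
    exact zetaEntire_of_ne hz
  have hd : logDeriv zetaEntire s = 1 / (s - 1) + deriv riemannZeta s / riemannZeta s := by
    rw [logDeriv_apply, hev.deriv_eq, hev.eq_of_nhds]
    have hz : riemannZeta s ≠ 0 := riemannZeta_ne_zero_of_one_le_re hs.le
    have hs1' : s - 1 ≠ 0 := sub_ne_zero.2 hs1
    have : deriv (fun z => (z - 1) * riemannZeta z) s =
        1 * riemannZeta s + (s - 1) * deriv riemannZeta s :=
      (((hasDerivAt_id s).sub_const 1).mul (differentiableAt_riemannZeta hs1).hasDerivAt).deriv
    rw [this]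
    field_simp
  have he : 1 / (s - 1) - logDeriv zetaEntire s = -deriv riemannZeta s / riemannZeta s := by
    rw [hd]; ring
  rw [he]
  refine h1.congr_fun ?_
  intro n
  exact (vonMangoldt_term s n).symm

lemma summable_vonMangoldt_rpow {σ : ℝ} (hσ : 1 < σ) :
    Summable fun n : ℕ => Λ n * (n : ℝ) ^ (-σ) := by
  have h := (hasSum_vonMangoldt (s := (σ : ℂ)) (by simpa using hσ)).summable.norm
  refine h.congr ?_
  intro n
  rcases Nat.eq_zero_or_pos n with rfl | hn
  · simp
  · rw [norm_mul, Complex.norm_real, norm_of_nonneg vonMangoldt_nonneg,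
      Complex.norm_natCast_cpow_of_pos hn]
    simp

lemma logDeriv_zetaEntire_bound_two : ∃ C : ℝ, 0 ≤ C ∧ ∀ t : ℝ,
    ‖logDeriv zetaEntire (2 + I * t)‖ ≤ C := by
  refine ⟨1 + ∑' n : ℕ, Λ n * (n : ℝ) ^ (-(2 : ℝ)), ?_, ?_⟩
  · have : 0 ≤ ∑' n : ℕ, Λ n * (n : ℝ) ^ (-(2 : ℝ)) :=
      tsum_nonneg fun n => mul_nonneg vonMangoldt_nonneg (by positivity)
    linarith
  · intro t
    have hs : 1 < (2 + I * t).re := by simp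
    have h := hasSum_vonMangoldt hs
    have h2 : ‖∑' n : ℕ, ((Λ n : ℝ) : ℂ) * (n : ℂ) ^ (-(2 + I * t))‖ ≤
        ∑' n : ℕ, Λ n * (n : ℝ) ^ (-(2 : ℝ)) := by
      refine tsum_of_norm_bounded (summable_vonMangoldt_rpow (by norm_num : (1 : ℝ) < 2)).hasSum ?_
      intro n
      rcases Nat.eq_zero_or_pos n with rfl | hn
      · simp
      · rw [norm_mul, Complex.norm_real, norm_of_nonneg vonMangoldt_nonneg,
          Complex.norm_natCast_cpow_of_pos hn]
        simp
    rw [h.tsum_eq] at h2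
    have h3 : ‖1 / ((2 + I * t) - 1)‖ ≤ 1 := by
      rw [norm_div, norm_one]
      apply div_le_one_of_le₀ _ (norm_nonneg _)
      have := Complex.abs_re_le_norm (2 + I * t - 1)
      simp at this
      norm_num at this
      exact this
    have h4 := norm_sub_norm_le (logDeriv zetaEntire (2 + I * t)) (1 / ((2 + I * t) - 1))
    rw [norm_sub_rev] at h4
    linarith

lemma summable_zeroMult (hRH : RiemannHypothesis) (t : ℝ) :
    Summable fun γ : ℝ => (zeroMult γ : ℝ) / (1 + (t - γ) ^ 2) := by
  obtain ⟨K, hK0, hK⟩ := zetaEntire_growth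
  have h := summable_order_div differentiable_zetaEntire zetaEntire_zero_ne hK0 hK
  have h1 := (summable_zeros hRH (φ := fun ρ : ℂ => 1 / (1 + ‖ρ‖ ^ 2)) (by
    refine h.congr ?_
    intro ρ; simp [div_eq_mul_inv])).1
  refine Summable.of_nonneg_of_le (fun γ => by positivity) (fun γ => ?_)
    (h1.mul_left (4 * (1 + t ^ 2)))
  have e : ‖(1 / 2 + I * γ : ℂ)‖ ^ 2 = 1 / 4 + γ ^ 2 := by
    rw [← Complex.normSq_eq_norm_sq, Complex.normSq_apply]; simp; ring
  rw [e, smul_eq_mul, mul_one_div, mul_div_assoc']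
  rw [div_le_div_iff₀ (by positivity) (by positivity)]
  have : 1 + (1 / 4 + γ ^ 2) ≤ 4 * (1 + t ^ 2) * (1 + (t - γ) ^ 2) := by
    nlinarith [sq_nonneg (t - (γ - t)), sq_nonneg (t * (t - γ)), sq_nonneg (2 * t - γ), sq_nonneg γ,
      sq_nonneg t]
  calc (zeroMult γ : ℝ) * (1 + (1 / 4 + γ ^ 2))
      ≤ (zeroMult γ : ℝ) * (4 * (1 + t ^ 2) * (1 + (t - γ) ^ 2)) :=
        mul_le_mul_of_nonneg_left this (Nat.cast_nonneg _)
    _ = _ := by ring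

lemma logDeriv_zetaEntire_sub (hRH : RiemannHypothesis) {s w : ℂ} (hs : zetaEntire s ≠ 0)
    (hw : zetaEntire w ≠ 0) :
    (Summable fun γ : ℝ => (zeroMult γ : ℝ) • (1 / (s - (1 / 2 + I * γ)) -
        1 / (w - (1 / 2 + I * γ)))) ∧
    (Summable fun k : ℕ => 1 / (s - (-2 * ((k : ℂ) + 1))) - 1 / (w - (-2 * ((k : ℂ) + 1)))) ∧
    logDeriv zetaEntire s - logDeriv zetaEntire w =
      ∑' γ : ℝ, (zeroMult γ : ℝ) • (1 / (s - (1 / 2 + I * γ)) -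
        1 / (w - (1 / 2 + I * γ))) +
      ∑' k : ℕ, (1 / (s - (-2 * ((k : ℂ) + 1))) - 1 / (w - (-2 * ((k : ℂ) + 1)))) := by
  obtain ⟨K, hK0, hK⟩ := zetaEntire_growth
  have h1 := summable_order_mul_sub differentiable_zetaEntire zetaEntire_zero_ne hK0 hK hs hw
  have h2 := logDeriv_sub_eq_tsum differentiable_zetaEntire zetaEntire_zero_ne hK0 hK hs hw
  have he : (fun ρ : ℂ => (analyticOrderNatAt zetaEntire ρ : ℂ) * (1 / (s - ρ) - 1 / (w - ρ))) =
      fun ρ : ℂ => (analyticOrderNatAt zetaEntire ρ : ℝ) • (1 / (s - ρ) - 1 / (w - ρ)) := by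
    ext ρ; rw [Complex.real_smul]; simp
  rw [he] at h2
  have h3 := summable_zeros hRH (φ := fun ρ : ℂ => 1 / (s - ρ) - 1 / (w - ρ)) (by
    rw [← he]; exact Summable.of_norm h1)
  exact ⟨h3.1, h3.2.1, h2.trans h3.2.2⟩

lemma sum_trivial_log_bound (t : ℝ) (N : ℕ) :
    ∑ k ∈ range N, t ^ 2 / ((2 * (k + 2)) * ((2 * (k + 2)) ^ 2 + t ^ 2)) ≤
      log (1 + |t|) := by
  set H : ℕ → ℝ := fun k => log (1 + |t| / (k + 1)) with hH
  have hstep : ∀ k : ℕ, t ^ 2 / ((2 * ((k : ℝ) + 2)) * ((2 * (k + 2)) ^ 2 + t ^ 2)) ≤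
      H k - H (k + 1) := by
    intro k
    have hk : (0 : ℝ) ≤ k := Nat.cast_nonneg k
    have ht := abs_nonneg t
    have hpos1 : 0 < 1 + |t| / ((k : ℝ) + 1) := by positivity
    have hpos2 : 0 < 1 + |t| / (((k + 1 : ℕ) : ℝ) + 1) := by positivity
    have e1 : H k - H (k + 1) = -log ((1 + |t| / (((k + 1 : ℕ) : ℝ) + 1)) /
        (1 + |t| / ((k : ℝ) + 1))) := by
      rw [log_div hpos2.ne' hpos1.ne']; simp only [hH]; ring
    have e2 : |t| / ((k + 2) * (k + 1 + |t|)) ≤ H k - H (k + 1) := by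
      rw [e1]
      have := log_le_sub_one_of_pos (div_pos hpos2 hpos1)
      have e3 : (1 + |t| / (((k + 1 : ℕ) : ℝ) + 1)) / (1 + |t| / ((k : ℝ) + 1)) - 1 =
          - (|t| / ((k + 2) * (k + 1 + |t|))) := by
        push_cast
        have : (k : ℝ) + 1 + 1 ≠ 0 := by positivity
        have : (k : ℝ) + 1 + |t| ≠ 0 := by positivity
        have : (1 + |t| / ((k : ℝ) + 1)) ≠ 0 := hpos1.ne'
        have : (k : ℝ) + 2 ≠ 0 := by positivity
        field_simp
        ring
      linarith
    refine le_trans ?_ e2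
    rw [div_le_div_iff₀ (by positivity) (by positivity)]
    rw [← sq_abs t]
    set a := |t|
    have h1 : a * (k + 1 + a) ≤ 2 * ((2 * (k + 2)) ^ 2 + a ^ 2) := by nlinarith [sq_nonneg (a - (k + 1))]
    have : a ^ 2 * ((k + 2) * (k + 1 + a)) = a * (k + 2) * (a * (k + 1 + a)) := by ring
    rw [this]
    calc _ ≤ a * (k + 2) * (2 * ((2 * (k + 2)) ^ 2 + a ^ 2)) :=
          mul_le_mul_of_nonneg_left h1 (by positivity)
      _ = _ := by ring
  calc _ ≤ ∑ k ∈ range N, (H k - H (k + 1)) := sum_le_sum fun k _ => hstep k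
    _ = H 0 - H N := sum_range_sub' H N
    _ ≤ log (1 + |t|) := by
      have : 0 ≤ H N := log_nonneg (by
        have := abs_nonneg t
        have : 0 ≤ |t| / ((N : ℝ) + 1) := by positivity
        linarith)
      have e : H 0 = log (1 + |t|) := by simp [hH]
      linarith

theorem zero_sum_le_log (hRH : RiemannHypothesis) : ∃ C : ℝ, 0 < C ∧ ∀ t : ℝ,
    ∑' γ : ℝ, (zeroMult γ : ℝ) / (1 + (t - γ) ^ 2) ≤ C * log (|t| + 2) := by
  obtain ⟨C1, hC1, hb⟩ := logDeriv_zetaEntire_bound_two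
  set S0 : ℝ := ∑' γ : ℝ, (zeroMult γ : ℝ) / (1 + (0 - γ) ^ 2) with hS0
  have hS00 : 0 ≤ S0 := tsum_nonneg fun γ => by positivity
  have hlog2 : 0 < log 2 := log_pos (by norm_num)
  refine ⟨2 * ((2 * C1 + 2 * S0) / log 2 + 1), by positivity, ?_⟩
  intro t
  have hs : zetaEntire (2 + I * t) ≠ 0 :=
    zetaEntire_ne_zero_of_one_le_re (by simp)
  have hw : zetaEntire (2 + I * (0 : ℝ)) ≠ 0 :=
    zetaEntire_ne_zero_of_one_le_re (by simp)
  obtain ⟨h1, h2, h3⟩ := logDeriv_zetaEntire_sub hRH hs hw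
  have hre : ∀ (u γ : ℝ), (1 / (2 + I * u - (1 / 2 + I * γ))).re =
      (3 / 2) / (9 / 4 + (u - γ) ^ 2) := by
    intro u γ
    rw [one_div, Complex.inv_re, Complex.normSq_apply]
    simp
    norm_num
    congr 1
    ring
  have hre2 : ∀ (u : ℝ) (k : ℕ), (1 / (2 + I * u - (-2 * ((k : ℂ) + 1)))).re =
      (2 * (k + 2)) / ((2 * (k + 2)) ^ 2 + u ^ 2) := by
    intro u k
    rw [one_div, Complex.inv_re, Complex.normSq_apply]
    simp
    congr 1 <;> ring
  have h1' := Complex.hasSum_re h1.hasSum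
  have h2' := Complex.hasSum_re h2.hasSum
  set A := ∑' γ : ℝ, (zeroMult γ : ℝ) • (1 / (2 + I * t - (1 / 2 + I * γ)) -
        1 / (2 + I * (0 : ℝ) - (1 / 2 + I * γ)) : ℂ) with hA
  set B := ∑' k : ℕ, (1 / (2 + I * t - (-2 * ((k : ℂ) + 1))) -
    1 / (2 + I * (0 : ℝ) - (-2 * ((k : ℂ) + 1)))) with hB
  have hBre : -log (1 + |t|) ≤ B.re := by
    have h2'' : HasSum (fun k : ℕ => t ^ 2 / ((2 * ((k : ℝ) + 2)) * ((2 * (k + 2)) ^ 2 + t ^ 2)))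
        (-B.re) := by
      refine h2'.neg.congr_fun ?_
      intro k
      rw [Complex.sub_re, hre2, hre2]
      have hk : (0 : ℝ) ≤ k := Nat.cast_nonneg k
      field_simp
      ring
    have := le_of_tendsto' h2''.tendsto_sum_nat (sum_trivial_log_bound t)
    linarith
  have hAre : ∑' γ : ℝ, (zeroMult γ : ℝ) / (1 + (t - γ) ^ 2) ≤ 2 * (A.re + 2 * S0) := by
    have g1 : HasSum (fun γ : ℝ => (zeroMult γ : ℝ) * ((3 / 2) / (9 / 4 + (t - γ) ^ 2) -
        (3 / 2) / (9 / 4 + (0 - γ) ^ 2))) A.re := by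
      refine h1'.congr_fun ?_
      intro γ
      rw [Complex.smul_re, Complex.sub_re, hre, hre, smul_eq_mul]
    have g2 := (summable_zeroMult hRH 0).hasSum
    have g3 := (summable_zeroMult hRH t).hasSum
    refine hasSum_le ?_ g3 ((g1.add (g2.mul_left 2)).mul_left 2)
    intro γ
    have hm : (0 : ℝ) ≤ zeroMult γ := Nat.cast_nonneg _
    have i1 : 1 / (1 + (t - γ) ^ 2) ≤ 2 * ((3 / 2) / (9 / 4 + (t - γ) ^ 2)) := by
      rw [mul_div_assoc', div_le_div_iff₀ (by positivity) (by positivity)]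
      nlinarith [sq_nonneg (t - γ)]
    have i2 : (3 / 2) / (9 / 4 + (0 - γ) ^ 2) ≤ 2 * (1 / (1 + (0 - γ) ^ 2)) := by
      rw [mul_div_assoc', div_le_div_iff₀ (by positivity) (by positivity)]
      nlinarith [sq_nonneg (0 - γ)]
    have j1 := mul_le_mul_of_nonneg_left i1 hm
    have j2 := mul_le_mul_of_nonneg_left i2 hm
    rw [mul_one_div] at j1
    have e : 2 * ((zeroMult γ : ℝ) / (1 + (0 - γ) ^ 2)) = zeroMult γ * (2 * (1 / (1 + (0 - γ) ^ 2))) := by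
      ring
    rw [e, mul_sub]
    linarith
  have hsum : A.re + B.re ≤ 2 * C1 := by
    rw [← Complex.add_re, ← h3]
    refine (Complex.re_le_norm _).trans ((norm_sub_le _ _).trans ?_)
    linarith [hb t, hb 0]
  have hl1 : log (1 + |t|) ≤ log (|t| + 2) :=
    log_le_log (by positivity) (by linarith)
  have hl2 : log 2 ≤ log (|t| + 2) :=
    log_le_log (by norm_num) (by linarith [abs_nonneg t])
  have : 2 * C1 + 2 * S0 ≤ (2 * C1 + 2 * S0) / log 2 * log (|t| + 2) := by
    rw [div_mul_eq_mul_div, le_div_iff₀ hlog2]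
    exact mul_le_mul_of_nonneg_left hl2 (by positivity)
  linarith

theorem norm_logDeriv_zetaEntire_le (hRH : RiemannHypothesis) : ∃ C : ℝ, 0 < C ∧ ∀ t : ℝ,
    ‖logDeriv zetaEntire (-1 / 2 + I * t)‖ ≤ C * log (|t| + 2) := by
  obtain ⟨C1, hC1, hb⟩ := logDeriv_zetaEntire_bound_two
  obtain ⟨C2, hC2, hz⟩ := zero_sum_le_log hRH
  have hs2 : Summable fun k : ℕ => 1 / ((k : ℝ) + 1) ^ 2 := by
    have := (summable_nat_add_iff 1).2 (summable_one_div_nat_pow.2 (by norm_num : 1 < 2))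
    refine this.congr fun k => ?_
    push_cast; rfl
  set S := ∑' k : ℕ, 1 / ((k : ℝ) + 1) ^ 2 with hS
  have hS0 : 0 ≤ S := tsum_nonneg fun k => by positivity
  have hlog2 : 0 < log 2 := log_pos (by norm_num)
  refine ⟨5 / 2 * C2 + (C1 + S) / log 2, by positivity, ?_⟩
  intro t
  have hre1 : (-1 / 2 + I * t : ℂ).re = -1 / 2 := by simp
  have hs : zetaEntire (-1 / 2 + I * t) ≠ 0 := by
    intro h
    rcases zetaEntire_zero_cases hRH h with ⟨k, hk⟩ | h
    · rw [hk] at hre1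
      simp at hre1
      linarith [(Nat.cast_nonneg k : (0 : ℝ) ≤ k)]
    · rw [hre1] at h; norm_num at h
  have hw : zetaEntire (2 + I * t) ≠ 0 :=
    zetaEntire_ne_zero_of_one_le_re (by simp)
  obtain ⟨h1, h2, h3⟩ := logDeriv_zetaEntire_sub hRH hs hw
  have hdiff : ∀ ρ : ℂ, -1 / 2 + I * t - ρ ≠ 0 → 2 + I * t - ρ ≠ 0 →
      1 / (-1 / 2 + I * t - ρ) - 1 / (2 + I * t - ρ) =
      (5 / 2) / ((-1 / 2 + I * t - ρ) * (2 + I * t - ρ)) := by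
    intro ρ ha hb
    rw [div_sub_div _ _ ha hb]
    congr 1
    ring
  have b1 : ‖∑' γ : ℝ, (zeroMult γ : ℝ) • (1 / (-1 / 2 + I * t - (1 / 2 + I * γ)) -
        1 / (2 + I * t - (1 / 2 + I * γ)))‖ ≤
        5 / 2 * ∑' γ : ℝ, (zeroMult γ : ℝ) / (1 + (t - γ) ^ 2) := by
    refine tsum_of_norm_bounded ((summable_zeroMult hRH t).hasSum.mul_left (5 / 2)) ?_
    intro γ
    have r1 : (-1 / 2 + I * t - (1 / 2 + I * γ) : ℂ).re = -1 := by simp; norm_num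
    have r2 : (2 + I * t - (1 / 2 + I * γ) : ℂ).re = 3 / 2 := by simp; norm_num
    have n1 : ‖(-1 / 2 + I * t - (1 / 2 + I * γ) : ℂ)‖ = √(1 + (t - γ) ^ 2) := by
      rw [Complex.norm_def, Complex.normSq_apply, r1]; simp; ring_nf
    have n2 : √(1 + (t - γ) ^ 2) ≤ ‖(2 + I * t - (1 / 2 + I * γ) : ℂ)‖ := by
      rw [Complex.norm_def, Complex.normSq_apply, r2]
      apply sqrt_le_sqrt
      simp; nlinarith
    rw [hdiff _ (by intro h; rw [h] at r1; simp at r1) (by intro h; rw [h] at r2; norm_num at r2),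
      norm_smul, norm_div, norm_mul, n1]
    have hp : 0 < 1 + (t - γ) ^ 2 := by positivity
    have : 1 + (t - γ) ^ 2 ≤ √(1 + (t - γ) ^ 2) *
        ‖(2 + I * t - (1 / 2 + I * γ) : ℂ)‖ := by
      calc 1 + (t - γ) ^ 2 = √(1 + (t - γ) ^ 2) * √(1 + (t - γ) ^ 2) :=
            (mul_self_sqrt hp.le).symm
        _ ≤ _ := mul_le_mul_of_nonneg_left n2 (sqrt_nonneg _)
    have h52 : ‖(5 / 2 : ℂ)‖ = 5 / 2 := by norm_num
    rw [h52, norm_of_nonneg (Nat.cast_nonneg _)]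
    calc _ ≤ (zeroMult γ : ℝ) * ((5 / 2) / (1 + (t - γ) ^ 2)) := by
          apply mul_le_mul_of_nonneg_left _ (Nat.cast_nonneg _)
          exact div_le_div_of_nonneg_left (by norm_num) hp this
      _ = _ := by ring
  have b2 : ‖∑' k : ℕ, (1 / (-1 / 2 + I * t - (-2 * ((k : ℂ) + 1))) -
        1 / (2 + I * t - (-2 * ((k : ℂ) + 1))))‖ ≤ S := by
    refine tsum_of_norm_bounded hs2.hasSum ?_
    intro k
    have hk : (0 : ℝ) ≤ k := Nat.cast_nonneg k
    have r1 : (-1 / 2 + I * t - (-2 * ((k : ℂ) + 1)) : ℂ).re = 2 * k + 3 / 2 := by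
      simp; ring
    have r2 : (2 + I * t - (-2 * ((k : ℂ) + 1)) : ℂ).re = 2 * k + 4 := by simp; ring
    have n1 := Complex.re_le_norm (-1 / 2 + I * t - (-2 * ((k : ℂ) + 1)) : ℂ)
    have n2 := Complex.re_le_norm (2 + I * t - (-2 * ((k : ℂ) + 1)) : ℂ)
    rw [r1] at n1
    rw [r2] at n2
    rw [hdiff _ (by intro h; rw [h] at r1; simp at r1; linarith)
      (by intro h; rw [h] at r2; simp at r2; linarith), norm_div, norm_mul]
    have h52 : ‖(5 / 2 : ℂ)‖ = 5 / 2 := by norm_num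
    rw [h52]
    have hm := mul_le_mul n1 n2 (by positivity) (norm_nonneg _)
    have hm2 : 3 * ((k : ℝ) + 1) ^ 2 ≤ (2 * k + 3 / 2) * (2 * k + 4) := by nlinarith
    rw [div_le_div_iff₀ (by nlinarith) (by positivity)]
    nlinarith
  have hl2 : log 2 ≤ log (|t| + 2) :=
    log_le_log (by norm_num) (by linarith [abs_nonneg t])
  have h5 : (C1 + S) ≤ (C1 + S) / log 2 * log (|t| + 2) := by
    rw [div_mul_eq_mul_div, le_div_iff₀ hlog2]
    exact mul_le_mul_of_nonneg_left hl2 (by positivity)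
  have h6 := norm_sub_norm_le (logDeriv zetaEntire (-1 / 2 + I * t))
    (logDeriv zetaEntire (2 + I * t))
  rw [h3] at h6
  have h7 := norm_add_le (∑' γ : ℝ, (zeroMult γ : ℝ) • (1 / (-1 / 2 + I * t -
    (1 / 2 + I * γ)) - 1 / (2 + I * t - (1 / 2 + I * γ))))
    (∑' k : ℕ, (1 / (-1 / 2 + I * t - (-2 * ((k : ℂ) + 1))) -
        1 / (2 + I * t - (-2 * ((k : ℂ) + 1)))))
  have := hz t
  have := hb t
  linarith

/-! ### A class of continuous integrable functions with prescribed Fourier transform -/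

/-- `h` is continuous and integrable with Fourier transform `F`. -/
structure FourierPairOn (h F : ℝ → ℂ) : Prop where
  cont : Continuous h
  int : Integrable h
  eq : ∀ v : ℝ, ∫ y : ℝ, Complex.exp (-(I * v * y)) * h y = F v

lemma norm_exp_neg_I_mul (v y : ℝ) : ‖Complex.exp (-(I * v * y))‖ = 1 := by
  rw [Complex.norm_exp]; simp

lemma integrable_exp_neg_I_mul {h : ℝ → ℂ} (hi : Integrable h) (v : ℝ) :
    Integrable fun y : ℝ => Complex.exp (-(I * v * y)) * h y := by
  refine hi.bdd_mul (c := 1) ?_ ?_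
  · exact Continuous.aestronglyMeasurable (by fun_prop)
  · exact Eventually.of_forall fun y => (norm_exp_neg_I_mul v y).le

namespace FourierPairOn

lemma add {h₁ h₂ F₁ F₂ : ℝ → ℂ} (p₁ : FourierPairOn h₁ F₁) (p₂ : FourierPairOn h₂ F₂) :
    FourierPairOn (fun y => h₁ y + h₂ y) (fun v => F₁ v + F₂ v) where
  cont := p₁.cont.add p₂.cont
  int := p₁.int.add p₂.int
  eq v := by
    rw [← p₁.eq v, ← p₂.eq v, ← integral_add (integrable_exp_neg_I_mul p₁.int v)
      (integrable_exp_neg_I_mul p₂.int v)]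
    simp_rw [mul_add]

lemma const_mul {h F : ℝ → ℂ} (p : FourierPairOn h F) (c : ℂ) :
    FourierPairOn (fun y => c * h y) (fun v => c * F v) where
  cont := continuous_const.mul p.cont
  int := p.int.const_mul c
  eq v := by
    rw [← p.eq v, ← integral_const_mul]
    congr 1; ext y; ring

lemma sub {h₁ h₂ F₁ F₂ : ℝ → ℂ} (p₁ : FourierPairOn h₁ F₁) (p₂ : FourierPairOn h₂ F₂) :
    FourierPairOn (fun y => h₁ y - h₂ y) (fun v => F₁ v - F₂ v) := by
  have := p₁.add (p₂.const_mul (-1))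
  simpa [sub_eq_add_neg] using this

lemma shift {h F : ℝ → ℂ} (p : FourierPairOn h F) (a : ℝ) :
    FourierPairOn (fun y => h (y - a)) (fun v => Complex.exp (-(I * v * a)) * F v) where
  cont := p.cont.comp (continuous_id.sub continuous_const)
  int := p.int.comp_sub_right a
  eq v := by
    rw [← p.eq v, ← integral_const_mul,
      ← integral_sub_right_eq_self (fun y : ℝ => Complex.exp (-(I * v * a)) *
        (Complex.exp (-(I * v * y)) * h y)) a]
    congr 1; ext y
    rw [← mul_assoc, ← Complex.exp_add]
    congr 2
    push_cast; ring

lemma tsum_of_countable {ι : Type*} [Countable ι] {h F : ι → ℝ → ℂ} {ν : ι → ℝ}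
    (hp : ∀ i, FourierPairOn (h i) (F i)) (hs : Summable ν) (hb : ∀ i y, ‖h i y‖ ≤ ν i)
    (hi : ∀ i, ∫ y, ‖h i y‖ ≤ 8 * ν i) :
    FourierPairOn (fun y => ∑' i, h i y) (fun v => ∑' i, F i v) := by
  have hcont : Continuous fun y => ∑' i, h i y := continuous_tsum (fun i => (hp i).cont) hs hb
  have hsn : Summable fun i => ∫ y, ‖h i y‖ :=
    Summable.of_nonneg_of_le (fun i => integral_nonneg fun _ => norm_nonneg _) hi (hs.mul_left 8)
  refine ⟨hcont, ⟨hcont.aestronglyMeasurable, ?_⟩, ?_⟩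
  · have h1 : ∀ y, ‖∑' i, h i y‖ₑ ≤ ∑' i, ‖h i y‖ₑ := fun y => enorm_tsum_le_tsum_enorm
    refine lt_of_le_of_lt (lintegral_mono h1) ?_
    rw [lintegral_tsum fun i => (hp i).cont.aestronglyMeasurable.enorm]
    have h2 : ∀ i, ∫⁻ y, ‖h i y‖ₑ = ENNReal.ofReal (∫ y, ‖h i y‖) := fun i =>
      (ofReal_integral_norm_eq_lintegral_enorm (hp i).int).symm
    simp_rw [h2]
    rw [← ENNReal.ofReal_tsum_of_nonneg (fun i => integral_nonneg fun _ => norm_nonneg _) hsn]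
    exact ENNReal.ofReal_lt_top
  · intro v
    have h3 := hasSum_integral_of_summable_integral_norm (μ := volume)
      (F := fun i (y : ℝ) => Complex.exp (-(I * v * y)) * h i y)
      (fun i => integrable_exp_neg_I_mul (hp i).int v) (by
        simp_rw [norm_mul, norm_exp_neg_I_mul, one_mul]; exact hsn)
    simp_rw [(hp _).eq v, tsum_mul_left] at h3
    exact h3.tsum_eq.symm

lemma tsum {ι : Type*} {h F : ι → ℝ → ℂ} {ν : ι → ℝ}
    (hp : ∀ i, FourierPairOn (h i) (F i)) (hs : Summable ν) (hb : ∀ i y, ‖h i y‖ ≤ ν i)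
    (hi : ∀ i, ∫ y, ‖h i y‖ ≤ 8 * ν i) :
    FourierPairOn (fun y => ∑' i, h i y) (fun v => ∑' i, F i v) := by
  have hc : Countable (Function.support ν) := hs.countable_support
  have h0 : ∀ i, ν i = 0 → ∀ y, h i y = 0 := fun i hi0 y => by
    have := hb i y
    rw [hi0] at this
    exact norm_le_zero_iff.1 this
  have p := tsum_of_countable (ι := Function.support ν) (fun i => hp i) (hs.subtype _)
    (fun i => hb i) (fun i => hi i)
  have e1 : ∀ y, ∑' i : Function.support ν, h i y = ∑' i, h i y := fun y => by
    refine tsum_subtype_eq_of_support_subset (f := fun i => h i y) ?_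
    intro i hi'
    rw [Function.mem_support] at hi' ⊢
    exact fun h' => hi' (h0 i h' y)
  have e2 : ∀ v, ∑' i : Function.support ν, F i v = ∑' i, F i v := fun v => by
    refine tsum_subtype_eq_of_support_subset (f := fun i => F i v) ?_
    intro i hi'
    rw [Function.mem_support] at hi' ⊢
    intro h'
    apply hi'
    simp only [← (hp i).eq v, h0 i h', mul_zero, integral_zero]
  simp_rw [e1, e2] at p
  exact p

open FourierTransform in
lemma unique {h₁ h₂ F : ℝ → ℂ} (p₁ : FourierPairOn h₁ F) (p₂ : FourierPairOn h₂ F) (y : ℝ) :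
    h₁ y = h₂ y := by
  have p := p₁.sub p₂
  set h : ℝ → ℂ := fun y => h₁ y - h₂ y with hh
  have hF : 𝓕 h = fun _ => 0 := by
    ext ξ
    rw [fourier_real_eq_integral_exp_smul]
    have := p.eq (2 * π * ξ)
    simp only [sub_self] at this
    rw [← this]
    congr 1; ext y
    rw [smul_eq_mul]
    congr 2
    push_cast; ring
  have h2 := p.cont.fourierInv_fourier_eq p.int (by rw [hF]; exact integrable_zero _ _ _)
  rw [hF] at h2
  have h3 : h y = 0 := by
    rw [← h2, fourierInv_eq]
    simp
  exact sub_eq_zero.1 h3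

end FourierPairOn

lemma integral_exp_neg_abs_div : ∫ y : ℝ, exp (-|y| / 4) = 8 := by
  have := integral_comp_abs (f := fun y : ℝ => exp ((-1 / 4) * y))
  rw [integral_exp_mul_Ioi (by norm_num) 0] at this
  have e : (fun y : ℝ => exp (-|y| / 4)) = fun y => exp ((-1 / 4) * |y|) := by
    ext y; congr 1; ring
  rw [e, this]; norm_num

lemma integrable_exp_neg_abs_div : Integrable fun y : ℝ => exp (-|y| / 4) := by
  apply Integrable.of_integral_ne_zero
  rw [integral_exp_neg_abs_div]
  norm_num

/-- A two-sided exponential, continuous at the origin when `a + b = d`. -/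
noncomputable def expPiece (a b d α : ℂ) (y : ℝ) : ℂ :=
  if 0 ≤ y then a * Complex.exp (α * y) + b * Complex.exp (-(7 / 4) * y)
  else d * Complex.exp (1 / 4 * y)

lemma norm_expPiece_le {a b d α : ℂ} {ν : ℝ} (hα : α.re ≤ -1 / 4) (hab : ‖a‖ + ‖b‖ ≤ ν)
    (hd : ‖d‖ ≤ ν) (y : ℝ) : ‖expPiece a b d α y‖ ≤ ν * exp (-|y| / 4) := by
  unfold expPiece
  split_ifs with hy
  · have h1 : ‖Complex.exp (α * y)‖ ≤ exp (-|y| / 4) := by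
      rw [Complex.norm_exp, abs_of_nonneg hy]
      apply exp_le_exp.2
      simp
      nlinarith
    have h2 : ‖Complex.exp (-(7 / 4) * y)‖ ≤ exp (-|y| / 4) := by
      rw [Complex.norm_exp, abs_of_nonneg hy]
      apply exp_le_exp.2
      simp
      nlinarith
    calc _ ≤ ‖a‖ * ‖Complex.exp (α * y)‖ + ‖b‖ * ‖Complex.exp (-(7 / 4) * y)‖ := by
          rw [← norm_mul, ← norm_mul]; exact norm_add_le _ _
      _ ≤ ‖a‖ * exp (-|y| / 4) + ‖b‖ * exp (-|y| / 4) := by gcongr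
      _ = (‖a‖ + ‖b‖) * exp (-|y| / 4) := by ring
      _ ≤ _ := by gcongr
  · rw [norm_mul, Complex.norm_exp, abs_of_neg (not_le.1 hy)]
    have : (1 / 4 * (y : ℂ)).re = - -y / 4 := by simp; ring
    rw [this]
    gcongr

lemma fourierPairOn_expPiece {a b d α : ℂ} (hα : α.re ≤ -1 / 4) (habd : a + b = d) :
    FourierPairOn (expPiece a b d α)
      (fun v => a / (I * v - α) + b / (I * v + 7 / 4) +
        d / (1 / 4 - I * v)) := by
  have hcont : Continuous (expPiece a b d α) := by
    unfold expPiece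
    apply Continuous.if_le (by fun_prop) (by fun_prop) continuous_const continuous_id
    intro y hy
    have hy' : y = 0 := hy.symm
    rw [hy']; simpa using habd
  have hint : Integrable (expPiece a b d α) := by
    refine Integrable.mono' (integrable_exp_neg_abs_div.const_mul (‖a‖ + ‖b‖ + ‖d‖))
      hcont.aestronglyMeasurable (Eventually.of_forall fun y => ?_)
    apply norm_expPiece_le hα <;> linarith [norm_nonneg a, norm_nonneg b, norm_nonneg d]
  refine ⟨hcont, hint, fun v => ?_⟩
  have hint' := integrable_exp_neg_I_mul hint v
  rw [← intervalIntegral.integral_Iic_add_Ioi (b := 0) hint'.integrableOn hint'.integrableOn]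
  have r1 : (α - I * v).re < 0 := by simp; linarith
  have r2 : (-(7 / 4) - I * v).re < 0 := by simp
  have r3 : 0 < (1 / 4 - I * v : ℂ).re := by simp
  have i1 : ∫ y in Set.Ioi (0 : ℝ), Complex.exp (-(I * v * y)) * expPiece a b d α y =
      a / (I * v - α) + b / (I * v + 7 / 4) := by
    have e : ∀ y ∈ Set.Ioi (0 : ℝ), Complex.exp (-(I * v * y)) * expPiece a b d α y =
        a * Complex.exp ((α - I * v) * y) +
          b * Complex.exp ((-(7 / 4) - I * v) * y) := by
      intro y hy
      rw [expPiece, if_pos (le_of_lt hy), mul_add, mul_left_comm, ← Complex.exp_add,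
        mul_left_comm _ b, ← Complex.exp_add]
      congr 3 <;> ring
    rw [setIntegral_congr_fun measurableSet_Ioi e, integral_add
      ((integrableOn_exp_mul_complex_Ioi r1 0).const_mul a)
      ((integrableOn_exp_mul_complex_Ioi r2 0).const_mul b), integral_const_mul,
      integral_const_mul, integral_exp_mul_complex_Ioi r1, integral_exp_mul_complex_Ioi r2]
    have n1 : α - I * v ≠ 0 := fun h => by rw [h] at r1; simp at r1
    have n2 : -(7 / 4) - I * v ≠ 0 := fun h => by rw [h] at r2; simp at r2
    have n1' : I * v - α ≠ 0 := fun h => n1 (by linear_combination -h)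
    have n2' : I * v + 7 / 4 ≠ 0 := fun h => n2 (by linear_combination -h)
    have e1 : α - I * v = -(I * v - α) := by ring
    have e2 : -(7 / 4) - I * v = -(I * v + 7 / 4) := by ring
    rw [e1, e2, neg_div_neg_eq, neg_div_neg_eq]
    simp [div_eq_mul_inv]
  have i2 : ∫ y in Set.Iic (0 : ℝ), Complex.exp (-(I * v * y)) * expPiece a b d α y =
      d / (1 / 4 - I * v) := by
    have e : ∀ y ∈ Set.Iio (0 : ℝ), Complex.exp (-(I * v * y)) * expPiece a b d α y =
        d * Complex.exp ((1 / 4 - I * v) * y) := by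
      intro y hy
      rw [expPiece, if_neg (not_le.2 hy), mul_left_comm, ← Complex.exp_add]
      congr 2; ring
    rw [integral_Iic_eq_integral_Iio, setIntegral_congr_fun measurableSet_Iio e,
      ← integral_Iic_eq_integral_Iio, integral_const_mul, integral_exp_mul_complex_Iic r3]
    simp [div_eq_mul_inv]
  rw [i1, i2]; ring

/-! ### The explicit formula -/

/-- The contribution of a zero at distance `β` from the centre to the explicit formula. -/
noncomputable def zeroPiece (β : ℂ) : ℝ → ℂ :=
  expPiece (2 / ((1 - β) * (1 + β))) (1 / (-1 - β) - 1 / (3 / 2 - β))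
    (1 / (1 - β) - 1 / (3 / 2 - β)) (β - 3 / 4)

lemma fourierPairOn_zeroPiece {β : ℂ} (hβ : β.re ≤ 1 / 2) (h1 : 1 + β ≠ 0) :
    FourierPairOn (zeroPiece β) (fun v => 2 / ((1 / 4 - I * v) * (7 / 4 + I * v)) *
      (1 / (3 / 4 + I * v - β) - 1 / (3 / 2 - β))) := by
  have h2 : 1 - β ≠ 0 := fun h => by
    have := congrArg Complex.re h; simp at this; linarith
  have h3 : 3 / 2 - β ≠ 0 := fun h => by
    have := congrArg Complex.re h; simp at this; norm_num at this; linarith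
  have h1' : -1 - β ≠ 0 := fun h => h1 (by linear_combination -h)
  have hab : 2 / ((1 - β) * (1 + β)) + (1 / (-1 - β) - 1 / (3 / 2 - β)) =
      1 / (1 - β) - 1 / (3 / 2 - β) := by
    have e : -1 - β = -(1 + β) := by ring
    rw [e]
    generalize 1 / (3 / 2 - β) = X
    field_simp
    ring
  have := fourierPairOn_expPiece (α := β - 3 / 4) (by simp; norm_num; linarith) hab
  unfold zeroPiece
  convert this using 1
  ext v
  have n1 : (1 / 4 - I * v : ℂ) ≠ 0 := fun h => by
    have := congrArg Complex.re h; simp at this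
  have n2 : (7 / 4 + I * v : ℂ) ≠ 0 := fun h => by
    have := congrArg Complex.re h; simp at this
  have n3 : (3 / 4 + I * v - β : ℂ) ≠ 0 := fun h => by
    have := congrArg Complex.re h; simp at this; norm_num at this; linarith
  have e1 : I * v - (β - 3 / 4) = 3 / 4 + I * v - β := by ring
  have e2 : I * v + 7 / 4 = 7 / 4 + I * v := by ring
  have e3 : -1 - β = -(1 + β) := by ring
  rw [e1, e2, e3]
  set w : ℂ := 3 / 4 + I * v with hw
  have e4 : (1 / 4 - I * v : ℂ) = 1 - w := by rw [hw]; ring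
  have e5 : (7 / 4 + I * v : ℂ) = 1 + w := by rw [hw]; ring
  rw [e4] at n1 ⊢
  rw [e5] at n2 ⊢
  generalize 1 / (3 / 2 - β) = X
  field_simp
  ring

lemma norm_zeroPiece_coeff {β : ℂ} {p q : ℝ} (hq : 0 < q) (hpq : q ≤ p ^ 2) (hp : 0 ≤ p)
    (h1 : p ≤ ‖1 - β‖) (h2 : p ≤ ‖1 + β‖) (h3 : p ≤ ‖3 / 2 - β‖) :
    ‖2 / ((1 - β) * (1 + β))‖ ≤ 2 / q ∧
    ‖1 / (-1 - β) - 1 / (3 / 2 - β)‖ ≤ (5 / 2) / q ∧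
    ‖1 / (1 - β) - 1 / (3 / 2 - β)‖ ≤ (1 / 2) / q := by
  have hp0 : 0 < p := by
    rcases hp.eq_or_lt with h | h
    · rw [← h] at hpq; norm_num at hpq; linarith
    · exact h
  have n1 : 1 - β ≠ 0 := norm_pos_iff.1 (hp0.trans_le h1)
  have n2 : 1 + β ≠ 0 := norm_pos_iff.1 (hp0.trans_le h2)
  have n3 : 3 / 2 - β ≠ 0 := norm_pos_iff.1 (hp0.trans_le h3)
  have n2' : -1 - β ≠ 0 := fun h => n2 (by linear_combination -h)
  have h2' : p ≤ ‖-1 - β‖ := by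
    have : -1 - β = -(1 + β) := by ring
    rw [this, norm_neg]; exact h2
  have key : ∀ {a b : ℂ} {c : ℝ}, 0 ≤ c → p ≤ ‖a‖ → p ≤ ‖b‖ → c / ‖a * b‖ ≤ c / q := by
    intro a b c hc ha hb
    apply div_le_div_of_nonneg_left hc hq
    rw [norm_mul]
    nlinarith [mul_le_mul ha hb hp (norm_nonneg a)]
  refine ⟨?_, ?_, ?_⟩
  · rw [norm_div]
    have : ‖(2 : ℂ)‖ = 2 := by norm_num
    rw [this]
    exact key (by norm_num) h1 h2
  · rw [div_sub_div _ _ n2' n3, norm_div]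
    have : ‖1 * (3 / 2 - β) - (-1 - β) * 1‖ = 5 / 2 := by
      have : 1 * (3 / 2 - β) - (-1 - β) * 1 = (5 / 2 : ℂ) := by ring
      rw [this]; norm_num
    rw [this]
    exact key (by norm_num) h2' h3
  · rw [div_sub_div _ _ n1 n3, norm_div]
    have : ‖1 * (3 / 2 - β) - (1 - β) * 1‖ = 1 / 2 := by
      have : 1 * (3 / 2 - β) - (1 - β) * 1 = (1 / 2 : ℂ) := by ring
      rw [this]; norm_num
    rw [this]
    exact key (by norm_num) h1 h3

lemma norm_zeroPiece_le {β : ℂ} {p q : ℝ} (hβ : β.re ≤ 1 / 2) (hq : 0 < q) (hpq : q ≤ p ^ 2)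
    (hp : 0 ≤ p) (h1 : p ≤ ‖1 - β‖) (h2 : p ≤ ‖1 + β‖) (h3 : p ≤ ‖3 / 2 - β‖) (y : ℝ) :
    ‖zeroPiece β y‖ ≤ 5 / q * exp (-|y| / 4) := by
  obtain ⟨a1, a2, a3⟩ := norm_zeroPiece_coeff hq hpq hp h1 h2 h3
  refine norm_expPiece_le (by simp; norm_num; linarith) ?_ ?_ y
  · have : 2 / q + (5 / 2) / q ≤ 5 / q := by
      rw [← add_div]; gcongr; norm_num
    linarith
  · refine a3.trans ?_
    gcongr; norm_num

lemma integral_norm_le_of_exp {h : ℝ → ℂ} {ν : ℝ}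
    (hb : ∀ y, ‖h y‖ ≤ ν * exp (-|y| / 4)) : ∫ y, ‖h y‖ ≤ 8 * ν := by
  rw [mul_comm, ← integral_exp_neg_abs_div, ← integral_const_mul]
  exact integral_mono_of_nonneg (Eventually.of_forall fun y => norm_nonneg _)
    (integrable_exp_neg_abs_div.const_mul ν) (Eventually.of_forall hb)

lemma le_of_exp_bound {ν X y : ℝ} (hX : 0 ≤ X) (hb : X ≤ ν * exp (-|y| / 4)) : X ≤ ν := by
  have he : exp (-|y| / 4) ≤ 1 := exp_le_one_iff.2 (by linarith [abs_nonneg y])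
  have hpos := exp_pos (-|y| / 4)
  have hν : 0 ≤ ν := by
    by_contra h
    push Not at h
    nlinarith
  nlinarith

lemma FourierPairOn.tsum_exp {ι : Type*} {h F : ι → ℝ → ℂ} {ν : ι → ℝ}
    (hp : ∀ i, FourierPairOn (h i) (F i)) (hs : Summable ν)
    (hb : ∀ i y, ‖h i y‖ ≤ ν i * exp (-|y| / 4)) :
    FourierPairOn (fun y => ∑' i, h i y) (fun v => ∑' i, F i v) :=
  FourierPairOn.tsum hp hs (fun i y => le_of_exp_bound (norm_nonneg _) (hb i y))
    (fun i => integral_norm_le_of_exp (hb i))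

lemma norm_critical (u : ℝ) : √(1 + u ^ 2) ≤ ‖1 - I * u‖ ∧
    √(1 + u ^ 2) ≤ ‖1 + I * u‖ ∧ √(1 + u ^ 2) ≤ ‖3 / 2 - I * u‖ := by
  refine ⟨?_, ?_, ?_⟩ <;> rw [Complex.norm_def, Complex.normSq_apply] <;>
    apply sqrt_le_sqrt <;> simp <;> nlinarith

lemma norm_trivial (t : ℝ) (k : ℕ) :
    ((k : ℝ) + 1) ≤ ‖1 - (-2 * ((k : ℂ) + 1) - (1 / 2 + I * t))‖ ∧
    ((k : ℝ) + 1) ≤ ‖1 + (-2 * ((k : ℂ) + 1) - (1 / 2 + I * t))‖ ∧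
    ((k : ℝ) + 1) ≤ ‖3 / 2 - (-2 * ((k : ℂ) + 1) - (1 / 2 + I * t))‖ := by
  have hk : (0 : ℝ) ≤ k := Nat.cast_nonneg k
  refine ⟨?_, ?_, ?_⟩ <;> refine le_trans ?_ (Complex.abs_re_le_norm _) <;> rw [le_abs]
  · left; simp; linarith
  · right; simp; linarith
  · left; simp; linarith

/-- The smoothed prime sum `∑ Λ(n) n^{-1/2-it} min(n/x, x/n)`. -/
noncomputable def primeSum (x t : ℝ) : ℂ :=
  ∑' n : ℕ, ((Λ n * min (n / x) (x / n) : ℝ) : ℂ) * (n : ℂ) ^ (-(1 / 2 + I * t))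

/-- The sum over zeros `∑_γ 2 x^{i(γ-t)} / (1 + (γ-t)²)`. -/
noncomputable def zeroSum (x t : ℝ) : ℂ :=
  ∑' γ : ℝ, (zeroMult γ : ℂ) * (2 / (1 + (γ - t) ^ 2) * (x : ℂ) ^ (I * (γ - t)))

lemma fourierPairOn_primes (t : ℝ) :
    FourierPairOn (fun y => Complex.exp (-(3 / 4) * y) * primeSum (exp y) t)
      (fun v => 2 / ((1 / 4 - I * v) * (7 / 4 + I * v)) *
        (1 / (3 / 4 + I * v - (1 / 2 - I * t)) -
          logDeriv zetaEntire (5 / 4 + I * t + I * v))) := by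
  set E : ℝ → ℂ := expPiece 0 1 1 (-1 / 4) with hE
  have pE := fourierPairOn_expPiece (a := 0) (b := 1) (d := 1) (α := -1 / 4) (by simp) (by simp)
  rw [← hE] at pE
  have bE : ∀ y, ‖E y‖ ≤ 1 * exp (-|y| / 4) := fun y =>
    norm_expPiece_le (by simp) (by simp) (by simp) y
  set c : ℕ → ℂ := fun n => ((Λ n : ℝ) : ℂ) * (n : ℂ) ^ (-(5 / 4 + I * t)) with hc
  have nc : ∀ n, ‖c n‖ = Λ n * (n : ℝ) ^ (-(5 / 4 : ℝ)) := by
    intro n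
    rcases Nat.eq_zero_or_pos n with rfl | hn
    · simp [hc]
    · simp only [hc]
      rw [norm_mul, Complex.norm_real, norm_of_nonneg vonMangoldt_nonneg,
        Complex.norm_natCast_cpow_of_pos hn]
      simp
  have pt := FourierPairOn.tsum (ι := ℕ) (ν := fun n => ‖c n‖)
    (fun n => (pE.shift (log n)).const_mul (c n))
    (by simp_rw [nc]; exact summable_vonMangoldt_rpow (by norm_num))
    (fun n y => by
      rw [norm_mul]
      have := le_of_exp_bound (norm_nonneg _) (bE (y - log n))
      nlinarith [norm_nonneg (c n)])
    (fun n => by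
      simp_rw [norm_mul]
      rw [integral_const_mul, integral_sub_right_eq_self (fun y => ‖E y‖)]
      have := integral_norm_le_of_exp bE
      nlinarith [norm_nonneg (c n)])
  have e1 : (fun y : ℝ => ∑' n, c n * E (y - log n)) =
      fun y : ℝ => Complex.exp (-(3 / 4) * y) * primeSum (exp y) t := by
    ext y
    rw [primeSum, ← tsum_mul_left]
    congr 1; ext n
    rcases Nat.eq_zero_or_pos n with rfl | hn
    · simp [hc]
    have hn0 : (n : ℂ) ≠ 0 := by exact_mod_cast hn.ne'
    have hnR : (0 : ℝ) < n := by exact_mod_cast hn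
    have hmin : E (y - log n) = Complex.exp (-(3 / 4) * (y - log n)) *
        ((min (n / exp y) (exp y / n) : ℝ) : ℂ) := by
      have g1 : (n : ℝ) / exp y = exp (-(y - log n)) := by
        rw [neg_sub, exp_sub, exp_log hnR]
      have g2 : exp y / n = exp (y - log n) := by
        rw [exp_sub, exp_log hnR]
      rw [g1, g2, hE, expPiece]
      split_ifs with h
      · rw [min_eq_left (exp_le_exp.2 (by linarith)), Complex.ofReal_exp, ← Complex.exp_add,
          zero_mul, zero_add, one_mul]
        congr 1; push_cast; ring
      · rw [min_eq_right (exp_le_exp.2 (by linarith)), Complex.ofReal_exp, ← Complex.exp_add,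
          one_mul]
        congr 1; push_cast; ring
    rw [hmin]
    simp only [hc]
    have h4 : (n : ℂ) ^ (-(5 / 4 + I * t)) = (n : ℂ) ^ (-(1 / 2 + I * t)) *
        Complex.exp (-(3 / 4) * log n) := by
      rw [Complex.cpow_def_of_ne_zero hn0, Complex.cpow_def_of_ne_zero hn0, ← Complex.exp_add,
        ← Complex.natCast_log]
      congr 1; ring
    have h5 : Complex.exp (-(3 / 4) * (y - log n)) * Complex.exp (-(3 / 4) * log n) =
        Complex.exp (-(3 / 4) * y) := by
      rw [← Complex.exp_add]; congr 1; ring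
    rw [h4, ← h5]
    push_cast
    ring
  rw [e1] at pt
  convert pt using 1
  ext v
  have hs : 1 < (5 / 4 + I * t + I * v : ℂ).re := by simp; norm_num
  have hsum := (hasSum_vonMangoldt hs).mul_left
    (1 / (I * v + 7 / 4) + 1 / (1 / 4 - I * v))
  have e2 : ∑' n, c n * (Complex.exp (-(I * v * log n)) *
      (0 / (I * v - -1 / 4) + 1 / (I * v + 7 / 4) + 1 / (1 / 4 - I * v))) =
      (1 / (I * v + 7 / 4) + 1 / (1 / 4 - I * v)) *
        (1 / (5 / 4 + I * t + I * v - 1) -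
          logDeriv zetaEntire (5 / 4 + I * t + I * v)) := by
    rw [← hsum.tsum_eq]
    congr 1; ext n
    rcases Nat.eq_zero_or_pos n with rfl | hn
    · simp [hc]
    have hn0 : (n : ℂ) ≠ 0 := by exact_mod_cast hn.ne'
    have h4 : (n : ℂ) ^ (-(5 / 4 + I * t + I * v)) =
        (n : ℂ) ^ (-(5 / 4 + I * t)) * Complex.exp (-(I * v * log n)) := by
      rw [Complex.cpow_def_of_ne_zero hn0, Complex.cpow_def_of_ne_zero hn0, ← Complex.exp_add,
        ← Complex.natCast_log]
      congr 1; ring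
    rw [h4]
    simp only [hc]
    ring
  rw [e2]
  have n1 : (1 / 4 - I * v : ℂ) ≠ 0 := fun h => by
    have := congrArg Complex.re h; simp at this
  have n2 : (7 / 4 + I * v : ℂ) ≠ 0 := fun h => by
    have := congrArg Complex.re h; simp at this
  have n2' : (I * v + 7 / 4 : ℂ) ≠ 0 := by rw [add_comm]; exact n2
  congr 1
  · rw [div_add_div _ _ n2' n1]
    congr 1 <;> ring
  · congr 2; ring

lemma summable_zeroMult_const (hRH : RiemannHypothesis) (t : ℝ) :
    Summable fun γ : ℝ => 5 * ((zeroMult γ : ℝ) / (1 + (γ - t) ^ 2)) := by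
  refine ((summable_zeroMult hRH t).mul_left 5).congr fun γ => ?_
  rw [← neg_sub γ t, neg_sq]

lemma norm_critical_piece (t γ y : ℝ) :
    ‖(zeroMult γ : ℂ) * zeroPiece (I * (γ - t)) y‖ ≤
      5 * ((zeroMult γ : ℝ) / (1 + (γ - t) ^ 2)) * exp (-|y| / 4) := by
  obtain ⟨h1, h2, h3⟩ := norm_critical (γ - t)
  push_cast at h1 h2 h3
  have hq : 0 < 1 + (γ - t) ^ 2 := by positivity
  have := norm_zeroPiece_le (β := I * (γ - t)) (by simp) hq
    (sq_sqrt hq.le).ge (sqrt_nonneg _) h1 h2 h3 y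
  rw [norm_mul, Complex.norm_natCast]
  calc _ ≤ (zeroMult γ : ℝ) * (5 / (1 + (γ - t) ^ 2) * exp (-|y| / 4)) :=
        mul_le_mul_of_nonneg_left this (Nat.cast_nonneg _)
    _ = _ := by ring

lemma trivial_re_le (t : ℝ) (k : ℕ) :
    (-2 * ((k : ℂ) + 1) - (1 / 2 + I * t)).re ≤ -1 := by
  have hk : (0 : ℝ) ≤ k := Nat.cast_nonneg k
  simp
  linarith

lemma trivial_coeff (t : ℝ) (k : ℕ) :
    ‖2 / ((1 - (-2 * ((k : ℂ) + 1) - (1 / 2 + I * t))) *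
      (1 + (-2 * ((k : ℂ) + 1) - (1 / 2 + I * t))))‖ ≤ 2 / ((k : ℝ) + 1) ^ 2 := by
  obtain ⟨h1, h2, h3⟩ := norm_trivial t k
  have hq : 0 < ((k : ℝ) + 1) ^ 2 := by positivity
  exact (norm_zeroPiece_coeff hq le_rfl (by positivity) h1 h2 h3).1

lemma norm_trivial_piece (t : ℝ) (k : ℕ) (y : ℝ) :
    ‖zeroPiece (-2 * ((k : ℂ) + 1) - (1 / 2 + I * t)) y‖ ≤
      5 / ((k : ℝ) + 1) ^ 2 * exp (-|y| / 4) := by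
  obtain ⟨h1, h2, h3⟩ := norm_trivial t k
  have hq : 0 < ((k : ℝ) + 1) ^ 2 := by positivity
  exact norm_zeroPiece_le (by linarith [trivial_re_le t k]) hq le_rfl (by positivity) h1 h2 h3 y

lemma summable_inv_succ_sq (c : ℝ) : Summable fun k : ℕ => c / ((k : ℝ) + 1) ^ 2 := by
  have := ((summable_nat_add_iff 1).2
    (summable_one_div_nat_pow.2 (by norm_num : 1 < 2))).mul_left c
  refine this.congr fun k => ?_
  push_cast; ring

/-- The pole contribution to the explicit formula. -/
noncomputable def poleCoeff (t : ℝ) : ℂ :=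
  2 / ((1 / 2 + I * t) * (3 / 2 - I * t))

lemma two_div_mul_of_add_eq_two {P Q : ℂ} (hP : P ≠ 0) (hQ : Q ≠ 0) (h : P + Q = 2) :
    2 / (P * Q) = 1 / P + 1 / Q := by
  rw [← h]; field_simp; ring

lemma partial_fractions_pole {P Q A B D : ℂ} (hP : P ≠ 0) (hQ : Q ≠ 0) (hA : A ≠ 0) (hB : B ≠ 0)
    (hD : D ≠ 0) (h1 : Q = 2 - P) (h2 : B = 2 - A) (h3 : D = P - A) :
    2 / (P * Q) / D + -(1 / Q) / B + 1 / P / A = 2 / (A * B) * (1 / D) := by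
  field_simp
  rw [h1, h2, h3]
  ring

lemma fourierPairOn_zeros (hRH : RiemannHypothesis) (t : ℝ) :
    FourierPairOn (fun y => expPiece (poleCoeff t) (-(1 / (3 / 2 - I * t)))
          (1 / (1 / 2 + I * t)) (-1 / 4 - I * t) y -
        logDeriv zetaEntire (2 + I * t) * expPiece 0 1 1 (-1 / 4) y -
        ∑' γ : ℝ, (zeroMult γ : ℂ) * zeroPiece (I * (γ - t)) y -
        ∑' k : ℕ, zeroPiece (-2 * ((k : ℂ) + 1) - (1 / 2 + I * t)) y)
      (fun v => 2 / ((1 / 4 - I * v) * (7 / 4 + I * v)) *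
        (1 / (3 / 4 + I * v - (1 / 2 - I * t)) -
          logDeriv zetaEntire (5 / 4 + I * t + I * v))) := by
  have m1 : (1 / 2 + I * t : ℂ) ≠ 0 := fun h => by
    have := congrArg Complex.re h; simp at this
  have m2 : (3 / 2 - I * t : ℂ) ≠ 0 := fun h => by
    have := congrArg Complex.re h; simp at this
  have p1 := fourierPairOn_expPiece (a := poleCoeff t) (b := -(1 / (3 / 2 - I * t)))
    (d := 1 / (1 / 2 + I * t)) (α := -1 / 4 - I * t) (by simp) (by
      rw [poleCoeff, two_div_mul_of_add_eq_two m1 m2 (by ring)]; ring)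
  have p2 := (fourierPairOn_expPiece (a := 0) (b := 1) (d := 1) (α := -1 / 4) (by simp)
    (by simp)).const_mul (logDeriv zetaEntire (2 + I * t))
  have p3 := FourierPairOn.tsum_exp (ι := ℝ)
    (fun γ => (fourierPairOn_zeroPiece (β := I * (γ - t)) (by simp) (by
      intro h; have := congrArg Complex.re h; simp at this)).const_mul (zeroMult γ : ℂ))
    (summable_zeroMult_const hRH t) (fun γ y => norm_critical_piece t γ y)
  have p4 := FourierPairOn.tsum_exp (ι := ℕ)
    (fun k => fourierPairOn_zeroPiece (β := -2 * ((k : ℂ) + 1) - (1 / 2 + I * t))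
      (by linarith [trivial_re_le t k]) (by
      intro h
      have := congrArg Complex.re h
      rw [Complex.add_re] at this
      simp at this
      linarith [(Nat.cast_nonneg k : (0 : ℝ) ≤ k)]))
    (summable_inv_succ_sq 5) (fun k y => norm_trivial_piece t k y)
  have p := ((p1.sub p2).sub p3).sub p4
  convert p using 1
  ext v
  have n1 : (1 / 4 - I * v : ℂ) ≠ 0 := fun h => by
    have := congrArg Complex.re h; simp at this
  have n2 : (7 / 4 + I * v : ℂ) ≠ 0 := fun h => by
    have := congrArg Complex.re h; simp at this
  have n3 : (1 / 4 + I * v + I * t : ℂ) ≠ 0 := fun h => by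
    have := congrArg Complex.re h; simp at this
  have hs : zetaEntire (5 / 4 + I * t + I * v) ≠ 0 :=
    zetaEntire_ne_zero_of_one_le_re (by simp; norm_num)
  have hw : zetaEntire (2 + I * t) ≠ 0 := zetaEntire_ne_zero_of_one_le_re (by simp)
  obtain ⟨-, -, h3⟩ := logDeriv_zetaEntire_sub hRH hs hw
  set K : ℂ := 2 / ((1 / 4 - I * v) * (7 / 4 + I * v)) with hK
  rw [tsum_congr (fun γ => mul_left_comm _ K _), tsum_mul_left, tsum_mul_left]
  have e3 : ∑' γ : ℝ, (zeroMult γ : ℂ) * (1 / (3 / 4 + I * v - I * (γ - t)) -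
      1 / (3 / 2 - I * (γ - t))) = ∑' γ : ℝ, (zeroMult γ : ℝ) •
        (1 / (5 / 4 + I * t + I * v - (1 / 2 + I * γ)) -
        1 / (2 + I * t - (1 / 2 + I * γ))) := by
    congr 1; ext γ
    rw [Complex.real_smul]
    push_cast
    congr 3 <;> ring
  have e4 : ∑' k : ℕ, (1 / (3 / 4 + I * v - (-2 * ((k : ℂ) + 1) -
      (1 / 2 + I * t))) - 1 / (3 / 2 - (-2 * ((k : ℂ) + 1) -
      (1 / 2 + I * t)))) = ∑' k : ℕ,
        (1 / (5 / 4 + I * t + I * v - (-2 * ((k : ℂ) + 1))) -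
        1 / (2 + I * t - (-2 * ((k : ℂ) + 1)))) := by
    congr 1; ext k
    congr 2 <;> ring
  rw [e3, e4]
  have e5 : 1 / (3 / 4 + I * v - (1 / 2 - I * t)) -
      logDeriv zetaEntire (5 / 4 + I * t + I * v) =
      1 / (1 / 4 + I * v + I * t) - logDeriv zetaEntire (2 + I * t) -
      (logDeriv zetaEntire (5 / 4 + I * t + I * v) -
        logDeriv zetaEntire (2 + I * t)) := by
    have : (3 / 4 + I * v - (1 / 2 - I * t) : ℂ) =
      1 / 4 + I * v + I * t := by ring
    rw [this]; ring
  rw [e5, h3, mul_sub, mul_sub, mul_add, ← sub_sub]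
  congr 2
  have n2' : (I * v + 7 / 4 : ℂ) ≠ 0 := by rw [add_comm]; exact n2
  have k1 : 1 / (I * v + 7 / 4) + 1 / (1 / 4 - I * v) = K := by
    rw [hK, div_add_div _ _ n2' n1]
    congr 1 <;> ring
  congr 1
  · have n4 : (I * v - (-1 / 4 - I * t) : ℂ) = 1 / 4 + I * v + I * t := by
      ring
    rw [n4, hK, poleCoeff, add_comm (I * (v : ℂ)) (7 / 4)]
    exact (partial_fractions_pole m1 m2 n1 n2 n3 (by ring) (by ring) (by ring)).symm
  · rw [zero_div, zero_add, k1]; ring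

theorem explicit_formula (hRH : RiemannHypothesis) : ∃ C : ℝ, 0 < C ∧ ∀ t x : ℝ, 1 ≤ x →
    ‖primeSum x t + zeroSum x t - poleCoeff t * (x : ℂ) ^ (1 / 2 - I * t)‖ ≤
      C * log (|t| + 2) / x := by
  obtain ⟨C1, hC1, hb⟩ := norm_logDeriv_zetaEntire_le hRH
  set S := ∑' k : ℕ, 2 / ((k : ℝ) + 1) ^ 2 with hS
  have hS0 : 0 ≤ S := tsum_nonneg fun k => by positivity
  have hlog2 : 0 < log 2 := log_pos (by norm_num)
  refine ⟨C1 + (1 + S) / log 2, by positivity, ?_⟩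
  intro t x hx
  have hx0 : 0 < x := by linarith
  set y := log x with hy
  have hy0 : 0 ≤ y := log_nonneg hx
  have hxy : exp y = x := exp_log hx0
  have hu := (fourierPairOn_primes t).unique (fourierPairOn_zeros hRH t) y
  simp only [hxy, expPiece, if_pos hy0, zeroPiece] at hu
  have hxe : ∀ z : ℂ, (x : ℂ) ^ z = Complex.exp (z * y) := by
    intro z
    rw [Complex.cpow_def_of_ne_zero (by exact_mod_cast hx0.ne'), ← Complex.ofReal_log hx0.le, mul_comm]
  set e := Complex.exp (-(3 / 4) * y) with he
  set e7 := Complex.exp (-(7 / 4) * y) with he7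
  have hs : zetaEntire (-1 / 2 + I * t) ≠ 0 := by
    have hre1 : (-1 / 2 + I * t : ℂ).re = -1 / 2 := by simp
    intro h
    rcases zetaEntire_zero_cases hRH h with ⟨k, hk⟩ | h
    · rw [hk] at hre1
      simp at hre1
      linarith [(Nat.cast_nonneg k : (0 : ℝ) ≤ k)]
    · rw [hre1] at h; norm_num at h
  have hw : zetaEntire (2 + I * t) ≠ 0 := zetaEntire_ne_zero_of_one_le_re (by simp)
  obtain ⟨hs1, hs2, h3⟩ := logDeriv_zetaEntire_sub hRH hs hw
  have hz1 : ∑' γ : ℝ, (zeroMult γ : ℂ) * (2 / ((1 - I * (γ - t)) *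
      (1 + I * (γ - t))) * Complex.exp ((I * (γ - t) - 3 / 4) * y) +
      (1 / (-1 - I * (γ - t)) - 1 / (3 / 2 - I * (γ - t))) * e7) =
      e * zeroSum x t + e7 * ∑' γ : ℝ, (zeroMult γ : ℝ) •
        (1 / (-1 / 2 + I * t - (1 / 2 + I * γ)) -
        1 / (2 + I * t - (1 / 2 + I * γ))) := by
    have hsz : Summable fun γ : ℝ => (zeroMult γ : ℂ) *
        (2 / (1 + ((γ : ℂ) - t) ^ 2) * (x : ℂ) ^ (I * (γ - t))) := by
      refine Summable.of_norm_bounded (summable_zeroMult_const hRH t) fun γ => ?_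
      rw [hxe, norm_mul, norm_mul, Complex.norm_natCast, Complex.norm_exp, norm_div]
      have n1 : ‖(1 + ((γ : ℂ) - t) ^ 2)‖ = 1 + (γ - t) ^ 2 := by
        have : (1 + ((γ : ℂ) - t) ^ 2) = ((1 + (γ - t) ^ 2 : ℝ) : ℂ) := by push_cast; ring
        rw [this, Complex.norm_real, norm_of_nonneg (by positivity)]
      rw [n1]
      simp
      have : 0 ≤ (zeroMult γ : ℝ) / (1 + (γ - t) ^ 2) := by positivity
      calc (zeroMult γ : ℝ) * (2 / (1 + (γ - t) ^ 2)) = 2 * ((zeroMult γ : ℝ) / (1 + (γ - t) ^ 2)) := by ring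
        _ ≤ _ := by linarith
    rw [zeroSum, ← tsum_mul_left, ← tsum_mul_left,
      ← (hsz.mul_left e).tsum_add (hs1.mul_left e7)]
    congr 1; ext γ
    rw [hxe, Complex.real_smul, mul_add]
    have g1 : Complex.exp ((I * (γ - t) - 3 / 4) * y) =
        e * Complex.exp (I * (γ - t) * y) := by
      rw [he, ← Complex.exp_add]; congr 1; ring
    have g2 : (1 - I * (γ - t)) * (1 + I * (γ - t)) = (1 + ((γ : ℂ) - t) ^ 2) := by
      linear_combination -((γ : ℂ) - t) ^ 2 * Complex.I_sq
    have g3 : (-1 / 2 + I * t - (1 / 2 + I * γ) : ℂ) = -1 - I * (γ - t) := by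
      ring
    have g4 : (2 + I * t - (1 / 2 + I * γ) : ℂ) = 3 / 2 - I * (γ - t) := by
      ring
    rw [g1, g2, g3, g4]
    push_cast
    ring
  set R : ℕ → ℂ := fun k => 2 / ((1 - (-2 * ((k : ℂ) + 1) - (1 / 2 + I * t))) *
      (1 + (-2 * ((k : ℂ) + 1) - (1 / 2 + I * t)))) *
      Complex.exp ((-2 * ((k : ℂ) + 1) - (1 / 2 + I * t)) * y) with hR
  have hRb : ∀ k, ‖R k‖ ≤ 2 / ((k : ℝ) + 1) ^ 2 * (1 / x) := by
    intro k
    simp only [hR]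
    rw [norm_mul, Complex.norm_exp]
    refine mul_le_mul (trivial_coeff t k) ?_ (exp_pos _).le (by positivity)
    have hxi : 1 / x = exp (-y) := by rw [exp_neg, hxy, one_div]
    rw [hxi]
    apply exp_le_exp.2
    rw [Complex.re_mul_ofReal]
    nlinarith [trivial_re_le t k]
  have hRs : Summable R := Summable.of_norm_bounded ((summable_inv_succ_sq 2).mul_right _) hRb
  have hRn : ‖∑' k, R k‖ ≤ S * (1 / x) :=
    tsum_of_norm_bounded ((summable_inv_succ_sq 2).hasSum.mul_right _) hRb
  have hz2 : ∑' k : ℕ, (2 / ((1 - (-2 * ((k : ℂ) + 1) - (1 / 2 + I * t))) *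
      (1 + (-2 * ((k : ℂ) + 1) - (1 / 2 + I * t)))) *
      Complex.exp ((-2 * ((k : ℂ) + 1) - (1 / 2 + I * t) - 3 / 4) * y) +
      (1 / (-1 - (-2 * ((k : ℂ) + 1) - (1 / 2 + I * t))) -
        1 / (3 / 2 - (-2 * ((k : ℂ) + 1) - (1 / 2 + I * t)))) * e7) =
      e * ∑' k, R k + e7 * ∑' k : ℕ, (1 / (-1 / 2 + I * t - (-2 * ((k : ℂ) + 1))) -
        1 / (2 + I * t - (-2 * ((k : ℂ) + 1)))) := by
    rw [← tsum_mul_left, ← tsum_mul_left, ← (hRs.mul_left e).tsum_add (hs2.mul_left e7)]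
    congr 1; ext k
    have g1 : Complex.exp ((-2 * ((k : ℂ) + 1) - (1 / 2 + I * t) - 3 / 4) * y) =
        e * Complex.exp ((-2 * ((k : ℂ) + 1) - (1 / 2 + I * t)) * y) := by
      rw [he, ← Complex.exp_add]; congr 1; ring
    have g3 : (-1 / 2 + I * t - (-2 * ((k : ℂ) + 1)) : ℂ) =
        -1 - (-2 * ((k : ℂ) + 1) - (1 / 2 + I * t)) := by ring
    have g4 : (2 + I * t - (-2 * ((k : ℂ) + 1)) : ℂ) =
        3 / 2 - (-2 * ((k : ℂ) + 1) - (1 / 2 + I * t)) := by ring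
    rw [g1, g3, g4]
    simp only [hR]
    ring
  rw [hz1, hz2] at hu
  have he0 : e ≠ 0 := Complex.exp_ne_zero _
  have hxC : (x : ℂ) ≠ 0 := by exact_mod_cast hx0.ne'
  have h7 : e7 = e * (1 / x) := by
    rw [he7, he, ← hxy, Complex.ofReal_exp, one_div, ← Complex.exp_neg, ← Complex.exp_add]
    congr 1; ring
  have hp : Complex.exp ((-1 / 4 - I * t) * y) =
      e * (x : ℂ) ^ (1 / 2 - I * t) := by
    rw [hxe, he, ← Complex.exp_add]; congr 1; ring
  have hfin : primeSum x t + zeroSum x t - poleCoeff t * (x : ℂ) ^ (1 / 2 - I * t) =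
      -(1 / x) * (1 / (3 / 2 - I * t) + logDeriv zetaEntire (-1 / 2 + I * t)) -
      ∑' k, R k := by
    apply mul_left_cancel₀ he0
    rw [hp, h7] at hu
    linear_combination hu + e * (1 / x) * h3
  rw [hfin]
  have hn1 : ‖1 / (3 / 2 - I * t)‖ ≤ 1 := by
    rw [norm_div, norm_one]
    apply div_le_one_of_le₀ _ (norm_nonneg _)
    have := Complex.abs_re_le_norm (3 / 2 - I * t)
    simp at this
    have h32 : (1 : ℝ) ≤ |3 / 2| := by rw [abs_of_pos] <;> norm_num
    exact h32.trans this
  have hl2 : log 2 ≤ log (|t| + 2) :=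
    log_le_log (by norm_num) (by linarith [abs_nonneg t])
  have h5 : (1 + S) ≤ (1 + S) / log 2 * log (|t| + 2) := by
    rw [div_mul_eq_mul_div, le_div_iff₀ hlog2]
    exact mul_le_mul_of_nonneg_left hl2 (by positivity)
  have hnx : ‖-(1 / (x : ℂ))‖ = 1 / x := by
    rw [norm_neg, norm_div, norm_one, Complex.norm_real, norm_of_nonneg hx0.le]
  calc _ ≤ ‖-(1 / (x : ℂ)) * (1 / (3 / 2 - I * t) +
        logDeriv zetaEntire (-1 / 2 + I * t))‖ + ‖∑' k, R k‖ := norm_sub_le _ _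
    _ ≤ 1 / x * (1 + C1 * log (|t| + 2)) + S * (1 / x) := by
      apply add_le_add _ hRn
      rw [norm_mul, hnx]
      apply mul_le_mul_of_nonneg_left _ (by positivity)
      exact (norm_add_le _ _).trans (add_le_add hn1 (hb t))
    _ = (1 + S + C1 * log (|t| + 2)) / x := by ring
    _ ≤ _ := by
      gcongr
      linarith

lemma summable_int_weight : Summable fun k : ℤ =>
    (1 + (k : ℝ) ^ 2) ^ (-(2 / 3) : ℝ) * (1 + log (|(k : ℝ)| + 2) / log 2) := by
  have h2 : 0 < log 2 := log_pos (by norm_num)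
  have hs := (summable_abs_int_rpow (b := 37 / 30) (by norm_num)).mul_left
    (1 + 30 / log 2)
  refine Summable.of_norm_bounded_eventually hs ?_
  filter_upwards [eventually_cofinite_ne (0 : ℤ)] with k hk
  have hk1 : (1 : ℝ) ≤ |(k : ℝ)| := by exact_mod_cast Int.one_le_abs hk
  have hk0 : (0 : ℝ) < |(k : ℝ)| := by linarith
  have hl0 : 0 ≤ log (|(k : ℝ)| + 2) := log_nonneg (by linarith)
  rw [norm_of_nonneg (by positivity)]
  have e1 : (1 + (k : ℝ) ^ 2) ^ (-(2 / 3) : ℝ) ≤ |(k : ℝ)| ^ (-(4 / 3) : ℝ) := by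
    have : |(k : ℝ)| ^ (-(4 / 3) : ℝ) = (|(k : ℝ)| ^ 2) ^ (-(2 / 3) : ℝ) := by
      rw [← rpow_natCast, ← rpow_mul hk0.le]; norm_num
    rw [this, sq_abs]
    exact rpow_le_rpow_of_nonpos (by rw [← sq_abs]; positivity) (by linarith) (by norm_num)
  have e2 : log (|(k : ℝ)| + 2) ≤ 30 * |(k : ℝ)| ^ (1 / 10 : ℝ) := by
    calc log (|(k : ℝ)| + 2) ≤ log (3 * |(k : ℝ)|) :=
          log_le_log (by positivity) (by linarith)
      _ ≤ (3 * |(k : ℝ)|) ^ (1 / 10 : ℝ) / (1 / 10) :=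
          log_le_rpow_div (by positivity) (by norm_num)
      _ = 10 * ((3 : ℝ) ^ (1 / 10 : ℝ) * |(k : ℝ)| ^ (1 / 10 : ℝ)) := by
          rw [mul_rpow (by norm_num) hk0.le]; ring
      _ ≤ 10 * (3 * |(k : ℝ)| ^ (1 / 10 : ℝ)) := by
          have : (3 : ℝ) ^ (1 / 10 : ℝ) ≤ 3 := by
            calc (3 : ℝ) ^ (1 / 10 : ℝ) ≤ (3 : ℝ) ^ (1 : ℝ) :=
                  rpow_le_rpow_of_exponent_le (by norm_num) (by norm_num)
              _ = 3 := rpow_one 3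
          have h0 : 0 ≤ |(k : ℝ)| ^ (1 / 10 : ℝ) := by positivity
          nlinarith
      _ = _ := by ring
  have e3 : 1 ≤ |(k : ℝ)| ^ (1 / 10 : ℝ) := one_le_rpow hk1 (by norm_num)
  have e4 : 1 + log (|(k : ℝ)| + 2) / log 2 ≤
      (1 + 30 / log 2) * |(k : ℝ)| ^ (1 / 10 : ℝ) := by
    rw [add_mul, one_mul, div_mul_eq_mul_div]
    exact add_le_add e3 (by gcongr)
  calc _ ≤ |(k : ℝ)| ^ (-(4 / 3) : ℝ) * ((1 + 30 / log 2) * |(k : ℝ)| ^ (1 / 10 : ℝ)) :=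
        mul_le_mul e1 e4 (by positivity) (by positivity)
    _ = (1 + 30 / log 2) * (|(k : ℝ)| ^ (-(4 / 3) : ℝ) * |(k : ℝ)| ^ (1 / 10 : ℝ)) := by ring
    _ = _ := by rw [← rpow_add hk0]; norm_num

lemma kernel_le (u : ℝ) : (1 + u ^ 2) ^ (-(2 / 3) : ℝ) ≤
    5 / 2 * ((1 + (round u : ℝ) ^ 2) ^ (-(2 / 3) : ℝ) * (1 / (1 + (u - round u) ^ 2))) := by
  have h := abs_sub_round u
  have h' := abs_le.1 h
  have h1 : (u - round u) ^ 2 ≤ 1 / 4 := by nlinarith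
  have h2 : 1 + (round u : ℝ) ^ 2 ≤ 2 * (1 + u ^ 2) := by
    nlinarith [sq_nonneg (2 * u - round u)]
  have h3 : 4 / 5 ≤ 1 / (1 + (u - round u) ^ 2) := by
    rw [le_div_iff₀ (by positivity)]; linarith
  have h4 : (2 * (1 + u ^ 2)) ^ (-(2 / 3) : ℝ) ≤ (1 + (round u : ℝ) ^ 2) ^ (-(2 / 3) : ℝ) :=
    rpow_le_rpow_of_nonpos (by positivity) h2 (by norm_num)
  rw [mul_rpow (by norm_num) (by positivity)] at h4
  have h5 : (1 : ℝ) / 2 ≤ 2 ^ (-(2 / 3) : ℝ) := by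
    calc (1 : ℝ) / 2 = 2 ^ (-1 : ℝ) := by rw [rpow_neg_one]; norm_num
      _ ≤ _ := rpow_le_rpow_of_exponent_le (by norm_num) (by norm_num)
  have h6 : 0 ≤ (1 + u ^ 2) ^ (-(2 / 3) : ℝ) := by positivity
  have h7 : 1 / 2 * (1 + u ^ 2) ^ (-(2 / 3) : ℝ) ≤ (1 + (round u : ℝ) ^ 2) ^ (-(2 / 3) : ℝ) :=
    (mul_le_mul_of_nonneg_right h5 h6).trans h4
  calc _ = 5 / 2 * ((1 / 2 * (1 + u ^ 2) ^ (-(2 / 3) : ℝ)) * (4 / 5)) := by ring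
    _ ≤ _ := by
      apply mul_le_mul_of_nonneg_left _ (by norm_num)
      exact mul_le_mul h7 h3 (by norm_num) (by positivity)

lemma log_add_le_mul (t k : ℝ) : log (|t + k| + 2) ≤
    log (|t| + 2) * (1 + log (|k| + 2) / log 2) := by
  have h2 : 0 < log 2 := log_pos (by norm_num)
  have ht := abs_nonneg t
  have hk := abs_nonneg k
  have h1 : log (|t + k| + 2) ≤ log (|t| + 2) + log (|k| + 2) := by
    rw [← log_mul (by positivity) (by positivity)]
    apply log_le_log (by positivity)
    nlinarith [abs_add_le t k]
  have h3 : log 2 ≤ log (|t| + 2) := log_le_log (by norm_num) (by linarith)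
  have h4 : 0 ≤ log (|k| + 2) := log_nonneg (by linarith)
  have h5 : log (|k| + 2) ≤ log (|t| + 2) * (log (|k| + 2) / log 2) := by
    rw [mul_div_assoc', le_div_iff₀ h2, mul_comm]
    exact mul_le_mul_of_nonneg_right h3 h4
  linarith

theorem zero_sum_two_thirds (hRH : RiemannHypothesis) : ∃ C : ℝ, 0 < C ∧ ∀ t : ℝ,
    (Summable fun γ : ℝ => (zeroMult γ : ℝ) * (1 + (γ - t) ^ 2) ^ (-(2 / 3) : ℝ)) ∧
    ∑' γ : ℝ, (zeroMult γ : ℝ) * (1 + (γ - t) ^ 2) ^ (-(2 / 3) : ℝ) ≤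
      C * log (|t| + 2) := by
  obtain ⟨C, hC, hZ⟩ := zero_sum_le_log hRH
  set W := ∑' k : ℤ, (1 + (k : ℝ) ^ 2) ^ (-(2 / 3) : ℝ) *
    (1 + log (|(k : ℝ)| + 2) / log 2) with hW
  have hW0 : 0 < W := by
    have h2 : 0 < log 2 := log_pos (by norm_num)
    refine summable_int_weight.tsum_pos (fun k => ?_) 0 ?_
    · have : 0 ≤ log (|(k : ℝ)| + 2) := log_nonneg (by linarith [abs_nonneg (k : ℝ)])
      positivity
    · simp [h2.ne']
  refine ⟨5 / 2 * C * W, by positivity, fun t => ?_⟩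
  have hl0 : 0 ≤ log (|t| + 2) := log_nonneg (by linarith [abs_nonneg t])
  set b : ℤ → ℝ := fun k => (1 + (k : ℝ) ^ 2) ^ (-(2 / 3) : ℝ) with hb
  have hb0 : ∀ k, 0 ≤ b k := fun k => by simp only [hb]; positivity
  have key : ∀ s : Finset ℝ, ∑ γ ∈ s, (zeroMult γ : ℝ) * (1 + (γ - t) ^ 2) ^ (-(2 / 3) : ℝ) ≤
      5 / 2 * C * W * log (|t| + 2) := by
    intro s
    have hbs : Summable b := by
      refine Summable.of_nonneg_of_le hb0 (fun k => ?_) summable_int_weight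
      have h2 : 0 < log 2 := log_pos (by norm_num)
      have : 0 ≤ log (|(k : ℝ)| + 2) := log_nonneg (by linarith [abs_nonneg (k : ℝ)])
      exact le_mul_of_one_le_right (hb0 k) (by linarith [div_nonneg this h2.le])
    have hks : ∀ γ : ℝ, Summable fun k : ℤ => b k * ((zeroMult γ : ℝ) / (1 + (t + k - γ) ^ 2)) := by
      intro γ
      refine Summable.of_nonneg_of_le (fun k => mul_nonneg (hb0 k) (by positivity))
        (fun k => ?_) (hbs.mul_right (zeroMult γ : ℝ))
      apply mul_le_mul_of_nonneg_left _ (hb0 k)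
      exact div_le_self (Nat.cast_nonneg _) (by nlinarith [sq_nonneg (t + k - γ)])
    calc ∑ γ ∈ s, (zeroMult γ : ℝ) * (1 + (γ - t) ^ 2) ^ (-(2 / 3) : ℝ)
        ≤ ∑ γ ∈ s, 5 / 2 * ∑' k : ℤ, b k * ((zeroMult γ : ℝ) / (1 + (t + k - γ) ^ 2)) := by
          refine sum_le_sum fun γ _ => ?_
          have h1 := (hks γ).le_tsum (round (γ - t))
            (fun k _ => mul_nonneg (hb0 k) (by positivity))
          have h2 := mul_le_mul_of_nonneg_left (kernel_le (γ - t))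
            (Nat.cast_nonneg (zeroMult γ) : (0 : ℝ) ≤ _)
          have h3 : (t + (round (γ - t) : ℝ) - γ) ^ 2 = (γ - t - round (γ - t)) ^ 2 := by ring
          rw [h3] at h1
          refine h2.trans ?_
          simp only [hb] at h1
          calc _ = 5 / 2 * ((1 + (round (γ - t) : ℝ) ^ 2) ^ (-(2 / 3) : ℝ) *
              ((zeroMult γ : ℝ) / (1 + (γ - t - round (γ - t)) ^ 2))) := by ring
            _ ≤ _ := mul_le_mul_of_nonneg_left h1 (by norm_num)
      _ = 5 / 2 * ∑' k : ℤ, ∑ γ ∈ s, b k * ((zeroMult γ : ℝ) / (1 + (t + k - γ) ^ 2)) := by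
          rw [← mul_sum, Summable.tsum_finsetSum (fun γ _ => hks γ)]
      _ ≤ 5 / 2 * ∑' k : ℤ, C * log (|t| + 2) *
            (b k * (1 + log (|(k : ℝ)| + 2) / log 2)) := by
          apply mul_le_mul_of_nonneg_left _ (by norm_num)
          refine Summable.tsum_le_tsum (fun k => ?_) (summable_sum fun γ _ => hks γ)
            (summable_int_weight.mul_left _)
          rw [← mul_sum]
          have h1 := (summable_zeroMult hRH (t + k)).sum_le_tsum s (fun γ _ => by positivity)
          have h2 := mul_le_mul_of_nonneg_left (log_add_le_mul t k) hC.le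
          calc _ ≤ b k * (C * (log (|t| + 2) *
                (1 + log (|(k : ℝ)| + 2) / log 2))) :=
                mul_le_mul_of_nonneg_left ((h1.trans (hZ _)).trans h2) (hb0 k)
            _ = _ := by ring
      _ = _ := by rw [tsum_mul_left]; ring
  exact ⟨summable_of_sum_le (fun γ => by positivity) key,
    tsum_le_of_sum_le (fun γ => by positivity) key⟩

lemma tendsto_log_shift {l : Filter ℝ} (d : ℝ) (hl : Tendsto (fun u : ℝ => u⁻¹) l (nhds 0))
    (h0 : ∀ᶠ u in l, u ≠ 0) :
    Tendsto (fun u : ℝ => log (1 + (u + d) ^ 2) - log (1 + u ^ 2)) l (nhds 0) := by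
  have h : Tendsto (fun u : ℝ => log (((u⁻¹) ^ 2 + (1 + d * u⁻¹) ^ 2) /
      ((u⁻¹) ^ 2 + 1))) l (nhds (log (((0 : ℝ) ^ 2 + (1 + d * 0) ^ 2) / ((0 : ℝ) ^ 2 + 1)))) := by
    apply Tendsto.log
    · exact ((hl.pow 2).add ((tendsto_const_nhds.add (hl.const_mul d)).pow 2)).div
        ((hl.pow 2).add tendsto_const_nhds) (by norm_num)
    · norm_num
  have e : log (((0 : ℝ) ^ 2 + (1 + d * 0) ^ 2) / ((0 : ℝ) ^ 2 + 1)) = 0 := by norm_num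
  rw [e] at h
  refine h.congr' ?_
  filter_upwards [h0] with u hu
  rw [← log_div (by positivity) (by positivity)]
  congr 1
  field_simp

lemma integral_lorentz_mul (d : ℝ) :
    Integrable (fun u : ℝ => 1 / ((1 + u ^ 2) * (1 + (u + d) ^ 2))) ∧
    ∫ u : ℝ, 1 / ((1 + u ^ 2) * (1 + (u + d) ^ 2)) = 2 * π / (4 + d ^ 2) := by
  have hi : Integrable (fun u : ℝ => 1 / ((1 + u ^ 2) * (1 + (u + d) ^ 2))) := by
    refine integrable_inv_one_add_sq.mono' ?_ (Eventually.of_forall fun u => ?_)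
    · exact (Continuous.div continuous_const (by fun_prop)
        fun u => by positivity).aestronglyMeasurable
    · rw [norm_of_nonneg (by positivity), one_div, mul_inv]
      apply mul_le_of_le_one_right (by positivity)
      exact inv_le_one_of_one_le₀ (by nlinarith [sq_nonneg (u + d)])
  refine ⟨hi, ?_⟩
  have a1 : ∀ c : ℝ, Tendsto (fun u : ℝ => arctan (u + c)) atTop
      (nhds (π / 2)) := fun c =>
    (tendsto_arctan_atTop.mono_right nhdsWithin_le_nhds).comp
      (tendsto_atTop_add_const_right _ c tendsto_id)
  have a2 : ∀ c : ℝ, Tendsto (fun u : ℝ => arctan (u + c)) atBot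
      (nhds (-(π / 2))) := fun c =>
    (tendsto_arctan_atBot.mono_right nhdsWithin_le_nhds).comp
      (tendsto_atBot_add_const_right _ c tendsto_id)
  have at0 : ∀ (u c : ℝ), HasDerivAt (fun u : ℝ => arctan (u + c)) (1 / (1 + (u + c) ^ 2)) u := by
    intro u c
    simpa using ((hasDerivAt_id u).add_const c).arctan
  have at1 : ∀ u : ℝ, HasDerivAt arctan (1 / (1 + u ^ 2)) u := fun u => by
    simpa using at0 u 0
  have lg : ∀ (u c : ℝ), HasDerivAt (fun u : ℝ => log (1 + (u + c) ^ 2))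
      (2 * (u + c) / (1 + (u + c) ^ 2)) u := by
    intro u c
    have h := ((((hasDerivAt_id u).add_const c).pow 2).const_add 1).log
      (by simp only [id, Pi.pow_apply]; positivity)
    simpa using h
  have lg1 : ∀ u : ℝ, HasDerivAt (fun u : ℝ => log (1 + u ^ 2)) (2 * u / (1 + u ^ 2)) u :=
    fun u => by simpa using lg u 0
  have b1 : Tendsto arctan atTop (nhds (π / 2)) := by simpa using a1 0
  have b2 : Tendsto arctan atBot (nhds (-(π / 2))) := by simpa using a2 0
  rcases eq_or_ne d 0 with rfl | hd
  · have c1 : ∀ l : Filter ℝ, Tendsto (fun u : ℝ => u⁻¹) l (nhds 0) →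
        (∀ᶠ u in l, u ≠ 0) → Tendsto (fun u : ℝ => u / (1 + u ^ 2)) l (nhds 0) := by
      intro l hl h0
      have h : Tendsto (fun u : ℝ => u⁻¹ / ((u⁻¹) ^ 2 + 1)) l
          (nhds (0 / ((0 : ℝ) ^ 2 + 1))) :=
        hl.div ((hl.pow 2).add tendsto_const_nhds) (by norm_num)
      rw [zero_div] at h
      refine h.congr' ?_
      filter_upwards [h0] with u hu
      field_simp
    have hd : ∀ u : ℝ, HasDerivAt (fun u : ℝ => (1 / 2 : ℝ) * (u / (1 + u ^ 2) + arctan u))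
        (1 / ((1 + u ^ 2) * (1 + (u + 0) ^ 2))) u := by
      intro u
      have h := (((hasDerivAt_id u).div (((hasDerivAt_id u).pow 2).const_add 1)
        (by simp only [id, Pi.pow_apply]; positivity)).add (at1 u)).const_mul (1 / 2 : ℝ)
      refine h.congr_deriv ?_
      have : (1 + u ^ 2 : ℝ) ≠ 0 := by positivity
      simp only [id, Pi.pow_apply]
      field_simp
      push_cast
      ring
    have t1 := ((c1 _ tendsto_inv_atTop_zero (eventually_ne_atTop 0)).add b1).const_mul
      (1 / 2 : ℝ)
    have t2 := ((c1 _ tendsto_inv_atBot_zero (eventually_ne_atBot 0)).add b2).const_mul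
      (1 / 2 : ℝ)
    rw [integral_of_hasDerivAt_of_tendsto hd hi t2 t1]
    ring
  · have hder : ∀ u : ℝ, HasDerivAt (fun u : ℝ => 1 / (d * (4 + d ^ 2)) *
        (log (1 + (u + d) ^ 2) - log (1 + u ^ 2) +
          d * (arctan u + arctan (u + d))))
        (1 / ((1 + u ^ 2) * (1 + (u + d) ^ 2))) u := by
      intro u
      refine ((((lg u d).sub (lg1 u)).add (((at1 u).add (at0 u d)).const_mul d)).const_mul
        (1 / (d * (4 + d ^ 2)))).congr_deriv ?_
      have n1 : (1 + u ^ 2 : ℝ) ≠ 0 := by positivity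
      have n2 : (1 + (u + d) ^ 2 : ℝ) ≠ 0 := by positivity
      have n3 : (4 + d ^ 2 : ℝ) ≠ 0 := by positivity
      field_simp
      ring
    have t1 := ((tendsto_log_shift d tendsto_inv_atTop_zero
      (eventually_ne_atTop 0)).add ((b1.add (a1 d)).const_mul d)).const_mul
      (1 / (d * (4 + d ^ 2)))
    have t2 := ((tendsto_log_shift d tendsto_inv_atBot_zero
      (eventually_ne_atBot 0)).add ((b2.add (a2 d)).const_mul d)).const_mul
      (1 / (d * (4 + d ^ 2)))
    rw [integral_of_hasDerivAt_of_tendsto hder hi t2 t1]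
    field_simp
    ring

lemma exists_zeros_finset (hRH : RiemannHypothesis) (T : ℝ) : ∃ Z : Finset ℝ,
    ∀ γ, γ ∈ Z ↔ (0 ≤ γ ∧ γ ≤ T) ∧ zeroMult γ ≠ 0 := by
  have hfin : {γ : ℝ | (0 ≤ γ ∧ γ ≤ T) ∧ zeroMult γ ≠ 0}.Finite := by
    have h := (summable_zeroMult hRH 0).tendsto_cofinite_zero
    have h2 := h.eventually_lt_const (show (0 : ℝ) < 1 / (1 + T ^ 2) by positivity)
    refine Set.Finite.subset (eventually_cofinite.1 h2) ?_
    rintro γ ⟨⟨h0, hT⟩, hm⟩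
    change ¬ _
    rw [not_lt]
    have hm1 : (1 : ℝ) ≤ zeroMult γ := by exact_mod_cast Nat.one_le_iff_ne_zero.2 hm
    apply div_le_div₀ (by positivity) hm1 (by positivity)
    nlinarith
  exact ⟨hfin.toFinset, fun γ => by rw [Set.Finite.mem_toFinset]; rfl⟩

lemma tsum_nontrivial_zeros (hRH : RiemannHypothesis) {T : ℝ} {Z : Finset ℝ}
    (hZ : ∀ γ, γ ∈ Z ↔ (0 ≤ γ ∧ γ ≤ T) ∧ zeroMult γ ≠ 0) (f : ℂ → ℂ) :
    ∑' ρ : {ρ : ℂ // IsNontrivialZero ρ ∧ 0 ≤ ρ.im ∧ ρ.im ≤ T}, f ρ =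
      ∑ γ ∈ Z, f (1 / 2 + I * γ) := by
  have hre : ∀ γ : ℝ, (1 / 2 + I * γ : ℂ).re = 1 / 2 := fun γ => by simp
  have him : ∀ γ : ℝ, (1 / 2 + I * γ : ℂ).im = γ := fun γ => by simp
  have hne : ∀ γ : ℝ, (1 / 2 + I * γ : ℂ) ≠ 1 := fun γ h => by
    have := congrArg Complex.re h; rw [hre] at this; norm_num at this
  have hpt : ∀ ρ : ℂ, IsNontrivialZero ρ → ρ = 1 / 2 + I * ρ.im := by
    rintro ρ ⟨h0, h1, h2⟩
    have := hRH ρ h0 (by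
      rintro ⟨n, hn⟩
      rw [hn] at h1
      simp at h1
      linarith [(Nat.cast_nonneg n : (0 : ℝ) ≤ n)]) (by rintro rfl; simp at h2)
    apply Complex.ext
    · rw [hre, this]
    · rw [him]
  let e : {γ : ℝ // γ ∈ Z} ≃ {ρ : ℂ // IsNontrivialZero ρ ∧ 0 ≤ ρ.im ∧ ρ.im ≤ T} :=
    { toFun := fun γ => ⟨1 / 2 + I * (γ : ℝ), by
        obtain ⟨hγ, hm⟩ := (hZ γ).1 γ.2
        have hz := eq_zero_of_analyticOrderNatAt_ne differentiable_zetaEntire hm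
        refine ⟨⟨(zeta_zero_of_zetaEntire hz).2, ?_, ?_⟩, ?_, ?_⟩
        · rw [hre]; norm_num
        · rw [hre]; norm_num
        · rw [him]; exact hγ.1
        · rw [him]; exact hγ.2⟩
      invFun := fun ρ => ⟨(ρ : ℂ).im, by
        refine (hZ _).2 ⟨ρ.2.2, ?_⟩
        have h := hpt ρ ρ.2.1
        have h0 : zetaEntire ρ = 0 := by
          rw [zetaEntire_of_ne (by rw [h]; exact hne _), ρ.2.1.1, mul_zero]
        have := analyticOrderNatAt_pos_of_zero differentiable_zetaEntire zetaEntire_zero_ne h0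
        rw [h] at this
        exact Nat.one_le_iff_ne_zero.1 this⟩
      left_inv := fun γ => Subtype.ext (him γ)
      right_inv := fun ρ => Subtype.ext (hpt ρ ρ.2.1).symm }
  rw [← e.tsum_eq, ← Finset.tsum_subtype]
  rfl

lemma Fpair_eq (hRH : RiemannHypothesis) {T : ℝ} {Z : Finset ℝ}
    (hZ : ∀ γ, γ ∈ Z ↔ (0 ≤ γ ∧ γ ≤ T) ∧ zeroMult γ ≠ 0) (x : ℝ) :
    Fpair x T = ∑ γ ∈ Z, ∑ γ' ∈ Z, ((zeroMult γ * zeroMult γ' : ℕ) : ℂ) *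
      (x : ℂ) ^ (I * ((γ - γ' : ℝ) : ℂ)) * (4 / (4 + ((γ - γ' : ℝ) : ℂ) ^ 2)) := by
  have him : ∀ γ : ℝ, (1 / 2 + I * γ : ℂ).im = γ := fun γ => by simp
  have hord : ∀ γ : ℝ, zetaZeroOrder (1 / 2 + I * γ) = zeroMult γ := fun γ =>
    zetaZeroOrder_eq (fun h => by
      have := congrArg Complex.re h
      simp at this)
  rw [Fpair]
  have h2 := fun ρ : ℂ => tsum_nontrivial_zeros hRH hZ (fun ρ' =>
    ((zetaZeroOrder ρ * zetaZeroOrder ρ' : ℕ) : ℂ) *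
        (x : ℂ) ^ (I * ((ρ.im - ρ'.im : ℝ) : ℂ)) *
        (4 / (4 + ((ρ.im - ρ'.im : ℝ) : ℂ) ^ 2)))
  simp only [h2]
  rw [tsum_nontrivial_zeros hRH hZ (fun ρ => ∑ γ' ∈ Z,
    ((zetaZeroOrder ρ * zetaZeroOrder (1 / 2 + I * γ') : ℕ) : ℂ) *
        (x : ℂ) ^ (I * ((ρ.im - (1 / 2 + I * γ' : ℂ).im : ℝ) : ℂ)) *
        (4 / (4 + ((ρ.im - (1 / 2 + I * γ' : ℂ).im : ℝ) : ℂ) ^ 2)))]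
  simp only [him, hord]

/-- The part of `zeroSum` coming from a finite set of ordinates. -/
noncomputable def partZeroSum (Z : Finset ℝ) (x t : ℝ) : ℂ :=
  ∑ γ ∈ Z, (zeroMult γ : ℂ) * (2 / (1 + (γ - t) ^ 2) * (x : ℂ) ^ (I * (γ - t)))

lemma normSq_partZeroSum (Z : Finset ℝ) {x : ℝ} (hx : 0 < x) (t : ℝ) :
    ((‖partZeroSum Z x t‖ ^ 2 : ℝ) : ℂ) = ∑ γ ∈ Z, ∑ γ' ∈ Z,
      ((zeroMult γ * zeroMult γ' : ℕ) : ℂ) * (x : ℂ) ^ (I * ((γ - γ' : ℝ) : ℂ)) *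
        ((4 / ((1 + (γ - t) ^ 2) * (1 + (γ' - t) ^ 2)) : ℝ) : ℂ) := by
  have hxC : (x : ℂ) ≠ 0 := by exact_mod_cast hx.ne'
  rw [← Complex.normSq_eq_norm_sq, ← Complex.mul_conj, partZeroSum, map_sum, sum_mul_sum]
  refine sum_congr rfl fun γ _ => sum_congr rfl fun γ' _ => ?_
  have h1 : (starRingEnd ℂ) ((x : ℂ) ^ (I * (γ' - t))) =
      (x : ℂ) ^ (-(I * (γ' - t))) := by
    rw [Complex.cpow_def_of_ne_zero hxC, Complex.cpow_def_of_ne_zero hxC, ← Complex.exp_conj,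
      ← Complex.ofReal_log hx.le]
    simp
  simp only [map_mul, map_natCast, map_div₀, map_add, map_pow, map_sub, map_ofNat, map_one,
    Complex.conj_ofReal]
  rw [h1]
  have h2 : (x : ℂ) ^ (I * ((γ - γ' : ℝ) : ℂ)) =
      (x : ℂ) ^ (I * (γ - t)) * (x : ℂ) ^ (-(I * (γ' - t))) := by
    rw [← Complex.cpow_add _ _ hxC]
    congr 1; push_cast; ring
  rw [h2]
  have h3 : ((4 / ((1 + (γ - t) ^ 2) * (1 + (γ' - t) ^ 2)) : ℝ) : ℂ) =
      2 / (1 + ((γ : ℂ) - t) ^ 2) * (2 / (1 + ((γ' : ℂ) - t) ^ 2)) := by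
    push_cast
    rw [div_mul_div_comm]; norm_num
  rw [h3]
  push_cast
  ring

lemma integral_lorentz_pair (a b : ℝ) :
    Integrable (fun t : ℝ => 4 / ((1 + (a - t) ^ 2) * (1 + (b - t) ^ 2))) ∧
    ∫ t : ℝ, 4 / ((1 + (a - t) ^ 2) * (1 + (b - t) ^ 2)) = 2 * π * (4 / (4 + (a - b) ^ 2)) := by
  obtain ⟨h1, h2⟩ := integral_lorentz_mul (a - b)
  have e : (fun t : ℝ => 4 / ((1 + (a - t) ^ 2) * (1 + (b - t) ^ 2))) =
      fun t : ℝ => 4 * (fun u : ℝ => 1 / ((1 + u ^ 2) * (1 + (u + (a - b)) ^ 2))) (t - a) := by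
    ext t
    have e1 : (a - t) ^ 2 = (t - a) ^ 2 := by ring
    have e2 : (b - t) ^ 2 = (t - a + (a - b)) ^ 2 := by ring
    simp only []
    rw [e1, e2]; ring
  rw [e]
  refine ⟨(h1.comp_sub_right a).const_mul 4, ?_⟩
  rw [integral_const_mul, integral_sub_right_eq_self
    (fun u : ℝ => 1 / ((1 + u ^ 2) * (1 + (u + (a - b)) ^ 2))), h2]
  ring

lemma integral_normSq_partZeroSum (hRH : RiemannHypothesis) {T : ℝ} {Z : Finset ℝ}
    (hZ : ∀ γ, γ ∈ Z ↔ (0 ≤ γ ∧ γ ≤ T) ∧ zeroMult γ ≠ 0) {x : ℝ} (hx : 0 < x) :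
    Integrable (fun t => ‖partZeroSum Z x t‖ ^ 2) ∧
    ((∫ t, ‖partZeroSum Z x t‖ ^ 2 : ℝ) : ℂ) = 2 * π * Fpair x T := by
  have hi : ∀ γ ∈ Z, ∀ γ' ∈ Z, Integrable fun t : ℝ => ((zeroMult γ * zeroMult γ' : ℕ) : ℂ) *
      (x : ℂ) ^ (I * ((γ - γ' : ℝ) : ℂ)) *
        ((4 / ((1 + (γ - t) ^ 2) * (1 + (γ' - t) ^ 2)) : ℝ) : ℂ) := fun γ _ γ' _ =>
    ((integral_lorentz_pair γ γ').1.ofReal).const_mul _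
  have hI : Integrable fun t => ((‖partZeroSum Z x t‖ ^ 2 : ℝ) : ℂ) := by
    simp only [normSq_partZeroSum Z hx]
    exact integrable_finsetSum _ fun γ h => integrable_finsetSum _ fun γ' h' => hi γ h γ' h'
  refine ⟨hI.re.congr (Eventually.of_forall fun t => Complex.ofReal_re _), ?_⟩
  rw [← integral_complex_ofReal]
  simp only [normSq_partZeroSum Z hx]
  rw [integral_finsetSum _ fun γ h => integrable_finsetSum _ fun γ' h' => hi γ h γ' h',
    Fpair_eq hRH hZ, mul_sum]
  refine sum_congr rfl fun γ h => ?_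
  rw [integral_finsetSum _ fun γ' h' => hi γ h γ' h', mul_sum]
  refine sum_congr rfl fun γ' h' => ?_
  rw [integral_const_mul, integral_complex_ofReal, (integral_lorentz_pair γ γ').2]
  push_cast
  ring

lemma norm_zero_term {x : ℝ} (hx : 0 < x) (m : ℕ) (γ t : ℝ) :
    ‖(m : ℂ) * (2 / (1 + (γ - t) ^ 2) * (x : ℂ) ^ (I * (γ - t)))‖ =
      m * (2 / (1 + (γ - t) ^ 2)) := by
  rw [norm_mul, norm_mul, Complex.norm_natCast, Complex.norm_cpow_eq_rpow_re_of_pos hx]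
  have h0 : (I * ((γ : ℂ) - t)).re = 0 := by simp
  have h1 : (2 / (1 + ((γ : ℂ) - t) ^ 2)) = ((2 / (1 + (γ - t) ^ 2) : ℝ) : ℂ) := by push_cast; ring
  rw [h0, rpow_zero, mul_one, h1, Complex.norm_real, norm_of_nonneg (by positivity)]

lemma two_div_eq (u : ℝ) : 2 / (1 + u ^ 2) =
    2 * (1 + u ^ 2) ^ (-(1 / 3) : ℝ) * (1 + u ^ 2) ^ (-(2 / 3) : ℝ) := by
  rw [mul_assoc, ← rpow_add (by positivity)]
  norm_num [rpow_neg_one, div_eq_mul_inv]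

/-- If all the ordinates in `s` satisfy `D ≤ 1 + (γ-t)²` and are no closer to `t` than to `t₀`,
then the sum over them is small. -/
lemma zero_term_le {D t t₀ γ : ℝ} (hD : 0 < D) (h1 : D ≤ 1 + (γ - t) ^ 2)
    (h2 : (γ - t₀) ^ 2 ≤ (γ - t) ^ 2) (m : ℕ) :
    (m : ℝ) * (2 / (1 + (γ - t) ^ 2)) ≤
      2 * D ^ (-(1 / 3) : ℝ) * (m * (1 + (γ - t₀) ^ 2) ^ (-(2 / 3) : ℝ)) := by
  rw [two_div_eq]
  have e1 : (1 + (γ - t) ^ 2) ^ (-(1 / 3) : ℝ) ≤ D ^ (-(1 / 3) : ℝ) :=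
    rpow_le_rpow_of_nonpos hD h1 (by norm_num)
  have e2 : (1 + (γ - t) ^ 2) ^ (-(2 / 3) : ℝ) ≤ (1 + (γ - t₀) ^ 2) ^ (-(2 / 3) : ℝ) :=
    rpow_le_rpow_of_nonpos (by positivity) (by linarith) (by norm_num)
  have e3 := mul_le_mul e1 e2 (by positivity) (by positivity)
  calc _ = (2 * (m : ℝ)) * ((1 + (γ - t) ^ 2) ^ (-(1 / 3) : ℝ) *
        (1 + (γ - t) ^ 2) ^ (-(2 / 3) : ℝ)) := by ring
    _ ≤ (2 * (m : ℝ)) * (D ^ (-(1 / 3) : ℝ) * (1 + (γ - t₀) ^ 2) ^ (-(2 / 3) : ℝ)) :=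
        mul_le_mul_of_nonneg_left e3 (by positivity)
    _ = _ := by ring

lemma norm_partZeroSum_le_of {C : ℝ}
    (hC : ∀ t : ℝ, (Summable fun γ : ℝ => (zeroMult γ : ℝ) * (1 + (γ - t) ^ 2) ^ (-(2 / 3) : ℝ)) ∧
      ∑' γ : ℝ, (zeroMult γ : ℝ) * (1 + (γ - t) ^ 2) ^ (-(2 / 3) : ℝ) ≤ C * log (|t| + 2))
    {D t t₀ x : ℝ} (hx : 0 < x) (hD : 0 < D) {Z : Finset ℝ}
    (h : ∀ γ ∈ Z, D ≤ 1 + (γ - t) ^ 2 ∧ (γ - t₀) ^ 2 ≤ (γ - t) ^ 2) :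
    ‖partZeroSum Z x t‖ ≤ 2 * D ^ (-(1 / 3) : ℝ) * (C * log (|t₀| + 2)) := by
  calc ‖partZeroSum Z x t‖ ≤ ∑ γ ∈ Z, (zeroMult γ : ℝ) * (2 / (1 + (γ - t) ^ 2)) := by
        refine (norm_sum_le _ _).trans (sum_le_sum fun γ _ => ?_)
        rw [norm_zero_term hx]
    _ ≤ ∑ γ ∈ Z, 2 * D ^ (-(1 / 3) : ℝ) *
          ((zeroMult γ : ℝ) * (1 + (γ - t₀) ^ 2) ^ (-(2 / 3) : ℝ)) :=
        sum_le_sum fun γ hγ => zero_term_le hD (h γ hγ).1 (h γ hγ).2 _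
    _ ≤ _ := by
        rw [← mul_sum]
        apply mul_le_mul_of_nonneg_left _ (by positivity)
        exact ((hC t₀).1.sum_le_tsum Z (fun γ _ => by positivity)).trans (hC t₀).2

lemma norm_zeroSum_sub_partZeroSum_le {C : ℝ}
    (hC : ∀ t : ℝ, (Summable fun γ : ℝ => (zeroMult γ : ℝ) * (1 + (γ - t) ^ 2) ^ (-(2 / 3) : ℝ)) ∧
      ∑' γ : ℝ, (zeroMult γ : ℝ) * (1 + (γ - t) ^ 2) ^ (-(2 / 3) : ℝ) ≤ C * log (|t| + 2))
    {D t x : ℝ} (hx : 0 < x) (hD : 0 < D) {Z : Finset ℝ}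
    (h : ∀ γ ∉ Z, zeroMult γ ≠ 0 → D ≤ 1 + (γ - t) ^ 2) :
    ‖zeroSum x t - partZeroSum Z x t‖ ≤ 2 * D ^ (-(1 / 3) : ℝ) * (C * log (|t| + 2)) := by
  classical
  set f : ℝ → ℂ := fun γ => (zeroMult γ : ℂ) *
    (2 / (1 + (γ - t) ^ 2) * (x : ℂ) ^ (I * (γ - t))) with hf
  have hfs : Summable f := by
    refine Summable.of_norm_bounded ((hC t).1.mul_left 2) fun γ => ?_
    rw [norm_zero_term hx]
    have := zero_term_le (D := 1) (t := t) (t₀ := t) (γ := γ) one_pos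
      (by nlinarith [sq_nonneg (γ - t)]) le_rfl (zeroMult γ)
    rwa [one_rpow, mul_one] at this
  have h1 : zeroSum x t - partZeroSum Z x t = ∑' γ, (Z : Set ℝ)ᶜ.indicator f γ := by
    have := hfs.sum_add_tsum_compl (s := Z)
    rw [zeroSum, partZeroSum, ← _root_.tsum_subtype]
    exact sub_eq_of_eq_add' this.symm
  rw [h1]
  refine (tsum_of_norm_bounded (((hC t).1.mul_left (2 * D ^ (-(1 / 3) : ℝ))).hasSum)
    fun γ => ?_).trans ?_
  · by_cases hγ : γ ∈ Z
    · rw [Set.indicator_of_notMem (by simpa using hγ), norm_zero]; positivity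
    · rw [Set.indicator_of_mem (by simpa using hγ), hf, norm_zero_term hx]
      by_cases hm : zeroMult γ = 0
      · simp [hm]
      · exact zero_term_le hD (h γ hγ hm) le_rfl _
  · rw [tsum_mul_left]
    exact mul_le_mul_of_nonneg_left (hC t).2 (by positivity)

lemma norm_zeroSum_le {C : ℝ}
    (hC : ∀ t : ℝ, (Summable fun γ : ℝ => (zeroMult γ : ℝ) * (1 + (γ - t) ^ 2) ^ (-(2 / 3) : ℝ)) ∧
      ∑' γ : ℝ, (zeroMult γ : ℝ) * (1 + (γ - t) ^ 2) ^ (-(2 / 3) : ℝ) ≤ C * log (|t| + 2))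
    {t x : ℝ} (hx : 0 < x) :
    ‖zeroSum x t‖ ≤ 2 * (C * log (|t| + 2)) := by
  have := norm_zeroSum_sub_partZeroSum_le hC (D := 1) (t := t) hx one_pos (Z := ∅)
    (fun γ _ _ => by nlinarith [sq_nonneg (γ - t)])
  simpa [partZeroSum] using this

lemma norm_primeSum_term {x : ℝ} (hx : 0 < x) (n : ℕ) (t : ℝ) :
    ‖((Λ n * min (n / x) (x / n) : ℝ) : ℂ) * (n : ℂ) ^ (-(1 / 2 + I * t))‖ ≤
      x * (Λ n * (n : ℝ) ^ (-(3 / 2) : ℝ)) := by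
  rcases Nat.eq_zero_or_pos n with rfl | hn
  · simp
  have hn0 : (0 : ℝ) < n := by exact_mod_cast hn
  rw [norm_mul, Complex.norm_natCast_cpow_of_pos hn, Complex.norm_real, norm_of_nonneg
    (mul_nonneg vonMangoldt_nonneg (by positivity))]
  have h0 : (-(1 / 2 + I * (t : ℂ))).re = -(1 / 2) := by simp
  have h1 : (n : ℝ) ^ (-(3 / 2) : ℝ) = 1 / n * (n : ℝ) ^ (-(1 / 2) : ℝ) := by
    rw [one_div, ← rpow_neg_one, ← rpow_add hn0]; norm_num
  rw [h0, h1]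
  have : min (n / x) (x / n) ≤ x * (1 / n) := (min_le_right _ _).trans (by rw [mul_one_div])
  have hΛ : 0 ≤ Λ n := vonMangoldt_nonneg
  calc _ ≤ Λ n * (x * (1 / n)) * (n : ℝ) ^ (-(1 / 2) : ℝ) := by gcongr
    _ = _ := by ring

lemma continuous_primeSum {x : ℝ} (hx : 0 < x) : Continuous (primeSum x) := by
  unfold primeSum
  refine continuous_tsum (fun n => ?_)
    ((summable_vonMangoldt_rpow (σ := 3 / 2) (by norm_num)).mul_left x)
    (fun n t => norm_primeSum_term hx n t)
  rcases Nat.eq_zero_or_pos n with rfl | hn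
  · simp only [ArithmeticFunction.map_zero, zero_mul, Complex.ofReal_zero]; exact continuous_const
  exact continuous_const.mul (Continuous.const_cpow (by fun_prop)
    (Or.inl (by exact_mod_cast hn.ne')))

lemma norm_poleCoeff_le {t : ℝ} (ht : t ≠ 0) : ‖poleCoeff t‖ ≤ 2 / t ^ 2 := by
  have h1 : |t| ≤ ‖(1 / 2 + I * t : ℂ)‖ := by
    have := Complex.abs_im_le_norm (1 / 2 + I * t)
    simpa using this
  have h2 : |t| ≤ ‖(3 / 2 - I * t : ℂ)‖ := by
    have := Complex.abs_im_le_norm (3 / 2 - I * t)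
    simpa using this
  have h0 := abs_pos.2 ht
  rw [poleCoeff, norm_div, norm_mul, Complex.norm_ofNat, ← sq_abs, sq]
  exact div_le_div_of_nonneg_left (by norm_num) (by positivity) (mul_le_mul h1 h2 h0.le
    (norm_nonneg _))

lemma abs_sq_sub_le {a b E : ℝ} (ha : 0 ≤ a) (hb : 0 ≤ b) (h : |a - b| ≤ E) :
    |a ^ 2 - b ^ 2| ≤ E * (a + b) := by
  rw [sq_sub_sq, abs_mul, abs_of_nonneg (by positivity : 0 ≤ a + b), mul_comm]
  exact mul_le_mul_of_nonneg_right h (by positivity)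

set_option maxHeartbeats 2000000 in
theorem Fpair_approx (hRH : RiemannHypothesis) : ∃ C : ℝ, 0 < C ∧ ∀ T x U : ℝ,
    3 ≤ T → T ≤ x → x ≤ T ^ 2 → 1 ≤ U → 4 * U ≤ T → T ^ 2 ≤ U ^ 3 → ∀ Φ : ℝ → ℝ, Continuous Φ →
    (∀ t, 0 ≤ Φ t) → (∀ t, Φ t ≤ 1) → (∀ t, 2 * U ≤ t → t ≤ T - 2 * U → Φ t = 1) →
    (∀ t, t ≤ U → Φ t = 0) → (∀ t, T - U ≤ t → Φ t = 0) →
    ‖2 * π * Fpair x T - ((∫ t, Φ t * ‖primeSum x t‖ ^ 2 : ℝ) : ℂ)‖ ≤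
      C * (U * log T ^ 2) := by
  obtain ⟨C, hC0, hC⟩ := zero_sum_two_thirds hRH
  obtain ⟨C', hC'0, hC'⟩ := explicit_formula hRH
  set k : ℝ → ℝ := fun t => (1 + t ^ 2) ^ (-(2 / 3) : ℝ) with hk
  have hki : Integrable k := by
    have := integrable_rpow_neg_one_add_norm_sq (E := ℝ) (μ := volume) (r := 4 / 3) (by simp; norm_num)
    refine this.congr (Eventually.of_forall fun t => ?_)
    simp only [hk, norm_eq_abs, sq_abs]
    norm_num
  set K := ∫ t, k t with hK
  have hK0 : 0 ≤ K := integral_nonneg fun t => by simp only [hk]; positivity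
  set C3 := 8 * C ^ 2 + (2 + C') * (4 * C + 2 + C') with hC3
  refine ⟨4 * (8 * C ^ 2 * K + 16 * C ^ 2 + C3), by positivity, ?_⟩
  intro T x U hT hTx hxT hU hUT hTU Φ hΦc hΦ0 hΦ1 hΦm hΦl hΦr
  have hx : 0 < x := by linarith
  have hT0 : 0 < T := by linarith
  have hU0 : 0 < U := by linarith
  set ℓ := log (T + 2) with hℓ
  have hℓ1 : 1 ≤ ℓ := by
    rw [hℓ, le_log_iff_exp_le (by linarith)]
    linarith [exp_one_lt_d9]
  have hℓT : ℓ ≤ 2 * log T := by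
    rw [hℓ, ← log_rpow hT0]
    apply log_le_log (by linarith)
    norm_num
    nlinarith
  obtain ⟨Z, hZ⟩ := exists_zeros_finset hRH T
  obtain ⟨hGi, hGF⟩ := integral_normSq_partZeroSum hRH hZ hx
  have hSc := continuous_primeSum hx
  have hSi : Integrable fun t => Φ t * ‖primeSum x t‖ ^ 2 := by
    apply Continuous.integrable_of_hasCompactSupport (hΦc.mul (hSc.norm.pow 2))
    apply HasCompactSupport.mul_right
    refine HasCompactSupport.intro (isCompact_Icc (a := U) (b := T - U)) fun t ht => ?_
    rw [Set.mem_Icc, not_and_or, not_le, not_le] at ht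
    exact ht.elim (fun h => hΦl t h.le) (fun h => hΦr t h.le)
  rw [← hGF, ← Complex.ofReal_sub, Complex.norm_real, ← integral_sub hGi hSi]
  set B : ℝ → ℝ := fun t => 4 * C ^ 2 * ℓ ^ 2 * (k t + k (t - T)) + (4 * C ^ 2 * ℓ ^ 2 *
    ((Set.Icc 0 (2 * U)).indicator 1 t + (Set.Icc (T - 2 * U) T).indicator 1 t) +
    C3 * ℓ ^ 2 * (U / T) * (Set.Icc 0 T).indicator 1 t) with hB
  have hind : ∀ a b : ℝ, Integrable ((Set.Icc a b).indicator (1 : ℝ → ℝ)) := fun a b =>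
    (integrable_indicator_iff measurableSet_Icc).2 (by simp [Pi.one_def])
  have hindv : ∀ a b : ℝ, a ≤ b → ∫ t, (Set.Icc a b).indicator (1 : ℝ → ℝ) t = b - a := by
    intro a b hab
    rw [integral_indicator_one measurableSet_Icc]
    simp [Measure.real, hab]
  have hBi1 : Integrable fun t => 4 * C ^ 2 * ℓ ^ 2 * (k t + k (t - T)) :=
    (hki.add (hki.comp_sub_right T)).const_mul _
  have hBi2 : Integrable fun t => 4 * C ^ 2 * ℓ ^ 2 *
    ((Set.Icc 0 (2 * U)).indicator (1 : ℝ → ℝ) t + (Set.Icc (T - 2 * U) T).indicator 1 t) :=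
    ((hind _ _).add (hind _ _)).const_mul _
  have hBi3 : Integrable fun t => C3 * ℓ ^ 2 * (U / T) * (Set.Icc 0 T).indicator (1 : ℝ → ℝ) t :=
    (hind _ _).const_mul _
  have hBi23 : Integrable fun t => 4 * C ^ 2 * ℓ ^ 2 * ((Set.Icc 0 (2 * U)).indicator (1 : ℝ → ℝ) t +
      (Set.Icc (T - 2 * U) T).indicator 1 t) +
      C3 * ℓ ^ 2 * (U / T) * (Set.Icc 0 T).indicator (1 : ℝ → ℝ) t := hBi2.add hBi3
  have hBi : Integrable B := hBi1.add hBi23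
  have hBv : ∫ t, B t = (8 * C ^ 2 * K + (16 * C ^ 2 + C3) * U) * ℓ ^ 2 := by
    simp only [hB]
    rw [integral_add hBi1 hBi23, integral_add hBi2 hBi3, integral_const_mul,
      integral_const_mul, integral_const_mul, integral_add hki (hki.comp_sub_right T),
      integral_add (hind _ _) (hind _ _), integral_sub_right_eq_self k, hindv _ _ (by linarith),
      hindv _ _ (by linarith), hindv _ _ hT0.le, ← hK]
    field_simp
    ring
  have hk0 : ∀ t, 0 ≤ k t := fun t => by simp only [hk]; positivity
  have hi0 : ∀ a b t : ℝ, 0 ≤ (Set.Icc a b).indicator (1 : ℝ → ℝ) t := fun a b t =>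
    Set.indicator_nonneg (fun _ _ => zero_le_one) t
  have hksq : ∀ t : ℝ, ((1 + t ^ 2) ^ (-(1 / 3) : ℝ)) ^ 2 = k t := by
    intro t
    simp only [hk]
    rw [← rpow_natCast, ← rpow_mul (by positivity)]; norm_num
  have hpt : ∀ t, ‖‖partZeroSum Z x t‖ ^ 2 - Φ t * ‖primeSum x t‖ ^ 2‖ ≤ B t := by
    intro t
    have hb1 : 0 ≤ 4 * C ^ 2 * ℓ ^ 2 * k t := mul_nonneg (by positivity) (hk0 _)
    have hb2 : 0 ≤ 4 * C ^ 2 * ℓ ^ 2 * k (t - T) := mul_nonneg (by positivity) (hk0 _)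
    have hb3 : 0 ≤ 4 * C ^ 2 * ℓ ^ 2 * ((Set.Icc 0 (2 * U)).indicator (1 : ℝ → ℝ) t +
      (Set.Icc (T - 2 * U) T).indicator 1 t) :=
      mul_nonneg (by positivity) (add_nonneg (hi0 _ _ _) (hi0 _ _ _))
    have hb4 : 0 ≤ C3 * ℓ ^ 2 * (U / T) * (Set.Icc 0 T).indicator (1 : ℝ → ℝ) t :=
      mul_nonneg (by positivity) (hi0 _ _ _)
    have hBt : B t = 4 * C ^ 2 * ℓ ^ 2 * k t + 4 * C ^ 2 * ℓ ^ 2 * k (t - T) +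
      (4 * C ^ 2 * ℓ ^ 2 * ((Set.Icc 0 (2 * U)).indicator (1 : ℝ → ℝ) t +
      (Set.Icc (T - 2 * U) T).indicator 1 t) +
      C3 * ℓ ^ 2 * (U / T) * (Set.Icc 0 T).indicator (1 : ℝ → ℝ) t) := by
      simp only [hB]; ring
    have hout : ∀ t₀ u : ℝ, |t₀| ≤ T → ‖partZeroSum Z x t‖ ≤
        2 * (1 + u ^ 2) ^ (-(1 / 3) : ℝ) * (C * log (|t₀| + 2)) →
        ‖partZeroSum Z x t‖ ^ 2 ≤ 4 * C ^ 2 * ℓ ^ 2 * k u := by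
      intro t₀ u ht₀ h
      have hl : log (|t₀| + 2) ≤ ℓ := log_le_log (by positivity) (by linarith)
      have h2 : ‖partZeroSum Z x t‖ ≤ 2 * (1 + u ^ 2) ^ (-(1 / 3) : ℝ) * (C * ℓ) :=
        h.trans (by gcongr)
      calc _ ≤ (2 * (1 + u ^ 2) ^ (-(1 / 3) : ℝ) * (C * ℓ)) ^ 2 :=
            pow_le_pow_left₀ (norm_nonneg _) h2 2
        _ = 4 * C ^ 2 * ℓ ^ 2 * ((1 + u ^ 2) ^ (-(1 / 3) : ℝ)) ^ 2 := by ring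
        _ = _ := by rw [hksq]
    rcases lt_or_ge t 0 with ht | ht
    · rw [hΦl t (by linarith), zero_mul, sub_zero, norm_of_nonneg (by positivity), hBt]
      have := hout 0 t (by simpa using hT0.le) (norm_partZeroSum_le_of hC hx (by positivity)
        fun γ hγ => by
          have := ((hZ γ).1 hγ).1.1
          constructor <;> nlinarith)
      linarith
    rcases lt_or_ge T t with ht' | ht'
    · rw [hΦr t (by linarith), zero_mul, sub_zero, norm_of_nonneg (by positivity), hBt]
      have := hout T (t - T) (abs_of_pos hT0).le (norm_partZeroSum_le_of hC hx (by positivity)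
        fun γ hγ => by
          have := ((hZ γ).1 hγ).1.2
          constructor <;> nlinarith)
      linarith
    have habs : |t| = t := abs_of_nonneg ht
    have hl0 : 0 ≤ log (|t| + 2) := log_nonneg (by linarith [abs_nonneg t])
    have hlt : log (|t| + 2) ≤ ℓ := log_le_log (by positivity) (by linarith)
    have hG1 : ‖partZeroSum Z x t‖ ≤ 2 * (C * ℓ) := by
      have := norm_partZeroSum_le_of hC (D := 1) (t := t) (t₀ := t) hx one_pos (Z := Z)
        (fun γ _ => ⟨by nlinarith [sq_nonneg (γ - t)], le_rfl⟩)
      rw [one_rpow, mul_one] at this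
      exact this.trans (by gcongr)
    have hG2 : ‖zeroSum x t‖ ≤ 2 * (C * ℓ) := (norm_zeroSum_le hC hx).trans (by gcongr)
    have hI : (Set.Icc 0 T).indicator (1 : ℝ → ℝ) t = 1 :=
      Set.indicator_of_mem (Set.mem_Icc.2 ⟨ht, ht'⟩) _
    have hfirst : (1 - Φ t) * ‖partZeroSum Z x t‖ ^ 2 ≤
        4 * C ^ 2 * ℓ ^ 2 * ((Set.Icc 0 (2 * U)).indicator (1 : ℝ → ℝ) t +
          (Set.Icc (T - 2 * U) T).indicator 1 t) := by
      have hsq : ‖partZeroSum Z x t‖ ^ 2 ≤ 4 * C ^ 2 * ℓ ^ 2 := by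
        calc _ ≤ (2 * (C * ℓ)) ^ 2 := pow_le_pow_left₀ (norm_nonneg _) hG1 2
          _ = _ := by ring
      have hle : (1 - Φ t) ≤ (Set.Icc 0 (2 * U)).indicator (1 : ℝ → ℝ) t +
          (Set.Icc (T - 2 * U) T).indicator 1 t := by
        by_cases c1 : t ≤ 2 * U
        · rw [Set.indicator_of_mem (s := Set.Icc 0 (2 * U)) ⟨ht, c1⟩]
          have := hi0 (T - 2 * U) T t
          simp only [Pi.one_apply]
          linarith [hΦ0 t]
        by_cases c2 : T - 2 * U ≤ t
        · rw [Set.indicator_of_mem (s := Set.Icc (T - 2 * U) T) ⟨c2, ht'⟩]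
          have := hi0 0 (2 * U) t
          simp only [Pi.one_apply]
          linarith [hΦ0 t]
        rw [hΦm t (by linarith) (by linarith)]
        linarith [hi0 0 (2 * U) t, hi0 (T - 2 * U) T t]
      calc _ ≤ ((Set.Icc 0 (2 * U)).indicator (1 : ℝ → ℝ) t +
          (Set.Icc (T - 2 * U) T).indicator 1 t) * (4 * C ^ 2 * ℓ ^ 2) :=
            mul_le_mul hle hsq (by positivity) (add_nonneg (hi0 _ _ _) (hi0 _ _ _))
        _ = _ := by ring
    have hsecond : Φ t * |‖partZeroSum Z x t‖ ^ 2 - ‖primeSum x t‖ ^ 2| ≤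
        C3 * ℓ ^ 2 * (U / T) := by
      by_cases c : U < t ∧ t < T - U
      swap
      · have : Φ t = 0 := by
          rw [not_and_or, not_lt, not_lt] at c
          exact c.elim (hΦl t) (hΦr t)
        rw [this, zero_mul]; positivity
      obtain ⟨c1, c2⟩ := c
      have hUT1 : U / T ≤ 1 := (div_le_one hT0).2 (by linarith)
      have hd1 : (1 + U ^ 2) ^ (-(1 / 3) : ℝ) ≤ U / T := by
        rw [rpow_neg (by positivity), ← one_div, div_le_div_iff₀ (by positivity) hT0, one_mul]
        have h3 : T ^ 3 ≤ U ^ 3 * (1 + U ^ 2) := by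
          have : T ≤ U ^ 2 := by
            have : T ^ 2 ≤ (U ^ 2) ^ 2 := by nlinarith [pow_pos hU0 3]
            exact le_of_sq_le_sq this (by positivity)
          nlinarith [pow_pos hU0 3, pow_pos hT0 2]
        have h4 := rpow_le_rpow (by positivity) h3 (by norm_num : (0 : ℝ) ≤ 1 / 3)
        rw [mul_rpow (by positivity) (by positivity), ← rpow_natCast, ← rpow_natCast,
          ← rpow_mul hT0.le, ← rpow_mul hU0.le] at h4
        norm_num at h4
        norm_num
        exact h4
      have e1 : |‖partZeroSum Z x t‖ - ‖zeroSum x t‖| ≤ 2 * (U / T) * (C * ℓ) := by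
        rw [abs_sub_comm]
        refine (abs_norm_sub_norm_le _ _).trans ?_
        refine (norm_zeroSum_sub_partZeroSum_le hC hx (D := 1 + U ^ 2) (by positivity)
          (fun γ hγ hm => ?_)).trans (by gcongr)
        have : ¬ (0 ≤ γ ∧ γ ≤ T) := fun h => hγ ((hZ γ).2 ⟨h, hm⟩)
        rw [not_and_or, not_le, not_le] at this
        rcases this with h | h <;> nlinarith
      have e2 : ‖primeSum x t + zeroSum x t‖ ≤ (2 + C') * ℓ * (U / T) := by
        have h1 := hC' t x (by linarith)
        have h2 : ‖poleCoeff t * (x : ℂ) ^ (1 / 2 - I * t)‖ ≤ 2 * (U / T) := by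
          rw [norm_mul, Complex.norm_cpow_eq_rpow_re_of_pos hx]
          have hre : (1 / 2 - I * (t : ℂ)).re = 1 / 2 := by simp
          have hxs : x ^ (1 / 2 : ℝ) ≤ T := by
            rw [← sqrt_eq_rpow]; exact sqrt_le_iff.2 ⟨hT0.le, hxT⟩
          rw [hre]
          calc _ ≤ 2 / U ^ 2 * T := by
                apply mul_le_mul _ hxs (by positivity) (by positivity)
                refine (norm_poleCoeff_le (by linarith)).trans ?_
                gcongr
            _ ≤ _ := by
                rw [div_mul_eq_mul_div, mul_div_assoc', div_le_div_iff₀ (by positivity) hT0]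
                nlinarith
        have h3 : C' * log (|t| + 2) / x ≤ C' * ℓ * (U / T) := by
          calc _ ≤ C' * ℓ / T := by gcongr
            _ ≤ C' * ℓ * U / T :=
              div_le_div_of_nonneg_right (le_mul_of_one_le_right (by positivity) hU) hT0.le
            _ = _ := by ring
        have h4 := norm_add_le (primeSum x t + zeroSum x t -
          poleCoeff t * (x : ℂ) ^ (1 / 2 - I * t))
          (poleCoeff t * (x : ℂ) ^ (1 / 2 - I * t))
        rw [sub_add_cancel] at h4
        have h5 : 2 * (U / T) ≤ 2 * ℓ * (U / T) := by
          have : 0 ≤ U / T := by positivity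
          nlinarith
        calc _ ≤ C' * ℓ * (U / T) + 2 * ℓ * (U / T) := by linarith
          _ = _ := by ring
      have e3 : |‖zeroSum x t‖ - ‖primeSum x t‖| ≤ (2 + C') * ℓ * (U / T) := by
        have := abs_norm_sub_norm_le (zeroSum x t) (-primeSum x t)
        rw [norm_neg, sub_neg_eq_add, add_comm (zeroSum x t)] at this
        exact this.trans e2
      have hS : ‖primeSum x t‖ ≤ 2 * (C * ℓ) + (2 + C') * ℓ := by
        have h1 := (abs_le.1 e3).1
        have h2 : (2 + C') * ℓ * (U / T) ≤ (2 + C') * ℓ :=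
          mul_le_of_le_one_right (by positivity) hUT1
        linarith
      have f1 := abs_sq_sub_le (norm_nonneg _) (norm_nonneg _) e1
      have f2 := abs_sq_sub_le (norm_nonneg _) (norm_nonneg _) e3
      have f3 := abs_sub_le (‖partZeroSum Z x t‖ ^ 2) (‖zeroSum x t‖ ^ 2) (‖primeSum x t‖ ^ 2)
      calc _ ≤ |‖partZeroSum Z x t‖ ^ 2 - ‖primeSum x t‖ ^ 2| :=
            mul_le_of_le_one_left (abs_nonneg _) (hΦ1 t)
        _ ≤ 2 * (U / T) * (C * ℓ) * (2 * (C * ℓ) + 2 * (C * ℓ)) +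
            (2 + C') * ℓ * (U / T) * (2 * (C * ℓ) + (2 * (C * ℓ) + (2 + C') * ℓ)) := by
            refine f3.trans (add_le_add (f1.trans ?_) (f2.trans ?_)) <;>
            apply mul_le_mul_of_nonneg_left _ (by positivity) <;> linarith
        _ = _ := by rw [hC3]; ring
    have hsplit : ‖partZeroSum Z x t‖ ^ 2 - Φ t * ‖primeSum x t‖ ^ 2 =
        (1 - Φ t) * ‖partZeroSum Z x t‖ ^ 2 +
          Φ t * (‖partZeroSum Z x t‖ ^ 2 - ‖primeSum x t‖ ^ 2) := by ring
    rw [hsplit, hBt, hI, mul_one, norm_eq_abs]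
    have h1 := abs_add_le ((1 - Φ t) * ‖partZeroSum Z x t‖ ^ 2)
      (Φ t * (‖partZeroSum Z x t‖ ^ 2 - ‖primeSum x t‖ ^ 2))
    rw [abs_mul (Φ t), abs_of_nonneg (hΦ0 t), abs_of_nonneg (mul_nonneg
      (by linarith [hΦ1 t]) (sq_nonneg _) : 0 ≤ (1 - Φ t) * ‖partZeroSum Z x t‖ ^ 2)] at h1
    linarith
  refine (norm_integral_le_of_norm_le hBi (Eventually.of_forall hpt)).trans ?_
  rw [hBv]
  have hℓ2 : ℓ ^ 2 ≤ 4 * log T ^ 2 := by nlinarith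
  calc _ ≤ (8 * C ^ 2 * K * U + (16 * C ^ 2 + C3) * U) * (4 * log T ^ 2) := by
        apply mul_le_mul _ hℓ2 (by positivity) (by positivity)
        have : 8 * C ^ 2 * K * 1 ≤ 8 * C ^ 2 * K * U := by gcongr
        linarith
    _ = _ := by ring

lemma rpow_neg_tangent {c s t : ℝ} (hc : 0 ≤ c) (hs : 0 < s) (ht : 0 < t) :
    s ^ (-c) - c * s ^ (-c - 1) * (t - s) ≤ t ^ (-c) := by
  have hz : 0 < t / s := by positivity
  have h1 : 1 - c * (t / s - 1) ≤ (t / s) ^ (-c) := by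
    rw [rpow_def_of_pos hz]
    have h2 := add_one_le_exp (log (t / s) * -c)
    have h3 := log_le_sub_one_of_pos hz
    nlinarith
  rw [div_rpow ht.le hs.le, le_div_iff₀ (by positivity)] at h1
  rw [rpow_sub hs, rpow_one]
  calc _ = (1 - c * (t / s - 1)) * s ^ (-c) := by field_simp
    _ ≤ _ := h1

lemma rpow_tangent {p s t : ℝ} (hp : 1 ≤ p) (hs : 0 < s) (ht : 0 ≤ t) :
    s ^ p + p * s ^ (p - 1) * (t - s) ≤ t ^ p := by
  have h1 := one_add_mul_self_le_rpow_one_add (s := t / s - 1) (by linarith [div_nonneg ht hs.le]) hp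
  rw [add_sub_cancel, div_rpow ht hs.le, le_div_iff₀ (by positivity)] at h1
  rw [rpow_sub hs, rpow_one]
  calc _ = (1 + p * (t / s - 1)) * s ^ p := by field_simp
    _ ≤ _ := h1

lemma hasSum_telescope {u : ℕ → ℝ} (hu : Antitone u) (h0 : Tendsto u atTop (nhds 0)) :
    HasSum (fun n => u n - u (n + 1)) (u 0) := by
  rw [hasSum_iff_tendsto_nat_of_nonneg fun n => sub_nonneg.2 (hu n.le_succ)]
  simp_rw [sum_range_sub']
  simpa using h0.const_sub (u 0)

/-- The tail of `∑ n ^ (-b)` compared with `∫ t ^ (-b)`. -/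
lemma abs_tsum_tail_sub_le {b y : ℝ} (hb : 1 < b) (N : ℕ) (hy : 0 < y) (h1 : (N : ℝ) - 1 ≤ y)
    (h2 : y ≤ N) : Summable (fun n : ℕ => ((n + N : ℕ) : ℝ) ^ (-b)) ∧
    |∑' n : ℕ, ((n + N : ℕ) : ℝ) ^ (-b) - y ^ (1 - b) / (b - 1)| ≤ y ^ (-b) := by
  have hs : Summable (fun n : ℕ => ((n + N : ℕ) : ℝ) ^ (-b)) :=
    (summable_nat_add_iff N).2 (summable_nat_rpow.2 (by linarith))
  have hc : 0 < b - 1 := by linarith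
  have hN0 : (0 : ℝ) < N := hy.trans_le h2
  set u : ℕ → ℝ := fun n => ((n + N : ℕ) : ℝ) ^ (-(b - 1)) with hu
  have hpos : ∀ n : ℕ, (0 : ℝ) < ((n + N : ℕ) : ℝ) := fun n => by
    push_cast; positivity
  have hut : HasSum (fun n => u n - u (n + 1)) (u 0) := by
    apply hasSum_telescope
    · intro m n hmn
      apply rpow_le_rpow_of_nonpos (hpos m) _ (by linarith)
      exact_mod_cast Nat.add_le_add_right hmn N
    · exact ((tendsto_rpow_neg_atTop hc).comp tendsto_natCast_atTop_atTop).comp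
        (tendsto_add_atTop_nat N)
  have hu0 : u 0 = (N : ℝ) ^ (-(b - 1)) := by simp [hu]
  have e : -(b - 1) - 1 = -b := by ring
  have hl : u 0 ≤ (b - 1) * ∑' n : ℕ, ((n + N : ℕ) : ℝ) ^ (-b) := by
    rw [← tsum_mul_left]
    refine hasSum_le (fun n => ?_) hut (hs.mul_left _).hasSum
    have := rpow_neg_tangent hc.le (hpos n) (hpos (n + 1))
    rw [e] at this
    simp only [hu]
    push_cast at this ⊢
    linarith
  have hr : (b - 1) * ∑' n : ℕ, ((n + N : ℕ) : ℝ) ^ (-b) ≤ (b - 1) * (N : ℝ) ^ (-b) + u 0 := by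
    rw [hs.tsum_eq_zero_add, mul_add, zero_add, ← tsum_mul_left]
    refine add_le_add le_rfl (hasSum_le (fun n => ?_)
      (((summable_nat_add_iff 1).2 hs).mul_left (b - 1)).hasSum hut)
    have := rpow_neg_tangent hc.le (hpos (n + 1)) (hpos n)
    rw [e] at this
    simp only [hu]
    push_cast at this ⊢
    linarith
  refine ⟨hs, ?_⟩
  have e2 : 1 - b = -(b - 1) := by ring
  rw [e2]
  have hy1 : (N : ℝ) ^ (-b) ≤ y ^ (-b) := rpow_le_rpow_of_nonpos hy h2 (by linarith)
  have hy2 : (N : ℝ) ^ (-(b - 1)) ≤ y ^ (-(b - 1)) := rpow_le_rpow_of_nonpos hy h2 (by linarith)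
  have hy3 := rpow_neg_tangent hc.le hy hN0
  rw [e] at hy3
  have hy4 : (b - 1) * y ^ (-b) * (N - y) ≤ (b - 1) * y ^ (-b) * 1 :=
    mul_le_mul_of_nonneg_left (by linarith) (by positivity)
  rw [hu0] at hl hr
  have key : ∀ S q w : ℝ, q - (b - 1) * w ≤ (b - 1) * S → (b - 1) * S ≤ (b - 1) * w + q →
      |S - q / (b - 1)| ≤ w := by
    intro S q w h h'
    have hq : q = (b - 1) * (q / (b - 1)) := by field_simp
    rw [abs_le]
    generalize q / (b - 1) = z at *
    constructor <;> nlinarith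
  apply key
  · linarith
  · have := mul_le_mul_of_nonneg_left hy1 hc.le
    linarith

lemma abs_sum_rpow_sub_le {a y : ℝ} (ha : 0 < a) (N : ℕ) (hy : 0 < y) (h1 : (N : ℝ) ≤ y)
    (h2 : y ≤ N + 1) :
    |∑ n ∈ range (N + 1), (n : ℝ) ^ a - y ^ (a + 1) / (a + 1)| ≤ y ^ a := by
  have hp : (1 : ℝ) ≤ a + 1 := by linarith
  have hpp : (0 : ℝ) < a + 1 := by linarith
  have key : ∀ m : ℕ, (m : ℝ) ^ (a + 1) ≤ (a + 1) * ∑ n ∈ range (m + 1), (n : ℝ) ^ a ∧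
      (a + 1) * ∑ n ∈ range (m + 1), (n : ℝ) ^ a ≤
        (m : ℝ) ^ (a + 1) + (a + 1) * (m : ℝ) ^ a := by
    intro m
    induction m with
    | zero => simp [zero_rpow ha.ne', zero_rpow hpp.ne']
    | succ m ih =>
      rw [sum_range_succ]
      have hm0 : (0 : ℝ) ≤ m := m.cast_nonneg
      have t1 := rpow_tangent hp (s := (m : ℝ) + 1) (t := m) (by linarith) hm0
      have t2 : (m : ℝ) ^ (a + 1) + (a + 1) * (m : ℝ) ^ a ≤ ((m : ℝ) + 1) ^ (a + 1) := by
        rcases hm0.eq_or_lt with h | h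
        · rw [← h]; simp [zero_rpow ha.ne', zero_rpow hpp.ne']
        · have := rpow_tangent hp h (t := (m : ℝ) + 1) (by linarith)
          rw [add_sub_cancel_right, add_sub_cancel_left, mul_one] at this
          exact this
      rw [add_sub_cancel_right] at t1
      push_cast
      constructor <;> nlinarith [ih.1, ih.2]
  obtain ⟨k1, k2⟩ := key N
  have hN0 : (0 : ℝ) ≤ N := N.cast_nonneg
  have t1 := rpow_tangent hp hy hN0
  rw [add_sub_cancel_right] at t1
  have t2 : (N : ℝ) ^ (a + 1) ≤ y ^ (a + 1) := rpow_le_rpow hN0 h1 hpp.le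
  have t3 : (a + 1) * (N : ℝ) ^ a ≤ (a + 1) * y ^ a :=
    mul_le_mul_of_nonneg_left (rpow_le_rpow hN0 h1 ha.le) hpp.le
  have t4 : (a + 1) * y ^ a * (N - y) ≥ (a + 1) * y ^ a * (-1) :=
    mul_le_mul_of_nonneg_left (by linarith) (by positivity)
  have key : ∀ S q w : ℝ, q - (a + 1) * w ≤ (a + 1) * S → (a + 1) * S ≤ (a + 1) * w + q →
      |S - q / (a + 1)| ≤ w := by
    intro S q w h h'
    have hq : q = (a + 1) * (q / (a + 1)) := by field_simp
    rw [abs_le]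
    generalize q / (a + 1) = z at *
    constructor <;> nlinarith
  apply key <;> linarith

/-- `∑ f(n)` for the tent-like function with powers `(t/y)^a` and `(y/t)^b`. -/
lemma tsum_tent {a b y : ℝ} (ha : 0 < a) (hb : 1 < b) (hy : 0 < y) :
    Summable (fun n : ℕ => if (n : ℝ) ≤ y then ((n : ℝ) / y) ^ a else (y / n) ^ b) ∧
    |∑' n : ℕ, (if (n : ℝ) ≤ y then ((n : ℝ) / y) ^ a else (y / n) ^ b) -
      y * (1 / (a + 1) + 1 / (b - 1))| ≤ 2 := by
  set N := ⌊y⌋₊ with hN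
  have h1 : (N : ℝ) ≤ y := Nat.floor_le hy.le
  have h2 : y ≤ N + 1 := (Nat.lt_floor_add_one y).le
  set f : ℕ → ℝ := fun n => if (n : ℝ) ≤ y then ((n : ℝ) / y) ^ a else (y / n) ^ b with hf
  obtain ⟨hs, ht⟩ := abs_tsum_tail_sub_le hb (N + 1) hy (by push_cast; linarith)
    (by push_cast; exact h2)
  have hA := abs_sum_rpow_sub_le ha N hy h1 h2
  have hf1 : ∀ n ∈ range (N + 1), f n = (n : ℝ) ^ a * y ^ (-a) := by
    intro n hn
    have : (n : ℝ) ≤ y := (Nat.cast_le.2 (Nat.lt_succ_iff.1 (mem_range.1 hn))).trans h1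
    simp only [hf, if_pos this]
    rw [div_rpow n.cast_nonneg hy.le, rpow_neg hy.le, div_eq_mul_inv]
  have hf2 : (fun n => f (n + (N + 1))) = fun n : ℕ => y ^ b * ((n + (N + 1) : ℕ) : ℝ) ^ (-b) := by
    funext n
    have : ¬ ((n + (N + 1) : ℕ) : ℝ) ≤ y := by
      have := Nat.lt_floor_add_one y
      rw [not_le]
      push_cast
      have h0 : (0 : ℝ) ≤ n := n.cast_nonneg
      linarith
    simp only [hf, if_neg this]
    rw [div_rpow hy.le (Nat.cast_nonneg _), rpow_neg (Nat.cast_nonneg _), div_eq_mul_inv]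
  have hfs : Summable f := by
    rw [← summable_nat_add_iff (N + 1), hf2]; exact hs.mul_left _
  refine ⟨hfs, ?_⟩
  rw [← hfs.sum_add_tsum_nat_add (N + 1), hf2, sum_congr rfl hf1, tsum_mul_left,
    ← sum_mul]
  generalize ∑' n : ℕ, ((n + (N + 1) : ℕ) : ℝ) ^ (-b) = S2 at *
  generalize ∑ n ∈ range (N + 1), (n : ℝ) ^ a = S1 at *
  have k1 : |S1 * y ^ (-a) - y / (a + 1)| ≤ 1 := by
    have e : S1 * y ^ (-a) - y / (a + 1) = (S1 - y ^ (a + 1) / (a + 1)) * y ^ (-a) := by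
      rw [sub_mul, div_mul_eq_mul_div, ← rpow_add hy]; simp
    rw [e, abs_mul, abs_of_pos (by positivity : 0 < y ^ (-a))]
    calc _ ≤ y ^ a * y ^ (-a) := mul_le_mul_of_nonneg_right hA (by positivity)
      _ = 1 := by rw [← rpow_add hy]; simp
  have k2 : |y ^ b * S2 - y / (b - 1)| ≤ 1 := by
    have e : y ^ b * S2 - y / (b - 1) = y ^ b * (S2 - y ^ (1 - b) / (b - 1)) := by
      rw [mul_sub, mul_div_assoc', ← rpow_add hy]; simp
    rw [e, abs_mul, abs_of_pos (by positivity : 0 < y ^ b)]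
    calc _ ≤ y ^ b * y ^ (-b) := mul_le_mul_of_nonneg_left ht (by positivity)
      _ = 1 := by rw [← rpow_add hy]; simp
  have e : S1 * y ^ (-a) + y ^ b * S2 - y * (1 / (a + 1) + 1 / (b - 1)) =
      (S1 * y ^ (-a) - y / (a + 1)) + (y ^ b * S2 - y / (b - 1)) := by ring
  rw [e]
  exact (abs_add_le _ _).trans (by linarith)

lemma tendsto_affine_mul_exp_atTop (a b : ℝ) {c : ℝ} (hc : 0 < c) :
    Tendsto (fun s : ℝ => (a + b * s) * exp (-c * s)) atTop (nhds 0) := by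
  have h0 := tendsto_rpow_mul_exp_neg_mul_atTop_nhds_zero 0 c hc
  have h1 := tendsto_rpow_mul_exp_neg_mul_atTop_nhds_zero 1 c hc
  simp only [rpow_zero, rpow_one, one_mul] at h0 h1
  have := (h0.const_mul a).add (h1.const_mul b)
  simp only [mul_zero, add_zero] at this
  exact this.congr fun s => by ring

lemma tendsto_affine_mul_exp_atBot (a b : ℝ) {c : ℝ} (hc : 0 < c) :
    Tendsto (fun s : ℝ => (a + b * s) * exp (c * s)) atBot (nhds 0) := by
  refine ((tendsto_affine_mul_exp_atTop a (-b) hc).comp tendsto_neg_atBot_atTop).congr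
    fun s => ?_
  simp

lemma hasDerivAt_affine_mul_exp (a b c d s : ℝ) :
    HasDerivAt (fun s => (a + b * s) * exp (c * s + d))
      ((b + c * (a + b * s)) * exp (c * s + d)) s := by
  have h1 : HasDerivAt (fun s : ℝ => a + b * s) b s := by
    simpa using ((hasDerivAt_id s).const_mul b).const_add a
  have h2 : HasDerivAt (fun s : ℝ => c * s + d) c s := by
    simpa using ((hasDerivAt_id s).const_mul c).add_const d
  exact (h1.mul h2.exp).congr_deriv (by ring_nf)

/-- Density representing a piecewise exponential by two-sided exponentials `exp (-|τ - s|)`. -/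
noncomputable def tentDensity (β γ A B s : ℝ) : ℝ :=
  if s ≤ 0 then 1 / 2 * ((A + B * s) * (1 - β ^ 2) - 2 * β * B) * exp (β * s)
  else 1 / 2 * ((A + B * s) * (1 - γ ^ 2) + 2 * γ * B) * exp (-γ * s)

lemma integral_tentDensity_of_nonpos {β γ A B τ : ℝ} (hβ : 1 < β) (hγ : 1 < γ) (hτ : τ ≤ 0)
    (hi : Integrable fun s => exp (-|τ - s|) * tentDensity β γ A B s) :
    ∫ s, exp (-|τ - s|) * tentDensity β γ A B s =
      (A + B * τ) * exp (β * τ) - (β + γ) / 2 * A * exp (-|τ|) := by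
  set f := fun s => exp (-|τ - s|) * tentDensity β γ A B s with hf
  have e1 : ∀ s ∈ Set.Iic τ, f s =
      ((1 - β) * B / 2 + (β + 1) * (((1 - β) * A - B) / 2 + (1 - β) * B / 2 * s)) *
        exp ((β + 1) * s + -τ) := by
    intro s hs
    have hs : s ≤ τ := hs
    simp only [hf, tentDensity, if_pos (hs.trans hτ)]
    rw [abs_of_nonneg (by linarith), show (β + 1) * s + -τ = -(τ - s) + β * s by ring, exp_add]
    ring
  have e2 : ∀ s ∈ Set.Ioc τ 0, f s =
      (-(1 + β) * B / 2 + (β - 1) * ((-(1 + β) * A - B) / 2 + -(1 + β) * B / 2 * s)) *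
        exp ((β - 1) * s + τ) := by
    intro s hs
    simp only [hf, tentDensity, if_pos hs.2]
    rw [abs_of_nonpos (by linarith [hs.1]), show (β - 1) * s + τ = - -(τ - s) + β * s by ring,
      exp_add]
    ring
  have e3 : ∀ s ∈ Set.Ioi (0 : ℝ), f s =
      (-(1 - γ) * B / 2 + (-(γ + 1)) * ((-(1 - γ) * A - B) / 2 + -(1 - γ) * B / 2 * s)) *
        exp ((-(γ + 1)) * s + τ) := by
    intro s hs
    have hs : 0 < s := hs
    simp only [hf, tentDensity, if_neg (not_le.2 hs)]
    rw [abs_of_nonpos (by linarith), show (-(γ + 1)) * s + τ = - -(τ - s) + -γ * s by ring,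
      exp_add]
    ring
  have hI1 : ∫ s in Set.Iic τ, f s = (((1 - β) * A - B) / 2 + (1 - β) * B / 2 * τ) *
      exp ((β + 1) * τ + -τ) := by
    rw [setIntegral_congr_fun measurableSet_Iic e1]
    have ht := (tendsto_affine_mul_exp_atBot (((1 - β) * A - B) / 2) ((1 - β) * B / 2)
      (c := β + 1) (by linarith)).mul_const (exp (-τ))
    rw [zero_mul] at ht
    rw [integral_Iic_of_hasDerivAt_of_tendsto' (fun s _ => hasDerivAt_affine_mul_exp _ _ _ _ s)
      (hi.integrableOn.congr_fun e1 measurableSet_Iic)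
      (ht.congr fun s => by rw [mul_assoc, ← exp_add]), sub_zero]
  have hI3 : ∫ s in Set.Ioi 0, f s = -(((-(1 - γ) * A - B) / 2 + -(1 - γ) * B / 2 * 0) *
      exp ((-(γ + 1)) * 0 + τ)) := by
    rw [setIntegral_congr_fun measurableSet_Ioi e3]
    have ht := (tendsto_affine_mul_exp_atTop ((-(1 - γ) * A - B) / 2) (-(1 - γ) * B / 2)
      (c := γ + 1) (by linarith)).mul_const (exp τ)
    rw [zero_mul] at ht
    rw [integral_Ioi_of_hasDerivAt_of_tendsto' (fun s _ => hasDerivAt_affine_mul_exp _ _ _ _ s)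
      (hi.integrableOn.congr_fun e3 measurableSet_Ioi)
      (ht.congr fun s => by rw [mul_assoc, ← exp_add]), zero_sub]
  have hI2 : ∫ s in Set.Ioc τ 0, f s =
      ((-(1 + β) * A - B) / 2 + -(1 + β) * B / 2 * 0) * exp ((β - 1) * 0 + τ) -
      ((-(1 + β) * A - B) / 2 + -(1 + β) * B / 2 * τ) * exp ((β - 1) * τ + τ) := by
    rw [setIntegral_congr_fun measurableSet_Ioc e2, ← intervalIntegral.integral_of_le hτ]
    apply intervalIntegral.integral_eq_sub_of_hasDerivAt
      (fun s _ => hasDerivAt_affine_mul_exp _ _ _ _ s)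
    exact Continuous.intervalIntegrable (by fun_prop) _ _
  rw [← intervalIntegral.integral_Iic_add_Ioi (b := τ) hi.integrableOn hi.integrableOn,
    ← Set.Ioc_union_Ioi_eq_Ioi hτ, setIntegral_union (Set.Ioc_disjoint_Ioi le_rfl)
    measurableSet_Ioi hi.integrableOn hi.integrableOn, hI1, hI2, hI3, abs_of_nonpos hτ]
  rw [show (β + 1) * τ + -τ = β * τ by ring, show (β - 1) * τ + τ = β * τ by ring, mul_zero,
    mul_zero, zero_add, neg_neg]
  ring_nf

lemma abs_tentDensity_le {β γ A B : ℝ} (hβ : 3 / 2 ≤ β) (hβ' : β ≤ 5 / 2) (hγ : 3 / 2 ≤ γ)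
    (hγ' : γ ≤ 5 / 2) (hA : 0 ≤ A) (hB : |B| ≤ 1) (s : ℝ) :
    |tentDensity β γ A B s| ≤ 12 * (A + 1) * exp (-(5 / 4 * |s|)) := by
  have key : ∀ δ σ : ℝ, 3 / 2 ≤ δ → δ ≤ 5 / 2 → |σ| ≤ 1 →
      |1 / 2 * ((A + B * s) * (1 - δ ^ 2) + 2 * δ * B * σ) * exp (-(δ * |s|))| ≤
        12 * (A + 1) * exp (-(5 / 4 * |s|)) := by
    intro δ σ h1 h2 h3
    have hs := abs_nonneg s
    have g1 : |A + B * s| ≤ A + |s| := by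
      refine (abs_add_le _ _).trans ?_
      rw [abs_of_nonneg hA, abs_mul]
      nlinarith [abs_nonneg B]
    have g2 : |1 - δ ^ 2| ≤ 21 / 4 := by rw [abs_le]; constructor <;> nlinarith
    have g3 : |2 * δ * B * σ| ≤ 5 := by
      rw [abs_mul, abs_mul, abs_of_nonneg (by linarith : 0 ≤ 2 * δ)]
      calc _ ≤ 2 * δ * 1 * 1 := by gcongr
        _ ≤ 5 := by linarith
    have g4 : |(A + B * s) * (1 - δ ^ 2) + 2 * δ * B * σ| ≤ (A + |s|) * (21 / 4) + 5 := by
      refine (abs_add_le _ _).trans (add_le_add ?_ g3)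
      rw [abs_mul]
      gcongr
    have g5 : 1 + |s| ≤ 4 * exp (|s| / 4) := by
      have := add_one_le_exp (|s| / 4); linarith
    have g6 : exp (-(δ * |s|)) ≤ exp (-(3 / 2 * |s|)) := by
      apply exp_le_exp.2; nlinarith
    rw [abs_mul, abs_mul, abs_exp, abs_of_pos (by norm_num : (0 : ℝ) < 1 / 2)]
    calc _ ≤ 1 / 2 * ((A + |s|) * (21 / 4) + 5) * exp (-(3 / 2 * |s|)) := by gcongr
      _ ≤ 3 * (A + 1) * (1 + |s|) * exp (-(3 / 2 * |s|)) := by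
          apply mul_le_mul_of_nonneg_right _ (exp_pos _).le
          nlinarith [mul_nonneg hA hs]
      _ ≤ 3 * (A + 1) * (4 * exp (|s| / 4)) * exp (-(3 / 2 * |s|)) := by gcongr
      _ = 12 * (A + 1) * (exp (|s| / 4) * exp (-(3 / 2 * |s|))) := by ring
      _ = _ := by rw [← exp_add]; ring_nf
  unfold tentDensity
  split_ifs with h
  · have := key β (-1) hβ hβ' (by simp)
    rw [abs_of_nonpos h] at this ⊢
    rw [show β * s = -(β * -s) by ring, show (A + B * s) * (1 - β ^ 2) - 2 * β * B =
      (A + B * s) * (1 - β ^ 2) + 2 * β * B * -1 by ring]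
    exact this
  · have := key γ 1 hγ hγ' (by simp)
    rw [abs_of_pos (not_le.1 h)] at this ⊢
    rw [mul_one] at this
    rw [show -γ * s = -(γ * s) by ring]
    exact this

lemma integral_exp_neg_abs {c : ℝ} (hc : 0 < c) :
    ∫ s : ℝ, exp (-(c * |s|)) = 2 / c := by
  rw [integral_comp_abs (f := fun s => exp (-(c * s)))]
  have := integral_exp_mul_Ioi (a := -c) (by linarith) 0
  simp only [neg_mul] at this
  rw [this]
  simp
  ring

lemma integrable_exp_neg_abs {c : ℝ} (hc : 0 < c) :
    Integrable fun s : ℝ => exp (-(c * |s|)) := by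
  apply Integrable.of_integral_ne_zero
  rw [integral_exp_neg_abs hc]
  positivity

lemma measurable_tentDensity (β γ A B : ℝ) : Measurable (tentDensity β γ A B) := by
  unfold tentDensity
  exact Measurable.ite measurableSet_Iic (by fun_prop) (by fun_prop)

lemma integrable_exp_mul_tentDensity {β γ A B : ℝ} (hβ : 3 / 2 ≤ β) (hβ' : β ≤ 5 / 2)
    (hγ : 3 / 2 ≤ γ) (hγ' : γ ≤ 5 / 2) (hA : 0 ≤ A) (hB : |B| ≤ 1) (τ : ℝ) :
    Integrable fun s => exp (-|τ - s|) * tentDensity β γ A B s := by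
  refine ((integrable_exp_neg_abs (c := 5 / 4) (by norm_num)).const_mul (12 * (A + 1))).mono'
    (by have := measurable_tentDensity β γ A B; fun_prop) (Eventually.of_forall fun s => ?_)
  rw [norm_mul, norm_eq_abs, abs_exp]
  calc _ ≤ 1 * |tentDensity β γ A B s| := by
        apply mul_le_mul_of_nonneg_right _ (abs_nonneg _)
        rw [exp_le_one_iff]; simp
    _ ≤ _ := by rw [one_mul]; exact abs_tentDensity_le hβ hβ' hγ hγ' hA hB s

lemma integral_tentDensity {A : ℝ} (hA : 0 ≤ A) (τ : ℝ) :
    ∫ s, exp (-|τ - s|) * tentDensity (3 / 2) (5 / 2) A 1 s =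
      (A + τ) * (if τ ≤ 0 then exp (3 / 2 * τ) else exp (-(5 / 2 * τ))) -
        2 * A * exp (-|τ|) := by
  split_ifs with h
  · rw [integral_tentDensity_of_nonpos (by norm_num) (by norm_num) h
      (integrable_exp_mul_tentDensity le_rfl (by norm_num) (by norm_num) le_rfl hA (by simp) τ)]
    ring
  · have := integral_tentDensity_of_nonpos (β := 5 / 2) (γ := 3 / 2) (A := A) (B := -1) (τ := -τ)
      (by norm_num) (by norm_num) (by linarith)
      (integrable_exp_mul_tentDensity (by norm_num) le_rfl le_rfl (by norm_num) hA (by simp) _)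
    rw [← integral_neg_eq_self]
    rw [abs_neg] at this
    have e : (fun s => exp (-|τ - -s|) * tentDensity (3 / 2) (5 / 2) A 1 (-s)) =ᵐ[volume]
        fun s => exp (-|-τ - s|) * tentDensity (5 / 2) (3 / 2) A (-1) s := by
      have h0 : ∀ᵐ s : ℝ, s ≠ 0 := by simp [ae_iff]
      filter_upwards [h0] with s hs
      rw [show -τ - s = -(τ - -s) by ring, abs_neg]
      congr 1
      unfold tentDensity
      rcases lt_or_gt_of_ne hs with h1 | h1
      · rw [if_neg (by linarith), if_pos h1.le]; ring_nf
      · rw [if_pos (by linarith), if_neg (by linarith)]; ring_nf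
    rw [integral_congr_ae e, this]
    ring_nf

/-- The weight `min (n/x, x/n) ^ 2 / n`. -/
noncomputable def sqWeight (x : ℝ) (n : ℕ) : ℝ := min (n / x) (x / n) ^ 2 / n

lemma sqWeight_nonneg (x : ℝ) (n : ℕ) : 0 ≤ sqWeight x n := by unfold sqWeight; positivity

lemma min_div_eq_exp {y : ℝ} (hy : 0 < y) {n : ℕ} (hn : 0 < n) :
    min (n / y) (y / n) = exp (-|log n - log y|) := by
  have hn0 : (0 : ℝ) < n := by exact_mod_cast hn
  rw [← log_div hn0.ne' hy.ne']
  rcases le_total (n : ℝ) y with h | h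
  · have h1 : (n : ℝ) / y ≤ 1 := (div_le_one hy).2 h
    rw [abs_of_nonpos (log_nonpos (by positivity) h1), neg_neg, exp_log (by positivity),
      min_eq_left (h1.trans ((one_le_div hn0).2 h))]
  · have h1 : 1 ≤ (n : ℝ) / y := (one_le_div hy).2 h
    rw [abs_of_nonneg (log_nonneg h1), exp_neg, exp_log (by positivity), inv_div,
      min_eq_right (((div_le_one hn0).2 h).trans h1)]

lemma sqWeight_le_rpow {x θ : ℝ} (hx : 0 < x) (h1 : -2 ≤ θ) (h2 : θ ≤ 2) (n : ℕ) :
    sqWeight x n ≤ x ^ θ * (n : ℝ) ^ (-1 - θ) := by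
  rcases Nat.eq_zero_or_pos n with rfl | hn
  · simp [sqWeight]; positivity
  have hn0 : (0 : ℝ) < n := by exact_mod_cast hn
  rw [sqWeight, min_div_eq_exp hx hn, rpow_def_of_pos hx, rpow_def_of_pos hn0,
    div_le_iff₀ hn0, ← exp_nat_mul, ← exp_add]
  refine le_trans ?_ (mul_le_mul_of_nonneg_left (exp_log hn0).le (exp_pos _).le)
  rw [← exp_add, exp_le_exp]
  push_cast
  rcases le_total (log n) (log x) with h | h
  · rw [abs_of_nonpos (by linarith)]; nlinarith
  · rw [abs_of_nonneg (by linarith)]; nlinarith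

lemma summable_div_rpow : Summable fun n : ℕ => (Λ n + 1) * (n : ℝ) ^ (-(3 / 2) : ℝ) := by
  simp_rw [add_mul, one_mul]
  exact (summable_vonMangoldt_rpow (by norm_num)).add (summable_nat_rpow.2 (by norm_num))

lemma primeSum_zero (x : ℝ) : primeSum x 0 =
    ((∑' n : ℕ, Λ n * (n : ℝ) ^ (-(1 / 2) : ℝ) * min (n / x) (x / n) : ℝ) : ℂ) := by
  unfold primeSum
  rw [Complex.ofReal_tsum]
  congr 1; funext n
  have : ((n : ℝ) ^ (-(1 / 2) : ℝ) : ℝ) = ((n : ℂ) ^ (-(1 / 2 + I * (0 : ℝ)) : ℂ)) := by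
    rw [Complex.ofReal_cpow (by positivity)]; simp
  rw [← this]
  push_cast; ring

lemma summable_primeSum_zero {x : ℝ} (hx : 0 < x) :
    Summable fun n : ℕ => Λ n * (n : ℝ) ^ (-(1 / 2) : ℝ) * min (n / x) (x / n) := by
  refine Summable.of_norm_bounded ((summable_vonMangoldt_rpow (σ := 3 / 2) (by norm_num)).mul_left x)
    fun n => ?_
  refine le_trans (le_of_eq ?_) (norm_primeSum_term hx n 0)
  rcases Nat.eq_zero_or_pos n with rfl | hn
  · simp
  rw [norm_mul (Complex.ofReal _), Complex.norm_natCast_cpow_of_pos hn, Complex.norm_real]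
  have h0 : (-(1 / 2 + I * ((0 : ℝ) : ℂ))).re = -(1 / 2) := by simp
  conv_rhs => rw [h0, ← norm_of_nonneg (rpow_nonneg (Nat.cast_nonneg n) _), ← norm_mul]
  congr 1; ring

lemma abs_primeSum_zero_sub_le (hRH : RiemannHypothesis) : ∃ C : ℝ, 0 < C ∧ ∀ y : ℝ, 1 ≤ y →
    |∑' n : ℕ, Λ n * (n : ℝ) ^ (-(1 / 2) : ℝ) * min (n / y) (y / n) - 8 / 3 * y ^ (1 / 2 : ℝ)| ≤
      C := by
  obtain ⟨C, hC0, hC⟩ := zero_sum_two_thirds hRH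
  obtain ⟨C', hC'0, hC'⟩ := explicit_formula hRH
  have hl : 0 < log 2 := log_pos (by norm_num)
  refine ⟨2 * (C * log 2) + C' * log 2, by positivity, fun y hy => ?_⟩
  have hy0 : 0 < y := by linarith
  have h1 := hC' 0 y hy
  have h2 := norm_zeroSum_le hC hy0 (t := 0)
  rw [abs_zero, zero_add] at h1 h2
  have h3 : C' * log 2 / y ≤ C' * log 2 := div_le_self (by positivity) hy
  have hp : poleCoeff 0 * (y : ℂ) ^ (1 / 2 - I * (0 : ℝ)) =
      ((8 / 3 * y ^ (1 / 2 : ℝ) : ℝ) : ℂ) := by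
    rw [Complex.ofReal_mul, Complex.ofReal_cpow hy0.le, poleCoeff]
    norm_num
  rw [primeSum_zero, hp] at h1
  set P := ∑' n : ℕ, Λ n * (n : ℝ) ^ (-(1 / 2) : ℝ) * min (n / y) (y / n)
  have h4 := norm_sub_le ((P : ℂ) + zeroSum y 0 - ((8 / 3 * y ^ (1 / 2 : ℝ) : ℝ) : ℂ)) (zeroSum y 0)
  have e : (P : ℂ) + zeroSum y 0 - ((8 / 3 * y ^ (1 / 2 : ℝ) : ℝ) : ℂ) - zeroSum y 0 =
      ((P - 8 / 3 * y ^ (1 / 2 : ℝ) : ℝ) : ℂ) := by push_cast; ring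
  rw [e, Complex.norm_real, norm_eq_abs] at h4
  linarith

lemma abs_tsum_rpow_min_sub_le {y : ℝ} (hy : 1 ≤ y) :
    Summable (fun n : ℕ => (n : ℝ) ^ (-(1 / 2) : ℝ) * min (n / y) (y / n)) ∧
    |∑' n : ℕ, (n : ℝ) ^ (-(1 / 2) : ℝ) * min (n / y) (y / n) - 8 / 3 * y ^ (1 / 2 : ℝ)| ≤ 2 := by
  have hy0 : 0 < y := by linarith
  obtain ⟨hs, ht⟩ := tsum_tent (a := 1 / 2) (b := 3 / 2) (by norm_num) (by norm_num) hy0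
  have e : (fun n : ℕ => (n : ℝ) ^ (-(1 / 2) : ℝ) * min (n / y) (y / n)) = fun n : ℕ =>
      y ^ (-(1 / 2) : ℝ) * (if (n : ℝ) ≤ y then ((n : ℝ) / y) ^ (1 / 2 : ℝ)
        else (y / n) ^ (3 / 2 : ℝ)) := by
    funext n
    rcases Nat.eq_zero_or_pos n with rfl | hn
    · simp [hy0.le]
    have hn0 : (0 : ℝ) < n := by exact_mod_cast hn
    have k1 : ∀ z : ℝ, 0 < z → z ^ (3 / 2 : ℝ) = z * z ^ (1 / 2 : ℝ) := fun z hz => by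
      nth_rw 2 [← rpow_one z]; rw [← rpow_add hz]; norm_num
    have k2 : ∀ z : ℝ, 0 < z → z = z ^ (1 / 2 : ℝ) * z ^ (1 / 2 : ℝ) := fun z hz => by
      rw [← rpow_add hz]; norm_num
    split_ifs with h
    · rw [min_eq_left (((div_le_one hy0).2 h).trans ((one_le_div hn0).2 h)),
        div_rpow hn0.le hy0.le, rpow_neg hn0.le, rpow_neg hy0.le]
      nth_rw 2 [k2 n hn0]; nth_rw 1 [k2 y hy0]
      field_simp
    · have h' := (not_le.1 h).le
      rw [min_eq_right (((div_le_one hn0).2 h').trans ((one_le_div hy0).2 h')), k1 _ (by positivity),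
        div_rpow hy0.le hn0.le, rpow_neg hn0.le, rpow_neg hy0.le]
      field_simp
  rw [e, tsum_mul_left]
  refine ⟨hs.mul_left _, ?_⟩
  generalize ∑' n : ℕ, (if (n : ℝ) ≤ y then ((n : ℝ) / y) ^ (1 / 2 : ℝ)
        else (y / n) ^ (3 / 2 : ℝ)) = S at *
  have hyy : y ^ (1 / 2 : ℝ) = y ^ (-(1 / 2) : ℝ) * y := by
    nth_rw 3 [← rpow_one y]; rw [← rpow_add hy0]; norm_num
  rw [hyy, show y ^ (-(1 / 2) : ℝ) * S - 8 / 3 * (y ^ (-(1 / 2) : ℝ) * y) = y ^ (-(1 / 2) : ℝ) *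
    (S - y * (1 / (1 / 2 + 1) + 1 / (3 / 2 - 1))) by ring, abs_mul, abs_of_nonneg (by positivity)]
  have : y ^ (-(1 / 2) : ℝ) ≤ 1 := rpow_le_one_of_one_le_of_nonpos hy (by norm_num)
  calc _ ≤ 1 * (2 : ℝ) := mul_le_mul this ht (abs_nonneg _) (by norm_num)
    _ = 2 := one_mul _

/-- The coefficients `(Λ(n) - 1) / √n`. -/
noncomputable def devCoeff (n : ℕ) : ℝ := (Λ n - 1) * (n : ℝ) ^ (-(1 / 2) : ℝ)

lemma devCoeff_zero : devCoeff 0 = 0 := by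
  simp [devCoeff]

lemma abs_devCoeff_div_le (n : ℕ) : |devCoeff n| / n ≤ (Λ n + 1) * (n : ℝ) ^ (-(3 / 2) : ℝ) := by
  rcases Nat.eq_zero_or_pos n with rfl | hn
  · simp
  have hn0 : (0 : ℝ) < n := by exact_mod_cast hn
  have h1 : (n : ℝ) ^ (-(3 / 2) : ℝ) = (n : ℝ) ^ (-(1 / 2) : ℝ) / n := by
    rw [← rpow_sub_one hn0.ne']; norm_num
  have hΛ : 0 ≤ Λ n := vonMangoldt_nonneg
  rw [devCoeff, abs_mul, abs_of_nonneg (rpow_nonneg hn0.le _), h1, mul_div_assoc]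
  apply mul_le_mul_of_nonneg_right _ (by positivity)
  rw [abs_le]; constructor <;> linarith

lemma abs_tsum_devCoeff_le (hRH : RiemannHypothesis) : ∃ C : ℝ, 0 < C ∧ ∀ v : ℝ,
    |∑' n : ℕ, devCoeff n * exp (-|log n - v|)| ≤ C := by
  obtain ⟨C, hC0, hC⟩ := abs_primeSum_zero_sub_le hRH
  have hS := summable_div_rpow
  have hS0 : 0 ≤ ∑' n : ℕ, (Λ n + 1) * (n : ℝ) ^ (-(3 / 2) : ℝ) := tsum_nonneg fun n =>
    mul_nonneg (add_nonneg vonMangoldt_nonneg zero_le_one) (by positivity)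
  refine ⟨C + 2 + ∑' n : ℕ, (Λ n + 1) * (n : ℝ) ^ (-(3 / 2) : ℝ), by positivity, fun v => ?_⟩
  rcases le_total 0 v with hv | hv
  · have hy : 1 ≤ exp v := one_le_exp hv
    have h1 := hC _ hy
    obtain ⟨h2s, h2⟩ := abs_tsum_rpow_min_sub_le hy
    have e : (fun n : ℕ => devCoeff n * exp (-|log n - v|)) = fun n : ℕ =>
        Λ n * (n : ℝ) ^ (-(1 / 2) : ℝ) * min (n / exp v) (exp v / n) -
          (n : ℝ) ^ (-(1 / 2) : ℝ) * min (n / exp v) (exp v / n) := by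
      funext n
      rcases Nat.eq_zero_or_pos n with rfl | hn
      · simp [devCoeff]
      rw [min_div_eq_exp (exp_pos v) hn, log_exp, devCoeff]; ring
    rw [e, (summable_primeSum_zero (exp_pos v)).tsum_sub h2s]
    rw [abs_le] at *
    constructor <;> linarith [h1.1, h1.2, h2.1, h2.2]
  · have : ‖∑' n : ℕ, devCoeff n * exp (-|log n - v|)‖ ≤ _ :=
      tsum_of_norm_bounded hS.hasSum fun n => ?_
    · rw [norm_eq_abs] at this; linarith
    refine le_trans ?_ (abs_devCoeff_div_le n)
    rcases Nat.eq_zero_or_pos n with rfl | hn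
    · simp [devCoeff_zero]
    have hn0 : (0 : ℝ) < n := by exact_mod_cast hn
    have hl : 0 ≤ log n := log_natCast_nonneg n
    rw [norm_mul, norm_eq_abs, norm_eq_abs, abs_exp, div_eq_mul_inv]
    apply mul_le_mul_of_nonneg_left _ (abs_nonneg _)
    nth_rw 2 [← exp_log hn0]
    rw [← exp_neg, exp_le_exp, abs_of_nonneg (by linarith)]
    linarith

lemma abs_devCoeff_mul_exp_le (n : ℕ) (v : ℝ) : |devCoeff n * exp (-|log n - v|)| ≤
    exp v * ((Λ n + 1) * (n : ℝ) ^ (-(3 / 2) : ℝ)) := by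
  rcases Nat.eq_zero_or_pos n with rfl | hn
  · simp [devCoeff_zero]
  have hn0 : (0 : ℝ) < n := by exact_mod_cast hn
  refine le_trans ?_ (mul_le_mul_of_nonneg_left (abs_devCoeff_div_le n) (exp_pos v).le)
  rw [abs_mul, abs_exp, mul_comm, mul_div_assoc', mul_div_right_comm]
  apply mul_le_mul_of_nonneg_right _ (abs_nonneg _)
  rw [le_div_iff₀ hn0]
  refine le_trans (mul_le_mul_of_nonneg_left (exp_log hn0).ge (exp_pos _).le) ?_
  rw [← exp_add, exp_le_exp]
  linarith [le_abs_self (log n - v)]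

lemma summable_devCoeff_mul_exp (v : ℝ) :
    Summable fun n : ℕ => devCoeff n * exp (-|log n - v|) :=
  Summable.of_norm_bounded (summable_div_rpow.mul_left (exp v)) fun n =>
    abs_devCoeff_mul_exp_le n v

lemma hasSum_integral_devCoeff {L : ℝ} (hL : 0 ≤ L) :
    HasSum (fun n : ℕ => devCoeff n *
        ∫ s, exp (-|(log n - L) - s|) * tentDensity (3 / 2) (5 / 2) L 1 s)
      (∫ s, (∑' n : ℕ, devCoeff n * exp (-|log n - (L + s)|)) *
        tentDensity (3 / 2) (5 / 2) L 1 s) := by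
  have hint : ∀ n : ℕ, Integrable fun s => devCoeff n * (exp (-|(log n - L) - s|) *
      tentDensity (3 / 2) (5 / 2) L 1 s) := fun n =>
    (integrable_exp_mul_tentDensity (by norm_num) (by norm_num) (by norm_num) (by norm_num) hL
      (by simp) _).const_mul _
  have key := hasSum_integral_of_summable_integral_norm hint ?_
  · have e1 : (fun n : ℕ => devCoeff n *
        ∫ s, exp (-|(log n - L) - s|) * tentDensity (3 / 2) (5 / 2) L 1 s) =
        fun n : ℕ => ∫ s, devCoeff n * (exp (-|(log n - L) - s|) *
      tentDensity (3 / 2) (5 / 2) L 1 s) := by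
      funext n; rw [integral_const_mul]
    have e2 : (fun s => (∑' n : ℕ, devCoeff n * exp (-|log n - (L + s)|)) *
        tentDensity (3 / 2) (5 / 2) L 1 s) = fun s => ∑' n : ℕ, devCoeff n *
        (exp (-|(log n - L) - s|) * tentDensity (3 / 2) (5 / 2) L 1 s) := by
      funext s
      rw [← tsum_mul_right]
      congr 1; funext n
      rw [sub_sub, mul_assoc]
    rw [e1, e2]; exact key
  · refine Summable.of_nonneg_of_le (fun n => integral_nonneg fun s => norm_nonneg _) (fun n => ?_)
      (summable_div_rpow.mul_left (exp L * (12 * (L + 1)) * (2 / (1 / 4))))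
    set a := (Λ n + 1) * (n : ℝ) ^ (-(3 / 2) : ℝ) with ha
    have ha0 : 0 ≤ a := mul_nonneg (add_nonneg vonMangoldt_nonneg zero_le_one)
      (by positivity)
    have hle : ∀ s, ‖devCoeff n * (exp (-|(log n - L) - s|) *
        tentDensity (3 / 2) (5 / 2) L 1 s)‖ ≤
        (exp L * (12 * (L + 1)) * a) * exp (-(1 / 4 * |s|)) := fun s => by
      have h1 := abs_devCoeff_mul_exp_le n (L + s)
      have h2 := abs_tentDensity_le (β := 3 / 2) (γ := 5 / 2) (A := L) (B := 1) (by norm_num)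
        (by norm_num) (by norm_num) (by norm_num) hL (by simp) s
      rw [← mul_assoc, norm_mul, norm_eq_abs, norm_eq_abs, sub_sub]
      refine (mul_le_mul h1 h2 (abs_nonneg _) (by positivity)).trans ?_
      have h3 : exp (L + s) * exp (-(5 / 4 * |s|)) ≤
          exp L * exp (-(1 / 4 * |s|)) := by
        rw [← exp_add, ← exp_add, exp_le_exp]
        linarith [le_abs_self s]
      calc exp (L + s) * a * (12 * (L + 1) * exp (-(5 / 4 * |s|)))
          = (a * (12 * (L + 1))) * (exp (L + s) * exp (-(5 / 4 * |s|))) := by ring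
        _ ≤ (a * (12 * (L + 1))) * (exp L * exp (-(1 / 4 * |s|))) :=
            mul_le_mul_of_nonneg_left h3 (by positivity)
        _ = _ := by ring
    calc _ ≤ ∫ s : ℝ, (exp L * (12 * (L + 1)) * a) * exp (-(1 / 4 * |s|)) :=
          integral_mono (hint n).norm ((integrable_exp_neg_abs (by norm_num)).const_mul _) hle
      _ = _ := by rw [integral_const_mul, integral_exp_neg_abs (by norm_num)]; ring

lemma log_mul_sqWeight {x : ℝ} (hx : 1 ≤ x) (n : ℕ) : (Λ n - 1) * (log n * sqWeight x n) =
    x ^ (-(1 / 2) : ℝ) * (devCoeff n *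
        (∫ s, exp (-|(log n - log x) - s|) *
          tentDensity (3 / 2) (5 / 2) (log x) 1 s) +
      2 * log x * (devCoeff n * exp (-|log n - log x|))) := by
  rcases Nat.eq_zero_or_pos n with rfl | hn
  · simp [devCoeff_zero]
  have hn0 : (0 : ℝ) < n := by exact_mod_cast hn
  have hx0 : 0 < x := by linarith
  rw [integral_tentDensity (log_nonneg hx), sqWeight, min_div_eq_exp hx0 hn, devCoeff]
  have h1 : exp (-|log n - log x|) ^ 2 / n = x ^ (-(1 / 2) : ℝ) *
      ((n : ℝ) ^ (-(1 / 2) : ℝ) * (if log n - log x ≤ 0 then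
        exp (3 / 2 * (log n - log x)) else
        exp (-(5 / 2 * (log n - log x))))) := by
    have h2 : (n : ℝ)⁻¹ = exp (-log n) := by rw [exp_neg, exp_log hn0]
    rw [rpow_def_of_pos hx0, rpow_def_of_pos hn0, div_eq_mul_inv, h2,
      ← exp_nat_mul, ← exp_add]
    split_ifs with h
    · rw [abs_of_nonpos h, ← exp_add, ← exp_add]; congr 1; push_cast; ring
    · rw [abs_of_nonneg (not_le.1 h).le, ← exp_add, ← exp_add]; congr 1; push_cast; ring
  rw [h1]; ring

lemma tsum_vonMangoldt_sub_one_mul (hRH : RiemannHypothesis) : ∃ C : ℝ, 0 < C ∧ ∀ x : ℝ, 1 ≤ x →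
    Summable (fun n : ℕ => (Λ n - 1) * (log n * sqWeight x n)) ∧
    |∑' n : ℕ, (Λ n - 1) * (log n * sqWeight x n)| ≤
      C * ((log x + 1) * x ^ (-(1 / 2) : ℝ)) := by
  obtain ⟨C, hC0, hC⟩ := abs_tsum_devCoeff_le hRH
  refine ⟨22 * C, by positivity, fun x hx => ?_⟩
  have hL : 0 ≤ log x := log_nonneg hx
  set L := log x with hLdef
  have hs1 := hasSum_integral_devCoeff hL
  have hs2 := (summable_devCoeff_mul_exp L).hasSum.mul_left (2 * L)
  have hs := (hs1.add hs2).mul_left (x ^ (-(1 / 2) : ℝ))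
  simp_rw [log_mul_sqWeight hx]
  refine ⟨hs.summable, ?_⟩
  rw [hs.tsum_eq, abs_mul, abs_of_nonneg (by positivity)]
  have h1 : ‖∫ s, (∑' n : ℕ, devCoeff n * exp (-|log n - (L + s)|)) *
        tentDensity (3 / 2) (5 / 2) L 1 s‖ ≤ ∫ s : ℝ, C * (12 * (L + 1)) *
          exp (-(5 / 4 * |s|)) := by
    apply norm_integral_le_of_norm_le ((integrable_exp_neg_abs (by norm_num)).const_mul _)
    refine Eventually.of_forall fun s => ?_
    have h2 := abs_tentDensity_le (β := 3 / 2) (γ := 5 / 2) (A := L) (B := 1) (by norm_num)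
        (by norm_num) (by norm_num) (by norm_num) hL (by simp) s
    rw [norm_mul, mul_assoc C]
    exact mul_le_mul (hC _) h2 (norm_nonneg _) hC0.le
  rw [integral_const_mul, integral_exp_neg_abs (by norm_num), norm_eq_abs] at h1
  have h2 : |2 * L * ∑' n : ℕ, devCoeff n * exp (-|log n - L|)| ≤ 2 * L * C := by
    rw [abs_mul, abs_of_nonneg (by positivity)]
    exact mul_le_mul_of_nonneg_left (hC _) (by positivity)
  rw [mul_comm, ← mul_assoc]
  apply mul_le_mul_of_nonneg_right _ (by positivity)
  refine (abs_add_le _ _).trans ((add_le_add h1 h2).trans ?_)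
  nlinarith [mul_nonneg hL hC0.le]

lemma vonMangoldt_eq_log_or_square_mul_cube (n : ℕ) : Λ n = 0 ∨ Λ n = log n ∨
    ∃ a b : ℕ, n = a ^ 2 * b ^ 3 := by
  by_cases h : IsPrimePow n
  · right
    obtain ⟨p, k, hp, hk, rfl⟩ := (isPrimePow_nat_iff n).1 h
    rcases k with _ | _ | k
    · omega
    · left; rw [zero_add, pow_one, vonMangoldt_apply_prime hp]
    · right
      rcases Nat.even_or_odd' k with ⟨i, rfl | rfl⟩
      · exact ⟨p ^ (i + 1), 1, by ring⟩
      · exact ⟨p ^ i, p, by ring⟩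
  · left; rw [vonMangoldt_apply, if_neg h]

lemma summable_indicator_square_mul_cube :
    Summable (Set.indicator {n : ℕ | ∃ a b : ℕ, n = a ^ 2 * b ^ 3}
      fun n : ℕ => (n : ℝ) ^ (-(5 / 8) : ℝ)) := by
  rw [← summable_subtype_iff_indicator]
  have h1 : Summable fun q : ℕ × ℕ => (q.1 : ℝ) ^ (-(5 / 4) : ℝ) * (q.2 : ℝ) ^ (-(15 / 8) : ℝ) :=
    (summable_nat_rpow.2 (by norm_num)).mul_of_nonneg (summable_nat_rpow.2 (by norm_num))
      (fun _ => by positivity) (fun _ => by positivity)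
  choose a b hab using fun n : {n : ℕ | ∃ a b : ℕ, n = a ^ 2 * b ^ 3} => n.2
  have hinj : Function.Injective fun n => (a n, b n) := fun m n h => by
    simp only [Prod.mk.injEq] at h
    exact Subtype.ext (by rw [hab m, hab n, h.1, h.2])
  refine (h1.comp_injective hinj).congr fun n => ?_
  have : ((n : ℕ) : ℝ) = (a n : ℝ) ^ 2 * (b n : ℝ) ^ 3 := by exact_mod_cast hab n
  simp only [Function.comp]
  rw [this, mul_rpow (by positivity) (by positivity), ← rpow_natCast_mul (by positivity),
    ← rpow_natCast_mul (by positivity)]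
  norm_num

lemma tsum_vonMangoldt_mul_sub : ∃ C : ℝ, 0 < C ∧ ∀ x : ℝ, 1 ≤ x →
    Summable (fun n : ℕ => Λ n * (log n - Λ n) * sqWeight x n) ∧
    |∑' n : ℕ, Λ n * (log n - Λ n) * sqWeight x n| ≤ C * x ^ (-(1 / 4) : ℝ) := by
  have hs := summable_indicator_square_mul_cube
  set f := Set.indicator {n : ℕ | ∃ a b : ℕ, n = a ^ 2 * b ^ 3}
      fun n : ℕ => (n : ℝ) ^ (-(5 / 8) : ℝ) with hf
  have hf0 : ∀ n, 0 ≤ f n := fun n => Set.indicator_nonneg (fun _ _ => by positivity) n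
  have hle : ∀ x : ℝ, 1 ≤ x → ∀ n : ℕ, ‖Λ n * (log n - Λ n) * sqWeight x n‖ ≤
      256 * x ^ (-(1 / 4) : ℝ) * f n := fun x hx n => by
    have hx0 : 0 < x := by linarith
    have h0 : 0 ≤ 256 * x ^ (-(1 / 4) : ℝ) * f n := mul_nonneg (by positivity) (hf0 n)
    rcases vonMangoldt_eq_log_or_square_mul_cube n with h | h | h
    · simpa [h] using h0
    · simpa [h] using h0
    rcases Nat.eq_zero_or_pos n with rfl | hn
    · simpa using h0
    have hn0 : (0 : ℝ) < n := by exact_mod_cast hn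
    have hfn : f n = (n : ℝ) ^ (-(5 / 8) : ℝ) := Set.indicator_of_mem (by exact h) _
    have hΛ : 0 ≤ Λ n := vonMangoldt_nonneg
    have hΛ' : Λ n ≤ log n := vonMangoldt_le_log
    have hlog : log n ≤ 16 * (n : ℝ) ^ (1 / 16 : ℝ) := by
      have := log_le_rpow_div hn0.le (show (0 : ℝ) < 1 / 16 by norm_num)
      linarith
    have hw := sqWeight_le_rpow hx0 (θ := -(1 / 4)) (by norm_num) (by norm_num) n
    rw [norm_mul, norm_of_nonneg (sqWeight_nonneg _ _), norm_mul, norm_of_nonneg hΛ,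
      norm_of_nonneg (by linarith), hfn]
    have h1 : Λ n * (log n - Λ n) ≤ (16 * (n : ℝ) ^ (1 / 16 : ℝ)) *
        (16 * (n : ℝ) ^ (1 / 16 : ℝ)) :=
      mul_le_mul (hΛ'.trans hlog) (by linarith) (by linarith) (by positivity)
    refine (mul_le_mul h1 hw (sqWeight_nonneg _ _) (by positivity)).trans (le_of_eq ?_)
    have h2 : (n : ℝ) ^ (-(5 / 8) : ℝ) = (n : ℝ) ^ (1 / 16 : ℝ) * (n : ℝ) ^ (1 / 16 : ℝ) *
        (n : ℝ) ^ (-1 - -(1 / 4) : ℝ) := by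
      rw [← rpow_add hn0, ← rpow_add hn0]; norm_num
    rw [h2]; ring
  refine ⟨256 * (∑' n, f n + 1), by
    have : 0 ≤ ∑' n, f n := tsum_nonneg hf0
    positivity, fun x hx => ?_⟩
  have hs' := hs.mul_left (256 * x ^ (-(1 / 4) : ℝ))
  refine ⟨Summable.of_norm_bounded hs' (hle x hx), ?_⟩
  refine (tsum_of_norm_bounded hs'.hasSum (hle x hx)).trans ?_
  rw [tsum_mul_left]
  nlinarith [rpow_nonneg (zero_le_one.trans hx) (-(1 / 4) : ℝ)]

lemma summable_rpow_mul_sqWeight {x θ : ℝ} (hx : 0 < x) (h2 : θ < 2) :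
    Summable fun n : ℕ => (n : ℝ) ^ θ * sqWeight x n := by
  refine Summable.of_nonneg_of_le (fun n => mul_nonneg (by positivity) (sqWeight_nonneg _ _))
    (fun n => ?_)
    ((summable_nat_rpow.2 (show θ + (-1 - 2) < -1 by linarith)).mul_left (x ^ (2 : ℝ)))
  rcases Nat.eq_zero_or_pos n with rfl | hn
  · simp [sqWeight]; positivity
  have hn0 : (0 : ℝ) < n := by exact_mod_cast hn
  rw [rpow_add hn0]
  have := mul_le_mul_of_nonneg_left (sqWeight_le_rpow hx (θ := 2) (by norm_num) le_rfl n)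
    (rpow_nonneg hn0.le θ)
  linarith

lemma tsum_rpow_mul_sqWeight_le {θ : ℝ} (h1 : -1 < θ) (h2 : θ < 2) : ∃ C : ℝ, 0 < C ∧ ∀ x : ℝ,
    1 ≤ x → ∑' n : ℕ, (n : ℝ) ^ θ * sqWeight x n ≤ C * x ^ θ := by
  have h4 : 0 < 1 / (1 + θ + 1) + 1 / (3 - θ - 1) := by
    have : 0 < 1 + θ + 1 := by linarith
    have : 0 < 3 - θ - 1 := by linarith
    positivity
  refine ⟨1 / (1 + θ + 1) + 1 / (3 - θ - 1) + 2, by positivity, fun x hx => ?_⟩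
  have hx0 : 0 < x := by linarith
  obtain ⟨hs, ht⟩ := tsum_tent (a := 1 + θ) (b := 3 - θ) (by linarith) (by linarith) hx0
  have e : (fun n : ℕ => (n : ℝ) ^ θ * sqWeight x n) = fun n : ℕ => x ^ (θ - 1) *
      (if (n : ℝ) ≤ x then ((n : ℝ) / x) ^ (1 + θ) else (x / n) ^ (3 - θ)) := by
    funext n
    rcases Nat.eq_zero_or_pos n with rfl | hn
    · simp [hx0.le, sqWeight, show 1 + θ ≠ 0 by linarith]
    have hn0 : (0 : ℝ) < n := by exact_mod_cast hn
    rw [sqWeight, rpow_sub_one hx0.ne']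
    split_ifs with h
    · rw [min_eq_left (((div_le_one hx0).2 h).trans ((one_le_div hn0).2 h)),
        rpow_add (by positivity), rpow_one, div_rpow hn0.le hx0.le]
      field_simp
    · have h' := (not_le.1 h).le
      rw [min_eq_right (((div_le_one hn0).2 h').trans ((one_le_div hx0).2 h')),
        rpow_sub (by positivity), div_rpow hx0.le hn0.le, div_rpow hx0.le hn0.le,
        show (3 : ℝ) = ((3 : ℕ) : ℝ) by norm_num, rpow_natCast, rpow_natCast]
      field_simp
  rw [e, tsum_mul_left]
  generalize ∑' n : ℕ, (if (n : ℝ) ≤ x then ((n : ℝ) / x) ^ (1 + θ)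
        else (x / n) ^ (3 - θ)) = S at *
  generalize 1 / (1 + θ + 1) + 1 / (3 - θ - 1) = c at *
  have hS : S ≤ (c + 2) * x := by rw [abs_le] at ht; nlinarith
  calc _ ≤ x ^ (θ - 1) * ((c + 2) * x) := mul_le_mul_of_nonneg_left hS (by positivity)
    _ = (c + 2) * x ^ θ := by rw [rpow_sub_one hx0.ne']; field_simp

lemma tsum_sqWeight_sub_one {x : ℝ} (hx : 1 ≤ x) : |∑' n : ℕ, sqWeight x n - 1| ≤ 2 / x := by
  have hx0 : 0 < x := by linarith
  obtain ⟨hs, ht⟩ := tsum_tent (a := 1) (b := 3) (by norm_num) (by norm_num) hx0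
  have e : (fun n : ℕ => sqWeight x n) = fun n : ℕ => x⁻¹ *
      (if (n : ℝ) ≤ x then ((n : ℝ) / x) ^ (1 : ℝ) else (x / n) ^ (3 : ℝ)) := by
    funext n
    rcases Nat.eq_zero_or_pos n with rfl | hn
    · simp [hx0.le, sqWeight]
    have hn0 : (0 : ℝ) < n := by exact_mod_cast hn
    rw [sqWeight]
    split_ifs with h
    · rw [min_eq_left (((div_le_one hx0).2 h).trans ((one_le_div hn0).2 h)), rpow_one]
      field_simp
    · have h' := (not_le.1 h).le
      rw [min_eq_right (((div_le_one hn0).2 h').trans ((one_le_div hx0).2 h')),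
        show (3 : ℝ) = ((3 : ℕ) : ℝ) by norm_num, rpow_natCast]
      field_simp
  rw [e, tsum_mul_left]
  generalize ∑' n : ℕ, (if (n : ℝ) ≤ x then ((n : ℝ) / x) ^ (1 : ℝ)
        else (x / n) ^ (3 : ℝ)) = S at *
  rw [show x⁻¹ * S - 1 = (S - x * (1 / (1 + 1) + 1 / (3 - 1))) / x by field_simp; ring,
    abs_div, abs_of_pos hx0]
  gcongr

lemma diagonal_sum (hRH : RiemannHypothesis) : ∃ C : ℝ, 0 < C ∧ ∀ x : ℝ, 1 ≤ x →
    Summable (fun n : ℕ => Λ n ^ 2 * sqWeight x n) ∧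
    |∑' n : ℕ, Λ n ^ 2 * sqWeight x n - ∑' n : ℕ, log n * sqWeight x n| ≤
      C * x ^ (-(1 / 4) : ℝ) := by
  obtain ⟨C, hC0, hC⟩ := tsum_vonMangoldt_sub_one_mul hRH
  obtain ⟨C', hC'0, hC'⟩ := tsum_vonMangoldt_mul_sub
  refine ⟨C * 5 + C', by positivity, fun x hx => ?_⟩
  have hx0 : 0 < x := by linarith
  obtain ⟨h1s, h1⟩ := hC x hx
  obtain ⟨h2s, h2⟩ := hC' x hx
  have h3s : Summable fun n : ℕ => log n * sqWeight x n := by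
    refine Summable.of_nonneg_of_le (fun n => mul_nonneg (log_natCast_nonneg n)
      (sqWeight_nonneg _ _)) (fun n => ?_) (summable_rpow_mul_sqWeight (θ := 1) hx0 (by norm_num))
    rw [rpow_one]
    exact mul_le_mul_of_nonneg_right (log_le_self (Nat.cast_nonneg n)) (sqWeight_nonneg _ _)
  have e : (fun n : ℕ => Λ n ^ 2 * sqWeight x n) = fun n : ℕ => log n * sqWeight x n +
      (Λ n - 1) * (log n * sqWeight x n) - Λ n * (log n - Λ n) * sqWeight x n := by
    funext n; ring
  have hs := (h3s.add h1s).sub h2s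
  rw [e]
  refine ⟨hs, ?_⟩
  rw [(h3s.add h1s).tsum_sub h2s, h3s.tsum_add h1s]
  have h4 : (log x + 1) * x ^ (-(1 / 2) : ℝ) ≤ 5 * x ^ (-(1 / 4) : ℝ) := by
    have h5 : x ^ (-(1 / 4) : ℝ) = x ^ (1 / 4 : ℝ) * x ^ (-(1 / 2) : ℝ) := by
      rw [← rpow_add hx0]; norm_num
    have h6 := log_le_rpow_div hx0.le (show (0 : ℝ) < 1 / 4 by norm_num)
    have h7 : 1 ≤ x ^ (1 / 4 : ℝ) := one_le_rpow hx (by norm_num)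
    rw [h5, ← mul_assoc]
    apply mul_le_mul_of_nonneg_right _ (by positivity)
    linarith
  rw [abs_le] at *
  have := mul_le_mul_of_nonneg_left h4 hC0.le
  constructor <;> linarith

/-- The sum `∑ {a r} / a ^ 2` over positive integers `a`. -/
noncomputable def fractSum (r : ℝ) : ℝ := ∑' a : ℕ, Int.fract (a * r) / (a : ℝ) ^ 2

lemma tsum_tail_inv_sq {y : ℝ} {N : ℕ} (hy : 0 < y) (h1 : (N : ℝ) - 1 ≤ y) (h2 : y ≤ N) :
    Summable (fun a : ℕ => if N ≤ a then 1 / (a : ℝ) ^ 2 else 0) ∧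
    |∑' a : ℕ, (if N ≤ a then 1 / (a : ℝ) ^ 2 else 0) - 1 / y| ≤ 1 / y ^ 2 := by
  obtain ⟨hs, ht⟩ := abs_tsum_tail_sub_le (b := 2) (by norm_num) N hy h1 h2
  have e : (fun n : ℕ => ((n + N : ℕ) : ℝ) ^ (-2 : ℝ)) =
      fun n : ℕ => if N ≤ n + N then 1 / ((n + N : ℕ) : ℝ) ^ 2 else 0 := by
    funext n
    rw [if_pos (by omega), rpow_neg (by positivity), one_div]
    norm_cast
  rw [e] at hs ht
  have hs' := (summable_nat_add_iff (f := fun a : ℕ => if N ≤ a then 1 / (a : ℝ) ^ 2 else 0) N).1 hs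
  refine ⟨hs', ?_⟩
  rw [← hs'.sum_add_tsum_nat_add N, sum_eq_zero, zero_add]
  · rw [rpow_neg hy.le, show (1 : ℝ) - 2 = -1 by norm_num, rpow_neg_one,
      show (2 : ℝ) - 1 = 1 by norm_num, div_one, rpow_two] at ht
    rwa [one_div y, one_div]
  · intro a ha
    rw [if_neg (by have := mem_range.1 ha; omega)]

lemma sum_ite_le_eq_floor {z : ℝ} (hz : 0 ≤ z) {K : ℕ} (h : z ≤ K) :
    ∑ k ∈ Icc 1 K, (if (k : ℝ) ≤ z then (1 : ℝ) else 0) = (⌊z⌋₊ : ℝ) := by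
  rw [sum_boole]
  congr 1
  have : (Icc 1 K).filter (fun k : ℕ => (k : ℝ) ≤ z) = Icc 1 ⌊z⌋₊ := by
    ext k
    simp only [mem_filter, mem_Icc, ← Nat.le_floor_iff hz]
    have : ⌊z⌋₊ ≤ K := Nat.floor_le_of_le h
    omega
  rw [this, Nat.card_Icc, Nat.add_sub_cancel]

lemma summable_fractSum (r : ℝ) : Summable fun a : ℕ => Int.fract (a * r) / (a : ℝ) ^ 2 := by
  refine Summable.of_nonneg_of_le (fun a => div_nonneg (Int.fract_nonneg _) (by positivity))
    (fun a => ?_) (summable_one_div_nat_pow.2 (le_refl 2))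
  exact div_le_div_of_nonneg_right (Int.fract_lt_one _).le (by positivity)

lemma abs_fractSum_sub_le_aux {r : ℝ} (hr : 0 < r) {K : ℕ} (hK : 0 < K) :
    |fractSum r - r * (harmonic ⌊(1 / r) * K⌋₊ - harmonic K : ℝ) - r| ≤
      2 * r ^ 2 + (r + 2 * r ^ 2) * (1 / (K : ℝ)) := by
  have hK0 : (0 : ℝ) < K := by exact_mod_cast hK
  have hK1 : (1 : ℝ) ≤ K := by exact_mod_cast hK
  set M := ⌊(1 / r) * K⌋₊ with hM
  have hy : 0 < (1 / r) * K := by positivity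
  obtain ⟨hTs, hT⟩ := tsum_tail_inv_sq (N := M + 1) hy
    (by push_cast; linarith [Nat.floor_le hy.le]) (by push_cast; exact (Nat.lt_floor_add_one _).le)
  have hTk : ∀ k : ℕ, k ∈ Icc 1 K →
      Summable (fun a : ℕ => if (k : ℝ) ≤ a * r then 1 / (a : ℝ) ^ 2 else 0) ∧
      |∑' a : ℕ, (if (k : ℝ) ≤ a * r then 1 / (a : ℝ) ^ 2 else 0) - r * (1 / k)| ≤
        r ^ 2 * (1 / (k : ℝ) ^ 2) := fun k hk => by
    have hk0 : (0 : ℝ) < k := by exact_mod_cast (mem_Icc.1 hk).1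
    have h := tsum_tail_inv_sq (y := k / r) (N := ⌈(k : ℝ) / r⌉₊) (by positivity)
      (by linarith [Nat.ceil_lt_add_one (show 0 ≤ (k : ℝ) / r by positivity)]) (Nat.le_ceil _)
    have e : (fun a : ℕ => if ⌈(k : ℝ) / r⌉₊ ≤ a then 1 / (a : ℝ) ^ 2 else 0) =
        fun a : ℕ => if (k : ℝ) ≤ a * r then 1 / (a : ℝ) ^ 2 else 0 := by
      funext a
      simp only [Nat.ceil_le, div_le_iff₀ hr]
    rw [e] at h
    refine ⟨h.1, ?_⟩
    have h2 := h.2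
    rw [show 1 / ((k : ℝ) / r) = r * (1 / k) by field_simp,
      show 1 / ((k : ℝ) / r) ^ 2 = r ^ 2 * (1 / (k : ℝ) ^ 2) by field_simp] at h2
    exact h2
  have hlow : HasSum (fun a : ℕ => if a ≤ M then r / (a : ℝ) else 0) (r * harmonic M) := by
    have h : HasSum (fun a : ℕ => if a ≤ M then r / (a : ℝ) else 0)
        (∑ a ∈ Icc 1 M, if a ≤ M then r / (a : ℝ) else 0) :=
      hasSum_sum_of_ne_finset_zero (fun a ha => by
        rcases Nat.eq_zero_or_pos a with rfl | h
        · simp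
        · rw [if_neg]; intro h'; exact ha (mem_Icc.2 ⟨h, h'⟩))
    have e : ∑ a ∈ Icc 1 M, (if a ≤ M then r / (a : ℝ) else 0) = r * harmonic M := by
      rw [harmonic_eq_sum_Icc]
      push_cast
      rw [mul_sum]
      refine sum_congr rfl fun a ha => ?_
      rw [if_pos (mem_Icc.1 ha).2, div_eq_mul_inv]
    rwa [e] at h
  have hfl : HasSum (fun a : ℕ => ∑ k ∈ Icc 1 K,
      (if (k : ℝ) ≤ a * r then 1 / (a : ℝ) ^ 2 else 0))
      (∑ k ∈ Icc 1 K, ∑' a : ℕ, (if (k : ℝ) ≤ a * r then 1 / (a : ℝ) ^ 2 else 0)) :=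
    hasSum_sum fun k hk => (hTk k hk).1.hasSum
  have htail := hTs.hasSum
  have hE := ((summable_fractSum r).hasSum.sub (hlow.add (htail.mul_left (K : ℝ)))).add hfl
  have hEle : |fractSum r - (r * harmonic M + K *
      ∑' a : ℕ, (if M + 1 ≤ a then 1 / (a : ℝ) ^ 2 else 0)) +
      ∑ k ∈ Icc 1 K, ∑' a : ℕ, (if (k : ℝ) ≤ a * r then 1 / (a : ℝ) ^ 2 else 0)| ≤
      ∑' a : ℕ, (if M + 1 ≤ a then 1 / (a : ℝ) ^ 2 else 0) := by
    rw [fractSum, ← hE.tsum_eq, ← norm_eq_abs]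
    refine tsum_of_norm_bounded htail fun a => ?_
    have hf : ∑ k ∈ Icc 1 K, (if (k : ℝ) ≤ a * r then 1 / (a : ℝ) ^ 2 else 0) =
        (∑ k ∈ Icc 1 K, (if (k : ℝ) ≤ a * r then (1 : ℝ) else 0)) * (1 / (a : ℝ) ^ 2) := by
      rw [sum_mul]
      refine sum_congr rfl fun k _ => ?_
      split_ifs <;> simp
    rw [hf, norm_eq_abs]
    by_cases h : a ≤ M
    · have h1 : (a : ℝ) * r ≤ K := by
        have := (Nat.le_floor_iff hy.le).1 h
        rw [one_div, inv_mul_eq_div, le_div_iff₀ hr] at this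
        exact this
      rw [sum_ite_le_eq_floor (by positivity) h1, if_pos h, if_neg (by omega)]
      rcases Nat.eq_zero_or_pos a with rfl | ha
      · simp
      have ha0 : (0 : ℝ) < a := by exact_mod_cast ha
      have h2 : ((⌊(a : ℝ) * r⌋₊ : ℕ) : ℝ) = a * r - Int.fract (a * r) := by
        rw [Int.self_sub_fract, natCast_floor_eq_intCast_floor (by positivity)]
      rw [h2]
      apply le_of_eq
      rw [abs_eq_zero]
      field_simp
      ring
    · have h1 : (K : ℝ) < a * r := by
        have := (Nat.floor_lt hy.le).1 (not_le.1 h)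
        rw [one_div, inv_mul_eq_div, div_lt_iff₀ hr] at this
        exact this
      have h2 : ∑ k ∈ Icc 1 K, (if (k : ℝ) ≤ a * r then (1 : ℝ) else 0) = K := by
        rw [sum_congr rfl (g := fun _ => (1 : ℝ))]
        · simp
        · intro k hk
          rw [if_pos]
          have : (k : ℝ) ≤ K := by exact_mod_cast (mem_Icc.1 hk).2
          linarith
      rw [h2, if_neg h, if_pos (by omega), zero_add, sub_add_cancel, abs_of_nonneg
        (div_nonneg (Int.fract_nonneg _) (by positivity))]
      exact div_le_div_of_nonneg_right (Int.fract_lt_one _).le (by positivity)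
  have hS : |∑ k ∈ Icc 1 K, ∑' a : ℕ, (if (k : ℝ) ≤ a * r then 1 / (a : ℝ) ^ 2 else 0) -
      r * harmonic K| ≤ 2 * r ^ 2 - r ^ 2 * (1 / K) := by
    have e : r * (harmonic K : ℝ) = ∑ k ∈ Icc 1 K, r * (1 / (k : ℝ)) := by
      rw [harmonic_eq_sum_Icc]; push_cast; rw [mul_sum]; simp
    rw [e, ← sum_sub_distrib]
    refine (abs_sum_le_sum_abs _ _).trans ((sum_le_sum fun k hk =>
      (hTk k hk).2).trans ?_)
    rw [← mul_sum, show 2 * r ^ 2 - r ^ 2 * (1 / K) = r ^ 2 * (2 - 1 / K) by ring]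
    apply mul_le_mul_of_nonneg_left _ (by positivity)
    clear_value M
    clear hTk hfl hE hEle hlow htail e hTs hT hy hM hK0 hK1
    induction K, (show 1 ≤ K from hK) using Nat.le_induction with
    | base => norm_num
    | succ n hn ih =>
      rw [sum_Icc_succ_top (by omega)]
      have hn0 : (0 : ℝ) < n := by exact_mod_cast hn
      have := ih hn
      have h3 : 1 / ((n : ℝ) + 1) ^ 2 ≤ 1 / n - 1 / (n + 1) := by
        rw [div_sub_div _ _ hn0.ne' (by positivity), div_le_div_iff₀ (by positivity) (by positivity)]
        nlinarith
      push_cast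
      linarith
  generalize ∑' a : ℕ, (if M + 1 ≤ a then 1 / (a : ℝ) ^ 2 else 0) = τ at *
  generalize ∑ k ∈ Icc 1 K, ∑' a : ℕ,
    (if (k : ℝ) ≤ a * r then 1 / (a : ℝ) ^ 2 else 0) = σ at *
  rw [show 1 / ((1 / r) * (K : ℝ)) = r * (1 / K) by field_simp,
    show 1 / ((1 / r) * (K : ℝ)) ^ 2 = r ^ 2 * (1 / K) * (1 / K) by field_simp] at hT
  have hKτ : |K * τ - r| ≤ r ^ 2 * (1 / K) := by
    have : K * τ - r = K * (τ - r * (1 / K)) := by field_simp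
    rw [this, abs_mul, abs_of_pos hK0]
    calc K * |τ - r * (1 / K)| ≤ K * (r ^ 2 * (1 / K) * (1 / K)) :=
          mul_le_mul_of_nonneg_left hT hK0.le
      _ = _ := by field_simp
  have hK2 : r ^ 2 * (1 / K) * (1 / K) ≤ r ^ 2 * (1 / (K : ℝ)) :=
    mul_le_of_le_one_right (by positivity) ((div_le_one hK0).2 hK1)
  rw [abs_le] at *
  constructor <;> nlinarith [hEle.1, hEle.2, hS.1, hS.2, hT.1, hT.2, hKτ.1, hKτ.2]

lemma abs_fractSum_sub_le {r : ℝ} (hr : 0 < r) :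
    |fractSum r - (-(r * log r) + r)| ≤ 2 * r ^ 2 := by
  have hA := tendsto_nat_floor_mul_div_atTop (R := ℝ) (a := 1 / r) (by positivity)
  have hB : Tendsto (fun K : ℕ => (⌊(1 / r) * (K : ℝ)⌋₊ : ℝ) / K) atTop
      (nhds (1 / r)) := hA.comp tendsto_natCast_atTop_atTop
  have hF : Tendsto (fun K : ℕ => ⌊(1 / r) * (K : ℝ)⌋₊) atTop atTop :=
    tendsto_nat_floor_atTop.comp
      (tendsto_natCast_atTop_atTop.const_mul_atTop (show 0 < 1 / r by positivity))
  have h1 := tendsto_harmonic_sub_log.comp hF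
  have h2 := tendsto_harmonic_sub_log
  have h3 := hB.log (by positivity)
  have h4 : Tendsto (fun K : ℕ => ((harmonic ⌊(1 / r) * (K : ℝ)⌋₊ : ℝ) - harmonic K))
      atTop (nhds (-log r)) := by
    have h := (h1.sub h2).add h3
    rw [sub_self, zero_add, one_div, log_inv] at h
    refine h.congr' ?_
    filter_upwards [eventually_gt_atTop 0, hF.eventually_gt_atTop 0] with K hK hK'
    rw [← one_div, Function.comp, log_div (by exact_mod_cast hK'.ne')
      (by exact_mod_cast hK.ne')]
    ring
  have h5 := (((h4.const_mul r).const_sub (fractSum r)).sub_const r).abs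
  have h6 := ((tendsto_one_div_atTop_nhds_zero_nat (𝕜 := ℝ)).const_mul (r + 2 * r ^ 2)).const_add
    (2 * r ^ 2)
  rw [mul_zero, add_zero] at h6
  have := le_of_tendsto_of_tendsto h5 h6 (by
    filter_upwards [eventually_gt_atTop 0] with K hK using abs_fractSum_sub_le_aux hr hK)
  rwa [show fractSum r - (-(r * log r) + r) = fractSum r - r * -log r - r by ring]

/-- The values at prime powers of the multiplicative function `sieveCoeff`. -/
noncomputable def sieveLocal (p k : ℕ) : ℝ :=
  if k = 0 then 1 else if p = 2 then (if k = 1 then -(1 / 2) else 0)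
  else if k = 1 then 2 / (p * (p - 2)) else if k = 2 then -(1 / (p * (p - 2))) else 0

/-- The multiplicative function `e` for which the singular series `𝔖(2j)` is proportional to
`∑ e(b) / a`, the sum being over `m a b = j`. -/
noncomputable def sieveCoeff (n : ℕ) : ℝ :=
  if n = 0 then 0 else ∏ p ∈ n.primeFactors, sieveLocal p (n.factorization p)

lemma sieveCoeff_zero : sieveCoeff 0 = 0 := by simp [sieveCoeff]

lemma sieveCoeff_one : sieveCoeff 1 = 1 := by simp [sieveCoeff]

lemma sieveLocal_zero (p : ℕ) : sieveLocal p 0 = 1 := by simp [sieveLocal]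

lemma sieveLocal_of_three_le (p : ℕ) {k : ℕ} (hk : 3 ≤ k) : sieveLocal p k = 0 := by
  have h0 : k ≠ 0 := by omega
  have h1 : k ≠ 1 := by omega
  have h2 : k ≠ 2 := by omega
  simp [sieveLocal, h0, h1, h2]

lemma sieveCoeff_mul {m n : ℕ} (h : m.Coprime n) :
    sieveCoeff (m * n) = sieveCoeff m * sieveCoeff n := by
  rcases Nat.eq_zero_or_pos m with rfl | hm
  · simp [sieveCoeff_zero]
  rcases Nat.eq_zero_or_pos n with rfl | hn
  · simp [sieveCoeff_zero]
  rw [sieveCoeff, sieveCoeff, sieveCoeff, if_neg (by positivity), if_neg hm.ne', if_neg hn.ne',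
    h.primeFactors_mul, prod_union h.disjoint_primeFactors]
  congr 1
  · refine prod_congr rfl fun p hp => ?_
    rw [Nat.factorization_eq_of_coprime_left h (by simpa using hp)]
  · refine prod_congr rfl fun p hp => ?_
    rw [Nat.factorization_eq_of_coprime_right h (by simpa using hp)]

lemma sieveCoeff_prime_pow {p : ℕ} (hp : p.Prime) (k : ℕ) : sieveCoeff (p ^ k) = sieveLocal p k := by
  rcases Nat.eq_zero_or_pos k with rfl | hk
  · simp [sieveCoeff_one, sieveLocal_zero]
  rw [sieveCoeff, if_neg (pow_ne_zero _ hp.ne_zero), Nat.primeFactors_prime_pow hk.ne' hp]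
  simp [hp.factorization]

lemma summable_of_multiplicative {F u : ℕ → ℝ} (hF : ∀ n, 0 ≤ F n) (h0 : F 0 = 0) (h1 : F 1 = 1)
    (hmul : ∀ {m n : ℕ}, m.Coprime n → F (m * n) = F m * F n)
    (hp : ∀ {p : ℕ}, p.Prime → Summable fun k : ℕ => F (p ^ k)) (hu : ∀ p, 0 ≤ u p)
    (hus : Summable u) (hle : ∀ {p : ℕ}, p.Prime → ∑' k : ℕ, F (p ^ k) ≤ 1 + u p) : Summable F := by
  refine summable_of_sum_le hF (c := exp (∑' p, u p)) fun s => ?_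
  set N := s.sup id + 1 with hN
  obtain ⟨-, hs⟩ := EulerProduct.summable_and_hasSum_smoothNumbers_prod_primesBelow_tsum h1 hmul
    (fun hq => (hp hq).norm) N
  have h2 : ∏ p ∈ N.primesBelow, ∑' k : ℕ, F (p ^ k) ≤ exp (∑' p, u p) := by
    calc ∏ p ∈ N.primesBelow, ∑' k : ℕ, F (p ^ k) ≤ ∏ p ∈ N.primesBelow, exp (u p) := by
          refine prod_le_prod (fun p _ => tsum_nonneg fun k => hF _) fun p hp' => ?_
          linarith [hle (Nat.prime_of_mem_primesBelow hp'), add_one_le_exp (u p)]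
      _ = exp (∑ p ∈ N.primesBelow, u p) := (exp_sum _ _).symm
      _ ≤ _ := exp_le_exp.2 (hus.sum_le_tsum _ fun p _ => hu p)
  have h3 : ∑ n ∈ s, F n = ∑ n ∈ s.erase 0, F n := by
    by_cases h : 0 ∈ s
    · rw [← add_sum_erase s F h, h0, zero_add]
    · rw [erase_eq_of_notMem h]
  rw [h3]
  have h4 : HasSum (Set.indicator N.smoothNumbers F) (∏ p ∈ N.primesBelow, ∑' k : ℕ, F (p ^ k)) :=
    hasSum_subtype_iff_indicator.1 hs
  refine le_trans ?_ h2
  have h5 : ∑ n ∈ s.erase 0, F n = ∑ n ∈ s.erase 0, Set.indicator N.smoothNumbers F n := by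
    refine sum_congr rfl fun n hn => ?_
    rw [Set.indicator_of_mem]
    have hn' := mem_erase.1 hn
    exact Nat.mem_smoothNumbers_of_lt (Nat.pos_of_ne_zero hn'.1)
      (Nat.lt_succ_of_le (le_sup (f := id) hn'.2))
  rw [h5]
  exact sum_le_hasSum _ (fun n _ => Set.indicator_nonneg (fun _ _ => hF _) _) h4

lemma tsum_eq_three {f : ℕ → ℝ} (h : ∀ k, 3 ≤ k → f k = 0) :
    HasSum f (f 0 + f 1 + f 2) := by
  have : HasSum f (∑ k ∈ range 3, f k) :=
    hasSum_sum_of_ne_finset_zero fun k hk => h k (by simpa using hk)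
  simpa [sum_range_succ] using this

lemma prime_sub_two {p : ℕ} (hp : p.Prime) (h2 : p ≠ 2) : (p : ℝ) / 3 ≤ p - 2 := by
  have : 3 ≤ p := by have := hp.two_le; omega
  have : (3 : ℝ) ≤ p := by exact_mod_cast this
  linarith

lemma summable_sieveCoeff {θ : ℝ} (h0 : 0 ≤ θ) (h1 : θ < 1 / 2) :
    Summable fun n : ℕ => |sieveCoeff n| * (n : ℝ) ^ θ := by
  have hpow : ∀ {p : ℕ}, p.Prime → HasSum (fun k : ℕ => |sieveCoeff (p ^ k)| * ((p ^ k : ℕ) : ℝ) ^ θ)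
      (1 + |sieveLocal p 1| * (p : ℝ) ^ θ + |sieveLocal p 2| * ((p : ℝ) ^ 2) ^ θ) := fun {p} hp => by
    simp_rw [sieveCoeff_prime_pow hp]
    have := tsum_eq_three (f := fun k : ℕ => |sieveLocal p k| * ((p ^ k : ℕ) : ℝ) ^ θ)
      fun k hk => by simp [sieveLocal_of_three_le p hk]
    simpa [sieveLocal_zero] using this
  refine summable_of_multiplicative (u := fun p => 9 * (p : ℝ) ^ (2 * θ - 2)) (fun n => by positivity)
    (by simp [sieveCoeff_zero]) (by simp [sieveCoeff_one]) (fun {m n} h => ?_)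
    (fun hp => (hpow hp).summable) (fun p => by positivity)
    ((summable_nat_rpow.2 (by linarith)).mul_left _) (fun {p} hp => ?_)
  · rw [sieveCoeff_mul h, abs_mul, Nat.cast_mul, mul_rpow (by positivity) (by positivity)]
    ring
  · rw [(hpow hp).tsum_eq]
    have hp0 : (0 : ℝ) < p := by exact_mod_cast hp.pos
    have hp1 : (1 : ℝ) ≤ p := by exact_mod_cast hp.one_lt.le
    have e2 : ((p : ℝ) ^ 2) ^ θ = (p : ℝ) ^ (2 * θ) := by
      rw [← rpow_natCast_mul hp0.le]; norm_num
    have e1 : (p : ℝ) ^ θ ≤ (p : ℝ) ^ (2 * θ) := rpow_le_rpow_of_exponent_le hp1 (by linarith)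
    have e3 : (p : ℝ) ^ (2 * θ - 2) = (p : ℝ) ^ (2 * θ) / p ^ 2 := by
      rw [rpow_sub hp0, rpow_two]
    rw [e2, e3, add_assoc]
    apply add_le_add le_rfl
    have h3 : |sieveLocal p 1| + |sieveLocal p 2| ≤ 9 / p ^ 2 := by
      by_cases h : p = 2
      · subst h; simp [sieveLocal]; norm_num [abs_of_pos]
      · have := prime_sub_two hp h
        have h4 : 0 < (p : ℝ) - 2 := by linarith [div_pos hp0 (show (0:ℝ) < 3 by norm_num)]
        simp only [sieveLocal, h, if_false, if_true, one_ne_zero, two_ne_zero]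
        rw [if_neg (by norm_num), abs_neg, abs_of_pos (by positivity), abs_of_pos (by positivity),
          ← add_div, div_le_div_iff₀ (by positivity) (by positivity)]
        nlinarith
    have hP : 0 ≤ (p : ℝ) ^ (2 * θ) := by positivity
    have h5 := mul_le_mul_of_nonneg_left e1 (abs_nonneg (sieveLocal p 1))
    have h6 := mul_le_mul_of_nonneg_right h3 hP
    calc _ ≤ (|sieveLocal p 1| + |sieveLocal p 2|) * (p : ℝ) ^ (2 * θ) := by linarith
      _ ≤ _ := h6
      _ = _ := by ring

lemma summable_abs_sieveCoeff : Summable fun n : ℕ => |sieveCoeff n| := by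
  simpa using summable_sieveCoeff (θ := 0) le_rfl (by norm_num)

lemma summable_abs_sieveCoeff_log : Summable fun n : ℕ => |sieveCoeff n * log n| := by
  refine Summable.of_nonneg_of_le (fun n => abs_nonneg _) (fun n => ?_)
    ((summable_sieveCoeff (θ := 1 / 4) (by norm_num) (by norm_num)).mul_left 4)
  have := log_le_rpow_div (Nat.cast_nonneg n) (show (0 : ℝ) < 1 / 4 by norm_num)
  rw [abs_mul, abs_of_nonneg (log_natCast_nonneg n)]
  nlinarith [abs_nonneg (sieveCoeff n)]

/-- The product over odd primes in the singular series. -/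
noncomputable def twinProduct : ℝ :=
  ∏' p : Nat.Primes, if 2 < (p : ℕ) then 1 - 1 / ((p : ℕ) - 1 : ℝ) ^ 2 else 1

lemma hasProd_twinProduct : HasProd (fun p : Nat.Primes =>
    if 2 < (p : ℕ) then 1 - 1 / ((p : ℕ) - 1 : ℝ) ^ 2 else 1) twinProduct := by
  have hs : Summable fun p : Nat.Primes => ‖(if 2 < (p : ℕ) then -(1 / ((p : ℕ) - 1 : ℝ) ^ 2) else 0)‖ := by
    refine Summable.of_nonneg_of_le (fun p => norm_nonneg _) (fun p => ?_)
      (((summable_one_div_nat_pow.2 (le_refl 2)).mul_left 4).comp_injective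
        Nat.Primes.coe_nat_injective)
    split_ifs with h
    · have h2 : (3 : ℝ) ≤ (p : ℕ) := by exact_mod_cast h
      rw [norm_neg, norm_of_nonneg (by positivity)]
      simp only [Function.comp]
      rw [mul_one_div, div_le_div_iff₀ (by nlinarith) (by positivity)]
      nlinarith
    · rw [norm_zero]; simp only [Function.comp]; positivity
  have h := (multipliable_one_add_of_summable hs).hasProd
  have e : (fun p : Nat.Primes => 1 + (if 2 < (p : ℕ) then -(1 / ((p : ℕ) - 1 : ℝ) ^ 2) else 0)) =
      fun p : Nat.Primes => if 2 < (p : ℕ) then 1 - 1 / ((p : ℕ) - 1 : ℝ) ^ 2 else 1 := by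
    funext p; split_ifs <;> ring
  rw [e] at h
  exact h

/-- The dual number whose components are `e(b)` and `e(b) log b`. -/
noncomputable def sieveDual (n : ℕ) : TrivSqZeroExt ℝ ℝ :=
  TrivSqZeroExt.inl (sieveCoeff n) + TrivSqZeroExt.inr (sieveCoeff n * log n)

lemma sieveDual_mul {m n : ℕ} (h : m.Coprime n) :
    sieveDual (m * n) = sieveDual m * sieveDual n := by
  rcases Nat.eq_zero_or_pos m with rfl | hm
  · ext <;> simp [sieveDual, sieveCoeff_zero]
  rcases Nat.eq_zero_or_pos n with rfl | hn
  · ext <;> simp [sieveDual, sieveCoeff_zero]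
  have hm' : (m : ℝ) ≠ 0 := by exact_mod_cast hm.ne'
  have hn' : (n : ℝ) ≠ 0 := by exact_mod_cast hn.ne'
  ext
  · simp [sieveDual, sieveCoeff_mul h]
  · simp [sieveDual, sieveCoeff_mul h, log_mul hm' hn']
    ring

lemma summable_norm_sieveDual : Summable fun n => ‖sieveDual n‖ := by
  refine (summable_abs_sieveCoeff.add summable_abs_sieveCoeff_log).congr fun n => ?_
  simp [sieveDual, TrivSqZeroExt.norm_def]

lemma tsum_sieveDual_prime {p : ℕ} (hp : p.Prime) : ∑' k : ℕ, sieveDual (p ^ k) =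
    TrivSqZeroExt.inl (1 + sieveLocal p 1 + sieveLocal p 2) +
      TrivSqZeroExt.inr ((sieveLocal p 1 + 2 * sieveLocal p 2) * log p) := by
  have : HasSum (fun k : ℕ => sieveDual (p ^ k)) (∑ k ∈ range 3, sieveDual (p ^ k)) :=
    hasSum_sum_of_ne_finset_zero fun k hk => by
      have hk' : 3 ≤ k := by simpa using hk
      ext <;> simp [sieveDual, sieveCoeff_prime_pow hp, sieveLocal_of_three_le p hk']
  rw [this.tsum_eq]
  ext
  · simp [sieveDual, sum_range_succ, sieveCoeff_prime_pow hp, sieveLocal_zero]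
  · simp [sieveDual, sum_range_succ, sieveCoeff_prime_pow hp]
    ring

lemma hasProd_sieveDual : HasProd (fun p : Nat.Primes =>
    TrivSqZeroExt.inl (1 + sieveLocal p 1 + sieveLocal p 2) +
      TrivSqZeroExt.inr ((sieveLocal p 1 + 2 * sieveLocal p 2) * log p))
    (TrivSqZeroExt.inl (∑' n, sieveCoeff n) +
      TrivSqZeroExt.inr (∑' n : ℕ, sieveCoeff n * log n) : TrivSqZeroExt ℝ ℝ) := by
  have h := EulerProduct.eulerProduct_hasProd (f := sieveDual)
    (by ext <;> simp [sieveDual, sieveCoeff_one]) (fun {m n} h => sieveDual_mul h)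
    summable_norm_sieveDual (by ext <;> simp [sieveDual, sieveCoeff_zero])
  have e : (fun p : Nat.Primes => ∑' k : ℕ, sieveDual (p ^ k)) = fun p : Nat.Primes =>
      TrivSqZeroExt.inl (1 + sieveLocal p 1 + sieveLocal p 2) +
      TrivSqZeroExt.inr ((sieveLocal p 1 + 2 * sieveLocal p 2) * log p) :=
    funext fun p => tsum_sieveDual_prime p.2
  rw [e] at h
  have hs := summable_norm_sieveDual.of_norm.hasSum
  have e1 : TrivSqZeroExt.fst (∑' n, sieveDual n) = ∑' n, sieveCoeff n := by
    have := (TrivSqZeroExt.hasSum_fst _ hs).tsum_eq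
    rw [← this]
    simp [sieveDual]
  have e2 : TrivSqZeroExt.snd (∑' n, sieveDual n) = ∑' n : ℕ, sieveCoeff n * log n := by
    have := (TrivSqZeroExt.hasSum_snd _ hs).tsum_eq
    rw [← this]
    simp [sieveDual]
  rw [← e1, ← e2, TrivSqZeroExt.inl_fst_add_inr_snd_eq]
  exact h

lemma sieveLocal_odd {p : ℕ} (hp : p ≠ 2) :
    sieveLocal p 1 = 2 / (p * (p - 2)) ∧ sieveLocal p 2 = -(1 / (p * (p - 2))) := by
  simp [sieveLocal, hp]

lemma twinProduct_mul_tsum : 2 * twinProduct * ∑' n, sieveCoeff n = 1 := by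
  have h1 : HasProd (fun p : Nat.Primes => 1 + sieveLocal p 1 + sieveLocal p 2)
      (∑' n, sieveCoeff n) := by
    have := hasProd_sieveDual.map (TrivSqZeroExt.fstHom ℝ ℝ ℝ) (TrivSqZeroExt.continuous_fst)
    simpa [Function.comp_def] using this
  have h2 := h1.mul hasProd_twinProduct
  have h3 : HasProd (fun p : Nat.Primes => if (p : ℕ) = 2 then (1 / 2 : ℝ) else 1) (1 / 2) := by
    have := hasProd_single (f := fun p : Nat.Primes => if (p : ℕ) = 2 then (1 / 2 : ℝ) else 1)
      ⟨2, Nat.prime_two⟩ (fun p hp => if_neg fun h => hp (Subtype.ext h))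
    simpa using this
  have h4 := h2.unique (?_ : HasProd _ (1 / 2 : ℝ))
  · simp at h4
    linarith
  · refine Eq.mp (congrArg (fun f => HasProd f (1 / 2 : ℝ)) (funext fun p => ?_)) h3
    rcases p with ⟨p, hp⟩
    by_cases h : p = 2
    · subst h; simp [sieveLocal]; norm_num
    · have h5 := prime_sub_two hp h
      have h6 : 2 < p := lt_of_le_of_ne hp.two_le (Ne.symm h)
      have h7 : (2 : ℝ) < p := by exact_mod_cast h6
      have h8 : (p : ℝ) - 2 ≠ 0 := by linarith
      have h9 : (p : ℝ) - 1 ≠ 0 := by linarith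
      have h10 : (p : ℝ) ≠ 0 := by linarith
      simp [h, h6, sieveLocal_odd h]
      field_simp
      ring

lemma tsum_sieveCoeff_log :
    ∑' n : ℕ, sieveCoeff n * log n = -log 2 * ∑' n, sieveCoeff n := by
  have h3 := hasProd_single (f := fun p : Nat.Primes => if (p : ℕ) = 2 then
      (1 + TrivSqZeroExt.inr (log 2) : TrivSqZeroExt ℝ ℝ) else 1)
      ⟨2, Nat.prime_two⟩ (fun p hp => if_neg fun h => hp (Subtype.ext h))
  have h4 := hasProd_sieveDual.mul h3
  have h5 : IsClosed {z : TrivSqZeroExt ℝ ℝ | TrivSqZeroExt.snd z = 0} :=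
    isClosed_eq TrivSqZeroExt.continuous_snd continuous_const
  have h6 := h5.mem_of_tendsto h4 (Eventually.of_forall fun s => ?_)
  · change TrivSqZeroExt.snd _ = 0 at h6
    simp at h6
    linarith
  · change TrivSqZeroExt.snd _ = 0
    refine prod_induction _ (fun z : TrivSqZeroExt ℝ ℝ => TrivSqZeroExt.snd z = 0)
      (fun a b ha hb => by simp [ha, hb]) (by simp) fun p _ => ?_
    rcases p with ⟨p, hp⟩
    by_cases h : p = 2
    · subst h; simp [sieveLocal]; ring
    · simp [h, sieveLocal_odd h]; left; field_simp; norm_num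

lemma summable_fiber_mul {F : ℕ × ℕ → ℝ} (hF : Summable F) (h0 : ∀ x : ℕ × ℕ, x.1 * x.2 = 0 → F x = 0) :
    HasSum (fun j : ℕ => ∑ x ∈ j.divisorsAntidiagonal, F x) (∑' x, F x) := by
  have h := hF.hasSum.tsum_fiberwise (fun x : ℕ × ℕ => x.1 * x.2)
  have e : (fun j : ℕ => ∑ x ∈ j.divisorsAntidiagonal, F x) =
      fun j : ℕ => ∑' x : (fun x : ℕ × ℕ => x.1 * x.2) ⁻¹' {j}, F x := by
    funext j
    rcases Nat.eq_zero_or_pos j with rfl | hj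
    · rw [Nat.divisorsAntidiagonal_zero, sum_empty]
      symm
      rw [← tsum_zero (α := ℝ) (β := (fun x : ℕ × ℕ => x.1 * x.2) ⁻¹' {0})]
      exact tsum_congr fun x => h0 _ x.2
    · rw [show (fun x : ℕ × ℕ => x.1 * x.2) ⁻¹' {j} = ↑(j.divisorsAntidiagonal) by
        ext x; simp [hj.ne']]
      exact (Finset.tsum_subtype' _ _).symm
  rw [e]
  exact h

lemma summable_convolution {u v : ArithmeticFunction ℝ} {κ : ℝ}
    (hu : Summable fun n : ℕ => |u n| * (n : ℝ) ^ (-κ))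
    (hv : Summable fun n : ℕ => |v n| * (n : ℝ) ^ (-κ)) :
    Summable fun n : ℕ => |(u * v) n| * (n : ℝ) ^ (-κ) := by
  have h := hu.mul_of_nonneg hv (fun n => by positivity) (fun n => by positivity)
  have h1 := (summable_fiber_mul h fun x hx => by
    rcases Nat.mul_eq_zero.1 hx with h | h <;> simp [h]).summable
  refine Summable.of_nonneg_of_le (fun n => by positivity) (fun n => ?_) h1
  rw [ArithmeticFunction.mul_apply]
  refine (mul_le_mul_of_nonneg_right (abs_sum_le_sum_abs _ _) (by positivity)).trans ?_
  rw [sum_mul]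
  refine sum_le_sum fun x hx => ?_
  rw [← (Nat.mem_divisorsAntidiagonal.1 hx).1, Nat.cast_mul,
    mul_rpow (Nat.cast_nonneg _) (Nat.cast_nonneg _), abs_mul]
  exact le_of_eq (by ring)

lemma hasSum_convolution {u v : ArithmeticFunction ℝ} {κ K : ℝ} {w : ℕ → ℝ}
    (hu : Summable fun n : ℕ => |u n| * (n : ℝ) ^ (-κ))
    (hv : Summable fun n : ℕ => |v n| * (n : ℝ) ^ (-κ))
    (hw : ∀ n : ℕ, 1 ≤ n → |w n| ≤ K * (n : ℝ) ^ (-κ)) :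
    HasSum (fun n : ℕ => (u * v) n * w n) (∑' a, u a * ∑' b, v b * w (a * b)) := by
  have hle : ∀ x : ℕ × ℕ, |u x.1 * v x.2 * w (x.1 * x.2)| ≤
      K * ((|u x.1| * (x.1 : ℝ) ^ (-κ)) * (|v x.2| * (x.2 : ℝ) ^ (-κ))) := fun x => by
    by_cases hx : x.1 * x.2 = 0
    · rcases Nat.mul_eq_zero.1 hx with h | h <;> simp [h]
    · have := hw _ (Nat.one_le_iff_ne_zero.2 hx)
      rw [Nat.cast_mul, mul_rpow (Nat.cast_nonneg _) (Nat.cast_nonneg _)] at this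
      rw [abs_mul, abs_mul]
      refine (mul_le_mul_of_nonneg_left this (by positivity)).trans (le_of_eq (by ring))
  have hF : Summable fun x : ℕ × ℕ => u x.1 * v x.2 * w (x.1 * x.2) :=
    Summable.of_norm_bounded ((hu.mul_of_nonneg hv (fun n => by positivity)
      (fun n => by positivity)).mul_left K) hle
  have h1 := summable_fiber_mul hF fun x hx => by
    rcases Nat.mul_eq_zero.1 hx with h | h <;> simp [h]
  have e1 : ∑' x : ℕ × ℕ, u x.1 * v x.2 * w (x.1 * x.2) =
      ∑' a, u a * ∑' b, v b * w (a * b) := by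
    rw [hF.tsum_prod]
    refine tsum_congr fun a => ?_
    rw [← tsum_mul_left]
    exact tsum_congr fun b => mul_assoc _ _ _
  rw [e1] at h1
  have e2 : (fun n : ℕ => (u * v) n * w n) =
      fun n : ℕ => ∑ x ∈ n.divisorsAntidiagonal, u x.1 * v x.2 * w (x.1 * x.2) := by
    funext n
    rw [ArithmeticFunction.mul_apply, sum_mul]
    exact sum_congr rfl fun x hx => by rw [(Nat.mem_divisorsAntidiagonal.1 hx).1]
  rw [e2]
  exact h1

/-- The arithmetic function `n ↦ 1 / n`. -/
noncomputable def invArith : ArithmeticFunction ℝ := ⟨fun n => (n : ℝ)⁻¹, by simp⟩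

/-- `sieveCoeff` as an arithmetic function. -/
noncomputable def sieveArith : ArithmeticFunction ℝ := ⟨sieveCoeff, sieveCoeff_zero⟩

/-- The non-constant part of the singular series. -/
noncomputable def singularRatio : ArithmeticFunction ℝ :=
  ⟨fun n => if n = 0 then 0 else
    ∏ p ∈ n.primeFactors, if 2 < p then ((p : ℝ) - 1) / ((p : ℝ) - 2) else 1, by simp⟩

/-- The constant function `1` on positive integers. -/
noncomputable def oneArith : ArithmeticFunction ℝ := (ArithmeticFunction.zeta : ArithmeticFunction ℝ)

lemma isMultiplicative_invArith : invArith.IsMultiplicative :=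
  ⟨by simp [invArith], fun {m n} _ => by simp [invArith, mul_comm]⟩

lemma isMultiplicative_sieveArith : sieveArith.IsMultiplicative :=
  ⟨sieveCoeff_one, fun {_ _} h => sieveCoeff_mul h⟩

lemma isMultiplicative_singularRatio : singularRatio.IsMultiplicative := by
  refine ⟨by simp [singularRatio], fun {m n} h => ?_⟩
  rcases Nat.eq_zero_or_pos m with rfl | hm
  · simp
  rcases Nat.eq_zero_or_pos n with rfl | hn
  · simp
  simp only [singularRatio, ArithmeticFunction.coe_mk]
  rw [if_neg (by positivity), if_neg hm.ne', if_neg hn.ne',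
    h.primeFactors_mul, prod_union h.disjoint_primeFactors]

lemma sieve_mul_inv_prime_pow {p : ℕ} (hp : p.Prime) (k : ℕ) : (invArith * sieveArith) (p ^ k) =
    if k = 0 then 1 else if k = 1 then (p : ℝ)⁻¹ + sieveLocal p 1 else 0 := by
  have hp0 : (p : ℝ) ≠ 0 := by exact_mod_cast hp.ne_zero
  have h1 : (invArith * sieveArith) (p ^ k) =
      ((p : ℝ) ^ k)⁻¹ * ∑ i ∈ range (k + 1), (p : ℝ) ^ i * sieveLocal p i := by
    rw [ArithmeticFunction.mul_apply,
      Nat.sum_divisorsAntidiagonal' (f := fun a b => invArith a * sieveArith b),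
      Nat.sum_divisors_prime_pow hp, mul_sum]
    refine sum_congr rfl fun i hi => ?_
    have hi' : i ≤ k := Nat.lt_succ_iff.1 (mem_range.1 hi)
    change (((p ^ k / p ^ i : ℕ) : ℝ))⁻¹ * sieveCoeff (p ^ i) = _
    rw [sieveCoeff_prime_pow hp, Nat.pow_div hi' hp.pos, Nat.cast_pow, pow_sub₀ _ hp0 hi']
    field_simp
  rw [h1]
  match k with
  | 0 => simp [sieveLocal_zero]
  | 1 => simp [sum_range_succ, sieveLocal_zero]; field_simp
  | k + 2 =>
    have h2 : ∑ i ∈ range (k + 2 + 1), (p : ℝ) ^ i * sieveLocal p i =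
        ∑ i ∈ range 3, (p : ℝ) ^ i * sieveLocal p i := by
      symm
      refine sum_subset (range_subset_range.2 (by omega)) fun i _ hi => ?_
      rw [sieveLocal_of_three_le p (by simpa using hi), mul_zero]
    rw [h2]
    by_cases h : p = 2
    · subst h; simp [sum_range_succ, sieveLocal]
    · have h5 := prime_sub_two hp h
      have h6 : 2 < p := lt_of_le_of_ne hp.two_le (Ne.symm h)
      have h7 : (2 : ℝ) < p := by exact_mod_cast h6
      have h8 : (p : ℝ) - 2 ≠ 0 := by linarith
      simp [sum_range_succ, sieveLocal_odd h, sieveLocal_zero]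
      right
      field_simp
      ring

lemma singularRatio_eq : singularRatio = sieveArith * (invArith * oneArith) := by
  have hz : oneArith.IsMultiplicative := ArithmeticFunction.isMultiplicative_zeta.natCast
  rw [show sieveArith * (invArith * oneArith) = oneArith * (invArith * sieveArith) by ring]
  rw [ArithmeticFunction.IsMultiplicative.eq_iff_eq_on_prime_powers _
    isMultiplicative_singularRatio _
    (hz.mul (isMultiplicative_invArith.mul isMultiplicative_sieveArith))]
  intro p k hp
  rw [oneArith, ArithmeticFunction.coe_zeta_mul_apply, Nat.sum_divisors_prime_pow hp]
  simp_rw [sieve_mul_inv_prime_pow hp]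
  rcases Nat.eq_zero_or_pos k with rfl | hk
  · simp [singularRatio]
  obtain ⟨k, rfl⟩ : ∃ j, k = j + 1 := ⟨k - 1, by omega⟩
  rw [sum_range_succ', sum_range_succ']
  simp only [singularRatio, ArithmeticFunction.coe_mk]
  rw [if_neg (pow_ne_zero _ hp.ne_zero), Nat.primeFactors_prime_pow hk.ne' hp]
  by_cases h : p = 2
  · subst h; simp [sieveLocal]
  · have h6 : 2 < p := lt_of_le_of_ne hp.two_le (Ne.symm h)
    have h7 : (2 : ℝ) < p := by exact_mod_cast h6
    have h8 : (p : ℝ) - 2 ≠ 0 := by linarith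
    simp [h6, sieveLocal_odd h]
    field_simp
    ring

lemma singularSeries_two_mul {j : ℕ} (hj : 1 ≤ j) :
    singularSeries (2 * j) = 2 * twinProduct * singularRatio j := by
  have hj0 : j ≠ 0 := by omega
  have h : (2 * j).primeFactors.filter (fun p => 2 < p) = j.primeFactors.filter (fun p => 2 < p) := by
    rw [Nat.primeFactors_mul two_ne_zero hj0, Nat.prime_two.primeFactors]
    ext p
    simp
    omega
  simp only [singularSeries, even_two, Even.mul_right, if_true, h, singularRatio,
    ArithmeticFunction.coe_mk, hj0, if_false, prod_filter, twinProduct]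

lemma summable_arith_one {κ : ℝ} (hκ : 1 < κ) :
    Summable fun n : ℕ => |oneArith n| * (n : ℝ) ^ (-κ) := by
  refine Summable.of_nonneg_of_le (fun n => by positivity) (fun n => ?_)
    (summable_nat_rpow.2 (by linarith : -κ < -1))
  rcases Nat.eq_zero_or_pos n with rfl | hn
  · simp; positivity
  · simp [oneArith, ArithmeticFunction.natCoe_apply, hn.ne']

lemma summable_arith_inv {κ : ℝ} (hκ : 1 < κ) :
    Summable fun n : ℕ => |invArith n| * (n : ℝ) ^ (-κ) := by
  refine Summable.of_nonneg_of_le (fun n => by positivity) (fun n => ?_)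
    (summable_nat_rpow.2 (by linarith : -κ < -1))
  refine mul_le_of_le_one_left (by positivity) ?_
  simp only [invArith, ArithmeticFunction.coe_mk]
  rw [abs_of_nonneg (by positivity)]
  exact Nat.cast_inv_le_one n

lemma summable_arith_sieve {κ : ℝ} (hκ : 1 < κ) :
    Summable fun n : ℕ => |sieveArith n| * (n : ℝ) ^ (-κ) := by
  refine Summable.of_nonneg_of_le (fun n => by positivity) (fun n => ?_) summable_abs_sieveCoeff
  rcases Nat.eq_zero_or_pos n with rfl | hn
  · simp
  · exact mul_le_of_le_one_right (abs_nonneg _)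
      (rpow_le_one_of_one_le_of_nonpos (by exact_mod_cast hn) (by linarith))

lemma summable_singularSeries {κ : ℝ} (hκ : 1 < κ) :
    Summable fun h : ℕ => |singularSeries (h + 1)| * ((h : ℝ) + 1) ^ (-κ) := by
  have h1 : Summable fun n : ℕ => |singularRatio n| * (n : ℝ) ^ (-κ) := by
    rw [singularRatio_eq]
    exact summable_convolution (summable_arith_sieve hκ)
      (summable_convolution (summable_arith_inv hκ) (summable_arith_one hκ))
  have hinj : Function.Injective fun j : ℕ => 2 * j + 1 := fun a b h => by simpa using h
  have h3 := (hinj.summable_iff (f := fun h : ℕ => |singularSeries (h + 1)| * ((h : ℝ) + 1) ^ (-κ))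
    fun h hh => by
      have : ¬ Even (h + 1) := fun ⟨r, hr⟩ => hh ⟨r - 1, by simp only; omega⟩
      simp [singularSeries, this]).1
  apply h3
  refine Summable.of_nonneg_of_le (fun n => by simp only [Function.comp]; positivity) (fun n => ?_)
    ((((summable_nat_add_iff 1).2 h1)).mul_left |2 * twinProduct|)
  simp only [Function.comp]
  rw [show 2 * n + 1 + 1 = 2 * (n + 1) by ring, singularSeries_two_mul (by omega), abs_mul, mul_assoc]
  refine mul_le_mul_of_nonneg_left (mul_le_mul_of_nonneg_left ?_ (abs_nonneg _)) (abs_nonneg _)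
  refine rpow_le_rpow_of_nonpos (by positivity) ?_ (by linarith)
  push_cast
  linarith [Nat.cast_nonneg (α := ℝ) n]

/-- Expansion of a sum weighted by the singular series. -/
lemma hasSum_singularSeries {κ K : ℝ} (hκ : 1 < κ) {w : ℕ → ℝ}
    (hw : ∀ n : ℕ, 1 ≤ n → |w n| ≤ K * (n : ℝ) ^ (-κ)) :
    HasSum (fun h : ℕ => singularSeries (h + 1) * w (h + 1)) (2 * twinProduct *
      ∑' b, sieveCoeff b * ∑' a : ℕ, (a : ℝ)⁻¹ * ∑' m : ℕ, w (2 * (b * (a * (m + 1))))) := by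
  have hK : 0 ≤ K := by
    have := hw 1 le_rfl
    simp at this
    exact (abs_nonneg _).trans this
  have hwmul : ∀ c : ℕ, 1 ≤ c → ∀ n : ℕ, 1 ≤ n → |w (c * n)| ≤ K * (n : ℝ) ^ (-κ) := fun c hc n hn => by
    refine (hw _ (Nat.mul_pos hc hn)).trans (mul_le_mul_of_nonneg_left ?_ hK)
    refine rpow_le_rpow_of_nonpos (by exact_mod_cast hn) ?_ (by linarith)
    exact_mod_cast Nat.le_mul_of_pos_left n hc
  have hone : ∀ f : ℕ → ℝ, ∑' m, oneArith m * f m = ∑' m, f (m + 1) := fun f => by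
    have hinj : Function.Injective fun m : ℕ => m + 1 := fun a b h => by simpa using h
    rw [← hinj.tsum_eq (f := fun m => oneArith m * f m) fun m hm => by
      rcases Nat.eq_zero_or_pos m with rfl | h
      · simp at hm
      · exact ⟨m - 1, by simp only; omega⟩]
    refine tsum_congr fun m => ?_
    simp [oneArith, ArithmeticFunction.natCoe_apply]
  have h1 := hasSum_convolution (summable_arith_sieve hκ)
    (summable_convolution (summable_arith_inv hκ) (summable_arith_one hκ)) (hwmul 2 (by norm_num))
  rw [← singularRatio_eq] at h1
  have e1 : ∑' b, sieveArith b * ∑' a, (invArith * oneArith) a * w (2 * (b * a)) =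
      ∑' b, sieveCoeff b * ∑' a : ℕ, (a : ℝ)⁻¹ * ∑' m : ℕ, w (2 * (b * (a * (m + 1)))) := by
    refine tsum_congr fun b => ?_
    change sieveCoeff b * _ = _
    rcases Nat.eq_zero_or_pos b with rfl | hb
    · simp [sieveCoeff_zero]
    congr 1
    have h2 := (hasSum_convolution (summable_arith_inv hκ) (summable_arith_one hκ)
      (hwmul (2 * b) (by omega))).tsum_eq
    simp_rw [mul_assoc 2 b] at h2
    rw [h2]
    refine tsum_congr fun a => ?_
    change (a : ℝ)⁻¹ * _ = _
    congr 1
    exact hone fun m => w (2 * (b * (a * m)))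
  rw [e1] at h1
  have hinj : Function.Injective fun m : ℕ => m + 1 := fun a b h => by simpa using h
  have hinj2 : Function.Injective fun j : ℕ => 2 * j + 1 := fun a b h => by simpa using h
  have h3 := (hinj.hasSum_iff (f := fun n => singularRatio n * w (2 * n)) fun m hm => by
      rcases Nat.eq_zero_or_pos m with rfl | h
      · simp
      · exact absurd ⟨m - 1, by simp only; omega⟩ hm).2 h1
  refine (hinj2.hasSum_iff (f := fun h : ℕ => singularSeries (h + 1) * w (h + 1)) fun h hh => by
      have : ¬ Even (h + 1) := fun ⟨r, hr⟩ => hh ⟨r - 1, by simp only; omega⟩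
      simp [singularSeries, this]).1 ?_
  have h4 := h3.mul_left (2 * twinProduct)
  have e2 : ((fun h : ℕ => singularSeries (h + 1) * w (h + 1)) ∘ fun j : ℕ => 2 * j + 1) =
      fun n => 2 * twinProduct * ((fun n => singularRatio n * w (2 * n)) ∘ fun m : ℕ => m + 1) n := by
    funext n
    simp only [Function.comp]
    rw [show 2 * n + 1 + 1 = 2 * (n + 1) by ring, singularSeries_two_mul (by omega), mul_assoc]
  rw [e2]
  exact h4

/-- The derivative of the standard smooth transition function. -/
noncomputable def stepDeriv : ℝ → ℝ := deriv smoothTransition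

/-- A smooth weight equal to `1` on `[2U, T - 2U]` and supported in `[U, T - U]`. -/
noncomputable def bump (U T t : ℝ) : ℝ :=
  smoothTransition ((t - U) / U) - smoothTransition ((t - T + 2 * U) / U)

/-- The derivative of `bump`. -/
noncomputable def bumpDeriv (U T t : ℝ) : ℝ :=
  (stepDeriv ((t - U) / U) - stepDeriv ((t - T + 2 * U) / U)) / U

/-- The cosine transform of `bump`. -/
noncomputable def bumpCos (U T ξ : ℝ) : ℝ := ∫ t, bump U T t * cos (t * ξ)

lemma continuous_stepDeriv : Continuous stepDeriv :=
  (smoothTransition.contDiff (n := 1)).continuous_deriv le_rfl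

lemma hasDerivAt_smoothTransition (s : ℝ) : HasDerivAt smoothTransition (stepDeriv s) s :=
  ((smoothTransition.contDiff (n := 1)).differentiable (by simp) s).hasDerivAt

lemma stepDeriv_nonneg (s : ℝ) : 0 ≤ stepDeriv s := smoothTransition.monotone.deriv_nonneg

lemma stepDeriv_of_nonpos {s : ℝ} (hs : s ≤ 0) : stepDeriv s = 0 := by
  refine IsLocalMin.deriv_eq_zero (Eventually.of_forall fun y => ?_)
  rw [smoothTransition.zero_of_nonpos hs]
  exact smoothTransition.nonneg y

lemma stepDeriv_of_one_le {s : ℝ} (hs : 1 ≤ s) : stepDeriv s = 0 := by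
  refine IsLocalMax.deriv_eq_zero (Eventually.of_forall fun y => ?_)
  rw [smoothTransition.one_of_one_le hs]
  exact smoothTransition.le_one y

lemma hasCompactSupport_stepDeriv : HasCompactSupport stepDeriv := by
  refine HasCompactSupport.of_support_subset_isCompact (isCompact_Icc (a := (0 : ℝ)) (b := 1))
    fun s hs => ⟨?_, ?_⟩
  · by_contra h
    exact hs (stepDeriv_of_nonpos (not_le.1 h).le)
  · by_contra h
    exact hs (stepDeriv_of_one_le (not_le.1 h).le)

lemma integrable_stepDeriv : Integrable stepDeriv :=
  continuous_stepDeriv.integrable_of_hasCompactSupport hasCompactSupport_stepDeriv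

lemma integral_stepDeriv : ∫ s, stepDeriv s = 1 := by
  have h : ∫ s in (0 : ℝ)..1, stepDeriv s = ∫ s, stepDeriv s := by
    refine intervalIntegral.integral_eq_integral_of_support_subset fun s hs => ⟨?_, ?_⟩
    · by_contra h
      exact hs (stepDeriv_of_nonpos (not_lt.1 h))
    · by_contra h
      exact hs (stepDeriv_of_one_le (not_le.1 h).le)
  rw [← h, intervalIntegral.integral_eq_sub_of_hasDerivAt (fun s _ => hasDerivAt_smoothTransition s)
    (continuous_stepDeriv.intervalIntegrable _ _)]
  simp

section bump
variable {U T : ℝ}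

lemma continuous_bump : Continuous (bump U T) := by
  unfold bump
  exact (smoothTransition.continuous.comp (by fun_prop)).sub
    (smoothTransition.continuous.comp (by fun_prop))

lemma bump_of_le (hU : 0 < U) (hT : 4 * U ≤ T) {t : ℝ} (ht : t ≤ U) : bump U T t = 0 := by
  rw [bump, smoothTransition.zero_of_nonpos, smoothTransition.zero_of_nonpos, sub_zero]
  · exact div_nonpos_of_nonpos_of_nonneg (by linarith) hU.le
  · exact div_nonpos_of_nonpos_of_nonneg (by linarith) hU.le

lemma bump_of_ge (hU : 0 < U) (hT : 4 * U ≤ T) {t : ℝ} (ht : T - U ≤ t) : bump U T t = 0 := by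
  rw [bump, smoothTransition.one_of_one_le, smoothTransition.one_of_one_le, sub_self]
  · rw [le_div_iff₀ hU]; linarith
  · rw [le_div_iff₀ hU]; linarith

lemma bump_eq_one (hU : 0 < U) {t : ℝ} (h1 : 2 * U ≤ t) (h2 : t ≤ T - 2 * U) :
    bump U T t = 1 := by
  rw [bump, smoothTransition.one_of_one_le, smoothTransition.zero_of_nonpos, sub_zero]
  · exact div_nonpos_of_nonpos_of_nonneg (by linarith) hU.le
  · rw [le_div_iff₀ hU]; linarith

lemma bump_nonneg (hU : 0 < U) (hT : 4 * U ≤ T) (t : ℝ) : 0 ≤ bump U T t := by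
  rw [bump, sub_nonneg]
  exact smoothTransition.monotone ((div_le_div_iff_of_pos_right hU).2 (by linarith))

lemma bump_le_one (t : ℝ) : bump U T t ≤ 1 := by
  rw [bump]
  linarith [smoothTransition.le_one ((t - U) / U),
    smoothTransition.nonneg ((t - T + 2 * U) / U)]

lemma hasDerivAt_bump (t : ℝ) : HasDerivAt (bump U T) (bumpDeriv U T t) t := by
  have h1 : HasDerivAt (fun t : ℝ => (t - U) / U) (1 / U) t :=
    ((hasDerivAt_id t).sub_const U).div_const U
  have h2 : HasDerivAt (fun t : ℝ => (t - T + 2 * U) / U) (1 / U) t :=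
    (((hasDerivAt_id t).sub_const T).add_const (2 * U)).div_const U
  have h := ((hasDerivAt_smoothTransition _).comp t h1).sub
    ((hasDerivAt_smoothTransition _).comp t h2)
  refine h.congr_deriv ?_
  rw [bumpDeriv]; ring

lemma continuous_bumpDeriv : Continuous (bumpDeriv U T) := by
  unfold bumpDeriv
  exact ((continuous_stepDeriv.comp (by fun_prop)).sub
    (continuous_stepDeriv.comp (by fun_prop))).div_const _

lemma bumpDeriv_of_le (hU : 0 < U) (hT : 4 * U ≤ T) {t : ℝ} (ht : t ≤ U) :
    bumpDeriv U T t = 0 := by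
  rw [bumpDeriv, stepDeriv_of_nonpos, stepDeriv_of_nonpos]
  · simp
  · exact div_nonpos_of_nonpos_of_nonneg (by linarith) hU.le
  · exact div_nonpos_of_nonpos_of_nonneg (by linarith) hU.le

lemma bumpDeriv_of_ge (hU : 0 < U) (hT : 4 * U ≤ T) {t : ℝ} (ht : T - U ≤ t) :
    bumpDeriv U T t = 0 := by
  rw [bumpDeriv, stepDeriv_of_one_le, stepDeriv_of_one_le]
  · simp
  · rw [le_div_iff₀ hU]; linarith
  · rw [le_div_iff₀ hU]; linarith

lemma integral_eq_of_bump (U T : ℝ) {f : ℝ → ℝ} (hl : ∀ t ≤ U, f t = 0)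
    (hr : ∀ t, T - U ≤ t → f t = 0) : ∫ t, f t = ∫ t in U..T - U, f t := by
  refine (intervalIntegral.integral_eq_integral_of_support_subset fun t ht => ⟨?_, ?_⟩).symm
  · by_contra h
    exact ht (hl t (not_lt.1 h))
  · by_contra h
    exact ht (hr t (not_le.1 h).le)

lemma hasCompactSupport_bump (hU : 0 < U) (hT : 4 * U ≤ T) : HasCompactSupport (bump U T) := by
  refine HasCompactSupport.of_support_subset_isCompact (isCompact_Icc (a := U) (b := T - U))
    fun s hs => ⟨?_, ?_⟩
  · by_contra h
    exact hs (bump_of_le hU hT (not_le.1 h).le)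
  · by_contra h
    exact hs (bump_of_ge hU hT (not_le.1 h).le)

lemma hasCompactSupport_bumpDeriv (hU : 0 < U) (hT : 4 * U ≤ T) :
    HasCompactSupport (bumpDeriv U T) := by
  refine HasCompactSupport.of_support_subset_isCompact (isCompact_Icc (a := U) (b := T - U))
    fun s hs => ⟨?_, ?_⟩
  · by_contra h
    exact hs (bumpDeriv_of_le hU hT (not_le.1 h).le)
  · by_contra h
    exact hs (bumpDeriv_of_ge hU hT (not_le.1 h).le)

lemma integrable_bump_mul (hU : 0 < U) (hT : 4 * U ≤ T) {g : ℝ → ℝ} (hg : Continuous g) :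
    Integrable fun t => bump U T t * g t :=
  (continuous_bump.mul hg).integrable_of_hasCompactSupport (hasCompactSupport_bump hU hT).mul_right

lemma integrable_bumpDeriv_mul (hU : 0 < U) (hT : 4 * U ≤ T) {g : ℝ → ℝ} (hg : Continuous g) :
    Integrable fun t => bumpDeriv U T t * g t :=
  (continuous_bumpDeriv.mul hg).integrable_of_hasCompactSupport
    (hasCompactSupport_bumpDeriv hU hT).mul_right

lemma integral_bumpDeriv_mul (hU : 0 < U) {g : ℝ → ℝ} (hg : Continuous g) :
    ∫ t, bumpDeriv U T t * g t =
      ∫ s, stepDeriv s * (g (U + U * s) - g (T - 2 * U + U * s)) := by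
  have hcomp : ∀ a : ℝ, Integrable fun s => stepDeriv s * g (a + U * s) := fun a =>
    (continuous_stepDeriv.mul (hg.comp (by fun_prop))).integrable_of_hasCompactSupport
      hasCompactSupport_stepDeriv.mul_right
  have key : ∀ a : ℝ, (∫ t, stepDeriv ((t - a) / U) / U * g t) = ∫ s, stepDeriv s * g (a + U * s) ∧
      Integrable fun t => stepDeriv ((t - a) / U) / U * g t := fun a => by
    have e : (fun t => stepDeriv ((t - a) / U) / U * g t) =
        fun t => U⁻¹ * (fun s => stepDeriv s * g (a + U * s)) ((t - a) / U) := by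
      funext t
      simp only
      rw [show a + U * ((t - a) / U) = t by field_simp; ring]
      ring
    rw [e]
    constructor
    · rw [integral_const_mul, integral_sub_right_eq_self
        (fun t => (fun s => stepDeriv s * g (a + U * s)) (t / U)) a,
        Measure.integral_comp_div (fun s => stepDeriv s * g (a + U * s)) U, smul_eq_mul,
        abs_of_pos hU]
      field_simp
    · exact (((hcomp a).comp_div hU.ne').comp_sub_right a).const_mul _
  have e : (fun t => bumpDeriv U T t * g t) = fun t => stepDeriv ((t - U) / U) / U * g t -
      stepDeriv ((t - (T - 2 * U)) / U) / U * g t := by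
    funext t
    rw [bumpDeriv, show t - T + 2 * U = t - (T - 2 * U) by ring]
    ring
  rw [e, integral_sub (key U).2 (key (T - 2 * U)).2, (key U).1, (key (T - 2 * U)).1,
    ← integral_sub (hcomp _) (hcomp _)]
  exact integral_congr_ae (Eventually.of_forall fun s => by ring)

lemma integral_abs_bumpDeriv_le (hU : 0 < U) : ∫ t, |bumpDeriv U T t| ≤ 2 := by
  have key : ∀ a : ℝ, (∫ t, stepDeriv ((t - a) / U) / U) = 1 ∧
      Integrable fun t => stepDeriv ((t - a) / U) / U := fun a => by
    constructor
    · rw [integral_div, integral_sub_right_eq_self (fun t => stepDeriv (t / U)) a,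
        Measure.integral_comp_div stepDeriv U, smul_eq_mul, abs_of_pos hU, integral_stepDeriv]
      field_simp
    · exact ((integrable_stepDeriv.comp_div hU.ne').comp_sub_right a).div_const _
  have h : ∫ t, |bumpDeriv U T t| ≤ ∫ t, (stepDeriv ((t - U) / U) / U +
      stepDeriv ((t - (T - 2 * U)) / U) / U) := by
    refine integral_mono_of_nonneg (Eventually.of_forall fun t => abs_nonneg _)
      ((key U).2.add (key (T - 2 * U)).2) (Eventually.of_forall fun t => ?_)
    change |bumpDeriv U T t| ≤ _
    rw [bumpDeriv, show t - T + 2 * U = t - (T - 2 * U) by ring, abs_div, abs_of_pos hU]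
    change _ ≤ _ / U + _ / U
    rw [← add_div]
    refine (div_le_div_iff_of_pos_right hU).2 ((abs_sub _ _).trans ?_)
    rw [abs_of_nonneg (stepDeriv_nonneg _), abs_of_nonneg (stepDeriv_nonneg _)]
  rw [integral_add (key U).2 (key (T - 2 * U)).2, (key U).1, (key (T - 2 * U)).1] at h
  linarith

lemma abs_integral_bumpDeriv_mul_le (hU : 0 < U) (hT : 4 * U ≤ T) {g : ℝ → ℝ} {B : ℝ}
    (hg : ∀ t, U < t → t < T - U → |g t| ≤ B) : |∫ t, bumpDeriv U T t * g t| ≤ 2 * B := by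
  have hB : 0 ≤ B := (abs_nonneg _).trans (hg (T / 2) (by linarith) (by linarith))
  have h1 : ‖∫ t, bumpDeriv U T t * g t‖ ≤ ∫ t, |bumpDeriv U T t| * B := by
    have hi : Integrable fun t => |bumpDeriv U T t| * B :=
      ((continuous_bumpDeriv.integrable_of_hasCompactSupport
        (hasCompactSupport_bumpDeriv hU hT)).abs).mul_const B
    refine norm_integral_le_of_norm_le hi (Eventually.of_forall fun t => ?_)
    rw [norm_mul, norm_eq_abs, norm_eq_abs]
    rcases le_or_gt t U with h | h
    · simp [bumpDeriv_of_le hU hT h]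
    rcases le_or_gt (T - U) t with h' | h'
    · simp [bumpDeriv_of_ge hU hT h']
    · exact mul_le_mul_of_nonneg_left (hg t h h') (abs_nonneg _)
  rw [integral_mul_const] at h1
  exact h1.trans (mul_le_mul_of_nonneg_right (integral_abs_bumpDeriv_le hU) hB)

lemma abs_integral_bump_mul_le (hU : 0 < U) (hT : 4 * U ≤ T) {g : ℝ → ℝ} {B : ℝ}
    (hg : ∀ t, U ≤ t → t ≤ T - U → |g t| ≤ B) : |∫ t, bump U T t * g t| ≤ B * T := by
  have hB : 0 ≤ B := (abs_nonneg _).trans (hg U le_rfl (by linarith))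
  rw [integral_eq_of_bump U T (fun t ht => by simp [bump_of_le hU hT ht])
    (fun t ht => by simp [bump_of_ge hU hT ht])]
  refine (intervalIntegral.norm_integral_le_of_norm_le_const (E := ℝ) (C := B) fun t ht => ?_).trans ?_
  · rw [Set.uIoc_of_le (by linarith)] at ht
    rw [norm_mul, norm_of_nonneg (bump_nonneg hU hT t)]
    exact (mul_le_of_le_one_left (abs_nonneg _) (bump_le_one t)).trans (hg t ht.1.le ht.2)
  · rw [abs_of_nonneg (by linarith)]
    exact mul_le_mul_of_nonneg_left (by linarith) hB

lemma abs_bumpCos_le (hU : 0 < U) (hT : 4 * U ≤ T) (ξ : ℝ) : |bumpCos U T ξ| ≤ T := by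
  have := abs_integral_bump_mul_le hU hT (g := fun t => cos (t * ξ)) (B := 1)
    fun t _ _ => abs_cos_le_one _
  simpa [bumpCos] using this

lemma abs_bumpCos_sub_le (hU : 0 < U) (hT : 4 * U ≤ T) (ξ ξ' : ℝ) :
    |bumpCos U T ξ - bumpCos U T ξ'| ≤ T ^ 2 * |ξ - ξ'| := by
  have h := abs_integral_bump_mul_le hU hT (g := fun t => cos (t * ξ) - cos (t * ξ'))
    (B := T * |ξ - ξ'|) fun t h1 h2 => by
      have h3 : |cos (t * ξ) - cos (t * ξ')| ≤ |t * ξ - t * ξ'| := by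
        have := abs_cos_sub_cos_le (t * ξ) (t * ξ')
        exact this
      rw [← mul_sub, abs_mul, abs_of_nonneg (by linarith : 0 ≤ t)] at h3
      exact h3.trans (mul_le_mul_of_nonneg_right (by linarith) (abs_nonneg _))
  rw [bumpCos, bumpCos, ← integral_sub (integrable_bump_mul hU hT (by fun_prop))
    (integrable_bump_mul hU hT (by fun_prop))]
  simp_rw [← mul_sub]
  refine h.trans (le_of_eq (by ring))

/-- Integration by parts against the weight. -/
lemma integral_bump_mul_deriv (hU : 0 < U) (hT : 4 * U ≤ T) {g g' : ℝ → ℝ}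
    (hg : ∀ t, U ≤ t → HasDerivAt g (g' t) t) (hg' : ContinuousOn g' (Set.Ici U)) :
    ∫ t, bump U T t * g' t = -∫ t, bumpDeriv U T t * g t := by
  rw [integral_eq_of_bump U T (fun t ht => by simp [bump_of_le hU hT ht])
    (fun t ht => by simp [bump_of_ge hU hT ht]),
    integral_eq_of_bump U T (fun t ht => by simp [bumpDeriv_of_le hU hT ht])
    (fun t ht => by simp [bumpDeriv_of_ge hU hT ht])]
  have hsub : Set.uIcc U (T - U) ⊆ Set.Ici U := by
    rw [Set.uIcc_of_le (by linarith)]; exact Set.Icc_subset_Ici_self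
  rw [intervalIntegral.integral_mul_deriv_eq_deriv_mul (fun t _ => hasDerivAt_bump t)
    (fun t ht => hg t (hsub ht)) (continuous_bumpDeriv.intervalIntegrable _ _)
    (hg'.mono hsub).intervalIntegrable, bump_of_ge hU hT le_rfl, bump_of_le hU hT le_rfl]
  ring

end bump

lemma contDiff_stepDeriv : ContDiff ℝ ((⊤ : ℕ∞) : WithTop ℕ∞) stepDeriv :=
  (contDiff_infty_iff_deriv.1 (smoothTransition.contDiff (n := ⊤))).2

lemma exists_decay_stepDeriv (K : ℕ) : ∃ C > 0, ∀ w > 0,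
    |∫ s, stepDeriv s * cos (s * w)| ≤ C / w ^ K ∧
    |∫ s, stepDeriv s * sin (s * w)| ≤ C / w ^ K := by
  have hc : HasCompactSupport fun s => (stepDeriv s : ℂ) :=
    hasCompactSupport_stepDeriv.comp_left (g := fun y : ℝ => (y : ℂ)) Complex.ofReal_zero
  have hd : ContDiff ℝ ((⊤ : ℕ∞) : WithTop ℕ∞) fun s => (stepDeriv s : ℂ) :=
    Complex.ofRealCLM.contDiff.comp contDiff_stepDeriv
  set f : SchwartzMap ℝ ℂ := hc.toSchwartzMap hd with hf
  obtain ⟨C, hC, h⟩ := (FourierTransform.fourier f).decay K 0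
  refine ⟨C * (2 * π) ^ K, by positivity, fun w hw => ?_⟩
  have h1 := h (-(w / (2 * π)))
  rw [norm_iteratedFDeriv_zero, norm_neg, norm_of_nonneg (by positivity),
    SchwartzMap.fourier_coe, fourier_real_eq_integral_exp_smul] at h1
  have e : ∀ v : ℝ, Complex.exp (↑(-2 * π * v * -(w / (2 * π))) * I) • f v =
      ((stepDeriv v * cos (v * w) : ℝ) : ℂ) +
        ((stepDeriv v * sin (v * w) : ℝ) : ℂ) * I := fun v => by
    rw [show -2 * π * v * -(w / (2 * π)) = v * w by field_simp, Complex.exp_mul_I,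
      show f v = (stepDeriv v : ℂ) from rfl]
    push_cast
    rw [smul_eq_mul]; ring
  simp_rw [e] at h1
  have i1 : Integrable fun s => stepDeriv s * cos (s * w) :=
    (continuous_stepDeriv.mul (by fun_prop)).integrable_of_hasCompactSupport
      hasCompactSupport_stepDeriv.mul_right
  have i2 : Integrable fun s => stepDeriv s * sin (s * w) :=
    (continuous_stepDeriv.mul (by fun_prop)).integrable_of_hasCompactSupport
      hasCompactSupport_stepDeriv.mul_right
  rw [integral_add i1.ofReal (i2.ofReal.mul_const _), integral_mul_const,
    integral_complex_ofReal, integral_complex_ofReal] at h1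
  set A := ∫ s, stepDeriv s * cos (s * w)
  set B := ∫ s, stepDeriv s * sin (s * w)
  have h2 : ‖(A : ℂ) + B * I‖ ≤ C * (2 * π) ^ K / w ^ K := by
    rw [le_div_iff₀ (by positivity)]
    rw [div_pow] at h1
    have := mul_le_mul_of_nonneg_right h1 (show 0 ≤ (2 * π) ^ K by positivity)
    refine le_trans (le_of_eq ?_) this
    field_simp
  have h3 := Complex.abs_re_le_norm ((A : ℂ) + B * I)
  have h4 := Complex.abs_im_le_norm ((A : ℂ) + B * I)
  simp only [Complex.add_re, Complex.ofReal_re, Complex.mul_re, Complex.I_re, Complex.ofReal_im,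
    Complex.I_im, Complex.add_im, Complex.mul_im] at h3 h4
  simp only [mul_zero, sub_zero, add_zero, mul_one, zero_add] at h3 h4
  exact ⟨h3.trans h2, h4.trans h2⟩

lemma bumpCos_decay (K : ℕ) : ∃ C > 0, ∀ U T ξ : ℝ, 0 < U → 4 * U ≤ T → 0 < ξ →
    |bumpCos U T ξ| ≤ C / (ξ * (U * ξ) ^ K) := by
  obtain ⟨C, hC, h⟩ := exists_decay_stepDeriv K
  refine ⟨4 * C, by positivity, fun U T ξ hU hT hξ => ?_⟩
  obtain ⟨hc, hs⟩ := h (U * ξ) (by positivity)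
  have h1 := integral_bump_mul_deriv hU hT (g := fun t => sin (t * ξ) / ξ)
    (g' := fun t => cos (t * ξ)) (fun t _ => by
      have := (((hasDerivAt_id t).mul_const ξ).sin).div_const ξ
      refine this.congr_deriv ?_
      simp; field_simp) (by fun_prop)
  rw [integral_bumpDeriv_mul hU (by fun_prop)] at h1
  have i1 : Integrable fun s => stepDeriv s * cos (s * (U * ξ)) :=
    (continuous_stepDeriv.mul (by fun_prop)).integrable_of_hasCompactSupport
      hasCompactSupport_stepDeriv.mul_right
  have i2 : Integrable fun s => stepDeriv s * sin (s * (U * ξ)) :=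
    (continuous_stepDeriv.mul (by fun_prop)).integrable_of_hasCompactSupport
      hasCompactSupport_stepDeriv.mul_right
  have e : (fun s => stepDeriv s * (sin ((U + U * s) * ξ) / ξ -
      sin ((T - 2 * U + U * s) * ξ) / ξ)) = fun s =>
      (sin (U * ξ) - sin ((T - 2 * U) * ξ)) / ξ * (stepDeriv s * cos (s * (U * ξ))) +
      (cos (U * ξ) - cos ((T - 2 * U) * ξ)) / ξ * (stepDeriv s * sin (s * (U * ξ))) := by
    funext s
    rw [show (U + U * s) * ξ = U * ξ + s * (U * ξ) by ring,
      show (T - 2 * U + U * s) * ξ = (T - 2 * U) * ξ + s * (U * ξ) by ring, sin_add, sin_add]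
    ring
  rw [e, integral_add (i1.const_mul _) (i2.const_mul _), integral_const_mul, integral_const_mul] at h1
  rw [bumpCos, h1, abs_neg]
  have b1 : |(sin (U * ξ) - sin ((T - 2 * U) * ξ)) / ξ| ≤ 2 / ξ := by
    rw [abs_div, abs_of_pos hξ]
    refine (div_le_div_iff_of_pos_right hξ).2 ((abs_sub _ _).trans ?_)
    linarith [abs_sin_le_one (U * ξ), abs_sin_le_one ((T - 2 * U) * ξ)]
  have b2 : |(cos (U * ξ) - cos ((T - 2 * U) * ξ)) / ξ| ≤ 2 / ξ := by
    rw [abs_div, abs_of_pos hξ]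
    refine (div_le_div_iff_of_pos_right hξ).2 ((abs_sub _ _).trans ?_)
    linarith [abs_cos_le_one (U * ξ), abs_cos_le_one ((T - 2 * U) * ξ)]
  refine (abs_add_le _ _).trans ?_
  rw [abs_mul, abs_mul]
  have h5 := mul_le_mul b1 hc (abs_nonneg _) (by positivity)
  have h6 := mul_le_mul b2 hs (abs_nonneg _) (by positivity)
  refine (add_le_add h5 h6).trans (le_of_eq ?_)
  field_simp
  ring

section poisson
variable {U T : ℝ}

lemma bumpCos_neg (ξ : ℝ) : bumpCos U T (-ξ) = bumpCos U T ξ := by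
  simp [bumpCos]

lemma contDiff_bump : ContDiff ℝ ((⊤ : ℕ∞) : WithTop ℕ∞) (bump U T) := by
  unfold bump
  exact ((smoothTransition.contDiff (n := ⊤)).comp (by fun_prop)).sub
    ((smoothTransition.contDiff (n := ⊤)).comp (by fun_prop))

lemma summable_bumpCos (hU : 0 < U) (hT : 4 * U ≤ T) {c : ℝ} (hc : 0 < c) :
    Summable fun m : ℕ => bumpCos U T (c * (m + 1)) := by
  obtain ⟨C, hC, h⟩ := bumpCos_decay 1
  have hs := ((summable_nat_add_iff 1).2 (summable_one_div_nat_pow.2 (le_refl 2))).mul_left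
    (C / (U * c ^ 2))
  refine Summable.of_norm_bounded hs fun m => (h U T _ hU hT (by positivity)).trans (le_of_eq ?_)
  push_cast
  field_simp

lemma poisson_bump (hU : 0 < U) (hT : 4 * U ≤ T) {ν : ℝ} (hν : 0 < ν) {N : ℕ} (hN : T ≤ N * ν) :
    2 * ∑' m : ℕ, bumpCos U T (2 * π / ν * (m + 1)) =
      ν * ∑ k ∈ Icc 1 N, bump U T (k * ν) - ∫ t, bump U T t := by
  have hc : HasCompactSupport fun t => (bump U T (t * ν) : ℂ) := by
    have : HasCompactSupport fun t => bump U T (t * ν) := by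
      refine HasCompactSupport.of_support_subset_isCompact
        (isCompact_Icc (a := U / ν) (b := (T - U) / ν)) fun s hs => ⟨?_, ?_⟩
      · by_contra h
        exact hs (bump_of_le hU hT ((le_div_iff₀ hν).1 (not_le.1 h).le))
      · by_contra h
        exact hs (bump_of_ge hU hT ((div_le_iff₀ hν).1 (not_le.1 h).le))
    exact this.comp_left (g := fun y : ℝ => (y : ℂ)) Complex.ofReal_zero
  have hd : ContDiff ℝ ((⊤ : ℕ∞) : WithTop ℕ∞) fun t => (bump U T (t * ν) : ℂ) :=
    Complex.ofRealCLM.contDiff.comp (contDiff_bump.comp (by fun_prop))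
  set f : SchwartzMap ℝ ℂ := hc.toSchwartzMap hd with hf
  have hfv : ∀ t : ℝ, f t = (bump U T (t * ν) : ℂ) := fun t => rfl
  have hp := SchwartzMap.tsum_eq_tsum_fourier f 0
  simp only [zero_add, hfv, QuotientAddGroup.mk_zero, fourier_eval_zero, mul_one] at hp
  have hsum : Summable fun n : ℤ => FourierTransform.fourier f (n : ℝ) :=
    summable_of_isBigO (summable_abs_int_rpow one_lt_two)
      (((FourierTransform.fourier f).isBigO_cocompact_rpow (-2)).comp_tendsto
        Int.tendsto_coe_cofinite)
  have hre : ∀ n : ℤ, (FourierTransform.fourier f (n : ℝ)).re = ν⁻¹ * bumpCos U T (2 * π / ν * n) := by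
    intro n
    rw [SchwartzMap.fourier_coe, fourier_real_eq_integral_exp_smul]
    have hcont : Continuous fun v : ℝ => Complex.exp (↑(-2 * π * v * n) * I) := by fun_prop
    have hi : Integrable fun v : ℝ => Complex.exp (↑(-2 * π * v * n) * I) • f v :=
      (hcont.smul f.continuous).integrable_of_hasCompactSupport hc.smul_left
    have hsub := Measure.integral_comp_mul_right
      (fun t => bump U T t * cos (t * (2 * π / ν * n))) ν
    rw [abs_of_pos (inv_pos.2 hν), smul_eq_mul] at hsub
    rw [← RCLike.re_eq_complex_re, ← integral_re hi, bumpCos, ← hsub]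
    refine integral_congr_ae (Eventually.of_forall fun v => ?_)
    simp only [hfv, smul_eq_mul, RCLike.re_eq_complex_re]
    rw [mul_comm (Complex.exp _), Complex.re_ofReal_mul, Complex.exp_ofReal_mul_I_re]
    rw [show v * ν * (2 * π / ν * n) = -(-2 * π * v * n) by field_simp, cos_neg]
  have h2 : ∑' n : ℤ, bump U T (n * ν) = ∑' n : ℤ, ν⁻¹ * bumpCos U T (2 * π / ν * n) := by
    have h3 := congrArg Complex.re hp
    rw [Complex.re_tsum hsum] at h3
    simp_rw [hre] at h3
    rw [← h3, ← Complex.ofReal_tsum, Complex.ofReal_re]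
  have h4 : ∑' n : ℤ, bump U T (n * ν) = ∑ k ∈ Icc 1 N, bump U T (k * ν) := by
    rw [← Nat.cast_injective.tsum_eq (g := fun n : ℕ => (n : ℤ)) (f := fun n : ℤ => bump U T (n * ν))
      (fun n hn => by
        rcases le_or_gt n 0 with h | h
        · refine absurd (bump_of_le hU hT ?_) hn
          have : (n : ℝ) ≤ 0 := by exact_mod_cast h
          nlinarith
        · exact ⟨n.toNat, by simp [h.le]⟩)]
    simp only [Int.cast_natCast]
    refine tsum_eq_sum fun k hk => ?_
    rcases Nat.eq_zero_or_pos k with rfl | h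
    · exact bump_of_le hU hT (by simpa using hU.le)
    · have : N + 1 ≤ k := by
        by_contra h'
        exact hk (mem_Icc.2 ⟨h, by omega⟩)
      have h5 : (N : ℝ) + 1 ≤ k := by exact_mod_cast this
      exact bump_of_ge hU hT (by nlinarith)
  have hs1 := (summable_bumpCos hU hT (show 0 < 2 * π / ν by positivity)).mul_left ν⁻¹
  have hs0 : Summable fun n : ℕ => ν⁻¹ * bumpCos U T (2 * π / ν * ((n : ℤ) : ℝ)) := by
    refine (summable_nat_add_iff 1).1 (hs1.congr fun n => ?_)
    push_cast; rfl
  have hneg : (fun n : ℕ => ν⁻¹ * bumpCos U T (2 * π / ν * ((-((n : ℤ) + 1) : ℤ) : ℝ))) =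
      fun n : ℕ => ν⁻¹ * bumpCos U T (2 * π / ν * (n + 1)) := by
    funext n
    push_cast
    rw [mul_neg, bumpCos_neg]
  have h5 := tsum_of_nat_of_neg_add_one (f := fun n : ℤ => ν⁻¹ * bumpCos U T (2 * π / ν * n)) hs0
    (by rw [hneg]; exact hs1)
  rw [hneg, hs0.tsum_eq_zero_add] at h5
  push_cast at h5
  simp only [tsum_mul_left, mul_zero] at h2 h5
  rw [← h4, h2, h5]
  have e0 : bumpCos U T 0 = ∫ t, bump U T t := by simp [bumpCos]
  rw [e0]
  field_simp
  ring

lemma tsum_bumpCos (hU : 0 < U) (hT : 4 * U ≤ T) {ν : ℝ} (hν : 0 < ν) :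
    2 * ∑' m : ℕ, bumpCos U T (2 * π / ν * (m + 1)) =
      ∫ t, bumpDeriv U T t * (ν * Int.fract (t / ν)) := by
  obtain ⟨N, hN⟩ := exists_nat_ge (T / ν)
  have hi : Integrable (bumpDeriv U T) := continuous_bumpDeriv.integrable_of_hasCompactSupport (hasCompactSupport_bumpDeriv hU hT)
  have hde : deriv (bump U T) = bumpDeriv U T := funext fun t => (hasDerivAt_bump t).deriv
  have hk : ∀ k : ℕ, bump U T (k * ν) =
      -∫ t, bumpDeriv U T t * (if (k : ℝ) ≤ t / ν then 1 else 0) := fun k => by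
    have h1 := (hasCompactSupport_bump hU hT).integral_Ioi_deriv_eq (contDiff_bump.of_le (by simp)) (k * ν)
    rw [hde, ← integral_Ici_eq_integral_Ioi, ← integral_indicator measurableSet_Ici] at h1
    rw [← neg_eq_iff_eq_neg.2 h1]
    congr 2
    funext t
    by_cases h : (k : ℝ) ≤ t / ν
    · rw [if_pos h, mul_one, Set.indicator_of_mem]
      exact (le_div_iff₀ hν).1 h
    · rw [if_neg h, mul_zero, Set.indicator_of_notMem]
      exact fun h' => h ((le_div_iff₀ hν).2 h')
  have hik : ∀ k : ℕ, Integrable fun t => bumpDeriv U T t * (if (k : ℝ) ≤ t / ν then 1 else 0) :=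
      fun k => by
    refine hi.mul_bdd (c := 1) (Measurable.aestronglyMeasurable ?_) (Eventually.of_forall fun t => ?_)
    · exact Measurable.ite (measurableSet_le measurable_const (by fun_prop)) measurable_const measurable_const
    · split_ifs <;> simp
  have h0 := integral_bump_mul_deriv hU hT (g := fun t => t) (g' := fun _ => 1)
    (fun t _ => hasDerivAt_id t) continuousOn_const
  simp only [mul_one] at h0
  rw [poisson_bump hU hT hν ((div_le_iff₀ hν).1 hN), h0]
  simp_rw [hk]
  rw [sum_neg_distrib, ← integral_finsetSum _ fun k _ => hik k, mul_neg, ← integral_const_mul,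
    neg_sub_neg, ← integral_sub (f := fun t => bumpDeriv U T t * t)
      (integrable_bumpDeriv_mul hU hT continuous_id) ((integrable_finsetSum _ fun k _ => hik k).const_mul _)]
  refine integral_congr_ae (Eventually.of_forall fun t => ?_)
  simp only
  rcases le_or_gt t U with h | h
  · simp [bumpDeriv_of_le hU hT h]
  rcases le_or_gt (T - U) t with h' | h'
  · simp [bumpDeriv_of_ge hU hT h']
  have hz : 0 ≤ t / ν := div_nonneg (by linarith) hν.le
  rw [← mul_sum, sum_ite_le_eq_floor hz
    (((div_le_div_iff_of_pos_right hν).2 (by linarith)).trans hN), Int.fract,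
    ← natCast_floor_eq_intCast_floor hz]
  field_simp

end poisson

lemma fractSum_nonneg (r : ℝ) : 0 ≤ fractSum r :=
  tsum_nonneg fun _ => div_nonneg (Int.fract_nonneg _) (by positivity)

lemma fractSum_le (r : ℝ) : fractSum r ≤ ∑' a : ℕ, 1 / (a : ℝ) ^ 2 :=
  Summable.tsum_le_tsum (fun _ =>
    div_le_div_of_nonneg_right (Int.fract_lt_one _).le (by positivity)) (summable_fractSum r)
    (summable_one_div_nat_pow.2 (le_refl 2))

lemma abs_fractSum_sub_le_rpow {θ : ℝ} (h0 : 0 < θ) (h1 : θ ≤ 1) : ∃ C > 0, ∀ r > 0,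
    |fractSum r - (-(r * log r) + r)| ≤ C * r ^ (1 + θ) := by
  set K := ∑' a : ℕ, 1 / (a : ℝ) ^ 2 with hK
  have hK0 : 0 ≤ K := tsum_nonneg fun a => by positivity
  refine ⟨K + 1 / θ + 3, by positivity, fun r hr => ?_⟩
  have hp : 0 < r ^ (1 + θ) := by positivity
  rcases le_or_gt r 1 with h | h
  · refine (abs_fractSum_sub_le hr).trans ?_
    have : r ^ (2 : ℕ) ≤ r ^ (1 + θ) := by
      rw [← rpow_natCast]
      exact rpow_le_rpow_of_exponent_ge hr h (by push_cast; linarith)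
    have h3 : 0 ≤ (K + 1 / θ) * r ^ (1 + θ) := by positivity
    nlinarith
  · have e : r ^ (1 + θ) = r * r ^ θ := by rw [rpow_add hr, rpow_one]
    have hr1 : 1 ≤ r ^ θ := one_le_rpow h.le h0.le
    have hf : fractSum r ≤ K := fractSum_le r
    have hf0 : 0 ≤ fractSum r := fractSum_nonneg r
    have hl : log r ≤ r ^ θ / θ := log_le_rpow_div hr.le h0
    have hl0 : 0 ≤ log r := log_nonneg h.le
    have h2 : r * log r ≤ 1 / θ * r ^ (1 + θ) := by
      rw [e]
      refine (mul_le_mul_of_nonneg_left hl hr.le).trans (le_of_eq (by ring))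
    have h3 : r ≤ r ^ (1 + θ) := by rw [e]; nlinarith
    have h4 : K ≤ K * r ^ (1 + θ) := le_mul_of_one_le_right hK0 (h.le.trans h3)
    have h5 : 0 ≤ r * log r := by positivity
    rw [abs_le]
    constructor <;> nlinarith

lemma tsum_tsum_bumpCos {U T : ℝ} (hU : 0 < U) (hT : 4 * U ≤ T) {c : ℝ} (hc : 0 < c) :
    2 * ∑' a : ℕ, (a : ℝ)⁻¹ * ∑' m : ℕ, bumpCos U T (2 * π / c * (a * (m + 1))) =
      ∫ t, bumpDeriv U T t * (c * fractSum (t / c)) := by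
  have hi : Integrable (bumpDeriv U T) :=
    continuous_bumpDeriv.integrable_of_hasCompactSupport (hasCompactSupport_bumpDeriv hU hT)
  have hterm : ∀ a : ℕ, 2 * ((a : ℝ)⁻¹ * ∑' m : ℕ, bumpCos U T (2 * π / c * (a * (m + 1)))) =
      ∫ t, bumpDeriv U T t * (c * (Int.fract (a * (t / c)) / (a : ℝ) ^ 2)) := fun a => by
    rcases Nat.eq_zero_or_pos a with rfl | ha
    · simp
    have ha' : (0 : ℝ) < a := by exact_mod_cast ha
    have h := tsum_bumpCos hU hT (ν := c / a) (by positivity)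
    have e1 : (fun m : ℕ => bumpCos U T (2 * π / (c / a) * (m + 1))) =
        fun m : ℕ => bumpCos U T (2 * π / c * (a * (m + 1))) := by
      funext m; congr 1; field_simp
    rw [e1] at h
    rw [mul_left_comm, h, ← integral_const_mul]
    refine integral_congr_ae (Eventually.of_forall fun t => ?_)
    simp only
    rw [show t / (c / a) = a * (t / c) by field_simp]
    field_simp
  have hF : ∀ a : ℕ, Integrable fun t =>
      bumpDeriv U T t * (c * (Int.fract (a * (t / c)) / (a : ℝ) ^ 2)) := fun a => by
    refine hi.mul_bdd (c := c * (1 / (a : ℝ) ^ 2)) (Measurable.aestronglyMeasurable ?_)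
      (Eventually.of_forall fun t => ?_)
    · exact ((measurable_fract.comp (by fun_prop)).div_const _).const_mul _
    · rw [norm_of_nonneg (mul_nonneg hc.le (div_nonneg (Int.fract_nonneg _) (by positivity)))]
      exact mul_le_mul_of_nonneg_left
        (div_le_div_of_nonneg_right (Int.fract_lt_one _).le (by positivity)) hc.le
  have hsum : Summable fun a : ℕ =>
      ∫ t, ‖bumpDeriv U T t * (c * (Int.fract (a * (t / c)) / (a : ℝ) ^ 2))‖ := by
    refine Summable.of_nonneg_of_le (fun a => integral_nonneg fun t => norm_nonneg _) (fun a => ?_)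
      ((summable_one_div_nat_pow.2 (le_refl 2)).mul_left ((∫ t, |bumpDeriv U T t|) * c))
    rw [mul_assoc, ← integral_mul_const]
    refine integral_mono (hF a).norm (hi.abs.mul_const _) fun t => ?_
    simp only [norm_mul, norm_eq_abs]
    refine mul_le_mul_of_nonneg_left ?_ (abs_nonneg _)
    rw [← abs_mul, abs_of_nonneg (mul_nonneg hc.le (div_nonneg (Int.fract_nonneg _) (by positivity)))]
    exact mul_le_mul_of_nonneg_left
      (div_le_div_of_nonneg_right (Int.fract_lt_one _).le (by positivity)) hc.le
  have h := (hasSum_integral_of_summable_integral_norm hF hsum).tsum_eq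
  rw [← tsum_mul_left]
  simp_rw [hterm]
  rw [h]
  refine integral_congr_ae (Eventually.of_forall fun t => ?_)
  simp only
  rw [tsum_mul_left, tsum_mul_left, fractSum]

lemma integral_bumpDeriv_fractSum {θ : ℝ} (h0 : 0 < θ) (h1 : θ ≤ 1) : ∃ C > 0, ∀ U T c : ℝ,
    0 < U → 4 * U ≤ T → 0 < c →
    |(∫ t, bumpDeriv U T t * (c * fractSum (t / c))) -
      ((∫ t, bump U T t * log t) - log c * ∫ t, bump U T t)| ≤
      C * (T * (T / c) ^ θ) := by
  obtain ⟨C, hC, h⟩ := abs_fractSum_sub_le_rpow h0 h1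
  refine ⟨2 * C, by positivity, fun U T c hU hT hc => ?_⟩
  have hTpos : 0 < T := by linarith
  have hi : Integrable (bumpDeriv U T) :=
    continuous_bumpDeriv.integrable_of_hasCompactSupport (hasCompactSupport_bumpDeriv hU hT)
  have hib : Integrable (bump U T) :=
    continuous_bump.integrable_of_hasCompactSupport (hasCompactSupport_bump hU hT)
  have hlog : Integrable fun t => bump U T t * log t := by
    have e : (fun t => bump U T t * log t) = fun t => bump U T t * log (max t U) := by
      funext t
      rcases le_total t U with h | h
      · simp [bump_of_le hU hT h]
      · rw [max_eq_left h]
    rw [e]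
    exact integrable_bump_mul hU hT (Continuous.log (by fun_prop) fun t =>
      (hU.trans_le (le_max_right t U)).ne')
  have h2 := integral_bump_mul_deriv hU hT (g := fun t => t * log t - t - t * log c)
    (g' := fun t => log t - log c) (fun t ht => by
      have ht0 : t ≠ 0 := by linarith
      have := ((hasDerivAt_mul_log ht0).sub (hasDerivAt_id t)).sub
        ((hasDerivAt_id t).mul_const (log c))
      refine this.congr_deriv (by ring))
    (ContinuousOn.sub (continuousOn_log.mono fun t ht => by
      have : U ≤ t := ht
      simp; linarith) continuousOn_const)
  have h3 : ∫ t, bump U T t * (log t - log c) =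
      (∫ t, bump U T t * log t) - log c * ∫ t, bump U T t := by
    rw [← integral_const_mul, ← integral_sub hlog (hib.const_mul _)]
    refine integral_congr_ae (Eventually.of_forall fun t => ?_)
    simp only; ring
  rw [← h3, h2, sub_neg_eq_add, ← integral_add]
  · have h4 := abs_integral_bumpDeriv_mul_le hU hT
      (g := fun t => c * fractSum (t / c) + (t * log t - t - t * log c))
      (B := C * (T * (T / c) ^ θ)) fun t h5 h6 => by
        have ht : 0 < t := by linarith
        have h7 := h (t / c) (by positivity)
        rw [log_div ht.ne' hc.ne'] at h7
        have e : c * fractSum (t / c) + (t * log t - t - t * log c) =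
            c * (fractSum (t / c) - (-(t / c * (log t - log c)) + t / c)) := by
          field_simp; ring
        rw [e, abs_mul, abs_of_pos hc]
        refine (mul_le_mul_of_nonneg_left h7 hc.le).trans ?_
        have h8 : (t / c) ^ (1 + θ) ≤ (T / c) ^ (1 + θ) :=
          rpow_le_rpow (by positivity) ((div_le_div_iff_of_pos_right hc).2 (by linarith))
            (by positivity)
        rw [rpow_add (by positivity : 0 < T / c), rpow_one] at h8
        calc c * (C * (t / c) ^ (1 + θ)) ≤ c * (C * (T / c * (T / c) ^ θ)) := by
              exact mul_le_mul_of_nonneg_left (mul_le_mul_of_nonneg_left h8 hC.le) hc.le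
          _ = _ := by field_simp
    rw [mul_assoc]
    refine le_trans (le_of_eq ?_) h4
    congr 2
    funext t; ring
  · have hm : Measurable fun t => c * fractSum (t / c) := by
      have : Measurable fractSum := by
        refine measurable_of_tendsto_metrizable (f := fun N r => ∑ a ∈ range N,
          Int.fract ((a : ℝ) * r) / (a : ℝ) ^ 2) (fun N => ?_)
          (tendsto_pi_nhds.2 fun r => (summable_fractSum r).hasSum.tendsto_sum_nat)
        exact Finset.measurable_fun_sum _ fun a _ =>
          (measurable_fract.comp (by fun_prop)).div_const _
      fun_prop
    refine hi.mul_bdd (c := c * ∑' a : ℕ, 1 / (a : ℝ) ^ 2) hm.aestronglyMeasurable (Eventually.of_forall fun t => ?_)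
    rw [norm_of_nonneg (mul_nonneg hc.le (fractSum_nonneg _))]
    exact mul_le_mul_of_nonneg_left (fractSum_le _) hc.le
  · exact integrable_bumpDeriv_mul hU hT (by
      have := continuous_mul_log
      fun_prop)

lemma tsum_singularSeries_bumpCos {θ : ℝ} (h0 : 0 < θ) (h1 : θ < 1 / 2) : ∃ C > 0, ∀ U T : ℝ,
    0 < U → 4 * U ≤ T → ∀ n : ℕ, 1 ≤ n →
    Summable (fun h : ℕ => singularSeries (h + 1) * bumpCos U T ((h + 1 : ℕ) / (n : ℝ))) ∧
    |2 * (∑' h : ℕ, singularSeries (h + 1) * bumpCos U T ((h + 1 : ℕ) / (n : ℝ))) -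
      ((∫ t, bump U T t * log t) - log (2 * π) * (∫ t, bump U T t) -
        log n * ∫ t, bump U T t)| ≤ C * (T * (T / n) ^ θ) := by
  obtain ⟨C, hC, hI⟩ := integral_bumpDeriv_fractSum h0 (by linarith)
  obtain ⟨K, hK, hψ⟩ := bumpCos_decay 1
  have hse := summable_sieveCoeff h0.le h1
  set E := ∑' b : ℕ, |sieveCoeff b| * (b : ℝ) ^ θ with hE
  have hE0 : 0 ≤ E := tsum_nonneg fun b => by positivity
  have htp : 0 < |2 * twinProduct| + 1 := by positivity
  refine ⟨(|2 * twinProduct| + 1) * (C * (E + 1)), by positivity, fun U T hU hT n hn => ?_⟩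
  have hn0 : (0 : ℝ) < n := by exact_mod_cast hn
  have hTpos : 0 < T := by linarith
  have hw : ∀ m : ℕ, 1 ≤ m → |bumpCos U T (m / (n : ℝ))| ≤ K * n ^ 2 / U * (m : ℝ) ^ (-(2 : ℝ)) := by
    intro m hm
    have hm0 : (0 : ℝ) < m := by exact_mod_cast hm
    refine (hψ U T _ hU hT (by positivity)).trans (le_of_eq ?_)
    rw [rpow_neg hm0.le, rpow_two]
    field_simp
  have hS := hasSum_singularSeries (κ := 2) one_lt_two (w := fun m => bumpCos U T (m / (n : ℝ))) hw
  refine ⟨hS.summable, ?_⟩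
  rw [hS.tsum_eq]
  set L := ∫ t, bump U T t * log t
  set I := ∫ t, bump U T t
  set D := T * (T / n) ^ θ
  have hD : 0 ≤ D := by positivity
  set G : ℕ → ℝ := fun b => 2 * ∑' a : ℕ, (a : ℝ)⁻¹ *
    ∑' m : ℕ, bumpCos U T ((2 * (b * (a * (m + 1))) : ℕ) / (n : ℝ)) with hG
  have hb : ∀ b : ℕ, |sieveCoeff b * (G b - (L - log π * I - log n * I + log b * I))| ≤
      C * D * (|sieveCoeff b| * (b : ℝ) ^ θ) := by
    intro b
    rcases Nat.eq_zero_or_pos b with rfl | hb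
    · simp [sieveCoeff_zero]
    have hb0 : (0 : ℝ) < b := by exact_mod_cast hb
    have h2 := tsum_tsum_bumpCos hU hT (c := π * n / b) (by positivity)
    have e : ∀ a m : ℕ, 2 * π / (π * n / b) * ((a : ℝ) * (m + 1)) =
        ((2 * (b * (a * (m + 1))) : ℕ) : ℝ) / n := fun a m => by
      push_cast; field_simp
    simp_rw [e] at h2
    have h3 := hI U T (π * n / b) hU hT (by positivity)
    rw [← h2, log_div (by positivity) hb0.ne', log_mul pi_pos.ne' hn0.ne'] at h3
    rw [abs_mul]
    have h4 : (T / (π * n / b)) ^ θ ≤ (T / n) ^ θ * (b : ℝ) ^ θ := by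
      rw [← mul_rpow (by positivity) hb0.le]
      refine rpow_le_rpow (by positivity) ?_ h0.le
      rw [show T / (π * n / b) = T / n * b / π by field_simp]
      exact div_le_self (by positivity) (by linarith [pi_gt_three])
    have h5 : |G b - (L - log π * I - log n * I + log b * I)| ≤ C * D * (b : ℝ) ^ θ := by
      have e2 : G b - (L - log π * I - log n * I + log b * I) =
          G b - (L - (log π + log n - log b) * I) := by ring
      rw [e2]
      refine h3.trans ?_
      calc C * (T * (T / (π * n / b)) ^ θ) ≤ C * (T * ((T / n) ^ θ * (b : ℝ) ^ θ)) := by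
            exact mul_le_mul_of_nonneg_left (mul_le_mul_of_nonneg_left h4 hTpos.le) hC.le
        _ = _ := by simp only [D]; ring
    calc _ ≤ |sieveCoeff b| * (C * D * (b : ℝ) ^ θ) := mul_le_mul_of_nonneg_left h5 (abs_nonneg _)
      _ = _ := by ring
  have hsum1 : Summable fun b : ℕ => sieveCoeff b *
      (G b - (L - log π * I - log n * I + log b * I)) :=
    (hse.mul_left (C * D)).of_norm_bounded hb
  have hB : ‖∑' b : ℕ, sieveCoeff b *
      (G b - (L - log π * I - log n * I + log b * I))‖ ≤ C * D * E :=
    tsum_of_norm_bounded (hse.hasSum.mul_left (C * D)) hb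
  have hs0 : Summable sieveCoeff := summable_abs_sieveCoeff.of_abs
  have hs1 : Summable fun b : ℕ => sieveCoeff b * log b := summable_abs_sieveCoeff_log.of_abs
  have hsumG : Summable fun b : ℕ => sieveCoeff b *
      (L - log π * I - log n * I + log b * I) := by
    refine ((hs0.mul_right (L - log π * I - log n * I)).add (hs1.mul_right I)).congr
      fun b => by ring
  have e3 : ∑' b : ℕ, sieveCoeff b * (L - log π * I - log n * I + log b * I) =
      (L - log (2 * π) * I - log n * I) * ∑' b, sieveCoeff b := by
    have e4 : (fun b : ℕ => sieveCoeff b * (L - log π * I - log n * I + log b * I)) =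
      fun b : ℕ => sieveCoeff b * (L - log π * I - log n * I) +
        sieveCoeff b * log b * I := by funext b; ring
    rw [e4, Summable.tsum_add (hs0.mul_right _) (hs1.mul_right _), tsum_mul_right, tsum_mul_right,
      tsum_sieveCoeff_log, log_mul two_ne_zero pi_pos.ne']
    ring
  have hGsum : Summable fun b : ℕ => sieveCoeff b * G b := by
    refine (hsum1.add hsumG).congr fun b => by ring
  have e5 : ∑' b : ℕ, sieveCoeff b * (G b - (L - log π * I - log n * I + log b * I)) =
      ∑' b : ℕ, sieveCoeff b * G b -
        (L - log (2 * π) * I - log n * I) * ∑' b, sieveCoeff b := by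
    rw [← e3, ← Summable.tsum_sub hGsum hsumG]
    congr 1; funext b; ring
  rw [e5, norm_eq_abs] at hB
  have e6 : 2 * (2 * twinProduct * ∑' b : ℕ, sieveCoeff b * ∑' a : ℕ, (a : ℝ)⁻¹ *
      ∑' m : ℕ, bumpCos U T ((2 * (b * (a * (m + 1))) : ℕ) / (n : ℝ))) =
      2 * twinProduct * ∑' b : ℕ, sieveCoeff b * G b := by
    simp only [hG]
    simp_rw [mul_left_comm (sieveCoeff _) 2]
    rw [tsum_mul_left]
    ring
  rw [e6]
  have h1' := twinProduct_mul_tsum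
  have e7 : 2 * twinProduct * ∑' b : ℕ, sieveCoeff b * G b -
      (L - log (2 * π) * I - log n * I) = 2 * twinProduct * (∑' b : ℕ, sieveCoeff b * G b -
        (L - log (2 * π) * I - log n * I) * ∑' b, sieveCoeff b) := by
    linear_combination (L - log (2 * π) * I - log n * I) * h1'
  rw [e7, abs_mul]
  calc _ ≤ |2 * twinProduct| * (C * D * E) := mul_le_mul_of_nonneg_left hB (abs_nonneg _)
    _ ≤ (|2 * twinProduct| + 1) * (C * D * (E + 1)) :=
        mul_le_mul (by linarith) (mul_le_mul_of_nonneg_left (by linarith) (by positivity))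
          (by positivity) (by positivity)
    _ = _ := by ring

noncomputable def weightRoot (x : ℝ) (n : ℕ) : ℝ := min (n / x) (x / n) * (n : ℝ) ^ (-(1 / 2) : ℝ)

noncomputable def primeCoeff (x : ℝ) (n : ℕ) : ℝ := Λ n * weightRoot x n

section
variable {x : ℝ}

lemma weightRoot_nonneg (hx : 0 < x) (n : ℕ) : 0 ≤ weightRoot x n := by
  unfold weightRoot; positivity

lemma weightRoot_sq (x : ℝ) (n : ℕ) : weightRoot x n ^ 2 = sqWeight x n := by
  rw [weightRoot, sqWeight, mul_pow, ← rpow_mul_natCast (by positivity)]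
  norm_num [rpow_neg_one]
  rfl

lemma primeCoeff_nonneg (hx : 0 < x) (n : ℕ) : 0 ≤ primeCoeff x n :=
  mul_nonneg vonMangoldt_nonneg (weightRoot_nonneg hx n)

lemma primeCoeff_le (n : ℕ) : primeCoeff x n ≤ x * (Λ n * (n : ℝ) ^ (-(3 / 2) : ℝ)) := by
  rcases Nat.eq_zero_or_pos n with rfl | hn
  · simp [primeCoeff]
  have hn0 : (0 : ℝ) < n := by exact_mod_cast hn
  have h1 : weightRoot x n ≤ x * (n : ℝ) ^ (-(3 / 2) : ℝ) := by
    refine (mul_le_mul_of_nonneg_right (min_le_right _ _) (by positivity)).trans (le_of_eq ?_)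
    rw [show (-(3 / 2) : ℝ) = -(1 / 2) - 1 by norm_num, rpow_sub_one hn0.ne']
    ring
  calc _ ≤ Λ n * (x * (n : ℝ) ^ (-(3 / 2) : ℝ)) :=
        mul_le_mul_of_nonneg_left h1 vonMangoldt_nonneg
    _ = _ := by ring

lemma summable_primeCoeff (hx : 0 < x) : Summable (primeCoeff x) :=
  Summable.of_nonneg_of_le (primeCoeff_nonneg hx) primeCoeff_le
    ((summable_vonMangoldt_rpow (by norm_num)).mul_left x)

lemma tsum_primeCoeff_le (hx : 0 < x) :
    ∑' n, primeCoeff x n ≤ x * ∑' n : ℕ, Λ n * (n : ℝ) ^ (-(3 / 2) : ℝ) := by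
  rw [← tsum_mul_left]
  exact Summable.tsum_le_tsum primeCoeff_le (summable_primeCoeff hx)
    ((summable_vonMangoldt_rpow (by norm_num)).mul_left x)

lemma primeSum_term_eq (t : ℝ) (n : ℕ) :
    ((Λ n * min (n / x) (x / n) : ℝ) : ℂ) * (n : ℂ) ^ (-(1 / 2 + I * t)) =
      ((primeCoeff x n * cos (t * log n) : ℝ) : ℂ) -
        ((primeCoeff x n * sin (t * log n) : ℝ) : ℂ) * I := by
  rcases Nat.eq_zero_or_pos n with rfl | hn
  · simp [primeCoeff]
  have hn0 : (0 : ℝ) < n := by exact_mod_cast hn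
  have h1 : (n : ℂ) ^ (-(1 / 2 + I * t)) = (((n : ℝ) ^ (-(1 / 2) : ℝ) : ℝ) : ℂ) *
      Complex.exp (((-(t * log n) : ℝ) : ℂ) * I) := by
    rw [Complex.ofReal_cpow hn0.le, Complex.cpow_def_of_ne_zero (by exact_mod_cast hn0.ne'),
      Complex.cpow_def_of_ne_zero (by exact_mod_cast hn0.ne'), ← Complex.exp_add]
    push_cast
    congr 1
    ring
  rw [h1, Complex.exp_mul_I, ← Complex.ofReal_cos, ← Complex.ofReal_sin, cos_neg, sin_neg,
    primeCoeff, weightRoot]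
  push_cast
  ring

lemma hasSum_norm_primeSum_sq (hx : 0 < x) (t : ℝ) : HasSum (fun p : ℕ × ℕ =>
    primeCoeff x p.1 * primeCoeff x p.2 * cos (t * (log p.1 - log p.2)))
    (‖primeSum x t‖ ^ 2) := by
  have hs := summable_primeCoeff hx
  have hc : Summable fun n : ℕ => ‖primeCoeff x n * cos (t * log n)‖ :=
    Summable.of_nonneg_of_le (fun n => norm_nonneg _) (fun n => by
      rw [norm_mul, norm_of_nonneg (primeCoeff_nonneg hx n)]
      exact mul_le_of_le_one_right (primeCoeff_nonneg hx n) (abs_cos_le_one _)) hs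
  have hsn : Summable fun n : ℕ => ‖primeCoeff x n * sin (t * log n)‖ :=
    Summable.of_nonneg_of_le (fun n => norm_nonneg _) (fun n => by
      rw [norm_mul, norm_of_nonneg (primeCoeff_nonneg hx n)]
      exact mul_le_of_le_one_right (primeCoeff_nonneg hx n) (abs_sin_le_one _)) hs
  have h1 : HasSum (fun n : ℕ => ((primeCoeff x n * cos (t * log n) : ℝ) : ℂ) -
        ((primeCoeff x n * sin (t * log n) : ℝ) : ℂ) * I) _ :=
    (Complex.hasSum_ofReal.2 hc.of_norm.hasSum).sub
      ((Complex.hasSum_ofReal.2 hsn.of_norm.hasSum).mul_right I)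
  have h2 : primeSum x t = _ := (tsum_congr (primeSum_term_eq t)).trans h1.tsum_eq
  have h3 := (summable_mul_of_summable_norm hc hc).hasSum.add (summable_mul_of_summable_norm hsn hsn).hasSum
  rw [← tsum_mul_tsum_of_summable_norm hc hc, ← tsum_mul_tsum_of_summable_norm hsn hsn] at h3
  rw [h2, ← Complex.normSq_eq_norm_sq]
  set A := ∑' n : ℕ, primeCoeff x n * cos (t * log n)
  set B := ∑' n : ℕ, primeCoeff x n * sin (t * log n)
  have e : Complex.normSq ((A : ℂ) - B * I) = A * A + B * B := by
    simp [Complex.normSq_apply]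
  rw [e]
  refine Eq.mp (congrArg (fun f => HasSum f _) (funext fun p => ?_)) h3
  rw [mul_sub, cos_sub]
  ring

lemma hasSum_integral_primeSum {U T : ℝ} (hU : 0 < U) (hT : 4 * U ≤ T) (hx : 0 < x) :
    HasSum (fun p : ℕ × ℕ => primeCoeff x p.1 * primeCoeff x p.2 *
      bumpCos U T (log p.1 - log p.2)) (∫ t, bump U T t * ‖primeSum x t‖ ^ 2) := by
  have hib : Integrable (bump U T) :=
    continuous_bump.integrable_of_hasCompactSupport (hasCompactSupport_bump hU hT)
  have hs := summable_primeCoeff hx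
  have hss : Summable fun p : ℕ × ℕ => primeCoeff x p.1 * primeCoeff x p.2 :=
    hs.mul_of_nonneg hs (primeCoeff_nonneg hx) (primeCoeff_nonneg hx)
  have hF : ∀ p : ℕ × ℕ, Integrable fun t => bump U T t * (primeCoeff x p.1 * primeCoeff x p.2 *
      cos (t * (log p.1 - log p.2))) := fun p =>
    integrable_bump_mul hU hT (by fun_prop)
  have hsum : Summable fun p : ℕ × ℕ => ∫ t, ‖bump U T t * (primeCoeff x p.1 * primeCoeff x p.2 *
      cos (t * (log p.1 - log p.2)))‖ := by
    refine Summable.of_nonneg_of_le (fun a => integral_nonneg fun t => norm_nonneg _) (fun p => ?_)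
      (hss.mul_left (∫ t, bump U T t))
    rw [← integral_mul_const]
    refine integral_mono (hF p).norm (hib.mul_const _) fun t => ?_
    have h0 := mul_nonneg (primeCoeff_nonneg hx p.1) (primeCoeff_nonneg hx p.2)
    simp only [norm_mul (bump U T t), norm_of_nonneg (bump_nonneg hU hT t)]
    refine mul_le_mul_of_nonneg_left ?_ (bump_nonneg hU hT t)
    rw [norm_mul, norm_of_nonneg h0]
    exact mul_le_of_le_one_right h0 (abs_cos_le_one _)
  have h := hasSum_integral_of_summable_integral_norm hF hsum
  have e1 : (fun t => ∑' p : ℕ × ℕ, bump U T t * (primeCoeff x p.1 * primeCoeff x p.2 *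
      cos (t * (log p.1 - log p.2)))) = fun t => bump U T t * ‖primeSum x t‖ ^ 2 := by
    funext t
    rw [tsum_mul_left, (hasSum_norm_primeSum_sq hx t).tsum_eq]
  rw [e1] at h
  refine Eq.mp (congrArg (fun f => HasSum f _) (funext fun p => ?_)) h
  rw [bumpCos, ← integral_const_mul]
  congr 1
  funext t
  ring

end

lemma tsum_eq_diag_add_of_symm {f : ℕ × ℕ → ℝ} (hf : Summable f) (hs : ∀ n m, f (n, m) = f (m, n)) :
    ∑' p, f p = ∑' n, f (n, n) + 2 * ∑' p : ℕ × ℕ, f (p.2, p.2 + (p.1 + 1)) := by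
  have i1 : Function.Injective fun n : ℕ => (n, n) := fun a b h => (Prod.mk.inj h).1
  have i2 : Function.Injective fun p : ℕ × ℕ => (p.2, p.2 + (p.1 + 1)) := fun a b h => by
    obtain ⟨h1, h2⟩ := Prod.mk.inj h
    exact Prod.ext (by omega) h1
  have i3 : Function.Injective fun p : ℕ × ℕ => (p.2 + (p.1 + 1), p.2) := fun a b h => by
    obtain ⟨h1, h2⟩ := Prod.mk.inj h
    exact Prod.ext (by omega) h2
  have hi : ∀ s : Set (ℕ × ℕ), Summable (s.indicator f) := fun s => hf.indicator s
  have e : f = fun p => ({p | p.1 = p.2} : Set (ℕ × ℕ)).indicator f p +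
      (({p | p.1 < p.2} : Set (ℕ × ℕ)).indicator f p +
        ({p | p.2 < p.1} : Set (ℕ × ℕ)).indicator f p) := by
    funext ⟨a, b⟩
    simp only [Set.indicator_apply, Set.mem_ofPred_eq]
    rcases lt_trichotomy a b with h | h | h
    · simp [h, h.ne, h.not_gt]
    · simp [h]
    · simp [h, h.ne', h.not_gt]
  have h1 : ∑' p, ({p | p.1 = p.2} : Set (ℕ × ℕ)).indicator f p = ∑' n, f (n, n) := by
    rw [← i1.tsum_eq (f := ({p | p.1 = p.2} : Set (ℕ × ℕ)).indicator f)]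
    · simp
    · rintro ⟨a, b⟩ h
      have : a = b := by
        by_contra h'
        exact h (Set.indicator_of_notMem (show (a, b) ∉ ({p | p.1 = p.2} : Set (ℕ × ℕ)) from h') f)
      exact ⟨a, by simp [this]⟩
  have h2 : ∑' p, ({p | p.1 < p.2} : Set (ℕ × ℕ)).indicator f p =
      ∑' p : ℕ × ℕ, f (p.2, p.2 + (p.1 + 1)) := by
    rw [← i2.tsum_eq (f := ({p | p.1 < p.2} : Set (ℕ × ℕ)).indicator f)]
    · refine tsum_congr fun p => Set.indicator_of_mem ?_ _
      change p.2 < p.2 + (p.1 + 1)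
      omega
    · rintro ⟨a, b⟩ h
      have : a < b := by
        by_contra h'
        exact h (Set.indicator_of_notMem (show (a, b) ∉ ({p | p.1 < p.2} : Set (ℕ × ℕ)) from h') f)
      exact ⟨(b - a - 1, a), Prod.ext rfl (show a + (b - a - 1 + 1) = b by omega)⟩
  have h3 : ∑' p, ({p | p.2 < p.1} : Set (ℕ × ℕ)).indicator f p =
      ∑' p : ℕ × ℕ, f (p.2, p.2 + (p.1 + 1)) := by
    rw [← i3.tsum_eq (f := ({p | p.2 < p.1} : Set (ℕ × ℕ)).indicator f)]
    · refine tsum_congr fun p => (Set.indicator_of_mem ?_ _).trans (hs _ _)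
      change p.2 < p.2 + (p.1 + 1)
      omega
    · rintro ⟨a, b⟩ h
      have : b < a := by
        by_contra h'
        exact h (Set.indicator_of_notMem (show (a, b) ∉ ({p | p.2 < p.1} : Set (ℕ × ℕ)) from h') f)
      exact ⟨(a - b - 1, b), Prod.ext (show b + (a - b - 1 + 1) = a by omega) rfl⟩
  conv_lhs => rw [e]
  rw [Summable.tsum_add (hi _) ((hi _).add (hi _)), Summable.tsum_add (hi _) (hi _), h1, h2, h3]
  ring

lemma integral_bump_primeSum {U T x : ℝ} (hU : 0 < U) (hT : 4 * U ≤ T) (hx : 0 < x) :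
    Summable (fun p : ℕ × ℕ => primeCoeff x p.2 * primeCoeff x (p.2 + (p.1 + 1)) *
      bumpCos U T (log (p.2 + (p.1 + 1) : ℕ) - log p.2)) ∧
    ∫ t, bump U T t * ‖primeSum x t‖ ^ 2 =
      (∫ t, bump U T t) * ∑' n : ℕ, Λ n ^ 2 * sqWeight x n +
        2 * ∑' p : ℕ × ℕ, primeCoeff x p.2 * primeCoeff x (p.2 + (p.1 + 1)) *
          bumpCos U T (log (p.2 + (p.1 + 1) : ℕ) - log p.2) := by
  have hsym : ∀ ξ η : ℝ, bumpCos U T (ξ - η) = bumpCos U T (η - ξ) := fun ξ η => by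
    rw [← bumpCos_neg, neg_sub]
  have e0 : bumpCos U T 0 = ∫ t, bump U T t := by simp [bumpCos]
  have h := hasSum_integral_primeSum hU hT hx
  obtain ⟨f, hf⟩ : ∃ f : ℕ × ℕ → ℝ, f = fun p => primeCoeff x p.1 * primeCoeff x p.2 *
    bumpCos U T (log p.1 - log p.2) := ⟨_, rfl⟩
  rw [← hf] at h
  have hv : ∀ a b : ℕ, f (a, b) = primeCoeff x a * primeCoeff x b *
    bumpCos U T (log a - log b) := fun a b => by rw [hf]
  have h2 := tsum_eq_diag_add_of_symm h.summable fun n m => by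
    rw [hv, hv, hsym]; ring
  have i2 : Function.Injective fun p : ℕ × ℕ => (p.2, p.2 + (p.1 + 1)) := fun a b h => by
    obtain ⟨h1, h2⟩ := Prod.mk.inj h
    exact Prod.ext (by omega) h1
  have e : (fun p : ℕ × ℕ => primeCoeff x p.2 * primeCoeff x (p.2 + (p.1 + 1)) *
      bumpCos U T (log (p.2 + (p.1 + 1) : ℕ) - log p.2)) =
      fun p : ℕ × ℕ => f (p.2, p.2 + (p.1 + 1)) := by
    funext p; rw [hv, hsym]
  have e2 : (fun n : ℕ => f (n, n)) = fun n : ℕ => (∫ t, bump U T t) * (Λ n ^ 2 * sqWeight x n) := by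
    funext n
    rw [hv, sub_self, e0, ← weightRoot_sq, primeCoeff]
    ring
  rw [e]
  refine ⟨h.summable.comp_injective i2, ?_⟩
  rw [← h.tsum_eq, h2, e2, tsum_mul_left]

lemma abs_tsum_mul_le_of_partial_sums {c v g : ℕ → ℝ} (hcv : Summable fun n => c n * v n)
    (hg : Summable g)
    (hb : Tendsto (fun N => v N * ∑ n ∈ range (N + 1), c n) atTop (nhds 0))
    (h : ∀ i, |∑ n ∈ range (i + 1), c n| * |v i - v (i + 1)| ≤ g i) :
    |∑' n, c n * v n| ≤ ∑' n, g n := by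
  have hid : ∀ N, ∑ n ∈ range (N + 1), c n * v n =
      v N * ∑ n ∈ range (N + 1), c n +
        ∑ i ∈ range N, (∑ n ∈ range (i + 1), c n) * (v i - v (i + 1)) := fun N => by
    induction N with
    | zero => simp [mul_comm]
    | succ N ih =>
      rw [sum_range_succ, ih, sum_range_succ (fun i => _ * (v i - v (i + 1))) N,
        sum_range_succ c (N + 1)]
      ring
  have hg0 : ∀ i, 0 ≤ g i := fun i => le_trans (by positivity) (h i)
  have h1 : Tendsto (fun N => |∑ n ∈ range (N + 1), c n * v n|) atTop
      (nhds |∑' n, c n * v n|) :=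
    ((tendsto_add_atTop_iff_nat 1).2 hcv.hasSum.tendsto_sum_nat).abs
  have h2 : Tendsto (fun N => |v N * ∑ n ∈ range (N + 1), c n| + ∑' n, g n)
      atTop (nhds (∑' n, g n)) := by
    simpa using hb.abs.add_const (∑' n, g n)
  refine le_of_tendsto_of_tendsto' h1 h2 fun N => ?_
  rw [hid]
  refine (abs_add_le _ _).trans (add_le_add_right ?_ _)
  refine (abs_sum_le_sum_abs _ _).trans ?_
  refine le_trans (sum_le_sum fun i _ => ?_) (hg.sum_le_tsum _ fun i _ => hg0 i)
  rw [abs_mul]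
  exact h i

section
variable {x : ℝ}

lemma sqWeight_add_mul_le (hx : 0 < x) {n : ℕ} (hn : 1 ≤ n) (H : ℕ) :
    sqWeight x (n + H : ℕ) * n ≤ sqWeight x n * (n + H) := by
  have hn0 : (0 : ℝ) < n := by exact_mod_cast hn
  have hH : (0 : ℝ) ≤ H := by positivity
  have h1 : min (((n + H : ℕ) : ℝ) / x) (x / (n + H : ℕ)) ≤ (n + H) / n * min (n / x) (x / n) := by
    rw [mul_min_of_nonneg _ _ (by positivity)]
    push_cast
    refine min_le_min (le_of_eq (by field_simp)) ?_
    refine (div_le_div_of_nonneg_left hx.le hn0 (by linarith)).trans ?_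
    exact le_mul_of_one_le_left (by positivity) ((one_le_div hn0).2 (by linarith))
  have h2 := pow_le_pow_left₀ (by positivity) h1 2
  unfold sqWeight
  calc _ ≤ ((n + H) / n * min (n / x) (x / n)) ^ 2 / (n + H : ℕ) * n :=
        mul_le_mul_of_nonneg_right (div_le_div_of_nonneg_right h2 (by positivity)) hn0.le
    _ = _ := by push_cast; field_simp

lemma sqWeight_mul_cube_le (hx : 0 < x) {n : ℕ} (hn : 1 ≤ n) (H : ℕ) :
    sqWeight x n * (n : ℝ) ^ 3 ≤ sqWeight x (n + H : ℕ) * ((n : ℝ) + H) ^ 3 := by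
  have hn0 : (0 : ℝ) < n := by exact_mod_cast hn
  have hH : (0 : ℝ) ≤ H := by positivity
  have h1 : min (n / x) (x / n) * n ≤ min (((n + H : ℕ) : ℝ) / x) (x / (n + H : ℕ)) * (n + H) := by
    rw [min_mul_of_nonneg _ _ (show (0 : ℝ) ≤ n + H by positivity)]
    push_cast
    refine le_min ?_ ?_
    · refine (mul_le_mul_of_nonneg_right (min_le_left _ _) hn0.le).trans ?_
      gcongr <;> linarith
    · refine (mul_le_mul_of_nonneg_right (min_le_right _ _) hn0.le).trans (le_of_eq ?_)
      field_simp
  have h2 := pow_le_pow_left₀ (by positivity) h1 2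
  unfold sqWeight
  push_cast at h2 ⊢
  rw [div_mul_eq_mul_div, div_mul_eq_mul_div, pow_succ (n : ℝ) 2, pow_succ ((n : ℝ) + H) 2,
    ← mul_assoc, ← mul_assoc, mul_div_cancel_right₀ _ hn0.ne', mul_div_cancel_right₀ _ (by positivity),
    ← mul_pow, ← mul_pow]
  exact h2

lemma abs_weightRoot_mul_sub_le (hx : 0 < x) {n : ℕ} (hn : 1 ≤ n) (H : ℕ) :
    |weightRoot x n * weightRoot x (n + H) - sqWeight x n| ≤ 2 * (H / n) * sqWeight x n := by
  have hn0 : (0 : ℝ) < n := by exact_mod_cast hn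
  have hH : (0 : ℝ) ≤ H := by positivity
  have h1 := sqWeight_add_mul_le hx hn H
  have h2 := sqWeight_mul_cube_le hx hn H
  rw [← weightRoot_sq, ← weightRoot_sq] at h1 h2
  rw [← weightRoot_sq]
  have ha := weightRoot_nonneg hx n
  have hb := weightRoot_nonneg hx (n + H)
  set a := weightRoot x n
  set b := weightRoot x (n + H)
  have hu : (0 : ℝ) ≤ H / n := by positivity
  set u : ℝ := H / n with hudef
  have e : (n : ℝ) + H = n * (1 + u) := by rw [hudef]; field_simp
  rw [e] at h1 h2
  have h3 : b ^ 2 ≤ a ^ 2 * (1 + u) := by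
    refine le_of_mul_le_mul_right ?_ hn0
    linarith
  have h4 : a ^ 2 ≤ b ^ 2 * (1 + u) ^ 3 := by
    refine le_of_mul_le_mul_right ?_ (show (0 : ℝ) < n ^ 3 by positivity)
    rw [mul_pow] at h2
    linarith
  have h5 : b ≤ a * (1 + u) := by
    refine le_of_sq_le_sq ?_ (by positivity)
    nlinarith [mul_nonneg (sq_nonneg a) hu, mul_nonneg (mul_nonneg (sq_nonneg a) hu) hu]
  have h6 : a ≤ b * (1 + u) ^ 2 := by
    refine le_of_sq_le_sq ?_ (by positivity)
    have : b ^ 2 * (1 + u) ^ 3 ≤ b ^ 2 * (1 + u) ^ 4 :=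
      mul_le_mul_of_nonneg_left (pow_le_pow_right₀ (by linarith) (by norm_num)) (sq_nonneg b)
    linarith [mul_pow b ((1 + u) ^ 2) 2, pow_mul (1 + u) 2 2]
  have h7 : a * (1 - 2 * u) ≤ b := by
    rcases le_or_gt (1 - 2 * u) 0 with h | h
    · exact (mul_nonpos_of_nonneg_of_nonpos ha h).trans hb
    · calc a * (1 - 2 * u) ≤ b * (1 + u) ^ 2 * (1 - 2 * u) := mul_le_mul_of_nonneg_right h6 h.le
        _ ≤ b * 1 := by
            rw [mul_assoc]
            refine mul_le_mul_of_nonneg_left ?_ hb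
            nlinarith [mul_nonneg hu hu, mul_nonneg (mul_nonneg hu hu) hu]
        _ = b := mul_one b
  rw [abs_le]
  constructor
  · nlinarith [mul_le_mul_of_nonneg_left h7 ha]
  · nlinarith [mul_le_mul_of_nonneg_left h5 ha, mul_nonneg (mul_nonneg ha ha) hu]

lemma abs_log_add_sub_log_sub_le {n : ℕ} (hn : 1 ≤ n) (H : ℕ) :
    |log (n + H : ℕ) - log n - H / n| ≤ (H / n : ℝ) ^ 2 := by
  have hn0 : (0 : ℝ) < n := by exact_mod_cast hn
  have hu : (0 : ℝ) ≤ H / n := by positivity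
  rw [← log_div (by positivity) hn0.ne',
    show ((n + H : ℕ) : ℝ) / n = 1 + H / n by push_cast; field_simp]
  set u : ℝ := H / n
  have h1 := log_le_sub_one_of_pos (show 0 < 1 + u by linarith)
  have h2 := one_sub_inv_le_log_of_pos (show 0 < 1 + u by linarith)
  have h3 : u - u ^ 2 ≤ 1 - (1 + u)⁻¹ := by
    rw [show 1 - (1 + u)⁻¹ = u / (1 + u) by field_simp; ring, le_div_iff₀ (by linarith)]
    nlinarith [mul_nonneg (mul_nonneg hu hu) hu]
  rw [abs_le]
  constructor <;> nlinarith

lemma div_le_log_add_sub_log {n : ℕ} (hn : 1 ≤ n) {H : ℕ} {Y : ℝ} (hY : 1 ≤ Y) (h : (n : ℝ) ≤ H * Y) :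
    1 / (2 * Y) ≤ log (n + H : ℕ) - log n := by
  have hn0 : (0 : ℝ) < n := by exact_mod_cast hn
  rw [← log_div (by positivity) hn0.ne',
    show ((n + H : ℕ) : ℝ) / n = 1 + H / n by push_cast; field_simp]
  have hu : 1 / Y ≤ (H : ℝ) / n := by
    rw [div_le_div_iff₀ (by linarith) hn0]; linarith
  have h1 : 1 - (1 + 1 / Y)⁻¹ ≤ log (1 + 1 / Y) :=
    one_sub_inv_le_log_of_pos (by positivity)
  have h2 : log (1 + 1 / Y) ≤ log (1 + H / n) :=
    log_le_log (by positivity) (by linarith)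
  refine le_trans ?_ (h1.trans h2)
  rw [show 1 - (1 + 1 / Y)⁻¹ = 1 / (Y + 1) by field_simp; ring]
  exact div_le_div_of_nonneg_left zero_le_one (by linarith) (by linarith)

variable {U T : ℝ}

lemma abs_pair_weight_sub_le (hU : 0 < U) (hT : 4 * U ≤ T) (hx : 0 < x) {n : ℕ} (hn : 1 ≤ n) (H : ℕ) :
    |weightRoot x n * weightRoot x (n + H) * bumpCos U T (log (n + H : ℕ) - log n) -
      sqWeight x n * bumpCos U T (H / n)| ≤
      sqWeight x n * (2 * (T * (H / n)) + (T * (H / n)) ^ 2) := by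
  have hTpos : 0 < T := by linarith
  have hu : (0 : ℝ) ≤ H / n := by positivity
  have h1 := abs_weightRoot_mul_sub_le hx hn H
  have h2 := abs_bumpCos_le hU hT (log (n + H : ℕ) - log n)
  have h3 := (abs_bumpCos_sub_le hU hT (log (n + H : ℕ) - log n) (H / n)).trans
    (mul_le_mul_of_nonneg_left (abs_log_add_sub_log_sub_le hn H) (sq_nonneg T))
  have hk := sqWeight_nonneg x n
  set k := sqWeight x n
  set a := weightRoot x n * weightRoot x (n + H)
  set p := bumpCos U T (log (n + H : ℕ) - log n)
  set q := bumpCos U T (H / n)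
  set u : ℝ := H / n
  calc |a * p - k * q| = |(a - k) * p + k * (p - q)| := by congr 1; ring
    _ ≤ |a - k| * |p| + k * |p - q| := by
        refine (abs_add_le _ _).trans (le_of_eq ?_)
        rw [abs_mul, abs_mul, abs_of_nonneg hk]
    _ ≤ 2 * u * k * T + k * (T ^ 2 * u ^ 2) :=
        add_le_add (mul_le_mul h1 h2 (abs_nonneg _) (by positivity)) (mul_le_mul_of_nonneg_left h3 hk)
    _ = _ := by ring

lemma abs_weight_succ_sub_le (hU : 0 < U) (hT : 4 * U ≤ T) (hx : 0 < x) {m : ℕ} (hm : 1 ≤ m) (H : ℕ) :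
    |sqWeight x m * bumpCos U T (H / m) - sqWeight x (m + 1) * bumpCos U T (H / (m + 1 : ℕ))| ≤
      sqWeight x m / m * (3 * T + T * (T * (H / m))) := by
  have hm0 : (0 : ℝ) < m := by exact_mod_cast hm
  have hTpos : 0 < T := by linarith
  have h1 := sqWeight_add_mul_le hx hm 1
  have h2 := sqWeight_mul_cube_le hx hm 1
  have h3 := abs_bumpCos_le hU hT (H / m)
  have h4 := abs_bumpCos_sub_le hU hT (H / m) (H / (m + 1 : ℕ))
  have e : ((m + 1 : ℕ) : ℝ) = m + 1 := by push_cast; ring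
  simp only [Nat.cast_one] at h1 h2
  have hk := sqWeight_nonneg x m
  have hk' := sqWeight_nonneg x (m + 1 : ℕ)
  rw [e] at h4
  rw [e]
  set k := sqWeight x m
  set k' := sqWeight x (m + 1)
  set p := bumpCos U T (H / m)
  set q := bumpCos U T (H / (m + 1))
  have h5 : |k - k'| ≤ 3 * (k / m) := by
    have h6 : k' - k ≤ k / m := by
      rw [le_div_iff₀ hm0]; linarith
    have h7 : k - k' ≤ 3 * (k / m) := by
      rw [mul_div_assoc', le_div_iff₀ hm0]
      by_contra hcon
      push Not at hcon
      have h8 : k' * (m + 1) ^ 3 * m = k' * m * (m + 1) ^ 3 := by ring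
      have h9 : k' * m < k * (m - 3) := by linarith
      have h10 : k * (m : ℝ) ^ 3 * m < k * (m - 3) * (m + 1) ^ 3 := by
        calc _ ≤ k' * (m + 1) ^ 3 * m := mul_le_mul_of_nonneg_right h2 hm0.le
          _ = k' * m * (m + 1) ^ 3 := h8
          _ < _ := mul_lt_mul_of_pos_right h9 (by positivity)
      have h11 : k * ((m : ℝ) ^ 4 - (m - 3) * (m + 1) ^ 3) < 0 := by linarith
      have h12 : 0 ≤ (m : ℝ) ^ 4 - (m - 3) * (m + 1) ^ 3 := by
        have : (m : ℝ) ^ 4 - (m - 3) * (m + 1) ^ 3 = 6 * m ^ 2 + 8 * m + 3 := by ring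
        rw [this]; positivity
      exact absurd h11 (not_lt.2 (mul_nonneg hk h12))
    rw [abs_le]
    have : 0 ≤ k / m := by positivity
    constructor <;> linarith
  have h6 : k' * |(H : ℝ) / m - H / (m + 1)| ≤ k / m * (H / m) := by
    rw [show (H : ℝ) / m - H / (m + 1) = H / (m * (m + 1)) by field_simp; ring, abs_of_nonneg (by positivity)]
    rw [show k' * ((H : ℝ) / (m * (m + 1))) = k' * m * (H / (m ^ 2 * (m + 1))) by field_simp,
      show k / m * ((H : ℝ) / m) = k * (m + 1) * (H / (m ^ 2 * (m + 1))) by field_simp]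
    exact mul_le_mul_of_nonneg_right h1 (by positivity)
  calc |k * p - k' * q| = |(k - k') * p + k' * (p - q)| := by congr 1; ring
    _ ≤ |k - k'| * |p| + k' * |p - q| := by
        refine (abs_add_le _ _).trans (le_of_eq ?_)
        rw [abs_mul, abs_mul, abs_of_nonneg hk']
    _ ≤ 3 * (k / m) * T + k' * (T ^ 2 * |(H : ℝ) / m - H / (m + 1)|) :=
        add_le_add (mul_le_mul h5 h3 (abs_nonneg _) (by positivity)) (mul_le_mul_of_nonneg_left h4 hk')
    _ = 3 * (k / m) * T + T ^ 2 * (k' * |(H : ℝ) / m - H / (m + 1)|) := by ring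
    _ ≤ 3 * (k / m) * T + T ^ 2 * (k / m * (H / m)) := by
        exact add_le_add_right (mul_le_mul_of_nonneg_left h6 (sq_nonneg T)) _
    _ = _ := by ring

end

lemma abs_sum_correlation_le (hTPC : TwinPrimeConjecture) {δ : ℝ} (hδ : 0 < δ) : ∃ C > 0,
    ∀ (Y : ℝ) (H i : ℕ), 1 < Y → 1 ≤ H → (H : ℝ) * Y ≤ i →
    |∑ n ∈ range (i + 1),
      (if (H : ℝ) * Y ≤ n then Λ n * Λ (n + H) - singularSeries H else 0)| ≤
        C * (i : ℝ) ^ (1 / 2 + δ) := by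
  obtain ⟨C, hC, h⟩ := hTPC δ hδ
  refine ⟨2 * C, by positivity, fun Y H i hY hH hi => ?_⟩
  have hH0 : (0 : ℝ) < H := by exact_mod_cast hH
  set f : ℕ → ℝ := fun n => Λ n * Λ (n + H) - singularSeries H with hf
  have hQ : ∀ N, H ≤ N → |∑ n ∈ range (N + 1), f n + singularSeries H| ≤
      C * (N : ℝ) ^ (1 / 2 + δ) := fun N hN => by
    refine le_trans (le_of_eq ?_) (h N H hH hN)
    congr 1
    rw [hf, sum_sub_distrib, sum_const, card_range, sum_range_eq_add_Ico _
      (Nat.succ_pos N)]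
    rw [show Ico 1 (N + 1) = Icc 1 N from rfl]
    simp
    ring
  set a := ⌈(H : ℝ) * Y⌉₊ with ha
  have hai : a ≤ i := Nat.ceil_le.2 hi
  have hHa : H < a := Nat.lt_ceil.2 (by nlinarith)
  obtain ⟨b, hb⟩ : ∃ b, a = b + 1 := ⟨a - 1, by omega⟩
  have e : ∑ n ∈ range (i + 1), (if (H : ℝ) * Y ≤ n then f n else 0) =
      (∑ n ∈ range (i + 1), f n + singularSeries H) -
        (∑ n ∈ range (b + 1), f n + singularSeries H) := by
    rw [add_sub_add_right_eq_sub, ← hb, ← sum_Ico_eq_sub _ (by omega), ← sum_filter]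
    refine sum_congr ?_ fun _ _ => rfl
    ext n
    simp only [mem_filter, mem_range, mem_Ico, ← Nat.ceil_le, ← ha]
    omega
  rw [e]
  refine (abs_sub _ _).trans ?_
  have h1 := hQ i (by omega)
  have h2 := hQ b (by omega)
  have h3 : (b : ℝ) ^ (1 / 2 + δ) ≤ (i : ℝ) ^ (1 / 2 + δ) :=
    rpow_le_rpow (by positivity) (by exact_mod_cast (by omega : b ≤ i)) (by positivity)
  have h4 := mul_le_mul_of_nonneg_left h3 hC.le
  linarith

lemma abs_tsum_correlation_le (hTPC : TwinPrimeConjecture) {δ : ℝ} (hδ : 0 < δ) (hδ' : δ < 1 / 4) :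
    ∃ C > 0, ∀ (U T Y x : ℝ) (H : ℕ), 0 < U → 4 * U ≤ T → 1 < Y → Y ≤ T → 1 ≤ x → 1 ≤ H →
    Summable (fun n : ℕ => (if (H : ℝ) * Y ≤ n then Λ n * Λ (n + H) - singularSeries H else 0) *
      (sqWeight x n * bumpCos U T (H / n))) →
    |∑' n : ℕ, (if (H : ℝ) * Y ≤ n then Λ n * Λ (n + H) - singularSeries H else 0) *
      (sqWeight x n * bumpCos U T (H / n))| ≤
      C * (T ^ 2 / Y * (H * Y) ^ (-(1 + δ)) * x ^ (1 / 2 + 2 * δ)) := by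
  obtain ⟨C₁, hC₁, h₁⟩ := abs_sum_correlation_le hTPC hδ
  obtain ⟨C₂, hC₂, h₂⟩ := tsum_rpow_mul_sqWeight_le (θ := 1 / 2 + 2 * δ) (by linarith) (by linarith)
  refine ⟨C₁ * 4 * C₂, by positivity, fun U T Y x H hU hT hY hYT hx hH hsum => ?_⟩
  have hx0 : 0 < x := by linarith
  have hH0 : (0 : ℝ) < H := by exact_mod_cast hH
  have hY0 : 0 < Y := by linarith
  have hT0 : 0 < T := by linarith
  set D := C₁ * 4 * (T ^ 2 / Y) * (H * Y) ^ (-(1 + δ)) with hD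
  have hD0 : 0 ≤ D := by positivity
  have hg := (summable_rpow_mul_sqWeight hx0 (show 1 / 2 + 2 * δ < 2 by linarith)).mul_left D
  have hsmall : ∀ i : ℕ, ¬ (H : ℝ) * Y ≤ i → ∑ n ∈ range (i + 1),
      (if (H : ℝ) * Y ≤ n then Λ n * Λ (n + H) - singularSeries H else 0) = 0 := fun i hi =>
    sum_eq_zero fun n hn => if_neg fun h => hi (h.trans (by
      exact_mod_cast Nat.lt_succ_iff.1 (mem_range.1 hn)))
  refine (abs_tsum_mul_le_of_partial_sums hsum hg ?_ fun i => ?_).trans ?_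
  · have hz := ((summable_rpow_mul_sqWeight hx0 (show 1 / 2 + δ < 2 by linarith)).mul_left
      (T * C₁)).tendsto_atTop_zero
    refine squeeze_zero_norm (fun N => ?_) hz
    by_cases hN : (H : ℝ) * Y ≤ N
    · rw [norm_mul, norm_mul, norm_of_nonneg (sqWeight_nonneg x N)]
      calc _ ≤ sqWeight x N * T * (C₁ * (N : ℝ) ^ (1 / 2 + δ)) :=
            mul_le_mul (mul_le_mul_of_nonneg_left (abs_bumpCos_le hU hT _) (sqWeight_nonneg x N))
              (h₁ Y H N hY hH hN) (abs_nonneg _) (mul_nonneg (sqWeight_nonneg x N) hT0.le)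
        _ = _ := by ring
    · rw [hsmall N hN, mul_zero, norm_zero]
      exact mul_nonneg (by positivity) (mul_nonneg (by positivity) (sqWeight_nonneg x N))
  · by_cases hi : (H : ℝ) * Y ≤ i
    · have hi0 : (0 : ℝ) < i := lt_of_lt_of_le (by positivity) hi
      have hi1 : 1 ≤ i := by exact_mod_cast hi0
      have h3 := abs_weight_succ_sub_le hU hT hx0 hi1 H
      have hk := sqWeight_nonneg x i
      have h4 : (H : ℝ) / i ≤ 1 / Y := by
        rw [div_le_div_iff₀ hi0 hY0]; linarith
      have h5 : 3 * T + T * (T * (H / i)) ≤ 4 * (T ^ 2 / Y) := by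
        have h6 : T * (T * (H / i)) ≤ T * (T * (1 / Y)) :=
          mul_le_mul_of_nonneg_left (mul_le_mul_of_nonneg_left h4 hT0.le) hT0.le
        have h7 : T ≤ T ^ 2 / Y := by rw [le_div_iff₀ hY0]; nlinarith
        have h8 : T * (T * (1 / Y)) = T ^ 2 / Y := by ring
        linarith
      have h6 : 1 ≤ (H * Y) ^ (-(1 + δ)) * (i : ℝ) ^ (1 + δ) := by
        rw [rpow_neg (by positivity), inv_mul_eq_div, one_le_div (by positivity)]
        exact rpow_le_rpow (by positivity) hi (by positivity)
      have e : (i : ℝ) ^ (1 / 2 + δ) * (sqWeight x i / i) * (i : ℝ) ^ (1 + δ) =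
          (i : ℝ) ^ (1 / 2 + 2 * δ) * sqWeight x i := by
        rw [show 1 / 2 + 2 * δ = (1 / 2 + δ) + (1 + δ) - 1 by ring, rpow_sub_one hi0.ne',
          rpow_add hi0 (1 / 2 + δ)]
        ring
      calc _ ≤ C₁ * (i : ℝ) ^ (1 / 2 + δ) * (sqWeight x i / i * (4 * (T ^ 2 / Y))) :=
            mul_le_mul (h₁ Y H i hY hH hi) (h3.trans (mul_le_mul_of_nonneg_left h5 (by positivity)))
              (abs_nonneg _) (by positivity)
        _ ≤ C₁ * (i : ℝ) ^ (1 / 2 + δ) * (sqWeight x i / i * (4 * (T ^ 2 / Y))) *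
              ((H * Y) ^ (-(1 + δ)) * (i : ℝ) ^ (1 + δ)) :=
            le_mul_of_one_le_right (by positivity) h6
        _ = D * ((i : ℝ) ^ (1 / 2 + δ) * (sqWeight x i / i) * (i : ℝ) ^ (1 + δ)) := by
            rw [hD]; ring
        _ = _ := by rw [e]
    · rw [hsmall i hi, abs_zero, zero_mul]
      exact mul_nonneg hD0 (mul_nonneg (by positivity) (sqWeight_nonneg x i))
  · rw [tsum_mul_left]
    refine (mul_le_mul_of_nonneg_left (h₂ x hx) hD0).trans (le_of_eq ?_)
    rw [hD]; ring

lemma vonMangoldt_mul_le {δ : ℝ} (hδ : 0 < δ) (hδ' : δ < 1) {n H : ℕ} (hn : 1 ≤ n) (hH : H ≤ n) :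
    Λ n * Λ (n + H) ≤ 8 / δ ^ 2 * (n : ℝ) ^ δ := by
  have hn0 : (0 : ℝ) < n := by exact_mod_cast hn
  have h1 : Λ n ≤ 2 / δ * (n : ℝ) ^ (δ / 2) :=
    (vonMangoldt_le_log).trans
      ((log_le_rpow_div hn0.le (half_pos hδ)).trans (le_of_eq (by field_simp)))
  have h2 : Λ (n + H) ≤ 2 * (2 / δ * (n : ℝ) ^ (δ / 2)) := by
    refine (vonMangoldt_le_log).trans
      ((log_le_rpow_div (by positivity) (half_pos hδ)).trans ?_)
    have h3 : ((n + H : ℕ) : ℝ) ^ (δ / 2) ≤ 2 * (n : ℝ) ^ (δ / 2) := by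
      have h4 : ((n + H : ℕ) : ℝ) ≤ 2 * n := by exact_mod_cast (by omega : n + H ≤ 2 * n)
      refine (rpow_le_rpow (by positivity) h4 (by positivity)).trans ?_
      rw [mul_rpow two_pos.le hn0.le]
      refine mul_le_mul_of_nonneg_right ?_ (by positivity)
      exact (rpow_le_rpow_of_exponent_le one_le_two (by linarith : δ / 2 ≤ 1)).trans
        (rpow_one 2).le
    rw [div_le_iff₀ (half_pos hδ)]
    refine h3.trans (le_of_eq (by field_simp))
  refine (mul_le_mul h1 h2 vonMangoldt_nonneg (by positivity)).trans (le_of_eq ?_)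
  rw [show (n : ℝ) ^ δ = (n : ℝ) ^ (δ / 2) * (n : ℝ) ^ (δ / 2) by
    rw [← rpow_add hn0, add_halves]]
  field_simp
  norm_num

/-- The term of the off-diagonal sum for the pair `n`, `n + h + 1`, with `p = (h, n)`. -/
noncomputable def pairTerm (U T x : ℝ) (p : ℕ × ℕ) : ℝ :=
  primeCoeff x p.2 * primeCoeff x (p.2 + (p.1 + 1)) *
    bumpCos U T (log (p.2 + (p.1 + 1) : ℕ) - log p.2)

/-- The expected value of `pairTerm`. -/
noncomputable def pairModel (U T x : ℝ) (p : ℕ × ℕ) : ℝ :=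
  singularSeries (p.1 + 1) * (sqWeight x p.2 * bumpCos U T ((p.1 + 1 : ℕ) / p.2))

lemma summable_of_abs_le_mul {f : ℕ × ℕ → ℝ} {a b : ℕ → ℝ} {c : ℝ} (ha : Summable a)
    (hb : Summable b) (ha0 : ∀ n, 0 ≤ a n) (hb0 : ∀ n, 0 ≤ b n)
    (hf : ∀ p, |f p| ≤ c * (a p.1 * b p.2)) :
    Summable f ∧ |∑' p, f p| ≤ c * ((∑' n, a n) * ∑' n, b n) := by
  have hab := ha.mul_of_nonneg hb ha0 hb0
  have hc : Summable fun p : ℕ × ℕ => c * (a p.1 * b p.2) := hab.mul_left c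
  refine ⟨Summable.of_norm_bounded hc hf, ?_⟩
  rw [ha.tsum_mul_tsum hb hab, ← tsum_mul_left]
  have h : ‖∑' p, f p‖ ≤ ∑' p : ℕ × ℕ, c * (a p.1 * b p.2) := tsum_of_norm_bounded hc.hasSum hf
  exact h

section
variable {U T Y x D : ℝ}

lemma abs_tsum_far_pairTerm_le (hx : 0 < x) (hY : 1 ≤ Y) (hD : 0 ≤ D)
    (hψ : ∀ ξ : ℝ, 1 / (2 * Y) ≤ ξ → |bumpCos U T ξ| ≤ D) :
    |∑' p, {p : ℕ × ℕ | ((p.1 + 1 : ℕ) : ℝ) * Y ≤ p.2}ᶜ.indicator (pairTerm U T x) p| ≤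
      D * (x ^ 2 * (∑' n : ℕ, Λ n * (n : ℝ) ^ (-(3 / 2) : ℝ)) ^ 2) := by
  have ha := summable_primeCoeff hx
  have ha0 := primeCoeff_nonneg hx
  have hab := ha.mul_of_nonneg ha ha0 ha0
  have hab0 : ∀ q : ℕ × ℕ, 0 ≤ primeCoeff x q.1 * primeCoeff x q.2 := fun q =>
    mul_nonneg (ha0 _) (ha0 _)
  let i : ℕ × ℕ → ℕ × ℕ := fun p => (p.2, p.2 + (p.1 + 1))
  have hi : Function.Injective i := fun p q h => by
    have h1 : p.2 = q.2 := congrArg Prod.fst h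
    have h2 : p.2 + (p.1 + 1) = q.2 + (q.1 + 1) := congrArg Prod.snd h
    exact Prod.ext (by omega) h1
  have hs : Summable fun p : ℕ × ℕ => D * (primeCoeff x p.2 * primeCoeff x (p.2 + (p.1 + 1))) :=
    (hab.comp_injective hi).mul_left D
  have hle : ‖∑' p, {p : ℕ × ℕ | ((p.1 + 1 : ℕ) : ℝ) * Y ≤ p.2}ᶜ.indicator (pairTerm U T x) p‖ ≤
      ∑' p : ℕ × ℕ, D * (primeCoeff x p.2 * primeCoeff x (p.2 + (p.1 + 1))) := by
    refine tsum_of_norm_bounded hs.hasSum fun p => ?_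
    have h0 : 0 ≤ primeCoeff x p.2 * primeCoeff x (p.2 + (p.1 + 1)) := mul_nonneg (ha0 _) (ha0 _)
    by_cases hp : p ∈ {p : ℕ × ℕ | ((p.1 + 1 : ℕ) : ℝ) * Y ≤ p.2}ᶜ
    · rw [Set.indicator_of_mem hp, pairTerm, norm_mul, norm_of_nonneg h0, mul_comm]
      rcases Nat.eq_zero_or_pos p.2 with h | h
      · simp [h, primeCoeff]
      · have hp' : ¬ ((p.1 + 1 : ℕ) : ℝ) * Y ≤ p.2 := hp
        exact mul_le_mul_of_nonneg_right
          (hψ _ (div_le_log_add_sub_log h hY (not_le.1 hp').le)) h0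
    · rw [Set.indicator_of_notMem hp, norm_zero]
      positivity
  refine hle.trans ?_
  rw [tsum_mul_left, ← mul_pow]
  refine mul_le_mul_of_nonneg_left ?_ hD
  have h1 := tsum_comp_le_tsum_of_inj hab hab0 hi
  refine h1.trans ?_
  rw [← ha.tsum_mul_tsum ha hab, ← sq]
  exact pow_le_pow_left₀ (tsum_nonneg ha0) (tsum_primeCoeff_le hx) 2

lemma abs_pairModel_le (p : ℕ × ℕ) (hD : |bumpCos U T ((p.1 + 1 : ℕ) / p.2)| ≤
      D * (((p.1 + 1 : ℕ) : ℝ) / p.2) ^ (-(3 / 2) : ℝ)) :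
    |pairModel U T x p| ≤ D * (|singularSeries (p.1 + 1)| * ((p.1 : ℝ) + 1) ^ (-(3 / 2) : ℝ) *
      ((p.2 : ℝ) ^ (3 / 2 : ℝ) * sqWeight x p.2)) := by
  have hk := sqWeight_nonneg x p.2
  rw [pairModel, abs_mul, abs_mul, abs_of_nonneg hk]
  refine (mul_le_mul_of_nonneg_left (mul_le_mul_of_nonneg_left hD hk) (abs_nonneg _)).trans
    (le_of_eq ?_)
  rw [div_rpow (by positivity) (by positivity), rpow_neg (Nat.cast_nonneg p.2), div_inv_eq_mul]
  push_cast
  ring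

lemma summable_pairModel (hx : 0 < x) (hY : 1 ≤ Y) (hU : 0 < U) (hT : 4 * U ≤ T) (hD : 0 ≤ D)
    (hψ : ∀ ξ : ℝ, 1 / (2 * Y) ≤ ξ → |bumpCos U T ξ| ≤ D * ξ ^ (-(3 / 2) : ℝ)) :
    Summable (pairModel U T x) ∧
    |∑' p, {p : ℕ × ℕ | ((p.1 + 1 : ℕ) : ℝ) * Y ≤ p.2}ᶜ.indicator (pairModel U T x) p| ≤
      D * ((∑' h : ℕ, |singularSeries (h + 1)| * ((h : ℝ) + 1) ^ (-(3 / 2) : ℝ)) *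
        ∑' n : ℕ, (n : ℝ) ^ (3 / 2 : ℝ) * sqWeight x n) := by
  have ha := summable_singularSeries (show (1 : ℝ) < 3 / 2 by norm_num)
  have hb := summable_rpow_mul_sqWeight hx (show (3 / 2 : ℝ) < 2 by norm_num)
  have ha0 : ∀ h : ℕ, 0 ≤ |singularSeries (h + 1)| * ((h : ℝ) + 1) ^ (-(3 / 2) : ℝ) := fun h => by
    positivity
  have hb0 : ∀ n : ℕ, 0 ≤ (n : ℝ) ^ (3 / 2 : ℝ) * sqWeight x n := fun n =>
    mul_nonneg (by positivity) (sqWeight_nonneg x n)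
  have hzero : ∀ p : ℕ × ℕ, p.2 = 0 → pairModel U T x p = 0 := fun p h => by
    simp [pairModel, sqWeight, h]
  have hfar : ∀ p : ℕ × ℕ, 0 < p.2 → ¬ ((p.1 + 1 : ℕ) : ℝ) * Y ≤ p.2 →
      |bumpCos U T ((p.1 + 1 : ℕ) / p.2)| ≤ D * (((p.1 + 1 : ℕ) : ℝ) / p.2) ^ (-(3 / 2) : ℝ) :=
    fun p h hp => hψ _ (by
      have h0 : (0 : ℝ) < p.2 := by exact_mod_cast h
      have := not_le.1 hp
      rw [div_le_div_iff₀ (by positivity) h0]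
      nlinarith)
  refine ⟨(summable_of_abs_le_mul (c := max D T) ha hb ha0 hb0 fun p => ?_).1,
    (summable_of_abs_le_mul ha hb ha0 hb0 fun p => ?_).2⟩
  · rcases Nat.eq_zero_or_pos p.2 with h | h
    · rw [hzero p h, abs_zero]
      exact mul_nonneg (le_max_of_le_left hD) (mul_nonneg (ha0 _) (hb0 _))
    have h0 : (0 : ℝ) < p.2 := by exact_mod_cast h
    refine abs_pairModel_le p ?_
    by_cases hp : ((p.1 + 1 : ℕ) : ℝ) * Y ≤ p.2
    · have h1 : (((p.1 + 1 : ℕ) : ℝ) / p.2) ≤ 1 := by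
        rw [div_le_one h0]
        exact (le_mul_of_one_le_right (by positivity) hY).trans hp
      refine (abs_bumpCos_le hU hT _).trans ((le_max_right D T).trans
        (le_mul_of_one_le_right (le_max_of_le_left hD) ?_))
      exact one_le_rpow_of_pos_of_le_one_of_nonpos (by positivity) h1 (by norm_num)
    · exact (hfar p h hp).trans (mul_le_mul_of_nonneg_right (le_max_left D T) (by positivity))
  · by_cases hp : p ∈ {p : ℕ × ℕ | ((p.1 + 1 : ℕ) : ℝ) * Y ≤ p.2}ᶜ
    · rw [Set.indicator_of_mem hp]
      rcases Nat.eq_zero_or_pos p.2 with h | h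
      · rw [hzero p h, abs_zero]
        exact mul_nonneg hD (mul_nonneg (ha0 _) (hb0 _))
      · exact abs_pairModel_le p (hfar p h hp)
    · rw [Set.indicator_of_notMem hp, abs_zero]
      exact mul_nonneg hD (mul_nonneg (ha0 _) (hb0 _))

lemma abs_pairTerm_sub_le {δ : ℝ} (hδ : 0 < δ) (hδ' : δ < 1) (hU : 0 < U) (hT : 4 * U ≤ T)
    (hx : 0 < x) (hY : 1 < Y) (hYT : Y ≤ T) (p : ℕ × ℕ) (hp : ((p.1 + 1 : ℕ) : ℝ) * Y ≤ p.2) :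
    |pairTerm U T x p - Λ p.2 * Λ (p.2 + (p.1 + 1)) *
      (sqWeight x p.2 * bumpCos U T ((p.1 + 1 : ℕ) / p.2))| ≤
    24 / δ ^ 2 * ((T / Y) ^ 2 / Y) * (((p.1 : ℝ) + 1) ^ (-(1 + δ)) *
      ((p.2 : ℝ) ^ (1 + 2 * δ) * sqWeight x p.2)) := by
  obtain ⟨h, n⟩ := p
  dsimp only at hp ⊢
  have hH : (0 : ℝ) < (h + 1 : ℕ) := by positivity
  have hY0 : 0 < Y := by linarith
  have hn0 : (0 : ℝ) < n := lt_of_lt_of_le (by positivity) hp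
  have hn : 1 ≤ n := by exact_mod_cast hn0
  have hHn : h + 1 ≤ n := by
    exact_mod_cast (le_mul_of_one_le_right hH.le hY.le).trans hp
  have hk := sqWeight_nonneg x n
  have hT0 : 0 < T := by linarith
  have hΛ : 0 ≤ Λ n * Λ (n + (h + 1)) :=
    mul_nonneg vonMangoldt_nonneg vonMangoldt_nonneg
  have hu : T * ((h + 1 : ℕ) / n) ≤ T / Y := by
    rw [div_eq_mul_inv T Y]
    refine mul_le_mul_of_nonneg_left ?_ hT0.le
    rw [div_le_iff₀ hn0, inv_mul_eq_div, le_div_iff₀ hY0]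
    exact hp
  have hu0 : 0 ≤ T * (((h + 1 : ℕ) : ℝ) / n) := by positivity
  have h1 : 1 ≤ T / Y := by rwa [one_le_div hY0]
  have h2 : 2 * (T * (((h + 1 : ℕ) : ℝ) / n)) + (T * (((h + 1 : ℕ) : ℝ) / n)) ^ 2 ≤
      3 * (T / Y) ^ 2 := by nlinarith
  have h3 : 1 ≤ 1 / Y * ((h : ℝ) + 1) ^ (-(1 + δ)) * (n : ℝ) ^ (1 + δ) := by
    have h4 : ((h + 1 : ℕ) : ℝ) ^ (1 + δ) * Y ≤ (n : ℝ) ^ (1 + δ) := by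
      refine le_trans ?_ (rpow_le_rpow (by positivity) hp (by positivity))
      rw [mul_rpow hH.le hY0.le]
      exact mul_le_mul_of_nonneg_left (self_le_rpow_of_one_le hY.le (by linarith))
        (by positivity)
    rw [rpow_neg (by positivity), ← div_eq_mul_inv, div_div, div_mul_eq_mul_div, one_mul,
      one_le_div (by positivity)]
    push_cast at h4
    linarith
  have e : pairTerm U T x (h, n) - Λ n * Λ (n + (h + 1)) *
      (sqWeight x n * bumpCos U T ((h + 1 : ℕ) / n)) = Λ n * Λ (n + (h + 1)) *
      (weightRoot x n * weightRoot x (n + (h + 1)) *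
        bumpCos U T (log (n + (h + 1) : ℕ) - log n) -
      sqWeight x n * bumpCos U T ((h + 1 : ℕ) / n)) := by
    rw [pairTerm, primeCoeff, primeCoeff]; ring
  rw [e, abs_mul, abs_of_nonneg hΛ]
  calc _ ≤ 8 / δ ^ 2 * (n : ℝ) ^ δ * (sqWeight x n * (3 * (T / Y) ^ 2)) :=
        mul_le_mul (vonMangoldt_mul_le hδ hδ' hn hHn)
          ((abs_pair_weight_sub_le hU hT hx hn (h + 1)).trans (mul_le_mul_of_nonneg_left h2 hk))
          (abs_nonneg _) (by positivity)
    _ ≤ 8 / δ ^ 2 * (n : ℝ) ^ δ * (sqWeight x n * (3 * (T / Y) ^ 2)) *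
          (1 / Y * ((h : ℝ) + 1) ^ (-(1 + δ)) * (n : ℝ) ^ (1 + δ)) :=
        le_mul_of_one_le_right (by positivity) h3
    _ = _ := by
        rw [show 1 + 2 * δ = δ + (1 + δ) by ring, rpow_add hn0 δ]; ring

end

lemma abs_tsum_pairTerm_sub_le (hTPC : TwinPrimeConjecture) {δ : ℝ} (hδ : 0 < δ) (hδ' : δ < 1 / 4) :
    ∃ C > 0, ∀ U T Y x D : ℝ, 0 < U → 4 * U ≤ T → 1 < Y → Y ≤ T → 1 ≤ x → 0 ≤ D →
    (∀ ξ : ℝ, 1 / (2 * Y) ≤ ξ → |bumpCos U T ξ| ≤ D) →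
    (∀ ξ : ℝ, 1 / (2 * Y) ≤ ξ → |bumpCos U T ξ| ≤ D * ξ ^ (-(3 / 2) : ℝ)) →
    Summable (pairModel U T x) ∧ |∑' p, pairTerm U T x p - ∑' p, pairModel U T x p| ≤
      C * (D * x ^ 2 + (T / Y) ^ 2 * (x ^ (1 + 2 * δ) / Y + x ^ (1 / 2 + 2 * δ))) := by
  obtain ⟨C₁, hC₁, h₁⟩ := abs_tsum_correlation_le hTPC hδ hδ'
  obtain ⟨C₂, hC₂, h₂⟩ := tsum_rpow_mul_sqWeight_le (θ := 3 / 2) (by norm_num) (by norm_num)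
  obtain ⟨C₃, hC₃, h₃⟩ := tsum_rpow_mul_sqWeight_le (θ := 1 + 2 * δ) (by linarith) (by linarith)
  set A := ∑' n : ℕ, Λ n * (n : ℝ) ^ (-(3 / 2) : ℝ) with hAd
  set B := ∑' h : ℕ, |singularSeries (h + 1)| * ((h : ℝ) + 1) ^ (-(3 / 2) : ℝ) with hB
  set Z := ∑' h : ℕ, ((h : ℝ) + 1) ^ (-(1 + δ)) with hZ
  have hB0 : 0 ≤ B := tsum_nonneg fun h => by positivity
  have hZ0 : 0 ≤ Z := tsum_nonneg fun h => by positivity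
  have hsZ : Summable fun h : ℕ => ((h : ℝ) + 1) ^ (-(1 + δ)) := by
    have := (summable_nat_add_iff 1).2 (summable_nat_rpow.2 (show -(1 + δ) < -1 by linarith))
    simpa only [Nat.cast_add, Nat.cast_one] using this
  refine ⟨A ^ 2 + B * C₂ + 24 / δ ^ 2 * (Z * C₃) + C₁ * Z + 1, by positivity,
    fun U T Y x D hU hT hY hYT hx hD hψ hψ' => ?_⟩
  have hx0 : 0 < x := by linarith
  have hY0 : 0 < Y := by linarith
  obtain ⟨hV, hVfar⟩ := summable_pairModel hx0 hY.le hU hT hD hψ'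
  refine ⟨hV, ?_⟩
  have hP : Summable (pairTerm U T x) := (integral_bump_primeSum hU hT hx0).1
  have hPfar := abs_tsum_far_pairTerm_le hx0 hY.le hD hψ
  set s := {p : ℕ × ℕ | ((p.1 + 1 : ℕ) : ℝ) * Y ≤ p.2} with hs
  set G : ℕ × ℕ → ℝ := fun p => Λ p.2 * Λ (p.2 + (p.1 + 1)) *
    (sqWeight x p.2 * bumpCos U T ((p.1 + 1 : ℕ) / p.2)) with hG
  obtain ⟨hE₁, hE₁'⟩ := summable_of_abs_le_mul (f := s.indicator fun p => pairTerm U T x p - G p)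
    (c := 24 / δ ^ 2 * ((T / Y) ^ 2 / Y)) hsZ
    (summable_rpow_mul_sqWeight hx0 (show 1 + 2 * δ < 2 by linarith))
    (fun h => by positivity) (fun n => mul_nonneg (by positivity) (sqWeight_nonneg x n))
    (fun p => by
      by_cases hp : p ∈ s
      · rw [Set.indicator_of_mem hp]
        exact abs_pairTerm_sub_le hδ (by linarith) hU hT hx0 hY hYT p hp
      · rw [Set.indicator_of_notMem hp, abs_zero]
        exact mul_nonneg (by positivity) (mul_nonneg (by positivity)
          (mul_nonneg (by positivity) (sqWeight_nonneg x _))))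
  have hE₂ : Summable (s.indicator fun p => G p - pairModel U T x p) := by
    have := ((hP.indicator s).sub hE₁).sub (hV.indicator s)
    refine this.congr fun p => ?_
    by_cases hp : p ∈ s
    · simp only [Set.indicator_of_mem hp]; ring
    · simp only [Set.indicator_of_notMem hp]; ring
  have hE₂' : |∑' p, s.indicator (fun p => G p - pairModel U T x p) p| ≤
      C₁ * ((T / Y) ^ 2 * x ^ (1 / 2 + 2 * δ)) * Z := by
    have hrow : ∀ h n : ℕ, s.indicator (fun p => G p - pairModel U T x p) (h, n) =
        (if ((h + 1 : ℕ) : ℝ) * Y ≤ n then Λ n * Λ (n + (h + 1)) - singularSeries (h + 1) else 0) *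
          (sqWeight x n * bumpCos U T ((h + 1 : ℕ) / n)) := fun h n => by
      by_cases hp : ((h + 1 : ℕ) : ℝ) * Y ≤ n
      · rw [Set.indicator_of_mem (show (h, n) ∈ s from hp), if_pos hp, pairModel]
        ring
      · rw [Set.indicator_of_notMem (show (h, n) ∉ s from hp), if_neg hp, zero_mul]
    rw [hE₂.tsum_prod, hZ]
    rw [← tsum_mul_left]
    have hb := hsZ.mul_left (C₁ * ((T / Y) ^ 2 * x ^ (1 / 2 + 2 * δ)))
    rw [← norm_eq_abs]
    refine tsum_of_norm_bounded hb.hasSum fun h => ?_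
    have hf := hE₂.prod_factor h
    simp only [hrow] at hf ⊢
    refine (h₁ U T Y x (h + 1) hU hT hY hYT hx (by omega) hf).trans ?_
    rw [mul_rpow (by positivity) hY0.le]
    have h4 : Y ^ (-(1 + δ)) ≤ Y⁻¹ := by
      rw [← rpow_neg_one]
      exact rpow_le_rpow_of_exponent_le hY.le (by linarith)
    have h5 : 0 ≤ C₁ * (T ^ 2 / Y * x ^ (1 / 2 + 2 * δ)) * ((h : ℝ) + 1) ^ (-(1 + δ)) := by
      positivity
    have h6 := mul_le_mul_of_nonneg_left h4 h5
    push_cast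
    refine (le_of_eq ?_).trans (h6.trans (le_of_eq ?_))
    · ring
    · field_simp
  have e : ∑' p, pairTerm U T x p - ∑' p, pairModel U T x p =
      ∑' p, sᶜ.indicator (pairTerm U T x) p - ∑' p, sᶜ.indicator (pairModel U T x) p +
      ∑' p, s.indicator (fun p => pairTerm U T x p - G p) p +
      ∑' p, s.indicator (fun p => G p - pairModel U T x p) p := by
    rw [← hP.tsum_sub hV, ← (hP.indicator _).tsum_sub (hV.indicator _),
      ← ((hP.indicator _).sub (hV.indicator _)).tsum_add hE₁,
      ← (((hP.indicator _).sub (hV.indicator _)).add hE₁).tsum_add hE₂]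
    refine tsum_congr fun p => ?_
    by_cases hp : p ∈ s
    · simp only [Set.indicator_of_mem hp, Set.indicator_of_notMem (show p ∉ sᶜ from fun h => h hp)]
      ring
    · simp only [Set.indicator_of_notMem hp, Set.indicator_of_mem (show p ∈ sᶜ from hp)]
      ring
  rw [e]
  have hb1 : D * (B * ∑' n : ℕ, (n : ℝ) ^ (3 / 2 : ℝ) * sqWeight x n) ≤ B * C₂ * (D * x ^ 2) := by
    have h4 : x ^ (3 / 2 : ℝ) ≤ x ^ 2 := by
      rw [← rpow_natCast]
      exact rpow_le_rpow_of_exponent_le hx (by norm_num)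
    have h5 := (h₂ x hx).trans (mul_le_mul_of_nonneg_left h4 hC₂.le)
    have h6 := mul_le_mul_of_nonneg_left h5 (mul_nonneg hD hB0)
    linarith
  have hb2 : 24 / δ ^ 2 * ((T / Y) ^ 2 / Y) * (Z * ∑' n : ℕ, (n : ℝ) ^ (1 + 2 * δ) * sqWeight x n) ≤
      24 / δ ^ 2 * (Z * C₃) * ((T / Y) ^ 2 * (x ^ (1 + 2 * δ) / Y)) := by
    have h6 := mul_le_mul_of_nonneg_left (h₃ x hx)
      (show 0 ≤ 24 / δ ^ 2 * ((T / Y) ^ 2 / Y) * Z by positivity)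
    refine (le_of_eq ?_).trans (h6.trans (le_of_eq ?_))
    · ring
    · ring
  have hE₁'' := hE₁'.trans hb2
  have hVfar' := hVfar.trans hb1
  clear_value A B Z
  generalize ∑' p, sᶜ.indicator (pairTerm U T x) p = t₁ at *
  generalize ∑' p, sᶜ.indicator (pairModel U T x) p = t₂ at *
  generalize ∑' p, s.indicator (fun p => pairTerm U T x p - G p) p = t₃ at *
  generalize ∑' p, s.indicator (fun p => G p - pairModel U T x p) p = t₄ at *
  have q1 : 0 ≤ D * x ^ 2 := by positivity
  have q2 : 0 ≤ (T / Y) ^ 2 * (x ^ (1 + 2 * δ) / Y) := by positivity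
  have q3 : 0 ≤ (T / Y) ^ 2 * x ^ (1 / 2 + 2 * δ) := by positivity
  rw [mul_add ((T / Y) ^ 2)]
  generalize (T / Y) ^ 2 * (x ^ (1 + 2 * δ) / Y) = w₂ at *
  generalize (T / Y) ^ 2 * x ^ (1 / 2 + 2 * δ) = w₃ at *
  generalize hw₁ : D * x ^ 2 = w₁ at *
  have ht : |t₁ - t₂ + t₃ + t₄| ≤ |t₁| + |t₂| + |t₃| + |t₄| :=
    (abs_add_le _ _).trans (add_le_add_left ((abs_add_le _ _).trans
      (add_le_add_left (abs_sub _ _) _)) _)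
  have hB2 : 0 ≤ B * C₂ := by positivity
  have hZ3 : 0 ≤ 24 / δ ^ 2 * (Z * C₃) := by positivity
  have hZ1 : 0 ≤ C₁ * Z := by positivity
  generalize B * C₂ = c₂ at *
  generalize 24 / δ ^ 2 * (Z * C₃) = c₃ at *
  have h7 : C₁ * w₃ * Z = C₁ * Z * w₃ := by ring
  have h8 : D * (x ^ 2 * A ^ 2) = A ^ 2 * w₁ := by rw [← hw₁]; ring
  rw [h7] at hE₂'
  rw [← hAd, h8] at hPfar
  have hA := sq_nonneg A
  generalize C₁ * Z = c₁ at *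
  generalize A ^ 2 = c₀ at *
  nlinarith [mul_nonneg hA q2, mul_nonneg hA q3, mul_nonneg hB2 q2, mul_nonneg hB2 q3,
    mul_nonneg hZ3 q1, mul_nonneg hZ3 q3, mul_nonneg hZ1 q1, mul_nonneg hZ1 q2]

lemma integral_bump_mul_log {U T : ℝ} (hU : 1 ≤ U) (hT : 4 * U ≤ T) :
    |(∫ t, bump U T t * log t) - log (2 * π) * ∫ t, bump U T t| ≤ (log T + 6) * T ∧
    |(∫ t, bump U T t * log t) - log (2 * π) * (∫ t, bump U T t) -
      (T * log T - T - T * log (2 * π))| ≤ 4 * U * (log T + 7) := by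
  have hU0 : 0 < U := by linarith
  set c := log (2 * π) with hc
  have hc0 : 0 ≤ c := log_nonneg (by linarith [pi_gt_three])
  have hc6 : c ≤ 6 := (log_le_sub_one_of_pos (by positivity)).trans
    (by linarith [pi_lt_d2])
  have hlog : Integrable fun t => bump U T t * log t := by
    have e : (fun t => bump U T t * log t) = fun t => bump U T t * log (max t U) := by
      funext t
      rcases le_total t U with h | h
      · simp [bump_of_le hU0 hT h]
      · rw [max_eq_left h]
    rw [e]
    exact integrable_bump_mul hU0 hT (Continuous.log (by fun_prop) fun t =>
      (hU0.trans_le (le_max_right t U)).ne')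
  have hb : Integrable fun t => bump U T t := by
    simpa using integrable_bump_mul hU0 hT (g := fun _ => (1 : ℝ)) continuous_const
  have e : (∫ t, bump U T t * log t) - c * ∫ t, bump U T t =
      ∫ t, bump U T t * (log t - c) := by
    rw [← integral_const_mul, ← integral_sub hlog (hb.const_mul c)]
    exact integral_congr_ae (Eventually.of_forall fun t => by ring)
  have hg : ∀ t, U ≤ t → t ≤ T → |log t - c| ≤ log T + 6 := fun t h1 h2 => by
    have h3 := log_nonneg (hU.trans h1)
    have h4 := log_le_log (by linarith) h2
    rw [abs_le]; constructor <;> linarith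
  rw [e]
  refine ⟨abs_integral_bump_mul_le hU0 hT fun t h1 h2 => hg t h1 (by linarith), ?_⟩
  have hii : ∀ {f : ℝ → ℝ} {a b : ℝ}, Continuous f → U ≤ a → U ≤ b →
      IntervalIntegrable (fun t => f t * (log t - c)) volume a b := fun hf ha hb =>
    (hf.continuousOn.mul ((continuousOn_log.mono fun t ht =>
      (hU0.trans_le ((le_min ha hb).trans ht.1)).ne').sub continuousOn_const)).intervalIntegrable
  have hone : Continuous fun t => 1 - bump U T t := continuous_const.sub continuous_bump
  have h1 : ∫ t, bump U T t * (log t - c) = ∫ t in U..T, bump U T t * (log t - c) := by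
    refine (intervalIntegral.integral_eq_integral_of_support_subset fun t ht => ⟨?_, ?_⟩).symm
    · by_contra h
      exact ht (by simp [bump_of_le hU0 hT (not_lt.1 h)])
    · by_contra h
      exact ht (by simp [bump_of_ge hU0 hT (show T - U ≤ t by linarith [not_le.1 h])])
  have h2 : ∫ t in U..T, bump U T t * (log t - c) = (∫ t in U..T, (log t - c)) -
      ∫ t in U..T, (1 - bump U T t) * (log t - c) := by
    have hi := hii (f := fun _ => 1) continuous_const le_rfl (show U ≤ T by linarith)
    simp only [one_mul] at hi
    rw [← intervalIntegral.integral_sub hi (hii hone le_rfl (by linarith))]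
    exact intervalIntegral.integral_congr fun t _ => by ring
  have h3 : ∫ t in U..T, (log t - c) =
      T * log T - U * log U - T + U - (T - U) * c := by
    rw [intervalIntegral.integral_sub intervalIntegral.intervalIntegrable_log'
      intervalIntegrable_const, integral_log, intervalIntegral.integral_const, smul_eq_mul]
  have h4 : ∫ t in U..T, (1 - bump U T t) * (log t - c) =
      (∫ t in U..2 * U, (1 - bump U T t) * (log t - c)) +
      ∫ t in T - 2 * U..T, (1 - bump U T t) * (log t - c) := by
    have h5 : ∫ t in 2 * U..T - 2 * U, (1 - bump U T t) * (log t - c) = 0 := by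
      rw [intervalIntegral.integral_congr (g := fun _ => 0), intervalIntegral.integral_zero]
      intro t ht
      rw [Set.uIcc_of_le (by linarith)] at ht
      simp [bump_eq_one hU0 ht.1 ht.2]
    rw [← intervalIntegral.integral_add_adjacent_intervals (b := 2 * U)
      (hii hone le_rfl (by linarith)) (hii hone (by linarith) (by linarith)),
      ← intervalIntegral.integral_add_adjacent_intervals (a := 2 * U) (b := T - 2 * U)
      (hii hone (by linarith) (by linarith)) (hii hone (by linarith) (by linarith)), h5, zero_add]
  have h5 : ∀ a b : ℝ, U ≤ a → a ≤ b → b ≤ T →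
      |∫ t in a..b, (1 - bump U T t) * (log t - c)| ≤ (log T + 6) * (b - a) :=
    fun a b ha hab hb' => by
    have := intervalIntegral.norm_integral_le_of_norm_le_const (a := a) (b := b)
      (f := fun t => (1 - bump U T t) * (log t - c)) (C := log T + 6) fun t ht => by
        rw [Set.uIoc_of_le hab] at ht
        have h6 := bump_nonneg hU0 hT t
        have h7 := bump_le_one (U := U) (T := T) t
        rw [norm_mul, norm_of_nonneg (show 0 ≤ 1 - bump U T t by linarith)]
        exact (mul_le_of_le_one_left (norm_nonneg _) (by linarith)).trans
          (hg t (ha.trans ht.1.le) (ht.2.trans hb'))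
    rwa [norm_eq_abs, abs_of_nonneg (show 0 ≤ b - a by linarith)] at this
  have h6 := abs_le.1 (h5 U (2 * U) le_rfl (by linarith) (by linarith))
  have h7 := abs_le.1 (h5 (T - 2 * U) T (by linarith) (by linarith) le_rfl)
  have h8 : 0 ≤ U * log U := mul_nonneg hU0.le (log_nonneg hU)
  have h9 : U * log U ≤ U * log T :=
    mul_le_mul_of_nonneg_left (log_le_log hU0 (by linarith)) hU0.le
  have h10 := mul_nonneg hU0.le hc0
  have h11 := mul_le_mul_of_nonneg_left hc6 hU0.le
  rw [h1, h2, h3, h4, abs_le]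
  constructor <;> nlinarith

lemma tsum_pairModel {θ : ℝ} (h0 : 0 < θ) (h1 : θ < 1 / 2) : ∃ C > 0, ∀ U T x : ℝ,
    1 ≤ U → 4 * U ≤ T → T ≤ x → Summable (pairModel U T x) →
    |2 * ∑' p, pairModel U T x p + (∫ t, bump U T t) * ∑' n : ℕ, log n * sqWeight x n -
      (T * log T - T - T * log (2 * π))| ≤
      C * (T * (T / x) ^ θ + U * (log T + 7)) := by
  obtain ⟨C₁, hC₁, h₁⟩ := tsum_singularSeries_bumpCos h0 h1
  obtain ⟨C₂, hC₂, h₂⟩ := tsum_rpow_mul_sqWeight_le (θ := -θ) (by linarith) (by linarith)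
  refine ⟨C₁ * C₂ + 6, by positivity, fun U T x hU hT hTx hV => ?_⟩
  have hU0 : 0 < U := by linarith
  have hT0 : 0 < T := by linarith
  have hx0 : 0 < x := by linarith
  obtain ⟨hJ, hJG⟩ := integral_bump_mul_log hU hT
  set I := ∫ t, bump U T t
  set J := (∫ t, bump U T t * log t) - log (2 * π) * I
  have hk : Summable fun n : ℕ => sqWeight x n := by
    simpa using summable_rpow_mul_sqWeight hx0 (show (0 : ℝ) < 2 by norm_num)
  have hlk : Summable fun n : ℕ => log n * sqWeight x n := by
    refine Summable.of_nonneg_of_le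
      (fun n => mul_nonneg (log_natCast_nonneg n) (sqWeight_nonneg x n)) (fun n => ?_)
      (summable_rpow_mul_sqWeight hx0 (show (1 : ℝ) < 2 by norm_num))
    rw [rpow_one]
    exact mul_le_mul_of_nonneg_right (log_le_self (Nat.cast_nonneg n)) (sqWeight_nonneg x n)
  have hcol : ∀ n : ℕ, ∑' h : ℕ, pairModel U T x (h, n) = sqWeight x n *
      ∑' h : ℕ, singularSeries (h + 1) * bumpCos U T ((h + 1 : ℕ) / (n : ℝ)) := fun n => by
    rw [← tsum_mul_left]
    exact tsum_congr fun h => by rw [pairModel]; ring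
  have hsw : Summable fun q : ℕ × ℕ => pairModel U T x (q.2, q.1) := hV.prod_symm
  have hV' : ∑' p, pairModel U T x p = ∑' n : ℕ, sqWeight x n *
      ∑' h : ℕ, singularSeries (h + 1) * bumpCos U T ((h + 1 : ℕ) / (n : ℝ)) := by
    rw [← (Equiv.prodComm ℕ ℕ).tsum_eq]
    refine hsw.tsum_prod.trans (tsum_congr hcol)
  have hVs : Summable fun n : ℕ => sqWeight x n *
      ∑' h : ℕ, singularSeries (h + 1) * bumpCos U T ((h + 1 : ℕ) / (n : ℝ)) :=
    hsw.prod.congr hcol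
  have hmain : |2 * ∑' p, pairModel U T x p + I * ∑' n : ℕ, log n * sqWeight x n -
      J * ∑' n : ℕ, sqWeight x n| ≤ C₁ * C₂ * (T * (T / x) ^ θ) := by
    rw [hV', ← tsum_mul_left, ← tsum_mul_left, ← tsum_mul_left,
      ← (hVs.mul_left 2).tsum_add (hlk.mul_left I),
      ← ((hVs.mul_left 2).add (hlk.mul_left I)).tsum_sub (hk.mul_left J), ← norm_eq_abs]
    have hs := (summable_rpow_mul_sqWeight hx0 (show -θ < 2 by linarith)).mul_left (C₁ * (T * T ^ θ))
    refine (tsum_of_norm_bounded hs.hasSum fun n => ?_).trans ?_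
    · have hkn := sqWeight_nonneg x n
      rcases Nat.eq_zero_or_pos n with rfl | hn
      · simp [sqWeight]
      · have h3 := (h₁ U T hU0 hT n hn).2
        generalize ∑' h : ℕ, singularSeries (h + 1) * bumpCos U T ((h + 1 : ℕ) / (n : ℝ)) = S at h3 ⊢
        have e : 2 * (sqWeight x n * S) + I * (log n * sqWeight x n) - J * sqWeight x n =
            sqWeight x n * (2 * S - (J - log n * I)) := by ring
        rw [e, norm_mul, norm_of_nonneg hkn]
        refine (mul_le_mul_of_nonneg_left h3 hkn).trans (le_of_eq ?_)
        rw [div_rpow hT0.le (Nat.cast_nonneg n), rpow_neg (Nat.cast_nonneg n)]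
        ring
    · rw [tsum_mul_left]
      refine (mul_le_mul_of_nonneg_left (h₂ x (by linarith)) (by positivity)).trans (le_of_eq ?_)
      rw [div_rpow hT0.le hx0.le, rpow_neg hx0.le]
      ring
  have hk1 := tsum_sqWeight_sub_one (show 1 ≤ x by linarith)
  generalize ∑' n : ℕ, sqWeight x n = κ at *
  have hL : 0 ≤ log T := log_nonneg (by linarith)
  have h3 : |J * (κ - 1)| ≤ 2 * (log T + 6) := by
    rw [abs_mul]
    refine (mul_le_mul hJ hk1 (abs_nonneg _) (by positivity)).trans ?_
    rw [mul_div_assoc', div_le_iff₀ hx0]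
    nlinarith
  have hpos : 0 ≤ C₁ * C₂ := by positivity
  have hp : 0 ≤ T * (T / x) ^ θ := by positivity
  generalize T * (T / x) ^ θ = E at *
  have h4 := mul_nonneg hpos (mul_nonneg hU0.le (show 0 ≤ log T + 7 by linarith))
  rw [abs_le] at *
  constructor <;> nlinarith

lemma exists_bumpCos_le_inv_pow {ε : ℝ} (hε : 0 < ε) : ∃ C > 0, ∀ U T Y : ℝ, 1 ≤ U → 4 * U ≤ T →
    1 ≤ Y → Y ≤ T → T ^ (ε / 2) * Y ≤ U → ∀ ξ : ℝ, 1 / (2 * Y) ≤ ξ →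
    |bumpCos U T ξ| ≤ C / T ^ 4 ∧ |bumpCos U T ξ| ≤ C / T ^ 4 * ξ ^ (-(3 / 2) : ℝ) := by
  obtain ⟨K, hK⟩ := exists_nat_ge (12 / ε)
  obtain ⟨C, hC, h⟩ := bumpCos_decay (K + 1)
  refine ⟨4 * (2 ^ K * C), by positivity, fun U T Y hU hT hY hYT hUY ξ hξ => ?_⟩
  have hY0 : 0 < Y := by linarith
  have hU0 : 0 < U := by linarith
  have hT1 : 1 ≤ T := by linarith
  have hT0 : 0 < T := by linarith
  have hξ0 : 0 < ξ := lt_of_lt_of_le (by positivity) hξ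
  have hYξ : 1 ≤ 2 * Y * ξ := by
    rw [div_le_iff₀ (by positivity)] at hξ; linarith
  have hTξ : 1 ≤ 2 * T * ξ := hYξ.trans (by gcongr)
  have h1 : T ^ (ε / 2) ≤ 2 * (U * ξ) := by
    have := mul_le_mul_of_nonneg_right hUY hξ0.le
    have h2 := mul_le_mul_of_nonneg_left hYξ (show 0 ≤ T ^ (ε / 2) by positivity)
    linarith
  have h2 : T ^ 6 ≤ 2 ^ K * (U * ξ) ^ K := by
    rw [← mul_pow]
    refine le_trans ?_ (pow_le_pow_left₀ (by positivity) h1 K)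
    rw [← rpow_natCast (T ^ (ε / 2)), ← rpow_mul hT0.le, ← rpow_natCast T]
    refine rpow_le_rpow_of_exponent_le hT1 ?_
    rw [div_le_iff₀ hε] at hK
    push_cast
    linarith
  have h3 : |bumpCos U T ξ| ≤ 2 ^ K * C / T ^ 6 * ξ ^ (-2 : ℝ) := by
    refine (h U T ξ hU0 hT hξ0).trans ?_
    rw [rpow_neg hξ0.le, rpow_two, ← div_eq_mul_inv, div_div,
      div_le_div_iff₀ (by positivity) (by positivity)]
    have h4 := mul_le_mul_of_nonneg_left h2 (show 0 ≤ C * ξ ^ 2 by positivity)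
    have h5 : 2 ^ K * (C * ξ ^ 2 * (U * ξ) ^ K) * 1 ≤ 2 ^ K * (C * ξ ^ 2 * (U * ξ) ^ K) * U :=
      mul_le_mul_of_nonneg_left hU (by positivity)
    rw [pow_succ (U * ξ)]
    linarith
  have key : ∀ s : ℝ, 0 ≤ s → s ≤ 2 → ξ ^ (-s) ≤ 4 * T ^ 2 := fun s hs0 hs2 => by
    rw [rpow_neg hξ0.le, inv_le_iff_one_le_mul₀ (by positivity)]
    have h5 : (1 : ℝ) ≤ (2 * T * ξ) ^ s := one_le_rpow hTξ hs0
    rw [mul_rpow (by positivity) hξ0.le] at h5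
    refine h5.trans (mul_le_mul_of_nonneg_right ?_ (by positivity))
    refine (rpow_le_rpow_of_exponent_le (by linarith) hs2).trans (le_of_eq ?_)
    rw [rpow_two]; ring
  have h4 : ∀ s : ℝ, 0 ≤ s → s ≤ 2 →
      |bumpCos U T ξ| ≤ 4 * (2 ^ K * C) / T ^ 4 * ξ ^ (-(2 - s)) := fun s h0 hs => by
    refine h3.trans ?_
    rw [show (-2 : ℝ) = -s + -(2 - s) by ring, rpow_add hξ0]
    have h5 := mul_le_mul_of_nonneg_left (key s h0 hs)
      (show 0 ≤ 2 ^ K * C / T ^ 6 * ξ ^ (-(2 - s)) by positivity)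
    refine (le_of_eq (by ring)).trans (h5.trans (le_of_eq ?_))
    field_simp
  refine ⟨?_, ?_⟩
  · simpa using h4 2 (by norm_num) le_rfl
  · have := h4 (1 / 2) (by norm_num) (by norm_num)
    norm_num at this ⊢
    exact this

lemma eventually_log_pow_le {ε : ℝ} (hε : 0 < ε) (M : ℕ) : ∃ T₀ : ℝ, ∀ T, T₀ ≤ T →
    4 ≤ log T ∧ log T ^ M ≤ T ^ (ε / 2) := by
  have h1 := (isLittleO_log_rpow_rpow_atTop (M : ℝ) (half_pos hε)).bound one_pos
  obtain ⟨T₀, h⟩ := eventually_atTop.1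
    ((tendsto_log_atTop.eventually_ge_atTop 4).and (h1.and (eventually_ge_atTop 1)))
  refine ⟨T₀, fun T hT => ⟨(h T hT).1, ?_⟩⟩
  obtain ⟨h4, h2, h3⟩ := h T hT
  rw [rpow_natCast, one_mul, norm_of_nonneg (by positivity),
    norm_of_nonneg (by positivity)] at h2
  exact h2

theorem pair_correlation_above_T
    (hRH : RiemannHypothesis) (hTPC : TwinPrimeConjecture)
    (ε : ℝ) (hε : 0 < ε) (M : ℕ) (hM : 2 < M) :
    ∃ C : ℝ, 0 < C ∧ ∃ T₀ : ℝ, ∀ T : ℝ, T₀ ≤ T → ∀ x : ℝ,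
      T ≤ x → x ≤ T ^ (2 - 29 * ε) →
      ‖Fpair x T - ((T / (2 * π) * Real.log (T / (2 * π)) - T / (2 * π) : ℝ) : ℂ)‖ ≤
        C * (T * (T / x) ^ ((1 : ℝ) / 2 - ε) + T / (Real.log T) ^ (M - 2)) := by
  obtain ⟨T₀, hT₀⟩ := eventually_log_pow_le hε M
  by_cases hε' : 1 / 29 < ε
  · refine ⟨1, one_pos, max T₀ 2, fun T hT x h1 h2 => absurd (h1.trans h2) (not_le.2 ?_)⟩
    have hT2 := (le_max_right _ _).trans hT
    exact (rpow_lt_rpow_of_exponent_lt (by linarith) (by linarith)).trans_eq (rpow_one T)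
  rw [not_lt] at hε'
  obtain ⟨C₁, hC₁, h₁⟩ := Fpair_approx hRH
  obtain ⟨C₂, hC₂, h₂⟩ := diagonal_sum hRH
  obtain ⟨C₃, hC₃, h₃⟩ := abs_tsum_pairTerm_sub_le hTPC hε (by linarith)
  obtain ⟨C₄, hC₄, h₄⟩ := tsum_pairModel (θ := 1 / 2 - ε) (by linarith) (by linarith)
  obtain ⟨C₅, hC₅, h₅⟩ := exists_bumpCos_le_inv_pow hε
  refine ⟨C₁ + C₂ + 2 * C₃ * (C₅ + 2) + C₄ * 8, by positivity, max T₀ 16, fun T hT x hTx hxT => ?_⟩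
  obtain ⟨hL4, hLM⟩ := hT₀ T ((le_max_left _ _).trans hT)
  have hT16 : 16 ≤ T := (le_max_right _ _).trans hT
  have hT0 : 0 < T := by linarith
  have hT1 : 1 ≤ T := by linarith
  have hx0 : 0 < x := by linarith
  have hx1 : 1 ≤ x := by linarith
  set L := log T with hL
  have hL0 : 0 < L := by linarith
  have hpow : ∀ s : ℝ, 0 ≤ s → x ^ s ≤ T ^ ((2 - 29 * ε) * s) := fun s hs => by
    rw [rpow_mul hT0.le]
    exact rpow_le_rpow hx0.le hxT hs
  have hxT2 : x ≤ T ^ 2 := hxT.trans (by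
    rw [← rpow_two]
    exact rpow_le_rpow_of_exponent_le hT1 (by linarith))
  set U := T / L ^ M with hU
  have hUT : T ^ (1 - ε / 2) ≤ U := by
    rw [hU, rpow_sub hT0, rpow_one]
    exact div_le_div_of_nonneg_left hT0.le (by positivity) hLM
  have hU1 : 1 ≤ U := (one_le_rpow hT1 (by linarith)).trans hUT
  have hU4 : 4 * U ≤ T := by
    rw [hU, mul_div_assoc', div_le_iff₀ (by positivity)]
    have := hL4.trans (le_self_pow₀ (show 1 ≤ L by linarith) (show M ≠ 0 by omega))
    nlinarith
  have hTU : T ^ 2 ≤ U ^ 3 := by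
    refine le_trans ?_ (pow_le_pow_left₀ (by positivity) hUT 3)
    rw [← rpow_natCast, ← rpow_natCast, ← rpow_mul hT0.le]
    exact rpow_le_rpow_of_exponent_le hT1 (by push_cast; linarith)
  set Y := T ^ (1 - ε) with hY
  have hY1 : 1 < Y := one_lt_rpow (by linarith) (by linarith)
  have hYT : Y ≤ T := (rpow_le_rpow_of_exponent_le hT1 (by linarith)).trans_eq (rpow_one T)
  have hYU : T ^ (ε / 2) * Y ≤ U := by
    rw [hY, ← rpow_add hT0]
    exact le_trans (le_of_eq (by ring_nf)) hUT
  have hU0 : 0 < U := by linarith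
  set E := T / L ^ (M - 2) with hE
  have hUE : U * L ^ 2 = E := by
    rw [hU, hE, show M = (M - 2) + 2 by omega, pow_add, Nat.add_sub_cancel]
    field_simp
  have hTE : T ^ (1 - ε) ≤ E := by
    rw [← hUE]
    refine (rpow_le_rpow_of_exponent_le hT1 (by linarith)).trans (hUT.trans ?_)
    exact le_mul_of_one_le_right hU0.le (one_le_pow₀ (by linarith))
  have hT2 : ∀ s : ℝ, s ≤ 1 - ε → T ^ s ≤ E := fun s hs =>
    (rpow_le_rpow_of_exponent_le hT1 hs).trans hTE
  have e₂ : T * x ^ (-(1 / 4) : ℝ) ≤ E := by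
    refine le_trans ?_ (hT2 (1 + -(1 / 4)) (by linarith))
    rw [rpow_add hT0, rpow_one]
    exact mul_le_mul_of_nonneg_left
      (rpow_le_rpow_of_nonpos hT0 hTx (by norm_num)) hT0.le
  have hTY : (T / Y) ^ 2 = T ^ (2 * ε) := by
    rw [hY, rpow_sub hT0, rpow_one, div_div_cancel₀ hT0.ne', ← rpow_natCast,
      ← rpow_mul hT0.le]
    push_cast; ring_nf
  have e₃ : (T / Y) ^ 2 * (x ^ (1 + 2 * ε) / Y + x ^ (1 / 2 + 2 * ε)) ≤ 2 * E := by
    rw [hTY, mul_add, two_mul E]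
    refine add_le_add ?_ ?_
    · rw [hY, div_eq_mul_inv, ← rpow_neg hT0.le]
      refine (mul_le_mul_of_nonneg_left (mul_le_mul_of_nonneg_right (hpow _ (by linarith))
        (by positivity)) (by positivity)).trans ?_
      rw [← rpow_add hT0, ← rpow_add hT0]
      exact hT2 _ (by nlinarith)
    · refine (mul_le_mul_of_nonneg_left (hpow _ (by linarith)) (by positivity)).trans ?_
      rw [← rpow_add hT0]
      exact hT2 _ (by nlinarith)
  have e₃' : C₅ / T ^ 4 * x ^ 2 ≤ C₅ * E := by
    have h6 : x ^ 2 ≤ T ^ 4 := (pow_le_pow_left₀ hx0.le hxT2 2).trans_eq (by ring)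
    rw [div_mul_eq_mul_div, div_le_iff₀ (by positivity)]
    have h7 : 1 ≤ E := (one_le_rpow hT1 (show 0 ≤ 1 - ε by linarith)).trans hTE
    have h8 : x ^ 2 ≤ E * T ^ 4 := h6.trans (le_mul_of_one_le_left (by positivity) h7)
    nlinarith
  have e₄ : U * (L + 7) ≤ E := by
    rw [← hUE]
    exact mul_le_mul_of_nonneg_left (by nlinarith) hU0.le
  have hψ := h₅ U T Y hU1 hU4 hY1.le hYT hYU
  obtain ⟨hV, hPV⟩ := h₃ U T Y x (C₅ / T ^ 4) hU0 hU4 hY1 hYT hx1 (by positivity)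
    (fun ξ hξ => (hψ ξ hξ).1) (fun ξ hξ => (hψ ξ hξ).2)
  have hF := h₁ T x U (by linarith) hTx hxT2 hU1 hU4 hTU (bump U T) continuous_bump
    (bump_nonneg hU0 hU4) bump_le_one (fun t => bump_eq_one hU0) (fun t => bump_of_le hU0 hU4)
    (fun t => bump_of_ge hU0 hU4)
  have hS : ∫ t, bump U T t * ‖primeSum x t‖ ^ 2 = (∫ t, bump U T t) *
      ∑' n : ℕ, Λ n ^ 2 * sqWeight x n +
      2 * ∑' p, pairTerm U T x p := (integral_bump_primeSum hU0 hU4 hx0).2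
  have hd := (h₂ x hx1).2
  have hm := h₄ U T x hU1 hU4 hTx hV
  have hI : |∫ t, bump U T t| ≤ T := by
    simpa using abs_integral_bump_mul_le hU0 hU4 (g := fun _ => 1) (B := 1) (by simp)
  set G := T * L - T - T * log (2 * π) with hG
  have hreal : |(∫ t, bump U T t * ‖primeSum x t‖ ^ 2) - G| ≤
      C₂ * E + 2 * (C₃ * (C₅ * E + 2 * E)) + C₄ * (T * (T / x) ^ (1 / 2 - ε) + E) := by
    rw [hS]
    generalize ∑' n : ℕ, Λ n ^ 2 * sqWeight x n = s at *
    generalize ∑' n : ℕ, log n * sqWeight x n = s' at *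
    generalize (∫ t, bump U T t) = I at *
    generalize ∑' p, pairTerm U T x p = P at *
    generalize ∑' p, pairModel U T x p = V at *
    have h6 : |I * (s - s')| ≤ C₂ * E := by
      rw [abs_mul]
      refine (mul_le_mul hI hd (abs_nonneg _) hT0.le).trans ?_
      have := mul_le_mul_of_nonneg_left e₂ hC₂.le
      linarith
    have h7 := hPV.trans (mul_le_mul_of_nonneg_left (add_le_add e₃' e₃) hC₃.le)
    have h8 := hm.trans (mul_le_mul_of_nonneg_left
      (add_le_add (le_refl (T * (T / x) ^ (1 / 2 - ε))) e₄) hC₄.le)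
    rw [abs_le] at h6 h7 h8 ⊢
    constructor <;> linarith [h6.1, h6.2, h7.1, h7.2, h8.1, h8.2]
  have hE0 : 0 ≤ E := by positivity
  have hW0 : 0 ≤ T * (T / x) ^ (1 / 2 - ε) := by positivity
  have hF' : ‖2 * π * Fpair x T - (G : ℂ)‖ ≤
      (C₁ + C₂ + 2 * C₃ * (C₅ + 2) + C₄ * 8) * (T * (T / x) ^ (1 / 2 - ε) + E) := by
    have h6 := hreal
    rw [← norm_eq_abs, ← Complex.norm_real, Complex.ofReal_sub] at h6
    refine (norm_sub_le_norm_sub_add_norm_sub _ _ _).trans ((add_le_add hF h6).trans ?_)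
    rw [hUE]
    have h7 : C₁ * E + (C₂ * E + 2 * (C₃ * (C₅ * E + 2 * E)) +
        C₄ * (T * (T / x) ^ (1 / 2 - ε) + E)) =
        (C₁ + C₂ + 2 * C₃ * (C₅ + 2) + C₄) * E + C₄ * (T * (T / x) ^ (1 / 2 - ε)) := by ring
    rw [h7, mul_add (C₁ + C₂ + 2 * C₃ * (C₅ + 2) + C₄ * 8), add_comm]
    refine add_le_add (mul_le_mul_of_nonneg_right ?_ hW0) (mul_le_mul_of_nonneg_right ?_ hE0)
    · linarith [show 0 ≤ C₁ + C₂ + 2 * C₃ * (C₅ + 2) by positivity]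
    · linarith
  refine le_trans ?_ hF'
  have e : 2 * π * Fpair x T - (G : ℂ) = (2 * π : ℝ) *
      (Fpair x T - ((T / (2 * π) * log (T / (2 * π)) - T / (2 * π) : ℝ) : ℂ)) := by
    have h6 : G = 2 * π * (T / (2 * π) * log (T / (2 * π)) - T / (2 * π)) := by
      rw [hG, log_div hT0.ne' (by positivity)]
      field_simp
      ring
    rw [h6]
    generalize T / (2 * π) * log (T / (2 * π)) - T / (2 * π) = r
    push_cast
    ring
  rw [e, norm_mul, Complex.norm_real]
  refine le_mul_of_one_le_left (norm_nonneg _) ?_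
  rw [norm_of_nonneg (by positivity)]
  linarith [pi_gt_three]
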